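/- Let G be a finitely generated subgroup of ℚ_p^×. Then G has the Mann property: for all nonzero a_1, …, a_n ∈ ℚ, the equation a_1 x_1 + … + a_n x_n = 1 has only finitely many nondegenerate solutions (g_1, …, g_n) ∈ G^n. -/

import Mathlib

section

open Finset

section Connectedness

variable {C E ι : Type*} [Field C] [Field E] [Algebra C E] [Fintype ι]

/-- A relation among the `y i` with nonempty support, all of whose nonzero sub-relations have the
same support. -/
def IsCircuit (C : Type*) {E ι : Type*} [Field C] [Field E] [Algebra C E] [Fintype ι]
    (y : ι → E) (b : ι → C) : Prop :=
  b ≠ 0 ∧ ∑ i, b i • y i = 0 ∧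
    ∀ b' : ι → C, b' ≠ 0 → ∑ i, b' i • y i = 0 → (∀ i, b i = 0 → b' i = 0) →
      ∀ i, b' i = 0 → b i = 0

theorem exists_isCircuit_le (y : ι → E) (a : ι → C) (ha : a ≠ 0) (hs : ∑ i, a i • y i = 0) :
    ∃ b, IsCircuit C y b ∧ ∀ i, a i = 0 → b i = 0 := by
  classical
  induction hn : #{i | a i ≠ 0} using Nat.strong_induction_on generalizing a with
  | _ n ih =>
    by_cases hc : IsCircuit C y a
    · exact ⟨a, hc, fun _ h => h⟩
    · unfold IsCircuit at hc
      push Not at hc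
      obtain ⟨b', hb0, hbs, hsub, i, hbi, hai⟩ := hc ha hs
      have hlt : #{i | b' i ≠ 0} < n := by
        rw [← hn]
        apply Finset.card_lt_card
        refine (Finset.ssubset_iff_of_subset ?_).2 ⟨i, by simpa using hai, by simpa using hbi⟩
        intro j hj
        simp only [mem_filter, mem_univ, true_and] at hj ⊢
        exact fun h => hj (hsub j h)
      obtain ⟨b, hb, hle⟩ := ih _ hlt b' hb0 hbs rfl
      exact ⟨b, hb, fun j hj => hle j (hsub j hj)⟩

/-- If the support of every circuit lies in a single class, then every relation splits along the
classes. -/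
theorem sum_class_eq_zero_of_isCircuit (y : ι → E) (r : Setoid ι)
    (h : ∀ b : ι → C, IsCircuit C y b → ∀ i j, b i ≠ 0 → b j ≠ 0 → r i j)
    (a : ι → C) (hs : ∑ i, a i • y i = 0) (i₀ : ι) [DecidablePred fun i => r i i₀] :
    ∑ i with r i i₀, a i • y i = 0 := by
  classical
  induction hn : #{i | a i ≠ 0} using Nat.strong_induction_on generalizing a with
  | _ n ih =>
    by_cases ha : a = 0
    · simp [ha]
    obtain ⟨b, hb, hle⟩ := exists_isCircuit_le y a ha hs
    obtain ⟨i, hi⟩ : ∃ i, b i ≠ 0 := by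
      by_contra! hcon
      exact hb.1 (funext hcon)
    have hbsum : ∑ j with r j i₀, b j • y j = 0 := by
      by_cases hr : r i i₀
      · rw [← hb.2.1]
        apply Finset.sum_subset (Finset.subset_univ _)
        intro j _ hj
        by_contra hne
        apply hj
        have hbj : b j ≠ 0 := fun h0 => hne (by simp [h0])
        simpa using r.trans (h b hb j i hbj hi) hr
      · apply Finset.sum_eq_zero
        intro j hj
        have hj' : r j i₀ := by simpa using hj
        have hbj : b j = 0 := by
          by_contra hbj
          exact hr (r.trans (h b hb i j hi hbj) hj')
        simp [hbj]
    set c := a i / b i with hc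
    have hlt : #{j | a j - c * b j ≠ 0} < n := by
      rw [← hn]
      apply Finset.card_lt_card
      refine (Finset.ssubset_iff_of_subset ?_).2 ⟨i, ?_, ?_⟩
      · intro j hj
        simp only [mem_filter, mem_univ, true_and] at hj ⊢
        exact fun h0 => hj (by simp [h0, hle j h0])
      · simpa using fun h0 => hi (hle i h0)
      · simp [hc, hi]
    have hsub : ∑ j, (a j - c * b j) • y j = 0 := by
      simp only [sub_smul, mul_smul, Finset.sum_sub_distrib, ← Finset.smul_sum, hs, hb.2.1]
      simp
    have := ih _ hlt (fun j => a j - c * b j) hsub rfl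
    simp only [sub_smul, mul_smul, Finset.sum_sub_distrib, ← Finset.smul_sum, hbsum] at this
    simpa using this

theorem ratio_mem_of_isCircuit_ratio (y : ι → E) (hy : ∀ i, y i ≠ 0) (hs : ∑ i, y i = 0)
    (hnd : ∀ J : Finset ι, J.Nonempty → J ≠ univ → ∑ i ∈ J, y i ≠ 0)
    (h : ∀ b : ι → C, IsCircuit C y b → ∀ i j, b i ≠ 0 → b j ≠ 0 →
      ∃ c : C, y i = c • y j) (i j : ι) :
    ∃ c : C, y i = c • y j := by
  classical
  let r : Setoid ι :=
    { r := fun i j => ∃ c : C, y i = c • y j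
      iseqv :=
        { refl := fun i => ⟨1, by simp⟩
          symm := by
            rintro i j ⟨c, hc⟩
            have hc0 : c ≠ 0 := by
              rintro rfl
              exact hy i (by simpa using hc)
            exact ⟨c⁻¹, by rw [hc, smul_smul, inv_mul_cancel₀ hc0, one_smul]⟩
          trans := by
            rintro i j k ⟨c, hc⟩ ⟨e, he⟩
            exact ⟨c * e, by rw [hc, he, smul_smul]⟩ } }
  have key := sum_class_eq_zero_of_isCircuit (C := C) y r h (fun _ => 1) (by simpa using hs) j
  simp only [one_smul] at key
  by_contra hij
  refine hnd {k | r k j} ⟨j, by simp⟩ (fun hu => hij ?_) key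
  have : i ∈ ({k | r k j} : Finset ι) := by rw [hu]; exact mem_univ _
  have h2 : r i j := by simpa using this
  exact h2

/-- If every sum-zero tuple of length at least three from `N` satisfies a second relation over `C`,
then every nondegenerate sum-zero tuple from `N` has all its ratios in `C`. -/
theorem ratio_mem_of_exists_nonconst_relation (N : Subgroup Eˣ)
    (hN : ∀ (c : C) (hc : c ≠ 0), Units.map (algebraMap C E).toMonoidHom (Units.mk0 c hc) ∈ N)
    (h : ∀ (n : ℕ) (y : Fin (n + 3) → Eˣ), (∀ i, y i ∈ N) → ∑ i, (y i : E) = 0 →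
      ∃ a : Fin (n + 3) → C, (∃ i j, a i ≠ a j) ∧ ∑ i, a i • (y i : E) = 0)
    (y : ι → Eˣ) (hy : ∀ i, y i ∈ N) (hs : ∑ i, (y i : E) = 0)
    (hnd : ∀ J : Finset ι, J.Nonempty → J ≠ univ → ∑ i ∈ J, (y i : E) ≠ 0) (i j : ι) :
    ∃ c : C, (y i : E) = c • (y j : E) := by
  classical
  refine ratio_mem_of_isCircuit_ratio (C := C) (fun i => (y i : E)) (fun i => (y i).ne_zero) hs hnd
    ?_ i j
  intro b hb i j hi hj
  by_cases hcard : 3 ≤ #{k | b k ≠ 0}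
  · exfalso
    obtain ⟨n, hn⟩ := Nat.exists_eq_add_of_le' hcard
    let e := (Finset.equivFinOfCardEq hn).symm
    have hbe : ∀ k, b (e k) ≠ 0 := fun k => (Finset.mem_filter.1 (e k).2).2
    have hsumtr : ∀ f : ι → E, (∀ k, b k = 0 → f k = 0) →
        ∑ k : Fin (n + 3), f (e k) = ∑ k, f k := by
      intro f hf
      rw [Equiv.sum_comp e (fun k => f k.1),
        Finset.sum_coe_sort _ f]
      apply Finset.sum_subset (Finset.subset_univ _)
      intro k _ hk
      apply hf
      simpa using hk
    obtain ⟨a, ⟨k, l, hkl⟩, has⟩ := h n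
      (fun k => Units.map (algebraMap C E).toMonoidHom (Units.mk0 (b (e k)) (hbe k)) * y (e k))
      (fun k => N.mul_mem (hN _ _) (hy _)) (by
        have := hsumtr (fun k => b k • (y k : E)) (fun k hk => by simp [hk])
        rw [hb.2.1] at this
        simpa [Algebra.smul_def] using this)
    let b' : ι → C := fun i => if hi : i ∈ ({k | b k ≠ 0} : Finset ι) then
      (a (e.symm ⟨i, hi⟩) - a k) * b i else 0
    have hb'e : ∀ q, b' (e q) = (a q - a k) * b (e q) := by
      intro q
      simp [b', hbe]
    have hl := hb.2.2 b' ?_ ?_ ?_ (e k) (by rw [hb'e]; simp)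
    · exact hbe k hl
    · intro h0
      have := congrFun h0 (e l)
      rw [hb'e] at this
      simp only [Pi.zero_apply, mul_eq_zero, sub_eq_zero, hbe, or_false] at this
      exact hkl this.symm
    · rw [← hsumtr (fun i => b' i • (y i : E)) (fun i hi => by simp [b', hi])]
      have h1 := hsumtr (fun k => b k • (y k : E)) (fun k hk => by simp [hk])
      rw [hb.2.1] at h1
      simp only [hb'e, mul_smul, sub_smul, Finset.sum_sub_distrib, ← Finset.smul_sum, h1]
      simp only [smul_zero, sub_zero]
      simpa [Algebra.smul_def] using has
    · intro i hi
      simp [b', hi]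
  · by_cases hij : i = j
    · exact ⟨1, by simp [hij]⟩
    have hset : ({k | b k ≠ 0} : Finset ι) = {i, j} := by
      symm
      apply Finset.eq_of_subset_of_card_le
      · intro k hk
        simp only [mem_insert, mem_singleton] at hk
        rcases hk with rfl | rfl <;> simpa
      · rw [Finset.card_pair hij]
        omega
    have h2 : b i • (y i : E) + b j • (y j : E) = 0 := by
      rw [← Finset.sum_pair hij (f := fun k => b k • (y k : E)), ← hset, ← hb.2.1]
      apply Finset.sum_subset (Finset.subset_univ _)
      intro k _ hk
      have : b k = 0 := by simpa using hk
      simp [this]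
    refine ⟨-(b i)⁻¹ * b j, ?_⟩
    have h3 : (b i)⁻¹ • (b i • (y i : E) + b j • (y j : E)) = 0 := by rw [h2, smul_zero]
    rw [smul_add, smul_smul, smul_smul, inv_mul_cancel₀ hi, one_smul] at h3
    rw [eq_neg_of_add_eq_zero_left h3, neg_mul, neg_smul]

end Connectedness

end

section Wronskian

variable {C A κ : Type*} [Field C] [CommRing A] [Algebra C A]

/-- The iterated derivative of `f` along the word `w`. -/
def wordDeriv (D : κ → Derivation C A A) (w : List κ) (f : A) : A :=
  w.foldr (fun i g => D i g) f

@[simp] theorem wordDeriv_nil (D : κ → Derivation C A A) (f : A) : wordDeriv D [] f = f := rfl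

@[simp] theorem wordDeriv_cons (D : κ → Derivation C A A) (i : κ) (w : List κ) (f : A) :
    wordDeriv D (i :: w) f = D i (wordDeriv D w f) := rfl

theorem wordDeriv_smul (D : κ → Derivation C A A) (w : List κ) (c : C) (f : A) :
    wordDeriv D w (c • f) = c • wordDeriv D w f := by
  induction w with
  | nil => rfl
  | cons i w ih => simp [ih]

/-- Linearly independent elements have a nonvanishing generalized Wronskian. -/
theorem exists_det_wordDeriv_ne_zero [IsDomain A] (D : κ → Derivation C A A)
    (H : ∀ M N : A, M ≠ 0 → (∀ i, M * D i N = N * D i M) → ∃ c : C, N = c • M)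
    (k : ℕ) (φ : Fin k → A) (hφ : LinearIndependent C φ) :
    ∃ w : Fin k → List κ, (∀ i, (w i).length ≤ i) ∧
      (Matrix.of fun i l => wordDeriv D (w i) (φ l)).det ≠ 0 := by
  induction k with
  | zero => exact ⟨Fin.elim0, fun i => i.elim0, by simp⟩
  | succ k ih =>
    obtain ⟨w, hw, hdet⟩ := ih (fun l => φ l.castSucc)
      (hφ.comp _ (Fin.castSucc_injective k))
    by_contra! hcon
    let M : Fin (k + 1) → A := fun l => (-1) ^ ((Fin.last k : ℕ) + l) *
      (Matrix.of fun (i : Fin k) (q : Fin k) => wordDeriv D (w i) (φ (l.succAbove q))).det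
    have hM : ∀ v : List κ, v.length ≤ k → ∑ l, M l * wordDeriv D v (φ l) = 0 := by
      intro v hv
      rw [← hcon (Fin.snoc w v) ?_, Matrix.det_succ_row _ (Fin.last k)]
      · refine Finset.sum_congr rfl fun l _ => ?_
        simp only [M, Matrix.of_apply, Fin.snoc_last]
        rw [mul_right_comm]
        congr 3
        ext i q
        simp
      · intro i
        refine Fin.lastCases ?_ (fun i => ?_) i
        · simpa using hv
        · simpa using hw i
    have hlast : M (Fin.last k) ≠ 0 := by
      simp only [M, Fin.succAbove_last]
      rw [← two_mul, pow_mul]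
      simpa using hdet
    have hD : ∀ (i : κ) (q : Fin k), ∑ l, D i (M l) * wordDeriv D (w q) (φ l) = 0 := by
      intro i q
      have h1 := congrArg (D i) (hM (w q) ((hw q).trans q.2.le))
      have h2 := hM (i :: w q) (by simpa using (Nat.succ_le_of_lt ((hw q).trans_lt q.2)))
      simp only [map_sum, Derivation.leibniz, smul_eq_mul, map_zero, Finset.sum_add_distrib] at h1
      simp only [wordDeriv_cons] at h2
      rw [h2, zero_add] at h1
      rw [← h1]
      exact Finset.sum_congr rfl fun l _ => mul_comm _ _
    have hprop : ∀ (i : κ) (l : Fin k),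
        M (Fin.last k) * D i (M l.castSucc) = M l.castSucc * D i (M (Fin.last k)) := by
      intro i
      have hz := Matrix.eq_zero_of_mulVec_eq_zero hdet (v := fun l : Fin k =>
        M (Fin.last k) * D i (M l.castSucc) - M l.castSucc * D i (M (Fin.last k))) ?_
      · intro l
        exact sub_eq_zero.1 (congrFun hz l)
      · ext q
        have h1 := hD i q
        have h2 := hM (w q) ((hw q).trans q.2.le)
        rw [Fin.sum_univ_castSucc] at h1 h2
        simp only [Matrix.mulVec, dotProduct, Matrix.of_apply, Pi.zero_apply, mul_sub,
          Finset.sum_sub_distrib]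
        have e1 : ∑ x : Fin k, wordDeriv D (w q) (φ x.castSucc) * (M (Fin.last k) * D i (M x.castSucc))
            = M (Fin.last k) * ∑ x : Fin k, D i (M x.castSucc) * wordDeriv D (w q) (φ x.castSucc) := by
          rw [Finset.mul_sum]
          exact Finset.sum_congr rfl fun _ _ => by ring
        have e2 : ∑ x : Fin k, wordDeriv D (w q) (φ x.castSucc) * (M x.castSucc * D i (M (Fin.last k)))
            = D i (M (Fin.last k)) * ∑ x : Fin k, M x.castSucc * wordDeriv D (w q) (φ x.castSucc) := by
          rw [Finset.mul_sum]
          exact Finset.sum_congr rfl fun _ _ => by ring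
        rw [e1, e2, eq_neg_of_add_eq_zero_left h1, eq_neg_of_add_eq_zero_left h2]
        ring
    have hc : ∀ l : Fin (k + 1), ∃ c : C, M l = c • M (Fin.last k) := by
      intro l
      refine Fin.lastCases ⟨1, by simp⟩ (fun l => ?_) l
      exact H _ _ hlast fun i => hprop i l
    choose c hc using hc
    have h0 := hM [] (by simp)
    have h1 : M (Fin.last k) * ∑ l, c l • φ l = 0 := by
      rw [← h0, Finset.mul_sum]
      refine Finset.sum_congr rfl fun l _ => ?_
      rw [hc l, wordDeriv_nil, mul_smul_comm, smul_mul_assoc]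
    have h2 := (mul_eq_zero.1 h1).resolve_left hlast
    have h3 := Fintype.linearIndependent_iff.1 hφ c h2 (Fin.last k)
    have h4 := hc (Fin.last k)
    rw [h3, zero_smul] at h4
    exact hlast h4

/-- The logarithmic-derivative criterion for proportionality of polynomials. -/
theorem MvPolynomial.exists_eq_smul_of_mul_pderiv_eq {m : ℕ} {k : Type*} [Field k] [CharZero k]
    (M N : MvPolynomial (Fin m) k) (hM : M ≠ 0)
    (h : ∀ i, M * MvPolynomial.pderiv i N = N * MvPolynomial.pderiv i M) :
    ∃ c : k, N = c • M := by
  classical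
  let o : MonomialOrder (Fin m) := MonomialOrder.lex
  have hE : ∀ (i : Fin m) (f : MvPolynomial (Fin m) k) (e : Fin m →₀ ℕ),
      (MvPolynomial.X i * MvPolynomial.pderiv i f).coeff e = e i * f.coeff e := by
    intro i f e
    rw [MvPolynomial.coeff_X_mul']
    split_ifs with hi
    · rw [MvPolynomial.coeff_pderiv]
      have : e - Finsupp.single i 1 + Finsupp.single i 1 = e := by
        apply tsub_add_cancel_of_le
        simpa [Finsupp.single_le_iff, Nat.one_le_iff_ne_zero] using hi
      rw [this]
      have hi' : 1 ≤ e i := by simpa [Nat.one_le_iff_ne_zero] using hi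
      have h2 : (((e - Finsupp.single i 1 : Fin m →₀ ℕ) i : ℕ) : k) + 1 = e i := by
        simp only [Finsupp.coe_tsub, Pi.sub_apply, Finsupp.single_eq_same]
        exact_mod_cast Nat.sub_add_cancel hi'
      rw [mul_comm]
      congr 1
    · have : e i = 0 := by simpa using hi
      simp [this]
  have key : ∀ N : MvPolynomial (Fin m) k, N ≠ 0 →
      (∀ i, M * MvPolynomial.pderiv i N = N * MvPolynomial.pderiv i M) →
      o.degree N = o.degree M := by
    intro N hN h
    ext i
    have h1 : M * (MvPolynomial.X i * MvPolynomial.pderiv i N) =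
        N * (MvPolynomial.X i * MvPolynomial.pderiv i M) := by
      linear_combination (MvPolynomial.X i) * h i
    have hdeg : ∀ f : MvPolynomial (Fin m) k,
        o.toSyn (o.degree (MvPolynomial.X i * MvPolynomial.pderiv i f)) ≤ o.toSyn (o.degree f) := by
      intro f
      rw [MonomialOrder.degree_le_iff]
      intro e he
      apply MonomialOrder.le_degree
      rw [MvPolynomial.mem_support_iff] at he ⊢
      rw [hE] at he
      exact right_ne_zero_of_mul he
    have h2 := congrArg (MvPolynomial.coeff (o.degree M + o.degree N)) h1
    rw [MonomialOrder.coeff_mul_of_add_of_degree_le (m := o) le_rfl (hdeg N), add_comm (o.degree M),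
      MonomialOrder.coeff_mul_of_add_of_degree_le (m := o) le_rfl (hdeg M), hE, hE] at h2
    have ha : M.coeff (o.degree M) ≠ 0 := MonomialOrder.leadingCoeff_ne_zero_iff.2 hM
    have hb : N.coeff (o.degree N) ≠ 0 := MonomialOrder.leadingCoeff_ne_zero_iff.2 hN
    have h3 : (M.coeff (o.degree M) * N.coeff (o.degree N)) *
        (((o.degree N) i : k) - ((o.degree M) i : k)) = 0 := by linear_combination h2
    have h4 := (mul_eq_zero.1 h3).resolve_left (mul_ne_zero ha hb)
    exact_mod_cast sub_eq_zero.1 h4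
  refine ⟨N.coeff (o.degree M) / M.coeff (o.degree M), ?_⟩
  set c := N.coeff (o.degree M) / M.coeff (o.degree M)
  have ha : M.coeff (o.degree M) ≠ 0 := MonomialOrder.leadingCoeff_ne_zero_iff.2 hM
  by_contra hne
  have hne' : N - c • M ≠ 0 := sub_ne_zero.2 hne
  have hd := key (N - c • M) hne' (fun i => by
    simp only [map_sub, Derivation.map_smul, mul_sub, sub_mul, h i, mul_smul_comm, smul_mul_assoc])
  have h5 := MonomialOrder.leadingCoeff_ne_zero_iff (m := o).2 hne'
  apply h5
  rw [MonomialOrder.leadingCoeff, hd]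
  simp only [MvPolynomial.coeff_sub, MvPolynomial.coeff_smul, smul_eq_mul, c]
  rw [div_mul_cancel₀ _ ha, sub_self]

end Wronskian

section

open NumberField Height

section Places

variable {K : Type*} [Field K] [NumberField K]

/-- The places of a number field, archimedean or not. -/
abbrev AllPlaces (K : Type*) [Field K] [NumberField K] := InfinitePlace K ⊕ FinitePlace K

/-- The (unnormalised) absolute value of a place. -/
noncomputable def placeAbs : AllPlaces K → AbsoluteValue K ℝ
  | Sum.inl v => v.val
  | Sum.inr v => v.val

/-- The exponent with which a place enters the product formula. -/
noncomputable def placeMult : AllPlaces K → ℕ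
  | Sum.inl v => v.mult
  | Sum.inr _ => 1

/-- The logarithm of the normalised absolute value. -/
noncomputable def logAbs (v : AllPlaces K) (x : K) : ℝ := placeMult v * Real.log (placeAbs v x)

theorem placeMult_pos (v : AllPlaces K) : 0 < placeMult v := by
  cases v with
  | inl v => exact v.mult_pos
  | inr v => exact one_pos

theorem placeAbs_pos (v : AllPlaces K) {x : K} (hx : x ≠ 0) : 0 < placeAbs v x :=
  (placeAbs v).pos hx

theorem logAbs_mul (v : AllPlaces K) {x y : K} (hx : x ≠ 0) (hy : y ≠ 0) :
    logAbs v (x * y) = logAbs v x + logAbs v y := by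
  rw [logAbs, logAbs, logAbs, map_mul, Real.log_mul (placeAbs_pos v hx).ne' (placeAbs_pos v hy).ne',
    mul_add]

@[simp] theorem logAbs_one (v : AllPlaces K) : logAbs v 1 = 0 := by simp [logAbs]

@[simp] theorem logAbs_neg (v : AllPlaces K) (x : K) : logAbs v (-x) = logAbs v x := by
  simp [logAbs]

theorem logAbs_inv (v : AllPlaces K) (x : K) : logAbs v x⁻¹ = -logAbs v x := by
  simp [logAbs]

theorem placeAbs_isNonarchimedean (v : FinitePlace K) :
    IsNonarchimedean (placeAbs (Sum.inr v : AllPlaces K)) :=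
  FinitePlace.add_le v

theorem finite_logAbs_ne_zero {x : K} (hx : x ≠ 0) : {v : AllPlaces K | logAbs v x ≠ 0}.Finite := by
  have h : {v : FinitePlace K | v x ≠ 1}.Finite := FinitePlace.hasFiniteMulSupport hx
  refine ((Set.finite_range (Sum.inl : InfinitePlace K → AllPlaces K)).union
    (h.image Sum.inr)).subset ?_
  rintro (v | v) hv
  · exact Or.inl ⟨v, rfl⟩
  · refine Or.inr ⟨v, fun h1 => hv ?_, rfl⟩
    have : placeAbs (Sum.inr v : AllPlaces K) x = 1 := h1
    simp [logAbs, this]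

theorem finsum_allPlaces (f : AllPlaces K → ℝ) (hf : f.support.Finite) :
    ∑ᶠ v, f v = ∑ v : InfinitePlace K, f (Sum.inl v) + ∑ᶠ v : FinitePlace K, f (Sum.inr v) := by
  have h2 : (fun v : FinitePlace K => f (Sum.inr v)).support.Finite :=
    hf.preimage Sum.inr_injective.injOn
  rw [finsum_eq_sum_of_support_subset (s := Finset.disjSum Finset.univ h2.toFinset) f,
    finsum_eq_sum _ h2, Finset.sum_disjSum]
  rintro (v | v) hv <;> simp_all

theorem finsum_logAbs {x : K} (hx : x ≠ 0) : ∑ᶠ v : AllPlaces K, logAbs v x = 0 := by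
  have hfin : (fun v : FinitePlace K => v x).HasFiniteMulSupport :=
    FinitePlace.hasFiniteMulSupport hx
  have hlog : Real.log (∏ᶠ v : FinitePlace K, v x) = ∑ᶠ v : FinitePlace K, Real.log (v x) := by
    rw [finprod_eq_prod _ hfin, Real.log_prod,
      finsum_eq_sum_of_support_subset (s := hfin.toFinset)]
    · intro v hv
      simp only [Function.mem_support, Real.log_ne_zero] at hv
      exact hfin.mem_toFinset.2 hv.2.1
    · intro v _
      exact (map_ne_zero v).2 hx
  rw [finsum_allPlaces _ (finite_logAbs_ne_zero hx)]
  have h := congrArg Real.log (prod_abs_eq_one hx)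
  rw [Real.log_mul, Real.log_one, Real.log_prod, hlog] at h
  · rw [← h]
    congr 1
    · refine Finset.sum_congr rfl fun v _ => ?_
      rw [Real.log_pow]
      rfl
    · refine finsum_congr fun v => ?_
      simp only [logAbs, placeMult, Nat.cast_one, one_mul]
      rfl
  · intro v _
    exact pow_ne_zero _ ((map_ne_zero v).2 hx)
  · exact Finset.prod_ne_zero_iff.2 fun v _ => pow_ne_zero _ ((map_ne_zero v).2 hx)
  · rw [finprod_eq_prod _ hfin]
    exact Finset.prod_ne_zero_iff.2 fun v _ => (map_ne_zero v).2 hx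

theorem finite_posLogAbs_ne_zero (x : K) :
    (fun v : AllPlaces K => max 0 (logAbs v x)).support.Finite := by
  rcases eq_or_ne x 0 with rfl | hx
  · convert Set.finite_empty
    ext v
    simp [logAbs]
  · refine (finite_logAbs_ne_zero hx).subset fun v hv h => hv ?_
    simp [h]

theorem logHeight₁_eq_finsum (x : K) :
    logHeight₁ x = ∑ᶠ v : AllPlaces K, max 0 (logAbs v x) := by
  rw [NumberField.logHeight₁_eq, finsum_allPlaces _ (finite_posLogAbs_ne_zero x)]
  congr 1
  · refine Finset.sum_congr rfl fun v _ => ?_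
    rw [Real.posLog_apply, mul_max_of_nonneg _ _ (Nat.cast_nonneg _), mul_zero]
    rfl
  · refine finsum_congr fun v => ?_
    rw [Real.posLog_apply]
    simp only [logAbs, placeMult, Nat.cast_one, one_mul]
    rfl

theorem logAbs_le_logHeight₁ (v : AllPlaces K) (x : K) : logAbs v x ≤ logHeight₁ x := by
  rw [logHeight₁_eq_finsum]
  exact (le_max_right _ _).trans (single_le_finsum v (finite_posLogAbs_ne_zero x)
    fun _ => le_max_left _ _)

theorem sum_abs_logAbs_le (x : K) (s : Finset (AllPlaces K)) :
    ∑ v ∈ s, |logAbs v x| ≤ 2 * logHeight₁ x := by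
  classical
  have h : ∀ x : K, ∑ v ∈ s, max 0 (logAbs v x) ≤ logHeight₁ x := by
    intro x
    rw [logHeight₁_eq_finsum, finsum_eq_sum_of_support_subset
      (s := s ∪ (finite_posLogAbs_ne_zero x).toFinset)]
    · exact Finset.sum_le_sum_of_subset_of_nonneg Finset.subset_union_left
        fun _ _ _ => le_max_left _ _
    · intro v hv
      simp only [Finset.coe_union, Set.mem_union]
      right
      simpa using hv
  have h1 := h x
  have h2 := h x⁻¹
  rw [logHeight₁_inv] at h2
  calc ∑ v ∈ s, |logAbs v x| = ∑ v ∈ s, max 0 (logAbs v x) + ∑ v ∈ s, max 0 (logAbs v x⁻¹) := by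
        rw [← Finset.sum_add_distrib]
        refine Finset.sum_congr rfl fun v _ => ?_
        rw [logAbs_inv]
        rcases le_total 0 (logAbs v x) with h | h
        · rw [abs_of_nonneg h, max_eq_right h, max_eq_left (by linarith), add_zero]
        · rw [abs_of_nonpos h, max_eq_left h, max_eq_right (by linarith), zero_add]
    _ ≤ _ := by linarith

theorem abs_logAbs_le (v : AllPlaces K) (x : K) : |logAbs v x| ≤ logHeight₁ x := by
  have h1 := logAbs_le_logHeight₁ v x
  have h2 := logAbs_le_logHeight₁ v x⁻¹
  rw [logHeight₁_inv, logAbs_inv] at h2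
  exact abs_le.2 ⟨by linarith, h1⟩

theorem placeAbs_intCast_le_one (v : FinitePlace K) (a : ℤ) :
    placeAbs (Sum.inr v : AllPlaces K) (a : K) ≤ 1 :=
  (placeAbs_isNonarchimedean v).apply_intCast_le_one

theorem placeAbs_inl_eq (v : InfinitePlace K) (x : K) :
    placeAbs (Sum.inl v : AllPlaces K) x = ‖v.embedding x‖ := by
  rw [InfinitePlace.norm_embedding_eq]
  rfl

end Places

section OneVariable

variable {K : Type*} [Field K] [NumberField K]

theorem sum_logAbs_inl_le_of_le (f : InfinitePlace K → ℝ) (L : ℝ) (h : ∀ v, f v ≤ v.mult * L) :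
    ∑ v, f v ≤ Module.finrank ℚ K * L := by
  have : (∑ v : InfinitePlace K, (v.mult : ℝ)) = Module.finrank ℚ K := by
    exact_mod_cast InfinitePlace.sum_mult_eq (K := K)
  rw [← this, Finset.sum_mul]
  exact Finset.sum_le_sum fun v _ => h v

theorem mul_logHeight₁_le_of_pow_dvd (p : Polynomial ℤ) (hp : p ≠ 0) (ξ : K) (i : ℕ)
    (hdvd : (Polynomial.X - Polynomial.C ξ) ^ i ∣ p.map (Int.castRingHom K)) :
    i * logHeight₁ ξ ≤ Module.finrank ℚ K * Real.log (p.sum fun _ a => |(a : ℝ)|) := by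
  obtain ⟨q, hq⟩ := hdvd
  have hinj : Function.Injective (Int.castRingHom K) := RingHom.injective_int _
  have hlead : q.leadingCoeff = (p.leadingCoeff : K) := by
    have := congrArg Polynomial.leadingCoeff hq
    rw [Polynomial.leadingCoeff_map_of_injective hinj, Polynomial.leadingCoeff_mul,
      Polynomial.leadingCoeff_pow, Polynomial.leadingCoeff_X_sub_C, one_pow, one_mul] at this
    exact this.symm
  set a : K := (p.leadingCoeff : K) with ha
  have ha0 : a ≠ 0 := by simpa [ha] using hp
  set L := Real.log (p.sum fun _ a => |(a : ℝ)|)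
  -- the archimedean and the ultrametric estimates
  have harch : ∀ v : InfinitePlace K, i * max 0 (logAbs (Sum.inl v) ξ) + logAbs (Sum.inl v) a
      ≤ v.mult * L := by
    intro v
    have e1 : p.map (Int.castRingHom ℂ) = (Polynomial.X - Polynomial.C (v.embedding ξ)) ^ i *
        q.map v.embedding := by
      have := congrArg (Polynomial.map v.embedding) hq
      rw [Polynomial.map_map, Polynomial.map_mul] at this
      simp only [Polynomial.map_pow, Polynomial.map_sub, Polynomial.map_X, Polynomial.map_C] at this
      rw [← this]
      congr 1
      exact RingHom.ext_int _ _
    have e2 : (p.map (Int.castRingHom ℂ)).mahlerMeasure ≤ p.sum fun _ a => |(a : ℝ)| := by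
      refine (Polynomial.mahlerMeasure_le_sum_norm_coeff _).trans (le_of_eq ?_)
      rw [Polynomial.sum_def, Polynomial.sum_def,
        Polynomial.support_map_of_injective _ (RingHom.injective_int _)]
      refine Finset.sum_congr rfl fun j _ => ?_
      rw [Polynomial.coeff_map, eq_intCast, Complex.norm_intCast]
    have e3 := congrArg Polynomial.mahlerMeasure e1
    have hpow : ((Polynomial.X - Polynomial.C (v.embedding ξ)) ^ i).mahlerMeasure =
        (max 1 ‖v.embedding ξ‖) ^ i := by
      clear hq e1 e3
      induction i with
      | zero => simp
      | succ i ih =>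
        rw [pow_succ, Polynomial.mahlerMeasure_mul, Polynomial.mahlerMeasure_X_sub_C, pow_succ, ih]
    rw [Polynomial.mahlerMeasure_mul, hpow] at e3
    have e4 : ‖v.embedding a‖ ≤ (q.map v.embedding).mahlerMeasure := by
      rw [← hlead, ← Polynomial.leadingCoeff_map_of_injective v.embedding.injective]
      exact Polynomial.leadingCoeff_le_mahlerMeasure _
    have hapos : 0 < ‖v.embedding a‖ := norm_pos_iff.2 ((map_ne_zero _).2 ha0)
    have e5 : (max 1 ‖v.embedding ξ‖) ^ i * ‖v.embedding a‖ ≤ p.sum fun _ a => |(a : ℝ)| := by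
      refine le_trans ?_ (e3.symm.le.trans e2)
      gcongr
    have e6 := Real.log_le_log (by positivity) e5
    rw [Real.log_mul (by positivity) hapos.ne', Real.log_pow] at e6
    have e7 : Real.log (max 1 ‖v.embedding ξ‖) = max 0 (Real.log ‖v.embedding ξ‖) := by
      rcases le_total ‖v.embedding ξ‖ 1 with h | h
      · rw [max_eq_left h, Real.log_one, max_eq_left (Real.log_nonpos (norm_nonneg _) h)]
      · rw [max_eq_right h, max_eq_right (Real.log_nonneg h)]
    rw [e7] at e6
    simp only [logAbs, placeAbs_inl_eq]
    change _ * max 0 ((v.mult : ℝ) * _) + (v.mult : ℝ) * _ ≤ _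
    have h8 : max 0 ((v.mult : ℝ) * Real.log ‖v.embedding ξ‖) =
        v.mult * max 0 (Real.log ‖v.embedding ξ‖) := by
      rw [mul_max_of_nonneg _ _ (Nat.cast_nonneg _), mul_zero]
    rw [h8]
    have : (0 : ℝ) ≤ v.mult := Nat.cast_nonneg _
    nlinarith
  have hfin : ∀ v : FinitePlace K,
      i * max 0 (logAbs (Sum.inr v) ξ) + logAbs (Sum.inr v) a ≤ 0 := by
    intro v
    set w := placeAbs (Sum.inr v : AllPlaces K) with hw
    have hna := placeAbs_isNonarchimedean v
    have hmul : ∀ f g : Polynomial K, (f * g).gaussNorm w 1 = f.gaussNorm w 1 * g.gaussNorm w 1 :=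
      Polynomial.gaussNorm_mul hna one_pos
    have h1 : (p.map (Int.castRingHom K)).gaussNorm w 1 ≤ 1 := by
      obtain ⟨j, hj⟩ := Polynomial.exists_eq_gaussNorm w 1 (p.map (Int.castRingHom K))
      rw [hj, one_pow, mul_one, Polynomial.coeff_map]
      exact placeAbs_intCast_le_one v _
    have h2 : w a ≤ q.gaussNorm w 1 := by
      have := Polynomial.le_gaussNorm w q zero_le_one q.natDegree
      rwa [one_pow, mul_one, Polynomial.coeff_natDegree, hlead] at this
    have h3 : max 1 (w ξ) ≤ (Polynomial.X - Polynomial.C ξ).gaussNorm w 1 := by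
      have e0 := Polynomial.le_gaussNorm w (Polynomial.X - Polynomial.C ξ) zero_le_one 0
      have e1 := Polynomial.le_gaussNorm w (Polynomial.X - Polynomial.C ξ) zero_le_one 1
      simp at e0 e1
      exact max_le e1 e0
    have h4 : max 1 (w ξ) ^ i ≤ ((Polynomial.X - Polynomial.C ξ) ^ i).gaussNorm w 1 := by
      clear hq
      induction i with
      | zero =>
        have := Polynomial.le_gaussNorm w (1 : Polynomial K) zero_le_one 0
        simpa using this
      | succ i ih =>
        rw [pow_succ, pow_succ, hmul]
        have := ih (by
          intro v
          have := harch v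
          push_cast at this
          have h9 : 0 ≤ max 0 (logAbs (Sum.inl v) ξ) := le_max_left _ _
          linarith)
        gcongr
        exact this.trans' (by positivity)
    have h5 : max 1 (w ξ) ^ i * w a ≤ 1 := by
      refine le_trans ?_ h1
      rw [hq, hmul]
      exact mul_le_mul h4 h2 (w.nonneg _) (h4.trans' (by positivity))
    have hwa : 0 < w a := w.pos ha0
    have h6 := Real.log_le_log (by positivity) h5
    rw [Real.log_mul (by positivity) hwa.ne', Real.log_pow, Real.log_one] at h6
    have e7 : Real.log (max 1 (w ξ)) = max 0 (Real.log (w ξ)) := by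
      rcases le_total (w ξ) 1 with h | h
      · rw [max_eq_left h, Real.log_one, max_eq_left (Real.log_nonpos (w.nonneg _) h)]
      · rw [max_eq_right h, max_eq_right (Real.log_nonneg h)]
    rw [e7] at h6
    simpa [logAbs, placeMult] using h6
  have h1 := (finite_posLogAbs_ne_zero ξ)
  have h2 := finite_logAbs_ne_zero ha0
  calc i * logHeight₁ ξ = i * ∑ᶠ v : AllPlaces K, max 0 (logAbs v ξ)
        + ∑ᶠ v : AllPlaces K, logAbs v a := by
        rw [finsum_logAbs ha0, logHeight₁_eq_finsum, add_zero]
    _ = ∑ᶠ v : AllPlaces K, (i * max 0 (logAbs v ξ) + logAbs v a) := by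
        rw [mul_finsum, finsum_add_distrib _ h2]
        exact h1.subset fun v hv h => hv (by simpa using Or.inr h)
    _ = _ := finsum_allPlaces _ ?_
    _ ≤ Module.finrank ℚ K * L + 0 := by
        apply add_le_add (sum_logAbs_inl_le_of_le _ _ harch)
        exact finsum_induction (fun x : ℝ => x ≤ 0) le_rfl (fun _ _ => add_nonpos) hfin
    _ = _ := add_zero _
  refine (h1.union h2).subset fun v hv => ?_
  by_contra hcon
  simp only [Set.mem_union, Function.mem_support, Set.mem_ofPred_eq, not_or, not_not] at hcon
  exact hv (by simp [hcon.1, hcon.2])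

end OneVariable

end

section

open MvPolynomial

section WeightedNorm

variable {σ τ R : Type*} [CommRing R]

/-- The `ℓ¹`-norm of a polynomial, the variables being weighted by `ρ`. -/
noncomputable def gnorm (v : AbsoluteValue R ℝ) (ρ : σ → ℝ) (p : MvPolynomial σ R) : ℝ :=
  ∑ e ∈ p.support, v (coeff e p) * e.prod fun h k => ρ h ^ k

variable (v : AbsoluteValue R ℝ) {ρ : σ → ℝ}

theorem weight_nonneg (hρ : ∀ h, 0 ≤ ρ h) (e : σ →₀ ℕ) : 0 ≤ e.prod fun h k => ρ h ^ k :=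
  Finset.prod_nonneg fun h _ => pow_nonneg (hρ h) _

theorem weight_add (e f : σ →₀ ℕ) : ((e + f).prod fun h k => ρ h ^ k) =
    (e.prod fun h k => ρ h ^ k) * f.prod fun h k => ρ h ^ k :=
  Finsupp.prod_add_index' (fun _ => pow_zero _) fun _ _ _ => pow_add _ _ _

theorem gnorm_eq_sum_of_support_subset (p : MvPolynomial σ R) (s : Finset (σ →₀ ℕ))
    (hs : p.support ⊆ s) : gnorm v ρ p = ∑ e ∈ s, v (coeff e p) * e.prod fun h k => ρ h ^ k :=
  Finset.sum_subset hs fun e _ he => by simp [notMem_support_iff.1 he]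

theorem gnorm_nonneg (hρ : ∀ h, 0 ≤ ρ h) (p : MvPolynomial σ R) : 0 ≤ gnorm v ρ p :=
  Finset.sum_nonneg fun e _ => mul_nonneg (v.nonneg _) (weight_nonneg hρ e)

@[simp] theorem gnorm_zero : gnorm v ρ 0 = 0 := by simp [gnorm]

theorem coeff_mul_weight_le_gnorm (hρ : ∀ h, 0 ≤ ρ h) (p : MvPolynomial σ R) (e : σ →₀ ℕ) :
    v (coeff e p) * (e.prod fun h k => ρ h ^ k) ≤ gnorm v ρ p := by
  classical
  rw [gnorm_eq_sum_of_support_subset v p (insert e p.support) (Finset.subset_insert _ _)]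
  exact Finset.single_le_sum (f := fun e => v (coeff e p) * e.prod fun h k => ρ h ^ k)
    (fun e _ => mul_nonneg (v.nonneg _) (weight_nonneg hρ e)) (Finset.mem_insert_self _ _)

theorem gnorm_add_le (hρ : ∀ h, 0 ≤ ρ h) (p q : MvPolynomial σ R) :
    gnorm v ρ (p + q) ≤ gnorm v ρ p + gnorm v ρ q := by
  classical
  rw [gnorm_eq_sum_of_support_subset v p (p.support ∪ q.support) Finset.subset_union_left,
    gnorm_eq_sum_of_support_subset v q (p.support ∪ q.support) Finset.subset_union_right,
    gnorm_eq_sum_of_support_subset v (p + q) (p.support ∪ q.support) support_add,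
    ← Finset.sum_add_distrib]
  refine Finset.sum_le_sum fun e _ => ?_
  rw [← add_mul, coeff_add]
  exact mul_le_mul_of_nonneg_right (v.add_le _ _) (weight_nonneg hρ e)

theorem gnorm_sum_le (hρ : ∀ h, 0 ≤ ρ h) {α : Type*} (s : Finset α) (f : α → MvPolynomial σ R) :
    gnorm v ρ (∑ i ∈ s, f i) ≤ ∑ i ∈ s, gnorm v ρ (f i) := by
  classical
  induction s using Finset.induction_on with
  | empty => simp
  | insert a s ha ih =>
    rw [Finset.sum_insert ha, Finset.sum_insert ha]
    exact (gnorm_add_le v hρ _ _).trans (by linarith)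

theorem gnorm_monomial (e : σ →₀ ℕ) (a : R) :
    gnorm v ρ (monomial e a) = v a * e.prod fun h k => ρ h ^ k := by
  classical
  rw [gnorm_eq_sum_of_support_subset v _ {e} support_monomial_subset, Finset.sum_singleton,
    coeff_monomial, if_pos rfl]

theorem gnorm_C (a : R) : gnorm v ρ (C a) = v a := by
  rw [← monomial_zero', gnorm_monomial]
  simp

theorem gnorm_X [IsDomain R] (h : σ) : gnorm v ρ (X h) = ρ h := by
  rw [X, gnorm_monomial]
  simp

theorem gnorm_neg (p : MvPolynomial σ R) : gnorm v ρ (-p) = gnorm v ρ p := by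
  simp only [gnorm, support_neg, coeff_neg, v.map_neg]

theorem gnorm_mul_le (hρ : ∀ h, 0 ≤ ρ h) (p q : MvPolynomial σ R) :
    gnorm v ρ (p * q) ≤ gnorm v ρ p * gnorm v ρ q := by
  conv_lhs => rw [p.as_sum, q.as_sum, Finset.sum_mul_sum]
  refine (gnorm_sum_le v hρ _ _).trans ?_
  rw [gnorm, gnorm, Finset.sum_mul_sum]
  refine Finset.sum_le_sum fun e _ => (gnorm_sum_le v hρ _ _).trans (Finset.sum_le_sum fun f _ => ?_)
  rw [monomial_mul, gnorm_monomial, weight_add, map_mul]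
  exact le_of_eq (by ring)

theorem gnorm_prod_le [IsDomain R] (hρ : ∀ h, 0 ≤ ρ h) {α : Type*} (s : Finset α)
    (f : α → MvPolynomial σ R) : gnorm v ρ (∏ i ∈ s, f i) ≤ ∏ i ∈ s, gnorm v ρ (f i) := by
  classical
  induction s using Finset.induction_on with
  | empty => simp [← C_1, gnorm_C, -map_one]
  | insert a s ha ih =>
    rw [Finset.prod_insert ha, Finset.prod_insert ha]
    exact (gnorm_mul_le v hρ _ _).trans
      (mul_le_mul_of_nonneg_left ih (gnorm_nonneg v hρ _))

theorem gnorm_pow_le [IsDomain R] (hρ : ∀ h, 0 ≤ ρ h) (p : MvPolynomial σ R) (k : ℕ) :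
    gnorm v ρ (p ^ k) ≤ gnorm v ρ p ^ k := by
  simpa using gnorm_prod_le v hρ (Finset.range k) fun _ => p

theorem gnorm_det_le [IsDomain R] (hρ : ∀ h, 0 ≤ ρ h) {k : ℕ}
    (M : Matrix (Fin k) (Fin k) (MvPolynomial σ R)) {B : ℝ} (hM : ∀ i j, gnorm v ρ (M i j) ≤ B) :
    gnorm v ρ M.det ≤ k.factorial * B ^ k := by
  rw [Matrix.det_apply]
  refine (gnorm_sum_le v hρ _ _).trans ?_
  refine (Finset.sum_le_card_nsmul _ _ (B ^ k) fun s _ => ?_).trans (le_of_eq ?_)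
  · have : gnorm v ρ (Equiv.Perm.sign s • ∏ i, M (s i) i) = gnorm v ρ (∏ i, M (s i) i) := by
      rcases Int.units_eq_one_or (Equiv.Perm.sign s) with h | h <;> simp [h, gnorm_neg]
    rw [this]
    refine (gnorm_prod_le v hρ _ _).trans ?_
    refine (Finset.prod_le_prod (fun i _ => gnorm_nonneg v hρ _) fun i _ => hM _ i).trans ?_
    simp
  · simp [Fintype.card_perm]

end WeightedNorm

section IntegerNorm

/-- The usual absolute value on the integers, with real values. -/
noncomputable def intAbs : AbsoluteValue ℤ ℝ :=
  (AbsoluteValue.abs : AbsoluteValue ℝ ℝ).comp (f := Int.castRingHom ℝ) Int.cast_injective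

@[simp] theorem intAbs_apply (a : ℤ) : intAbs a = |(a : ℝ)| := rfl

variable {σ τ : Type*}

/-- The sum of the absolute values of the coefficients. -/
noncomputable def l1norm (p : MvPolynomial σ ℤ) : ℝ := gnorm intAbs (fun _ => 1) p

theorem l1norm_eq (p : MvPolynomial σ ℤ) : l1norm p = ∑ e ∈ p.support, |((coeff e p : ℤ) : ℝ)| := by
  simp [l1norm, gnorm, Finsupp.prod]

theorem abs_coeff_le_l1norm (p : MvPolynomial σ ℤ) (e : σ →₀ ℕ) :
    |((coeff e p : ℤ) : ℝ)| ≤ l1norm p := by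
  simpa [l1norm, Finsupp.prod] using coeff_mul_weight_le_gnorm intAbs (ρ := fun _ => 1)
    (fun _ => zero_le_one) p e

theorem one_le_l1norm {p : MvPolynomial σ ℤ} (hp : p ≠ 0) : 1 ≤ l1norm p := by
  obtain ⟨e, he⟩ := ne_zero_iff.1 hp
  refine le_trans ?_ (abs_coeff_le_l1norm p e)
  exact_mod_cast Int.one_le_abs he

theorem l1norm_nonneg (p : MvPolynomial σ ℤ) : 0 ≤ l1norm p :=
  gnorm_nonneg _ (fun _ => zero_le_one) _

end IntegerNorm

section WeightedOrder

variable {σ τ R : Type*} [CommRing R] [Fintype σ]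

/-- Every monomial of `f` has weight at least `θ`. -/
def OrdGE (w : σ → ℝ) (f : MvPolynomial σ R) (θ : ℝ) : Prop :=
  ∀ e, coeff e f ≠ 0 → θ ≤ ∑ h, w h * e h

variable {w : σ → ℝ} {f g : MvPolynomial σ R} {θ η : ℝ}

theorem OrdGE.mono (hf : OrdGE w f θ) (h : η ≤ θ) : OrdGE w f η := fun e he => h.trans (hf e he)

theorem ordGE_zero_poly : OrdGE w (0 : MvPolynomial σ R) θ := fun _ he => (he (coeff_zero _)).elim

theorem ordGE_zero (hw : ∀ h, 0 ≤ w h) : OrdGE w f 0 := fun _ _ =>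
  Finset.sum_nonneg fun h _ => mul_nonneg (hw h) (Nat.cast_nonneg _)

theorem OrdGE.add (hf : OrdGE w f θ) (hg : OrdGE w g θ) : OrdGE w (f + g) θ := fun e he => by
  rw [coeff_add] at he
  by_cases h : coeff e f = 0
  · exact hg e (by simpa [h] using he)
  · exact hf e h

theorem OrdGE.smul (hf : OrdGE w f θ) (c : R) : OrdGE w (c • f) θ := fun e he =>
  hf e fun h => he (by simp [h])

theorem OrdGE.sum {α : Type*} (s : Finset α) {f : α → MvPolynomial σ R}
    (hf : ∀ i ∈ s, OrdGE w (f i) θ) : OrdGE w (∑ i ∈ s, f i) θ := by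
  classical
  induction s using Finset.induction_on with
  | empty => simpa using ordGE_zero_poly
  | insert a s ha ih =>
    rw [Finset.sum_insert ha]
    exact (hf a (by simp)).add (ih fun i hi => hf i (by simp [hi]))

theorem OrdGE.mul (hf : OrdGE w f θ) (hg : OrdGE w g η) : OrdGE w (f * g) (θ + η) := by
  classical
  intro e he
  rw [coeff_mul] at he
  obtain ⟨x, hx, hne⟩ := Finset.exists_ne_zero_of_sum_ne_zero he
  rw [Finset.HasAntidiagonal.mem_antidiagonal] at hx
  rw [← hx]
  have h1 := hf x.1 (left_ne_zero_of_mul hne)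
  have h2 := hg x.2 (right_ne_zero_of_mul hne)
  calc θ + η ≤ _ := add_le_add h1 h2
    _ = _ := by rw [← Finset.sum_add_distrib]; simp [mul_add]

theorem OrdGE.prod {α : Type*} (hw : ∀ h, 0 ≤ w h) (s : Finset α) {f : α → MvPolynomial σ R}
    {θ : α → ℝ} (hf : ∀ i ∈ s, OrdGE w (f i) (θ i)) :
    OrdGE w (∏ i ∈ s, f i) (∑ i ∈ s, θ i) := by
  classical
  induction s using Finset.induction_on with
  | empty => simpa using ordGE_zero hw
  | insert a s ha ih =>
    rw [Finset.prod_insert ha, Finset.sum_insert ha]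
    exact (hf a (by simp)).mul (ih fun i hi => hf i (by simp [hi]))

theorem OrdGE.det (hw : ∀ h, 0 ≤ w h) {k : ℕ} {M : Matrix (Fin k) (Fin k) (MvPolynomial σ R)}
    {θ : Fin k → ℝ} (hM : ∀ i j, OrdGE w (M i j) (θ i)) : OrdGE w M.det (∑ i, θ i) := by
  rw [Matrix.det_apply]
  refine OrdGE.sum _ fun s _ => ?_
  have h : OrdGE w (∏ i, M (s i) i) (∑ i, θ i) := by
    rw [← Equiv.sum_comp s θ]
    exact OrdGE.prod hw _ fun i _ => hM _ _
  rcases Int.units_eq_one_or (Equiv.Perm.sign s) with hs | hs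
  · simpa [hs] using h
  · simpa [hs] using h.smul (-1)

theorem OrdGE.pderiv (hf : OrdGE w f θ) (i : σ) : OrdGE w (pderiv i f) (θ - w i) := by
  classical
  intro e he
  have h1 : coeff (e + Finsupp.single i 1) f ≠ 0 := by
    intro h
    apply he
    rw [f.as_sum, map_sum, coeff_sum]
    refine Finset.sum_eq_zero fun x hx => ?_
    rw [pderiv_monomial, coeff_monomial]
    split_ifs with hxe
    · rcases Nat.eq_zero_or_pos (x i) with h0 | h0
      · simp [h0]
      · exfalso
        apply mem_support_iff.1 hx
        rw [← h, ← hxe, tsub_add_cancel_of_le]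
        rw [Finsupp.single_le_iff]
        exact h0
    · rfl
  have h2 := hf _ h1
  simp only [Finsupp.add_apply, Nat.cast_add, mul_add, Finset.sum_add_distrib] at h2
  have h3 : ∑ x, w x * ((Finsupp.single i 1 : σ →₀ ℕ) x : ℝ) = w i := by
    rw [Finset.sum_eq_single i] <;> simp +contextual [eq_comm]
  linarith

theorem OrdGE.wordDeriv {k : Type*} [Field k] {f : MvPolynomial σ k} (hf : OrdGE w f θ)
    (l : List σ) : OrdGE w (wordDeriv (fun i => MvPolynomial.pderiv (R := k) i) l f)
      (θ - (l.map w).sum) := by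
  induction l with
  | nil => simpa using hf
  | cons i l ih =>
    simpa [sub_sub, add_comm] using ih.pderiv i

end WeightedOrder

section Shift

variable {σ k : Type*} [Field k]

/-- The translation of polynomials by `ξ`. -/
noncomputable def shift (ξ : σ → k) : MvPolynomial σ k →ₐ[k] MvPolynomial σ k :=
  aeval fun h => X h + C (ξ h)

@[simp] theorem shift_X (ξ : σ → k) (h : σ) : shift ξ (X h) = X h + C (ξ h) := by simp [shift]

theorem shift_pderiv (ξ : σ → k) (i : σ) (f : MvPolynomial σ k) :
    shift ξ (pderiv i f) = pderiv i (shift ξ f) := by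
  classical
  induction f using MvPolynomial.induction_on with
  | C a => simp [shift]
  | add p q hp hq => simp [hp, hq]
  | mul_X p j hp =>
    simp only [Derivation.leibniz, map_add, map_mul, smul_eq_mul, hp, shift_X, pderiv_C,
      pderiv_X, add_zero]
    simp [Pi.single_apply]

theorem shift_wordDeriv (ξ : σ → k) (l : List σ) (f : MvPolynomial σ k) :
    shift ξ (wordDeriv (fun i => pderiv (R := k) i) l f) =
      wordDeriv (fun i => pderiv (R := k) i) l (shift ξ f) := by
  induction l with
  | nil => rfl
  | cons i l ih => simp [shift_pderiv, ih]

end Shift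

section Hasse

variable {σ : Type*} [Fintype σ]

/-- The Hasse derivative of index `I`. -/
noncomputable def hasse (I : σ →₀ ℕ) (p : MvPolynomial σ ℤ) : MvPolynomial σ ℤ :=
  ∑ e ∈ p.support, monomial (e - I) (coeff e p * ∏ h, ((e h).choose (I h) : ℤ))

theorem pderiv_hasse (I : σ →₀ ℕ) (p : MvPolynomial σ ℤ) (i : σ) :
    pderiv i (hasse I p) = (I i + 1) • hasse (I + Finsupp.single i 1) p := by
  classical
  rw [hasse, hasse, map_sum, Finset.smul_sum]
  refine Finset.sum_congr rfl fun e _ => ?_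
  rw [pderiv_monomial, tsub_tsub, ← map_nsmul]
  congr 1
  rw [← Finset.mul_prod_erase Finset.univ _ (Finset.mem_univ i),
    ← Finset.mul_prod_erase Finset.univ (fun h => ((e h).choose _ : ℤ)) (Finset.mem_univ i)]
  have h1 : ∏ x ∈ Finset.univ.erase i, ((e x).choose ((I + Finsupp.single i 1 : σ →₀ ℕ) x) : ℤ) =
      ∏ x ∈ Finset.univ.erase i, ((e x).choose (I x) : ℤ) := by
    refine Finset.prod_congr rfl fun x hx => ?_
    simp [(Finset.ne_of_mem_erase hx).symm]
  rw [h1]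
  have h2 := Nat.choose_succ_right_eq (e i) (I i)
  simp only [Finsupp.coe_add, Finsupp.coe_tsub, Pi.add_apply, Pi.sub_apply, Finsupp.single_eq_same,
    nsmul_eq_mul]
  have h3 : ((e i).choose (I i + 1) : ℤ) * (I i + 1 : ℕ) = (e i).choose (I i) * ((e i - I i : ℕ) : ℤ) := by
    exact_mod_cast h2
  linear_combination (-coeff e p * ∏ x ∈ Finset.univ.erase i, ((e x).choose (I x) : ℤ)) * h3

theorem l1norm_hasse_le (I : σ →₀ ℕ) (p : MvPolynomial σ ℤ) (d : σ → ℕ)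
    (hd : ∀ h, degreeOf h p ≤ d h) : l1norm (hasse I p) ≤ 2 ^ (∑ h, d h) * l1norm p := by
  refine (gnorm_sum_le _ (fun _ => zero_le_one) _ _).trans ?_
  rw [l1norm_eq, Finset.mul_sum]
  refine Finset.sum_le_sum fun e he => ?_
  rw [gnorm_monomial]
  simp only [intAbs_apply, one_pow, Finsupp.prod, Finset.prod_const_one, mul_one, Int.cast_mul,
    Int.cast_prod, Int.cast_natCast]
  rw [abs_mul]
  rw [mul_comm]
  refine mul_le_mul_of_nonneg_right ?_ (abs_nonneg _)
  rw [abs_of_nonneg (Finset.prod_nonneg fun _ _ => Nat.cast_nonneg _), ← Finset.prod_pow_eq_pow_sum]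
  refine Finset.prod_le_prod (fun _ _ => Nat.cast_nonneg _) fun h _ => ?_
  have h1 : (e h).choose (I h) ≤ 2 ^ d h := (Nat.choose_le_two_pow _ _).trans
    (Nat.pow_le_pow_right two_pos ((monomial_le_degreeOf h he).trans (hd h)))
  exact_mod_cast h1

theorem degreeOf_hasse_le (I : σ →₀ ℕ) (p : MvPolynomial σ ℤ) (h : σ) :
    degreeOf h (hasse I p) ≤ degreeOf h p := by
  classical
  refine (degreeOf_sum_le _ _ _).trans (Finset.sup_le fun e he => ?_)
  refine (degreeOf_le_iff.2 fun f hf => ?_)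
  have := Finset.mem_singleton.1 (support_monomial_subset hf)
  rw [this]
  exact (Nat.sub_le _ _).trans (monomial_le_degreeOf h he)

theorem hasse_zero (p : MvPolynomial σ ℤ) : hasse 0 p = p := by
  simp [hasse, ← p.as_sum]

theorem exists_wordDeriv_eq_hasse (k : Type*) [Field k] [CharZero k] (l : List σ) :
    ∃ (I : σ →₀ ℕ) (c : ℕ), c ≠ 0 ∧ ∀ p : MvPolynomial σ ℤ,
      wordDeriv (fun i => pderiv (R := k) i) l (map (Int.castRingHom k) p) =
        (c : k) • map (Int.castRingHom k) (hasse I p) := by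
  induction l with
  | nil => exact ⟨0, 1, one_ne_zero, fun p => by simp [hasse_zero]⟩
  | cons i l ih =>
    obtain ⟨I, c, hc, h⟩ := ih
    refine ⟨I + Finsupp.single i 1, c * (I i + 1), by positivity, fun p => ?_⟩
    rw [wordDeriv_cons, h p, Derivation.map_smul, pderiv_map, pderiv_hasse, map_nsmul,
      Nat.cast_mul, mul_smul, Nat.cast_smul_eq_nsmul k (I i + 1)]

end Hasse

section Factorization

theorem exists_rank_factorization {k M : Type*} [Field k] [AddCommGroup M] [Module k M] {N : ℕ}
    (q : Fin N → M) : ∃ (r : ℕ) (φ : Fin r → M) (a : Fin r → Fin N → k), r ≤ N ∧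
      LinearIndependent k φ ∧ LinearIndependent k a ∧ ∀ j, q j = ∑ l, a l j • φ l := by
  let V := Submodule.span k (Set.range q)
  have hmem : ∀ j, q j ∈ V := fun j => Submodule.subset_span ⟨j, rfl⟩
  have : Module.Finite k V := FiniteDimensional.span_of_finite k (Set.finite_range q)
  let b := Module.finBasis k V
  refine ⟨Module.finrank k V, fun l => b l, fun l j => b.repr ⟨q j, hmem j⟩ l, ?_,
    b.linearIndependent.map' V.subtype V.ker_subtype, ?_, fun j => ?_⟩
  · have : Module.finrank k V ≤ Fintype.card (Fin N) := finrank_range_le_card q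
    simpa using this
  · rw [Fintype.linearIndependent_iff]
    intro c hc
    have h0 : ∀ x : V, ∑ l, c l * b.repr x l = 0 := by
      rintro ⟨x, hx⟩
      induction hx using Submodule.span_induction with
      | mem x h =>
        obtain ⟨j, rfl⟩ := h
        simpa using congrFun hc j
      | zero =>
        simp [show (⟨0, Submodule.zero_mem _⟩ : V) = 0 from rfl]
      | add x y hx hy h1 h2 =>
        have : (⟨x + y, Submodule.add_mem _ hx hy⟩ : V) = ⟨x, hx⟩ + ⟨y, hy⟩ := rfl
        simp only [this, map_add, Finsupp.add_apply, mul_add, Finset.sum_add_distrib]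
        rw [h1, h2, add_zero]
      | smul t x hx h =>
        have : (⟨t • x, Submodule.smul_mem _ t hx⟩ : V) = t • ⟨x, hx⟩ := rfl
        simp only [this, map_smul, Finsupp.smul_apply, smul_eq_mul, mul_left_comm _ t,
          ← Finset.mul_sum, h, mul_zero]
    intro l
    simpa [Finsupp.single_apply] using h0 (b l)
  · have := congrArg (Subtype.val) (b.sum_repr ⟨q j, hmem j⟩)
    rw [Submodule.coe_sum] at this
    exact this.symm

variable {k : Type*} [Field k] {m : ℕ}

theorem finSuccEquiv_rename_succ (U : MvPolynomial (Fin m) k) :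
    finSuccEquiv k m (rename Fin.succ U) = Polynomial.C U := by
  have : ((finSuccEquiv k m).toAlgHom.comp (rename Fin.succ)) =
      (Algebra.ofId (MvPolynomial (Fin m) k) (Polynomial (MvPolynomial (Fin m) k))).restrictScalars k := by
    refine MvPolynomial.algHom_ext fun i => ?_
    simp [finSuccEquiv_X_succ, Algebra.ofId_apply]
  exact DFunLike.congr_fun this U

theorem finSuccEquiv_aeval_X_zero (V : Polynomial k) :
    finSuccEquiv k m (Polynomial.aeval (X 0) V) = V.map C := by
  rw [← AlgEquiv.coe_toAlgHom, ← Polynomial.aeval_algHom_apply, AlgEquiv.coe_toAlgHom,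
    finSuccEquiv_X_zero]
  rfl

theorem coeff_cons_rename_mul_aeval (U : MvPolynomial (Fin m) k) (V : Polynomial k)
    (i : ℕ) (e : Fin m →₀ ℕ) :
    coeff (e.cons i) (rename Fin.succ U * Polynomial.aeval (X 0) V) = V.coeff i * coeff e U := by
  rw [← finSuccEquiv_coeff_coeff, map_mul, finSuccEquiv_rename_succ, finSuccEquiv_aeval_X_zero,
    Polynomial.coeff_C_mul, Polynomial.coeff_map, mul_comm, coeff_C_mul]

/-- A polynomial is a sum of products separating the first variable from the others. -/
theorem exists_separation (p : MvPolynomial (Fin (m + 1)) k) (d : ℕ) (hd : degreeOf 0 p ≤ d) :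
    ∃ (r : ℕ) (φ : Fin r → MvPolynomial (Fin m) k) (ψ : Fin r → Polynomial k), r ≤ d + 1 ∧
      LinearIndependent k φ ∧ LinearIndependent k ψ ∧
      p = ∑ l, rename Fin.succ (φ l) * Polynomial.aeval (X 0) (ψ l) := by
  obtain ⟨r, φ, a, hr, hφ, ha, hq⟩ := exists_rank_factorization (k := k)
    (fun j : Fin (d + 1) => (finSuccEquiv k m p).coeff j)
  let T : (Fin (d + 1) → k) →ₗ[k] Polynomial k :=
    ∑ j : Fin (d + 1), (Polynomial.monomial (j : ℕ)).comp (LinearMap.proj j)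
  have hTc : ∀ f (j : Fin (d + 1)), (T f).coeff j = f j := by
    intro f j
    simp [T, Polynomial.coeff_monomial, Fin.val_inj]
  have hTc' : ∀ f (j : ℕ), d < j → (T f).coeff j = 0 := by
    intro f j hj
    simp only [T, LinearMap.sum_apply, LinearMap.comp_apply, LinearMap.proj_apply,
      Polynomial.finsetSum_coeff, Polynomial.coeff_monomial]
    exact Finset.sum_eq_zero fun i _ => if_neg (by have := i.2; omega)
  refine ⟨r, φ, fun l => T (a l), hr, hφ, ha.map' T ?_, ?_⟩
  · rw [LinearMap.ker_eq_bot']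
    intro f hf
    ext j
    rw [← hTc f j, hf]
    simp
  · ext f
    rw [← Finsupp.cons_tail f, coeff_sum]
    simp only [coeff_cons_rename_mul_aeval]
    rw [← finSuccEquiv_coeff_coeff]
    rcases lt_or_ge d (f 0) with h | h
    · rw [Polynomial.coeff_eq_zero_of_natDegree_lt (by rw [natDegree_finSuccEquiv]; omega)]
      simp [hTc' _ _ h]
    · have h1 := hq ⟨f 0, Nat.lt_succ_of_le h⟩
      have h2 := fun l => hTc (a l) ⟨f 0, Nat.lt_succ_of_le h⟩
      simp only at h1 h2
      simp [h1, h2, coeff_sum]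

theorem exists_eq_smul_of_mul_derivative_eq [CharZero k] (M N : Polynomial k) (hM : M ≠ 0)
    (h : M * Polynomial.derivative N = N * Polynomial.derivative M) : ∃ c : k, N = c • M := by
  have hinj : Function.Injective (Polynomial.aeval (X 0 : MvPolynomial (Fin 1) k)) :=
    transcendental_iff_injective.1 (transcendental_X k 0)
  obtain ⟨c, hc⟩ := exists_eq_smul_of_mul_pderiv_eq (m := 1) (Polynomial.aeval (X 0) M)
    (Polynomial.aeval (X 0 : MvPolynomial (Fin 1) k) N)
    (by rwa [Ne, map_eq_zero_iff _ hinj]) (fun i => by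
      rw [Subsingleton.elim i 0, Derivation.map_aeval, Derivation.map_aeval, smul_eq_mul,
        smul_eq_mul, ← mul_assoc, ← mul_assoc, ← map_mul, ← map_mul, h])
  exact ⟨c, hinj (by rw [hc, map_smul])⟩

/-- The separated Wronskian of a nonzero polynomial. -/
theorem exists_separated_wronskian [CharZero k] (p : MvPolynomial (Fin (m + 1)) k) (hp : p ≠ 0)
    (d : ℕ) (hd : degreeOf 0 p ≤ d) :
    ∃ (r : ℕ) (w : Fin r → List (Fin m)) (v : Fin r → List Unit) (U : MvPolynomial (Fin m) k)
      (V : Polynomial k), 0 < r ∧ r ≤ d + 1 ∧ (∀ i, (w i).length ≤ i) ∧ (∀ i, (v i).length ≤ i) ∧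
      U ≠ 0 ∧ V ≠ 0 ∧ (Matrix.of fun i j => wordDeriv (fun i => pderiv (R := k) i)
        ((v j).map fun _ => 0) (wordDeriv (fun i => pderiv (R := k) i) ((w i).map Fin.succ) p)).det =
        rename Fin.succ U * Polynomial.aeval (X 0) V := by
  obtain ⟨r, φ, ψ, hr, hφ, hψ, rfl⟩ := exists_separation p d hd
  obtain ⟨w, hw, hU⟩ := exists_det_wordDeriv_ne_zero (fun i => pderiv (R := k) i)
    exists_eq_smul_of_mul_pderiv_eq r φ hφ
  obtain ⟨v, hv, hV⟩ := exists_det_wordDeriv_ne_zero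
    (fun _ : Unit => (Polynomial.derivative' : Derivation k (Polynomial k) (Polynomial k)))
    (fun M N hM h => exists_eq_smul_of_mul_derivative_eq M N hM (h ())) r ψ hψ
  refine ⟨r, w, v, _, _, ?_, hr, hw, hv, hU, hV, ?_⟩
  · rcases Nat.eq_zero_or_pos r with rfl | h
    · simp at hp
    · exact h
  rw [← Matrix.det_transpose (Matrix.of fun i l => wordDeriv (fun _ : Unit => _) (v i) (ψ l)),
    AlgHom.map_det, AlgHom.map_det, ← Matrix.det_mul]
  congr 1
  ext1 i j
  have h1 : ∀ (l : List (Fin m)) (f : MvPolynomial (Fin m) k) (g : Polynomial k),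
      wordDeriv (fun i => pderiv (R := k) i) (l.map Fin.succ)
        (rename Fin.succ f * Polynomial.aeval (X 0) g) =
      rename Fin.succ (wordDeriv (fun i => pderiv (R := k) i) l f) * Polynomial.aeval (X 0) g := by
    intro l f g
    induction l with
    | nil => rfl
    | cons i l ih =>
      rw [List.map_cons, wordDeriv_cons, ih, Derivation.leibniz, Derivation.map_aeval,
        pderiv_rename (Fin.succ_injective m)]
      simp [mul_comm]
  have h0 : ∀ f : MvPolynomial (Fin m) k, pderiv (0 : Fin (m + 1)) (rename Fin.succ f) = 0 := by
    intro f
    refine pderiv_eq_zero_of_notMem_vars fun h => ?_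
    obtain ⟨x, -, hx⟩ := Finset.mem_image.1 (vars_rename _ _ h)
    exact Fin.succ_ne_zero x hx
  have h2 : ∀ (l : List Unit) (f : MvPolynomial (Fin m) k) (g : Polynomial k),
      wordDeriv (fun i => pderiv (R := k) i) (l.map fun _ => (0 : Fin (m + 1)))
        (rename Fin.succ f * Polynomial.aeval (X 0) g) =
      rename Fin.succ f * Polynomial.aeval (X 0) (wordDeriv (fun _ : Unit =>
        (Polynomial.derivative' : Derivation k (Polynomial k) (Polynomial k))) l g) := by
    intro l f g
    induction l with
    | nil => rfl
    | cons i l ih =>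
      rw [List.map_cons, wordDeriv_cons, ih, Derivation.leibniz, Derivation.map_aeval,
        h0]
      simp
  have hadd : ∀ (l : List (Fin (m + 1))) (f : Fin r → MvPolynomial (Fin (m + 1)) k),
      wordDeriv (fun i => pderiv (R := k) i) l (∑ x, f x) =
        ∑ x, wordDeriv (fun i => pderiv (R := k) i) l (f x) := by
    intro l f
    induction l with
    | nil => rfl
    | cons i l ih => simp [ih]
  simp only [Matrix.of_apply, hadd, h1, h2, Matrix.mul_apply, AlgHom.mapMatrix_apply,
    Matrix.map_apply, Matrix.transpose_apply]

end Factorization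

end

section

open MvPolynomial NumberField Height

section Roth

theorem le_sum_max_sub_div (r d : ℕ) (hd : 0 < d) (hr : r ≤ d + 1) (θ : ℝ) (h0 : 0 < θ)
    (h1 : θ ≤ 1) : r * (θ ^ 2 / 8) ≤ ∑ j : Fin r, max 0 (θ - j / d) := by
  have hd' : (1 : ℝ) ≤ d := by exact_mod_cast hd
  have hr' : (r : ℝ) ≤ d + 1 := by exact_mod_cast hr
  let s := min r (⌊θ * d / 2⌋₊ + 1)
  have hs : r * (θ / 4) ≤ s := by
    simp only [s, Nat.cast_min, le_min_iff]
    constructor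
    · nlinarith [Nat.cast_nonneg (α := ℝ) r]
    · have := Nat.lt_floor_add_one (θ * d / 2)
      push_cast
      nlinarith [Nat.cast_nonneg (α := ℝ) ⌊θ * d / 2⌋₊]
  rw [Fin.sum_univ_eq_sum_range (fun j => max 0 (θ - (j : ℝ) / d)) r]
  calc (r : ℝ) * (θ ^ 2 / 8) = r * (θ / 4) * (θ / 2) := by ring
    _ ≤ s * (θ / 2) := by gcongr
    _ = ∑ j ∈ Finset.range s, θ / 2 := by simp
    _ ≤ ∑ j ∈ Finset.range s, max 0 (θ - (j : ℝ) / d) := by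
        refine Finset.sum_le_sum fun j hj => le_max_of_le_right ?_
        have hj1 : j ≤ ⌊θ * d / 2⌋₊ := by
          have := Finset.mem_range.1 hj
          omega
        have hj2 : (j : ℝ) ≤ θ * d / 2 :=
          (Nat.cast_le.2 hj1).trans (Nat.floor_le (by positivity))
        have : (j : ℝ) / d ≤ θ / 2 := by
          rw [div_le_iff₀ (by positivity)]
          linarith
        linarith
    _ ≤ _ := Finset.sum_le_sum_of_subset_of_nonneg
        (Finset.range_mono (min_le_left _ _)) fun _ _ _ => le_max_left _ _

theorem degreeOf_det_le {σ R : Type*} [CommRing R] (h : σ) {r : ℕ}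
    (M : Matrix (Fin r) (Fin r) (MvPolynomial σ R)) (d : ℕ) (hM : ∀ i j, degreeOf h (M i j) ≤ d) :
    degreeOf h M.det ≤ r * d := by
  rw [Matrix.det_apply]
  refine (degreeOf_sum_le _ _ _).trans (Finset.sup_le fun s _ => ?_)
  have h1 : degreeOf h (∏ i, M (s i) i) ≤ r * d :=
    (degreeOf_prod_le _ _ _).trans ((Finset.sum_le_sum fun i _ => hM _ i).trans (by simp))
  rcases Int.units_eq_one_or (Equiv.Perm.sign s) with hs | hs
  · simpa [hs] using h1
  · simpa [hs, degreeOf_neg] using h1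

variable {K : Type*} [Field K] {m : ℕ}

theorem coeff_cons_mul (c : K) (W : MvPolynomial (Fin (m + 1)) ℤ) (U : MvPolynomial (Fin m) K)
    (V : Polynomial K) (h : C c * map (Int.castRingHom K) W =
      rename Fin.succ U * Polynomial.aeval (X 0) V) (i : ℕ) (e : Fin m →₀ ℕ) :
    c * (coeff (e.cons i) W : ℤ) = V.coeff i * coeff e U := by
  rw [← coeff_cons_rename_mul_aeval, ← h, coeff_C_mul, coeff_map]
  rfl

/-- An integral polynomial which separates over a field separates over the integers. -/
theorem exists_int_separation [CharZero K] (c : K) (hc : c ≠ 0)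
    (W : MvPolynomial (Fin (m + 1)) ℤ) (U : MvPolynomial (Fin m) K)
    (V : Polynomial K) (h : C c * map (Int.castRingHom K) W =
      rename Fin.succ U * Polynomial.aeval (X 0) V) (hW : W ≠ 0) :
    ∃ (b : ℤ) (U' : MvPolynomial (Fin m) ℤ) (V' : Polynomial ℤ), b ≠ 0 ∧ U' ≠ 0 ∧ V' ≠ 0 ∧
      l1norm U' ≤ l1norm W ∧ (V'.sum fun _ a => |(a : ℝ)|) ≤ l1norm W ∧
      (∀ h, degreeOf h U' ≤ degreeOf h.succ W) ∧
      C (b : K) * map (Int.castRingHom K) W = rename Fin.succ (map (Int.castRingHom K) U') *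
        Polynomial.aeval (X 0) (V'.map (Int.castRingHom K)) := by
  classical
  obtain ⟨f, hf⟩ := ne_zero_iff.1 hW
  rw [← Finsupp.cons_tail f] at hf
  let i₀ := f 0
  let e₀ := f.tail
  let U' := (finSuccEquiv ℤ m W).coeff i₀
  let V' : Polynomial ℤ := ∑ i ∈ (finSuccEquiv ℤ m W).support,
    Polynomial.monomial i (coeff (e₀.cons i) W)
  have hU' : ∀ e, coeff e U' = coeff (e.cons i₀) W := fun e => finSuccEquiv_coeff_coeff _ _ _
  have hV' : ∀ i, V'.coeff i = coeff (e₀.cons i) W := by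
    intro i
    simp only [V', Polynomial.finsetSum_coeff, Polynomial.coeff_monomial, Finset.sum_ite_eq']
    split_ifs with hi
    · rfl
    · rw [← finSuccEquiv_coeff_coeff, Polynomial.notMem_support_iff.1 hi, coeff_zero]
  refine ⟨coeff (e₀.cons i₀) W, U', V', hf, fun h0 => hf ?_, fun h0 => hf ?_, ?_, ?_,
    fun h => degreeOf_coeff_finSuccEquiv _ _ _, ?_⟩
  · rw [← hU', h0, coeff_zero]
  · rw [← hV', h0, Polynomial.coeff_zero]
  · rw [l1norm_eq, l1norm_eq]
    simp only [hU']
    rw [← Finset.sum_image (g := Finsupp.cons i₀)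
      (f := fun e => |((coeff e W : ℤ) : ℝ)|) (Finsupp.cons_right_injective i₀).injOn]
    refine Finset.sum_le_sum_of_subset_of_nonneg ?_ fun _ _ _ => abs_nonneg _
    intro x hx
    obtain ⟨e, he, rfl⟩ := Finset.mem_image.1 hx
    rwa [mem_support_iff, ← hU', ← mem_support_iff]
  · rw [l1norm_eq, Polynomial.sum]
    simp only [hV']
    have hinj : Function.Injective fun i => e₀.cons i := fun i j hij => by
      simpa using DFunLike.congr_fun hij 0
    rw [← Finset.sum_image (g := fun i => e₀.cons i)
      (f := fun e => |((coeff e W : ℤ) : ℝ)|) hinj.injOn]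
    refine Finset.sum_le_sum_of_subset_of_nonneg ?_ fun _ _ _ => abs_nonneg _
    intro x hx
    obtain ⟨e, he, rfl⟩ := Finset.mem_image.1 hx
    rwa [mem_support_iff, ← hV', ← Polynomial.mem_support_iff]
  · ext x
    rw [← Finsupp.cons_tail x, coeff_cons_rename_mul_aeval, coeff_C_mul, coeff_map, coeff_map,
      Polynomial.coeff_map, hU', hV']
    have h1 := coeff_cons_mul c W U V h
    have e1 := h1 i₀ e₀
    have e2 := h1 (x 0) x.tail
    have e3 := h1 i₀ x.tail
    have e4 := h1 (x 0) e₀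
    simp only [eq_intCast]
    have : c ^ 2 ≠ 0 := pow_ne_zero _ hc
    apply mul_left_cancel₀ this
    linear_combination (c * ((coeff (Finsupp.cons (x 0) x.tail) W : ℤ) : K)) * e1
      + V.coeff i₀ * coeff e₀ U * e2 - c * ((coeff (Finsupp.cons (x 0) e₀) W : ℤ) : K) * e3
      - V.coeff i₀ * coeff x.tail U * e4

theorem shift_separated (ξ : Fin (m + 1) → K) (U : MvPolynomial (Fin m) K) (V : Polynomial K) :
    shift ξ (rename Fin.succ U * Polynomial.aeval (X 0) V) =
      rename Fin.succ (shift (fun h => ξ h.succ) U) *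
        Polynomial.aeval (X 0) (V.comp (Polynomial.X + Polynomial.C (ξ 0))) := by
  have h1 : (shift ξ).comp (rename Fin.succ) =
      (rename Fin.succ).comp (shift fun h : Fin m => ξ h.succ) := by
    refine MvPolynomial.algHom_ext fun i => ?_
    simp
  rw [map_mul, Polynomial.aeval_comp, ← Polynomial.aeval_algHom_apply]
  simp only [shift_X, map_add, Polynomial.aeval_X, Polynomial.aeval_C]
  congr 1
  exact DFunLike.congr_fun h1 U


theorem ordGE_shift_hasse [CharZero K] {σ : Type*} [Fintype σ] (w : σ → ℝ) (ξ : σ → K)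
    (p : MvPolynomial σ ℤ) (l₁ l₂ : List σ) (I₁ I₂ : σ →₀ ℕ) (c₁ c₂ : ℕ) (hc₁ : c₁ ≠ 0)
    (hc₂ : c₂ ≠ 0)
    (h₁ : ∀ p : MvPolynomial σ ℤ,
      wordDeriv (fun i => pderiv (R := K) i) l₁ (map (Int.castRingHom K) p) =
        (c₁ : K) • map (Int.castRingHom K) (hasse I₁ p))
    (h₂ : ∀ p : MvPolynomial σ ℤ,
      wordDeriv (fun i => pderiv (R := K) i) l₂ (map (Int.castRingHom K) p) =
        (c₂ : K) • map (Int.castRingHom K) (hasse I₂ p))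
    {θ : ℝ} (hp : OrdGE w (shift ξ (map (Int.castRingHom K) p)) θ) :
    OrdGE w (shift ξ (map (Int.castRingHom K) (hasse I₂ (hasse I₁ p))))
      (θ - (l₁.map w).sum - (l₂.map w).sum) := by
  have h := (hp.wordDeriv l₁).wordDeriv l₂
  rw [← shift_wordDeriv, ← shift_wordDeriv, h₁, wordDeriv_smul, h₂, map_smul, map_smul] at h
  have h3 := (h.smul ((c₁ : K)⁻¹)).smul ((c₂ : K)⁻¹)
  rwa [inv_smul_smul₀ (Nat.cast_ne_zero.2 hc₁), inv_smul_smul₀ (Nat.cast_ne_zero.2 hc₂)] at h3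

theorem log_l1norm_det_hasse_le {σ : Type*} [Fintype σ] (p : MvPolynomial σ ℤ) (hp : p ≠ 0)
    (d : σ → ℕ) (hd : ∀ h, degreeOf h p ≤ d h) (r : ℕ) (h₀ : σ) (hr : r ≤ d h₀ + 1) (hr0 : 0 < r)
    (I J : Fin r → σ →₀ ℕ)
    (hW : (Matrix.of fun i j => hasse (J j) (hasse (I i) p)).det ≠ 0) :
    Real.log (l1norm (Matrix.of fun i j => hasse (J j) (hasse (I i) p)).det) ≤
      r * (3 * (∑ h, (d h : ℝ) + Real.log (l1norm p))) := by
  have hl := one_le_l1norm hp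
  have hL : 0 ≤ Real.log (l1norm p) := Real.log_nonneg hl
  have h1 : l1norm (Matrix.of fun i j => hasse (J j) (hasse (I i) p)).det ≤
      r.factorial * (2 ^ (∑ h, d h) * (2 ^ (∑ h, d h) * l1norm p)) ^ r := by
    refine gnorm_det_le _ (fun _ => zero_le_one) _ fun i j => ?_
    refine (l1norm_hasse_le _ _ d fun h => (degreeOf_hasse_le _ _ _).trans (hd h)).trans ?_
    exact mul_le_mul_of_nonneg_left (l1norm_hasse_le _ _ d hd) (by positivity)
  have h2 := Real.log_le_log (zero_lt_one.trans_le (one_le_l1norm hW)) h1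
  have hr0' : (0 : ℝ) < r := Nat.cast_pos.2 hr0
  have hf : Real.log (r.factorial : ℝ) ≤ r * d h₀ := by
    have h3 : (r.factorial : ℝ) ≤ (r : ℝ) ^ r := by exact_mod_cast Nat.factorial_le_pow r
    have h4 := Real.log_le_log (by positivity) h3
    rw [Real.log_pow] at h4
    refine h4.trans (mul_le_mul_of_nonneg_left ?_ hr0'.le)
    have h5 := Real.log_le_sub_one_of_pos hr0'
    have h6 : (r : ℝ) ≤ d h₀ + 1 := by exact_mod_cast hr
    linarith
  have hd0 : (d h₀ : ℝ) ≤ ∑ h, (d h : ℝ) :=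
    Finset.single_le_sum (f := fun h => (d h : ℝ)) (fun _ _ => Nat.cast_nonneg _)
      (Finset.mem_univ h₀)
  rw [Real.log_mul (by positivity) (by positivity), Real.log_pow,
    Real.log_mul (by positivity) (by positivity), Real.log_mul (by positivity) (by positivity),
    Real.log_pow, Nat.cast_sum] at h2
  have h7 : Real.log 2 ≤ 1 := Real.log_two_lt_d9.le.trans (by norm_num)
  have hS : 0 ≤ ∑ h, (d h : ℝ) := Finset.sum_nonneg fun _ _ => Nat.cast_nonneg _
  have h8 := mul_le_mul_of_nonneg_left h7 hS
  refine h2.trans ?_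
  have h9 : (r : ℝ) * d h₀ + r * (∑ h, (d h : ℝ) * 1 + (∑ h, (d h : ℝ) * 1 +
      Real.log (l1norm p))) ≤ r * (3 * (∑ h, (d h : ℝ) + Real.log (l1norm p))) := by
    rw [← mul_add]
    refine mul_le_mul_of_nonneg_left ?_ hr0'.le
    simp only [mul_one]
    linarith
  refine le_trans ?_ h9
  simp only [mul_one] at h8 ⊢
  gcongr

variable [NumberField K]

theorem exists_coeff_comp_ne_zero (V : Polynomial ℤ) (hV : V ≠ 0) (ξ : K) :
    ∃ t : ℕ, ((V.map (Int.castRingHom K)).comp (Polynomial.X + Polynomial.C ξ)).coeff t ≠ 0 ∧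
      t * logHeight₁ ξ ≤ Module.finrank ℚ K * Real.log (V.sum fun _ a => |(a : ℝ)|) := by
  set Q := (V.map (Int.castRingHom K)).comp (Polynomial.X + Polynomial.C ξ) with hQ
  have hQ0 : Q ≠ 0 := by
    rw [hQ, Ne, Polynomial.comp_eq_zero_iff]
    rintro (h | ⟨-, h⟩)
    · exact hV ((Polynomial.map_eq_zero_iff (RingHom.injective_int _)).1 h)
    · have := congrArg (Polynomial.coeff · 1) h
      simp at this
  refine ⟨Q.natTrailingDegree, Polynomial.trailingCoeff_nonzero_iff_nonzero.2 hQ0, ?_⟩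
  refine mul_logHeight₁_le_of_pow_dvd V hV ξ _ ?_
  have h1 : Polynomial.X ^ Q.natTrailingDegree ∣ Q := Polynomial.X_pow_dvd_iff.2 fun d hd =>
    Polynomial.coeff_eq_zero_of_lt_natTrailingDegree hd
  obtain ⟨q, hq⟩ := h1
  have h2 := congrArg (Polynomial.comp · (Polynomial.X - Polynomial.C ξ)) hq
  simp only [hQ, Polynomial.comp_assoc, Polynomial.mul_comp, Polynomial.X_pow_comp,
    Polynomial.add_comp, Polynomial.X_comp, Polynomial.C_comp, sub_add_cancel,
    Polynomial.comp_X] at h2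
  exact ⟨_, h2⟩

/-- **Roth's lemma**. -/
theorem roth_lemma (m : ℕ) : ∀ ε : ℝ, 0 < ε → ∃ A ω : ℝ, 0 < A ∧ 0 < ω ∧
    ∀ (p : MvPolynomial (Fin m) ℤ) (d : Fin m → ℕ) (ξ : Fin m → K), p ≠ 0 → (∀ h, 0 < d h) →
      (∀ h, degreeOf h p ≤ d h) → (∀ i j, i < j → (d i : ℝ) ≤ ω * d j) →
      (∀ h, A * (∑ h, (d h : ℝ) + Real.log (l1norm p)) ≤ d h * logHeight₁ (ξ h)) →
      ¬ OrdGE (fun h => 1 / (d h : ℝ)) (shift ξ (map (Int.castRingHom K) p)) ε := by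
  induction m with
  | zero =>
    intro ε hε
    refine ⟨1, 1, one_pos, one_pos, fun p d ξ hp _ _ _ _ h => ?_⟩
    obtain ⟨e, he⟩ := ne_zero_iff.1 hp
    have hs : shift ξ (map (Int.castRingHom K) p) = map (Int.castRingHom K) p := by
      have : shift ξ = AlgHom.id K _ := MvPolynomial.algHom_ext fun i => i.elim0
      rw [this]
      rfl
    have := h e (by rw [hs, coeff_map]; simpa using he)
    simp at this
    linarith
  | succ m ih =>
    intro ε hε
    set θ := min ε 1 / 2 with hθ
    have hθ0 : 0 < θ := by positivity
    have hθ1 : θ ≤ 1 := by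
      have := min_le_right ε 1
      linarith
    have hθε : 2 * θ ≤ ε := by
      have := min_le_left ε 1
      linarith
    set ε' := θ ^ 2 / 16 with hε'
    have hε'0 : 0 < ε' := by positivity
    obtain ⟨A', ω', hA', hω', H⟩ := ih ε' hε'0
    set D : ℝ := (Module.finrank ℚ K : ℝ) with hD
    have hD0 : 0 ≤ D := Nat.cast_nonneg _
    refine ⟨4 * A' + 3 * D / ε' + 1, min ω' θ, by positivity, by positivity, ?_⟩
    intro p d ξ hp hd hdeg hratio hheight hord
    set B := ∑ h, (d h : ℝ) + Real.log (l1norm p) with hB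
    have hL : 0 ≤ Real.log (l1norm p) := Real.log_nonneg (one_le_l1norm hp)
    have hd0 : (1 : ℝ) ≤ d 0 := by exact_mod_cast hd 0
    have hd0B : (d 0 : ℝ) ≤ B := by
      have : (d 0 : ℝ) ≤ ∑ h, (d h : ℝ) :=
        Finset.single_le_sum (f := fun h => (d h : ℝ)) (fun _ _ => Nat.cast_nonneg _)
          (Finset.mem_univ 0)
      linarith
    have hB0 : 0 < B := by linarith
    have hmapinj : Function.Injective (map (Int.castRingHom K) : MvPolynomial (Fin (m + 1)) ℤ → _) :=
      map_injective _ (RingHom.injective_int _)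
    have hdegK : degreeOf 0 (map (Int.castRingHom K) p) ≤ d 0 := by
      exact degreeOf_le_iff.2 fun e he => degreeOf_le_iff.1 (hdeg 0) e (support_map_subset _ _ he)
    obtain ⟨r, w, v, U, V, hr0, hr, hw, hv, hU, hV, hdet⟩ := exists_separated_wronskian
      (map (Int.castRingHom K) p) ((map_ne_zero_iff _ hmapinj).2 hp) (d 0) hdegK
    choose I c hc hI using fun i => exists_wordDeriv_eq_hasse K ((w i).map Fin.succ)
    choose J c' hc' hJ using fun j => exists_wordDeriv_eq_hasse K ((v j).map fun _ => (0 : Fin (m + 1)))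
    set W := (Matrix.of fun i j => hasse (J j) (hasse (I i) p)).det with hW
    have hsep : C ((∏ i, (c i : K)) * ∏ j, (c' j : K)) * map (Int.castRingHom K) W =
        rename Fin.succ U * Polynomial.aeval (X 0) V := by
      rw [← hdet, hW, RingHom.map_det, map_mul, map_prod, map_prod, mul_assoc,
        ← Matrix.det_mul_row, ← Matrix.det_mul_column]
      congr 1
      ext1 i j
      simp only [Matrix.of_apply, RingHom.mapMatrix_apply, Matrix.map_apply]
      rw [hI, wordDeriv_smul, hJ, smul_eq_C_mul, smul_eq_C_mul]
    have hcc : (∏ i, (c i : K)) * ∏ j, (c' j : K) ≠ 0 :=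
      mul_ne_zero (Finset.prod_ne_zero_iff.2 fun i _ => Nat.cast_ne_zero.2 (hc i))
        (Finset.prod_ne_zero_iff.2 fun i _ => Nat.cast_ne_zero.2 (hc' i))
    have hW0 : W ≠ 0 := by
      intro h
      obtain ⟨e, he⟩ := ne_zero_iff.1 hU
      have := coeff_cons_mul _ W U V hsep V.natDegree e
      rw [h, coeff_zero, Int.cast_zero, mul_zero] at this
      exact mul_ne_zero (Polynomial.leadingCoeff_ne_zero.2 hV) he this.symm
    obtain ⟨b, U', V', hb, hU', hV', hlU, hlV, hdU, hsep'⟩ :=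
      exists_int_separation _ hcc W U V hsep hW0
    have hlogW : Real.log (l1norm W) ≤ r * (3 * B) :=
      log_l1norm_det_hasse_le p hp d hdeg r 0 hr hr0 I J hW0
    have hr0' : (0 : ℝ) < r := Nat.cast_pos.2 hr0
    have hdW : ∀ h, degreeOf h W ≤ r * d h := fun h => degreeOf_det_le h _ _ fun i j =>
      (degreeOf_hasse_le _ _ _).trans ((degreeOf_hasse_le _ _ _).trans (hdeg h))
    have hAB : 0 ≤ 3 * D / ε' * B := by positivity
    have hU₁ := H U' (fun h => r * d h.succ) (fun h => ξ h.succ) hU'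
      (fun h => Nat.mul_pos hr0 (hd _)) (fun h => (hdU h).trans (hdW _))
      (fun i j hij => by
        have := hratio i.succ j.succ (Fin.succ_lt_succ_iff.2 hij)
        have h2 : min ω' θ * d j.succ ≤ ω' * d j.succ :=
          mul_le_mul_of_nonneg_right (min_le_left _ _) (Nat.cast_nonneg _)
        push_cast
        nlinarith)
      (fun h => by
        have h1 := hheight h.succ
        have h2 : Real.log (l1norm U') ≤ r * (3 * B) :=
          (Real.log_le_log (zero_lt_one.trans_le (one_le_l1norm hU')) hlU).trans hlogW
        have h3 : ∑ h : Fin m, (d h.succ : ℝ) ≤ B := by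
          rw [hB, Fin.sum_univ_succ]
          linarith
        push_cast
        rw [← Finset.mul_sum, mul_assoc]
        calc A' * (r * ∑ h : Fin m, (d h.succ : ℝ) + Real.log (l1norm U'))
            ≤ A' * (r * B + r * (3 * B)) := by gcongr
          _ = r * (4 * A' * B) := by ring
          _ ≤ r * (d h.succ * logHeight₁ (ξ h.succ)) := by
            refine mul_le_mul_of_nonneg_left ?_ hr0'.le
            linarith)
    rw [OrdGE] at hU₁
    push Not at hU₁
    obtain ⟨e, he, hesum⟩ := hU₁
    obtain ⟨t, ht, htH⟩ := exists_coeff_comp_ne_zero V' hV' (ξ 0)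
    have ht1 : (t : ℝ) / d 0 < r * ε' := by
      have h1 : t * logHeight₁ (ξ 0) ≤ D * (r * (3 * B)) := by
        refine htH.trans (mul_le_mul_of_nonneg_left (le_trans ?_ hlogW) hD0)
        refine Real.log_le_log ?_ hlV
        obtain ⟨i, hi⟩ := Polynomial.support_nonempty.2 hV'
        exact Finset.sum_pos (fun i hi => abs_pos.2 (Int.cast_ne_zero.2
          (Polynomial.mem_support_iff.1 hi))) ⟨i, hi⟩
      have h2 := hheight 0
      rw [div_lt_iff₀ (by positivity)]
      have h3 : t * ((4 * A' + 3 * D / ε' + 1) * B) ≤ d 0 * (D * (r * (3 * B))) :=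
        calc t * ((4 * A' + 3 * D / ε' + 1) * B) ≤ t * (d 0 * logHeight₁ (ξ 0)) := by gcongr
          _ = d 0 * (t * logHeight₁ (ξ 0)) := by ring
          _ ≤ _ := by gcongr
      have h4 : t * (4 * A' + 3 * D / ε' + 1) ≤ d 0 * D * r * 3 := by
        refine le_of_mul_le_mul_right ?_ hB0
        linarith
      have h5 : t * (4 * A' * ε' + 3 * D + ε') ≤ d 0 * D * r * 3 * ε' := by
        have := mul_le_mul_of_nonneg_right h4 hε'0.le
        have h6 : 3 * D / ε' * ε' = 3 * D := div_mul_cancel₀ _ hε'0.ne'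
        calc _ = t * (4 * A' * ε' + 3 * D / ε' * ε' + ε') := by rw [h6]
          _ = t * (4 * A' + 3 * D / ε' + 1) * ε' := by ring
          _ ≤ _ := this
      by_contra! hcon
      have h7 : r * ε' * d 0 * (4 * A' * ε' + 3 * D + ε') ≤ d 0 * D * r * 3 * ε' :=
        (mul_le_mul_of_nonneg_right hcon (by positivity)).trans h5
      have h8 : 0 < r * ε' * d 0 * (4 * A' * ε' + ε') := by positivity
      linarith
    have hcoef : coeff (e.cons t) (shift ξ (map (Int.castRingHom K) W)) ≠ 0 := by
      have h1 := congrArg (fun f => coeff (e.cons t) (shift ξ f)) hsep'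
      intro h0
      have h2 : shift ξ (C (b : K)) = C (b : K) := by simp [shift]
      rw [shift_separated, coeff_cons_rename_mul_aeval, map_mul, h2, coeff_C_mul, h0,
        mul_zero] at h1
      exact mul_ne_zero ht he h1.symm
    have hwsum : ∀ i, (((w i).map Fin.succ).map fun h => 1 / (d h : ℝ)).sum ≤ θ := by
      intro i
      have h1 : ∀ x ∈ (((w i).map Fin.succ).map fun h => 1 / (d h : ℝ)), x ≤ θ / d 0 := by
        intro x hx
        simp only [List.map_map, List.mem_map, Function.comp_apply] at hx
        obtain ⟨h, -, rfl⟩ := hx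
        have h2 := hratio 0 h.succ (Fin.succ_pos h)
        have h3 : min ω' θ * d h.succ ≤ θ * d h.succ :=
          mul_le_mul_of_nonneg_right (min_le_right _ _) (Nat.cast_nonneg _)
        have h4 : (0 : ℝ) < d h.succ := Nat.cast_pos.2 (hd _)
        rw [div_le_div_iff₀ h4 (by positivity)]
        linarith
      have h2 := List.sum_le_card_nsmul _ _ h1
      refine h2.trans ?_
      simp only [List.length_map, nsmul_eq_mul]
      have h3 : ((w i).length : ℝ) ≤ d 0 := by
        have := hw i
        have := i.2
        exact_mod_cast (by omega : (w i).length ≤ d 0)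
      calc ((w i).length : ℝ) * (θ / d 0) ≤ d 0 * (θ / d 0) := by gcongr
        _ = θ := by field_simp
    have hvsum : ∀ j, (((v j).map fun _ => (0 : Fin (m + 1))).map fun h => 1 / (d h : ℝ)).sum ≤
        (j : ℕ) / (d 0 : ℝ) := by
      intro j
      have h1 : (((v j).map fun _ => (0 : Fin (m + 1))).map fun h => 1 / (d h : ℝ)).sum =
          (v j).length / (d 0 : ℝ) := by
        simp [div_eq_mul_inv]
      rw [h1]
      gcongr
      exact hv j
    have hentry : ∀ i j, OrdGE (fun h => 1 / (d h : ℝ))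
        (shift ξ (map (Int.castRingHom K) (hasse (J j) (hasse (I i) p))))
        (max 0 (θ - (j : ℕ) / (d 0 : ℝ))) := by
      intro i j
      rcases max_choice 0 (θ - (j : ℕ) / (d 0 : ℝ)) with h | h
      · rw [h]
        exact ordGE_zero fun h => by positivity
      · rw [h]
        refine (ordGE_shift_hasse _ ξ p _ _ _ _ _ _ (hc i) (hc' j) (hI i) (hJ j) hord).mono ?_
        have := hwsum i
        have := hvsum j
        linarith
    have hWord : OrdGE (fun h => 1 / (d h : ℝ)) (shift ξ (map (Int.castRingHom K) W))
        (∑ j : Fin r, max 0 (θ - (j : ℕ) / (d 0 : ℝ))) := by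
      rw [hW, ← Matrix.det_transpose, RingHom.map_det, AlgHom.map_det]
      exact OrdGE.det (fun h => by positivity) fun i j => hentry j i
    have hlow := hWord _ hcoef
    have hsumlow := le_sum_max_sub_div r (d 0) (hd 0) hr θ hθ0 hθ1
    rw [Fin.sum_univ_succ] at hlow
    simp only [Finsupp.cons_zero, Finsupp.cons_succ] at hlow
    have h1 : ∑ h : Fin m, 1 / (d h.succ : ℝ) * e h < r * ε' := by
      have h2 : ∑ h : Fin m, 1 / (d h.succ : ℝ) * e h =
          r * ∑ h : Fin m, 1 / ((r * d h.succ : ℕ) : ℝ) * e h := by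
        rw [Finset.mul_sum]
        refine Finset.sum_congr rfl fun h _ => ?_
        push_cast
        field_simp
      rw [h2]
      exact mul_lt_mul_of_pos_left hesum hr0'
    have h2 : 1 / (d 0 : ℝ) * t = t / d 0 := by ring
    rw [h2] at hlow
    have h3 : (r : ℝ) * (θ ^ 2 / 8) = 2 * (r * ε') := by
      rw [hε']
      ring
    linarith

end Roth

end

section

open MvPolynomial

section Variance

theorem sum_pi_sq_le (m : ℕ) (Ω : Fin m → Type) [∀ h, Fintype (Ω h)] (g : ∀ h, Ω h → ℝ)
    (hmean : ∀ h, ∑ i, g h i = 0) (hg : ∀ h i, |g h i| ≤ 1) :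
    ∑ i : ∀ h, Ω h, (∑ h, g h (i h)) ^ 2 ≤ m * ∏ h, (Fintype.card (Ω h) : ℝ) := by
  classical
  induction m with
  | zero => simp
  | succ m ih =>
    have ih' := ih (fun h => Ω h.succ) (fun h => g h.succ) (fun h => hmean _) fun h => hg _
    rw [← (Fin.consEquiv Ω).sum_comp, Fintype.sum_prod_type]
    simp only [Fin.consEquiv_apply, Fin.sum_univ_succ, Fin.cons_zero, Fin.cons_succ, add_sq]
    simp only [Finset.sum_add_distrib, Finset.sum_const, Finset.card_univ, nsmul_eq_mul,
      mul_assoc, ← Finset.mul_sum, ← Finset.sum_mul, hmean, zero_mul, mul_zero, add_zero]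
    rw [Fin.prod_univ_succ, Fintype.card_pi]
    have h1 : ∑ i, g 0 i ^ 2 ≤ Fintype.card (Ω 0) := by
      refine (Finset.sum_le_card_nsmul _ _ 1 fun i _ => ?_).trans (by simp)
      rw [← sq_abs]
      exact pow_le_one₀ (abs_nonneg _) (hg 0 i)
    have h2 : (0 : ℝ) ≤ ∏ h : Fin m, (Fintype.card (Ω h.succ) : ℝ) :=
      Finset.prod_nonneg fun _ _ => Nat.cast_nonneg _
    have h3 : (0 : ℝ) ≤ Fintype.card (Ω 0) := Nat.cast_nonneg _
    push_cast
    nlinarith [mul_le_mul_of_nonneg_left h1 h2, mul_le_mul_of_nonneg_left ih' h3]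

theorem sum_piAntidiag_apply (n d : ℕ) (j : Fin n) :
    n * ∑ f ∈ Finset.piAntidiag (Finset.univ : Finset (Fin n)) d, f j =
      d * (Finset.piAntidiag (Finset.univ : Finset (Fin n)) d).card := by
  classical
  have hsym : ∀ i, ∑ f ∈ Finset.piAntidiag (Finset.univ : Finset (Fin n)) d, f i =
      ∑ f ∈ Finset.piAntidiag (Finset.univ : Finset (Fin n)) d, f j := by
    intro i
    refine Finset.sum_bij' (fun f _ => f ∘ Equiv.swap i j) (fun f _ => f ∘ Equiv.swap i j)
      ?_ ?_ ?_ ?_ ?_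
    · intro f hf
      simp only [Finset.mem_piAntidiag, Finset.mem_univ, implies_true, and_true] at hf ⊢
      rw [← hf]
      exact Equiv.sum_comp (Equiv.swap i j) f
    · intro f hf
      simp only [Finset.mem_piAntidiag, Finset.mem_univ, implies_true, and_true] at hf ⊢
      rw [← hf]
      exact Equiv.sum_comp (Equiv.swap i j) f
    · intro f _
      ext x
      simp
    · intro f _
      ext x
      simp
    · intro f _
      simp
  have h1 : ∑ i : Fin n, ∑ f ∈ Finset.piAntidiag (Finset.univ : Finset (Fin n)) d, f i =
      d * (Finset.piAntidiag (Finset.univ : Finset (Fin n)) d).card := by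
    rw [Finset.sum_comm, Finset.sum_congr rfl fun f hf => (Finset.mem_piAntidiag.1 hf).1]
    simp [mul_comm]
  rw [← h1, Finset.sum_congr rfl fun i _ => hsym i]
  simp

theorem card_piAntidiag_le (n d : ℕ) :
    (Finset.piAntidiag (Finset.univ : Finset (Fin n)) d).card ≤ 2 ^ (n * d) := by
  classical
  have h1 : Finset.piAntidiag (Finset.univ : Finset (Fin n)) d ⊆
      Fintype.piFinset fun _ => Finset.range (d + 1) := by
    intro f hf
    rw [Fintype.mem_piFinset]
    intro i
    rw [Finset.mem_range, Nat.lt_succ_iff, ← (Finset.mem_piAntidiag.1 hf).1]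
    exact Finset.single_le_sum (f := f) (fun _ _ => Nat.zero_le _) (Finset.mem_univ i)
  refine (Finset.card_le_card h1).trans ?_
  rw [Fintype.card_piFinset]
  simp only [Finset.card_range, Finset.prod_const, Finset.card_univ, Fintype.card_fin]
  rw [mul_comm, pow_mul]
  exact Nat.pow_le_pow_left (Nat.succ_le_of_lt d.lt_two_pow_self) n

theorem card_deviation_le {n m : ℕ} (hn : 0 < n) (d : Fin m → ℕ) (hd : ∀ h, 0 < d h) (ε : ℝ)
    (hε : 0 < ε) (hm : 0 < m) (j : Fin n) :
    ((Finset.univ.filter fun i : ∀ h : Fin m, Finset.piAntidiag (Finset.univ : Finset (Fin n)) (d h)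
      => ε * m < |∑ h, ((i h).1 j / d h : ℝ) - m / n|).card : ℝ) * (ε ^ 2 * m) ≤
      Fintype.card (∀ h : Fin m, Finset.piAntidiag (Finset.univ : Finset (Fin n)) (d h)) := by
  classical
  have hn' : (0 : ℝ) < n := by exact_mod_cast hn
  have hm' : (0 : ℝ) < m := by exact_mod_cast hm
  have hd' : ∀ h, (0 : ℝ) < d h := fun h => by exact_mod_cast hd h
  have hvar := sum_pi_sq_le m
    (fun h => Finset.piAntidiag (Finset.univ : Finset (Fin n)) (d h))
    (fun h i => (i.1 j / d h : ℝ) - 1 / n) ?_ ?_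
  · have hnn : ∀ i : ∀ h : Fin m, Finset.piAntidiag (Finset.univ : Finset (Fin n)) (d h),
      (∑ h, (((i h).1 j / d h : ℝ) - 1 / n)) = ∑ h, ((i h).1 j / d h : ℝ) - m / n := by
      intro i
      rw [Finset.sum_sub_distrib]
      simp [div_eq_mul_inv]
    simp only [hnn] at hvar
    have h2 := Finset.sum_le_sum_of_subset_of_nonneg (Finset.filter_subset
      (fun i : ∀ h : Fin m, Finset.piAntidiag (Finset.univ : Finset (Fin n)) (d h)
      => ε * m < |∑ h, ((i h).1 j / d h : ℝ) - m / n|) Finset.univ)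
      (f := fun i => (∑ h, ((i h).1 j / d h : ℝ) - m / n) ^ 2) fun i _ _ => sq_nonneg _
    have h3 := Finset.card_nsmul_le_sum (Finset.univ.filter
      (fun i : ∀ h : Fin m, Finset.piAntidiag (Finset.univ : Finset (Fin n)) (d h)
      => ε * m < |∑ h, ((i h).1 j / d h : ℝ) - m / n|))
      (fun i => (∑ h, ((i h).1 j / d h : ℝ) - m / n) ^ 2) ((ε * m) ^ 2) ?_
    · rw [nsmul_eq_mul] at h3
      have h4 := (h3.trans h2).trans hvar
      rw [Fintype.card_pi]
      push_cast
      refine le_of_mul_le_mul_left ?_ hm'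
      refine le_trans (le_of_eq ?_) h4
      ring
    · intro i hi
      rw [← sq_abs (∑ h, ((i h).1 j / d h : ℝ) - m / n)]
      exact pow_le_pow_left₀ (by positivity) (Finset.mem_filter.1 hi).2.le 2
  · intro h
    have h1 := sum_piAntidiag_apply n (d h) j
    rw [Finset.sum_sub_distrib, ← Finset.sum_div, Finset.sum_coe_sort
      (Finset.piAntidiag (Finset.univ : Finset (Fin n)) (d h)) (fun f => (f j : ℝ))]
    rw [Finset.sum_const, Finset.card_univ, Fintype.card_coe, nsmul_eq_mul, mul_one_div,
      sub_eq_zero, div_eq_div_iff (hd' h).ne' hn'.ne']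
    have h2 : (n : ℝ) * ∑ f ∈ Finset.piAntidiag (Finset.univ : Finset (Fin n)) (d h), (f j : ℝ) =
      d h * (Finset.piAntidiag (Finset.univ : Finset (Fin n)) (d h)).card := by exact_mod_cast h1
    linarith
  · intro h i
    have h1 : (i.1 j : ℝ) ≤ d h := by
      have : i.1 j ≤ d h :=
        (Finset.single_le_sum (f := i.1) (fun _ _ => Nat.zero_le _) (Finset.mem_univ j)).trans
          (Finset.mem_piAntidiag.1 i.2).1.le
      exact_mod_cast this
    have h2 : (i.1 j / d h : ℝ) ≤ 1 := (div_le_one (hd' h)).2 h1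
    have h3 : (0 : ℝ) ≤ i.1 j / d h := by positivity
    have h4 : (0 : ℝ) < 1 / n := by positivity
    have h5 : (1 : ℝ) / n ≤ 1 := (div_le_one hn').2 (by exact_mod_cast hn)
    rw [abs_le]
    constructor <;> linarith

end Variance

section Systems

variable {m n : ℕ} {R : Type*} [CommRing R]

/-- The coordinates with respect to one of the `n + 1` systems `x` or `x_j - x_k` with `x₀ = 0`. -/
def sysMap (k : Option (Fin n)) (x : Fin n → R) : Fin n → R :=
  match k with
  | none => x
  | some k => fun j => if j = k then -x k else x j - x k

theorem sysMap_sysMap (k : Option (Fin n)) (x : Fin n → R) : sysMap k (sysMap k x) = x := by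
  cases k with
  | none => rfl
  | some k =>
    ext j
    by_cases h : j = k <;> simp [sysMap, h]

theorem map_sysMap {R' F : Type*} [CommRing R'] [FunLike F R R'] [RingHomClass F R R'] (f : F)
    (k : Option (Fin n)) (x : Fin n → R) (j : Fin n) :
    f (sysMap k x j) = sysMap k (fun i => f (x i)) j := by
  cases k with
  | none => rfl
  | some k => by_cases h : j = k <;> simp [sysMap, h]

/-- The change of variables between the systems, in each block of variables. -/
noncomputable def sysHom (k : Option (Fin n)) :
    MvPolynomial (Fin m × Fin n) ℤ →ₐ[ℤ] MvPolynomial (Fin m × Fin n) ℤ :=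
  aeval fun hj => sysMap k (fun j => X (hj.1, j)) hj.2

theorem aeval_sysHom [Algebra ℤ R] (k : Option (Fin n)) (x : Fin m → Fin n → R)
    (p : MvPolynomial (Fin m × Fin n) ℤ) :
    aeval (fun hj : Fin m × Fin n => sysMap k (x hj.1) hj.2) (sysHom k p) =
      aeval (fun hj : Fin m × Fin n => x hj.1 hj.2) p := by
  rw [← AlgHom.comp_apply]
  congr 1
  ext hj
  rw [AlgHom.comp_apply, sysHom, aeval_X, aeval_X, map_sysMap]
  simp only [aeval_X]
  rw [sysMap_sysMap]

theorem isWeightedHomogeneous_sysHom_X (k : Option (Fin n)) (hj : Fin m × Fin n) :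
    IsWeightedHomogeneous (fun hj : Fin m × Fin n => (Pi.single hj.1 1 : Fin m → ℕ))
      (sysHom k (X hj)) (Pi.single hj.1 1) := by
  have hX : ∀ j : Fin n, IsWeightedHomogeneous
      (fun hj : Fin m × Fin n => (Pi.single hj.1 1 : Fin m → ℕ))
      (X (hj.1, j) : MvPolynomial (Fin m × Fin n) ℤ) (Pi.single hj.1 1) := fun j =>
    isWeightedHomogeneous_X ℤ _ (hj.1, j)
  rw [sysHom, aeval_X]
  cases k with
  | none => exact hX _
  | some k =>
    by_cases h : hj.2 = k
    · simp only [sysMap, h, if_true]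
      exact (weightedHomogeneousSubmodule ℤ _ _).neg_mem (hX k)
    · simp only [sysMap, h, if_false]
      exact (weightedHomogeneousSubmodule ℤ _ _).sub_mem (hX _) (hX k)

theorem l1norm_sysHom_X_le (k : Option (Fin n)) (hj : Fin m × Fin n) :
    l1norm (sysHom k (X hj)) ≤ 2 := by
  have hX : ∀ j : Fin m × Fin n, l1norm (X j) = 1 := fun j => gnorm_X _ _
  rw [sysHom, aeval_X]
  cases k with
  | none => simp [sysMap, hX]
  | some k =>
    by_cases h : hj.2 = k
    · simp only [sysMap, h, if_true]
      rw [l1norm, gnorm_neg, ← l1norm, hX]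
      norm_num
    · simp only [sysMap, h, if_false]
      rw [sub_eq_add_neg]
      refine (gnorm_add_le _ (fun _ => zero_le_one) _ _).trans ?_
      rw [gnorm_neg, ← l1norm, ← l1norm, hX, hX]
      norm_num

theorem sysHom_monomial (k : Option (Fin n)) (e : Fin m × Fin n →₀ ℕ) :
    sysHom k (monomial e 1) = ∏ hj, sysHom k (X hj) ^ e hj := by
  rw [monomial_eq, C_1, one_mul, Finsupp.prod_fintype _ _ fun _ => pow_zero _, map_prod]
  simp only [map_pow]

theorem sum_block_of_coeff_ne_zero (k : Option (Fin n)) (e e' : Fin m × Fin n →₀ ℕ)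
    (he : coeff e' (sysHom k (monomial e 1)) ≠ 0) (h : Fin m) :
    ∑ j, e' (h, j) = ∑ j, e (h, j) := by
  have h1 : IsWeightedHomogeneous (fun hj : Fin m × Fin n => (Pi.single hj.1 1 : Fin m → ℕ))
      (sysHom k (monomial e 1)) (∑ hj, e hj • (Pi.single hj.1 1 : Fin m → ℕ)) := by
    rw [sysHom_monomial]
    exact IsWeightedHomogeneous.prod _ _ _ fun hj _ =>
      (isWeightedHomogeneous_sysHom_X k hj).pow _
  have h2 := h1 he
  rw [Finsupp.weight_apply, Finsupp.sum_fintype e' _ fun i => zero_smul ℕ (Pi.single i.1 1 : Fin m → ℕ)] at h2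
  have h3 : ∀ f : Fin m × Fin n →₀ ℕ,
      (∑ hj, f hj • (Pi.single hj.1 1 : Fin m → ℕ)) h = ∑ j, f (h, j) := by
    intro f
    rw [Finset.sum_apply, Fintype.sum_prod_type]
    rw [Finset.sum_eq_single h]
    · simp
    · intro h' _ hne
      simp [hne.symm]
    · simp
  rw [← h3, h2, h3]

theorem l1norm_sysHom_monomial_le (k : Option (Fin n)) (e : Fin m × Fin n →₀ ℕ) :
    l1norm (sysHom k (monomial e 1)) ≤ 2 ^ ∑ hj, e hj := by
  rw [sysHom_monomial, ← Finset.prod_pow_eq_pow_sum]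
  refine (gnorm_prod_le _ (fun _ => zero_le_one) _ _).trans
    (Finset.prod_le_prod (fun _ _ => l1norm_nonneg _) fun hj _ => ?_)
  exact (gnorm_pow_le _ (fun _ => zero_le_one) _ _).trans
    (pow_le_pow_left₀ (l1norm_nonneg _) (l1norm_sysHom_X_le k hj) _)

end Systems

section Auxiliary

/-- The exponent with prescribed blocks. -/
noncomputable def blockExp {m n : ℕ} (i : Fin m → Fin n → ℕ) : Fin m × Fin n →₀ ℕ :=
  Finsupp.equivFunOnFinite.symm fun hj => i hj.1 hj.2

@[simp] theorem blockExp_apply {m n : ℕ} (i : Fin m → Fin n → ℕ) (hj : Fin m × Fin n) :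
    blockExp i hj = i hj.1 hj.2 := rfl

theorem exists_auxiliary_polynomial {n m : ℕ} (hn : 0 < n) {ε : ℝ} (hε : 0 < ε)
    (hm : 2 * n * (n + 1) ≤ ε ^ 2 * m) (d : Fin m → ℕ) (hd : ∀ h, 0 < d h) :
    ∃ P : MvPolynomial (Fin m × Fin n) ℤ, P ≠ 0 ∧ ∀ k : Option (Fin n),
      (∀ e, coeff e (sysHom k P) ≠ 0 → (∀ h, ∑ j, e (h, j) = d h) ∧
        ∀ j, |∑ h, (e (h, j) / d h : ℝ) - m / n| ≤ ε * m) ∧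
      l1norm (sysHom k P) ≤ 2 ^ ((2 * n + 2) * ∑ h, d h) := by
  classical
  have hn' : (0 : ℝ) < n := by exact_mod_cast hn
  have hm0 : 0 < m := by
    rcases Nat.eq_zero_or_pos m with rfl | h
    · exfalso
      have : (0 : ℝ) < 2 * n * (n + 1) := by positivity
      simp only [Nat.cast_zero, mul_zero] at hm
      linarith
    · exact h
  let Ω := ∀ h : Fin m, Finset.piAntidiag (Finset.univ : Finset (Fin n)) (d h)
  let ex : Ω → (Fin m × Fin n →₀ ℕ) := fun i => blockExp fun h => (i h).1
  have hex_inj : Function.Injective ex := by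
    intro i i' h
    funext a
    refine Subtype.ext (funext fun j => ?_)
    exact DFunLike.congr_fun h (a, j)
  have hex_block : ∀ i h, ∑ j, ex i (h, j) = d h := fun i h =>
    (Finset.mem_piAntidiag.1 (i h).2).1
  have hex_surj : ∀ e : Fin m × Fin n →₀ ℕ, (∀ h, ∑ j, e (h, j) = d h) → ∃ i, ex i = e := by
    intro e he
    refine ⟨fun h => ⟨fun j => e (h, j), ?_⟩, ?_⟩
    · simp [Finset.mem_piAntidiag, he]
    · ext hj
      rfl
  have hex_sum : ∀ i, ∑ hj, ex i hj = ∑ h, d h := fun i => by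
    rw [Fintype.sum_prod_type]
    exact Finset.sum_congr rfl fun h _ => hex_block i h
  let bad : Fin n → Finset Ω := fun j =>
    Finset.univ.filter fun i => ε * m < |∑ h, ((i h).1 j / d h : ℝ) - m / n|
  let α := {ki : Option (Fin n) × Ω // ∃ j, ki.2 ∈ bad j}
  have hcardΩ : Fintype.card Ω ≤ 2 ^ (n * ∑ h, d h) := by
    rw [Fintype.card_pi, Finset.mul_sum, ← Finset.prod_pow_eq_pow_sum]
    refine Finset.prod_le_prod (fun _ _ => Nat.zero_le _) fun h _ => ?_
    rw [Fintype.card_coe]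
    exact card_piAntidiag_le n (d h)
  have hΩpos : 0 < Fintype.card Ω := by
    rw [Fintype.card_pos_iff]
    refine ⟨fun h => ⟨Pi.single ⟨0, hn⟩ (d h), ?_⟩⟩
    simp [Finset.mem_piAntidiag]
  have hcard : 2 * Fintype.card α ≤ Fintype.card Ω := by
    have h1 : Fintype.card α ≤ (n + 1) * ∑ j, (bad j).card := by
      rw [Fintype.card_subtype]
      refine (Finset.card_le_card (t := (Finset.univ : Finset (Option (Fin n))) ×ˢ
        (Finset.univ.biUnion bad)) ?_).trans ?_
      · intro ki hki
        simpa using hki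
      · rw [Finset.card_product]
        simp only [Finset.card_univ, Fintype.card_option, Fintype.card_fin]
        exact Nat.mul_le_mul_left _ Finset.card_biUnion_le
    have h2 : ∀ j, ((bad j).card : ℝ) * (ε ^ 2 * m) ≤ Fintype.card Ω := fun j =>
      card_deviation_le hn d hd ε hε hm0 j
    have h3 : ((∑ j, (bad j).card : ℕ) : ℝ) * (ε ^ 2 * m) ≤ n * Fintype.card Ω := by
      push_cast
      rw [Finset.sum_mul]
      exact (Finset.sum_le_sum fun j _ => h2 j).trans (by simp)
    have h4 : (Fintype.card α : ℝ) ≤ (n + 1) * (∑ j, (bad j).card : ℕ) := by exact_mod_cast h1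
    have h5 : (2 * Fintype.card α : ℝ) ≤ Fintype.card Ω := by
      have h6 : (0 : ℝ) ≤ (∑ j, (bad j).card : ℕ) := Nat.cast_nonneg _
      have h7 := mul_le_mul_of_nonneg_left hm h6
      have h8 : (0 : ℝ) < n := hn'
      have h9 : (n : ℝ) * (2 * ((n + 1) * (∑ j, (bad j).card : ℕ))) ≤ n * Fintype.card Ω := by
        linarith
      have := le_of_mul_le_mul_left h9 h8
      linarith
    exact_mod_cast h5
  let A : Matrix α Ω ℤ := fun ki i => coeff (ex ki.1.2) (sysHom ki.1.1 (monomial (ex i) 1))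
  let _ : SeminormedAddCommGroup (Matrix α Ω ℤ) := Matrix.seminormedAddCommGroup
  have hA : ‖A‖ ≤ 2 ^ ∑ h, d h := by
    rw [Matrix.norm_le_iff (by positivity)]
    intro ki i
    rw [Int.norm_eq_abs, ← hex_sum i]
    exact (abs_coeff_le_l1norm _ _).trans (l1norm_sysHom_monomial_le _ _)
  obtain ⟨t, ht0, hAt, htn⟩ : ∃ t : Ω → ℤ, t ≠ 0 ∧ A.mulVec t = 0 ∧
      ∀ i, |(t i : ℝ)| ≤ 2 ^ ((n + 1) * ∑ h, d h) := by
    rcases Nat.eq_zero_or_pos (Fintype.card α) with h0 | hpos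
    · have := Fintype.card_eq_zero_iff.1 h0
      obtain ⟨i0⟩ := Fintype.card_pos_iff.1 hΩpos
      refine ⟨fun _ => 1, fun h => one_ne_zero (congrFun h i0), ?_, fun i => ?_⟩
      · ext ki
        exact isEmptyElim ki
      · simp only [Int.cast_one, abs_one]
        exact one_le_pow₀ one_le_two
    · obtain ⟨t, ht0, hAt, htn⟩ := Int.Matrix.exists_ne_zero_int_vec_norm_le A (by omega) hpos
      refine ⟨t, ht0, hAt, fun i => ?_⟩
      have h1 : |(t i : ℝ)| ≤ ‖t‖ := by
        rw [← Int.norm_eq_abs]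
        exact norm_le_pi_norm t i
      have hone : (1 : ℝ) ≤ 2 ^ ∑ h, d h := one_le_pow₀ one_le_two
      have h2 : (Fintype.card Ω * max 1 ‖A‖ : ℝ) ≤ 2 ^ ((n + 1) * ∑ h, d h) := by
        rw [add_mul, one_mul, pow_add]
        exact mul_le_mul (by exact_mod_cast hcardΩ) (max_le hone hA) (by positivity) (by positivity)
      have h3 : (1 : ℝ) ≤ Fintype.card Ω * max 1 ‖A‖ := by
        have h4 : (1 : ℝ) ≤ Fintype.card Ω := by exact_mod_cast hΩpos
        have := le_max_left 1 ‖A‖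
        nlinarith
      refine h1.trans (htn.trans ((Real.rpow_le_rpow_of_exponent_le h3 (z := 1) ?_).trans ?_))
      · have h4 : (2 * Fintype.card α : ℝ) ≤ Fintype.card Ω := by exact_mod_cast hcard
        have h5 : (0 : ℝ) < Fintype.card α := by exact_mod_cast hpos
        rw [div_le_one (by linarith)]
        linarith
      · rw [Real.rpow_one]
        exact h2
  let P : MvPolynomial (Fin m × Fin n) ℤ := ∑ i, C (t i) * monomial (ex i) 1
  have hsys : ∀ k, sysHom k P = ∑ i, C (t i) * sysHom k (monomial (ex i) 1) := fun k => by
    simp only [P, map_sum, map_mul, algHom_C, algebraMap_eq]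
  refine ⟨P, ?_, fun k => ⟨fun e he => ?_, ?_⟩⟩
  · obtain ⟨i, hi⟩ := Function.ne_iff.1 ht0
    intro h
    apply hi
    have := congrArg (coeff (ex i)) h
    simp only [P, coeff_sum, coeff_C_mul, coeff_monomial, hex_inj.eq_iff] at this
    rw [Finset.sum_eq_single i (fun x _ hx => by simp [hx]) (by simp)] at this
    simpa using this
  · rw [hsys, coeff_sum] at he
    have hblock : ∀ h, ∑ j, e (h, j) = d h := by
      obtain ⟨i, -, hi⟩ := Finset.exists_ne_zero_of_sum_ne_zero he
      intro h
      rw [coeff_C_mul] at hi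
      rw [sum_block_of_coeff_ne_zero k _ _ (right_ne_zero_of_mul hi), hex_block]
    refine ⟨hblock, fun j => ?_⟩
    obtain ⟨i', rfl⟩ := hex_surj e hblock
    by_contra hcon
    have hmem : i' ∈ bad j := Finset.mem_filter.2 ⟨Finset.mem_univ _, not_le.1 hcon⟩
    apply he
    have := congrFun hAt ⟨(k, i'), j, hmem⟩
    rw [Matrix.mulVec, dotProduct] at this
    simpa only [A, coeff_sum, coeff_C_mul, mul_comm, Pi.zero_apply] using this
  · rw [hsys]
    refine (gnorm_sum_le _ (fun _ => zero_le_one) _ _).trans ?_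
    refine (Finset.sum_le_card_nsmul _ _ (2 ^ ((n + 1) * ∑ h, d h) * 2 ^ ∑ h, d h)
      fun i _ => ?_).trans ?_
    · refine (gnorm_mul_le _ (fun _ => zero_le_one) _ _).trans ?_
      rw [gnorm_C]
      refine mul_le_mul (htn i) ?_ (gnorm_nonneg _ (fun _ => zero_le_one) _) (by positivity)
      rw [← hex_sum i]
      exact l1norm_sysHom_monomial_le k _
    · rw [nsmul_eq_mul, Finset.card_univ]
      have h1 : (Fintype.card Ω : ℝ) ≤ 2 ^ (n * ∑ h, d h) := by exact_mod_cast hcardΩ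
      refine (mul_le_mul_of_nonneg_right h1 (by positivity)).trans (le_of_eq ?_)
      rw [← pow_add, ← pow_add]
      congr 1
      ring

end Auxiliary

end

section

open MvPolynomial NumberField Height

section EvaluationBounds

variable {σ τ K : Type*} [Field K]

theorem AbsoluteValue.intCast_le_abs (v : AbsoluteValue K ℝ) (a : ℤ) : v (a : K) ≤ |(a : ℝ)| := by
  have h : ∀ n : ℕ, v (n : K) ≤ n := by
    intro n
    induction n with
    | zero => simp
    | succ n ih =>
      push_cast
      exact (v.add_le _ _).trans (by simpa using ih)
  rw [← v.apply_natAbs_eq]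
  refine (h _).trans (le_of_eq ?_)
  rw [Nat.cast_natAbs, Int.cast_abs]

theorem aeval_int_eq_sum [Fintype τ] (Y : τ → MvPolynomial σ K) (P : MvPolynomial τ ℤ) :
    aeval Y P = ∑ e ∈ P.support, C ((coeff e P : ℤ) : K) * ∏ i, Y i ^ e i := by
  rw [aeval_def, eval₂_eq']
  refine Finset.sum_congr rfl fun e _ => ?_
  simp

theorem gnorm_aeval_le [Fintype τ] (v : AbsoluteValue K ℝ) {ρ : σ → ℝ} (hρ : ∀ h, 0 ≤ ρ h)
    (Y : τ → MvPolynomial σ K) (P : MvPolynomial τ ℤ) (c : τ → ℝ)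
    (hc : ∀ i, gnorm v ρ (Y i) ≤ c i) (B : ℝ)
    (hB : ∀ e, coeff e P ≠ 0 → ∏ i, c i ^ e i ≤ B) :
    gnorm v ρ (aeval Y P) ≤ l1norm P * B := by
  rw [aeval_int_eq_sum, l1norm_eq, Finset.sum_mul]
  refine (gnorm_sum_le v hρ _ _).trans (Finset.sum_le_sum fun e he => ?_)
  refine (gnorm_mul_le v hρ _ _).trans ?_
  rw [gnorm_C]
  refine mul_le_mul (v.intCast_le_abs _) ?_ (gnorm_nonneg v hρ _) (abs_nonneg _)
  refine (gnorm_prod_le v hρ _ _).trans (le_trans ?_ (hB e (mem_support_iff.1 he)))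
  exact Finset.prod_le_prod (fun _ _ => gnorm_nonneg v hρ _) fun i _ =>
    (gnorm_pow_le v hρ _ _).trans (pow_le_pow_left₀ (gnorm_nonneg v hρ _) (hc i) _)

/-- All coefficients of the polynomial are bounded by `B`. -/
def CoeffLE {R : Type*} [CommRing R] (v : AbsoluteValue R ℝ) (f : MvPolynomial σ R) (B : ℝ) : Prop :=
  ∀ e, v (coeff e f) ≤ B

theorem coeffLE_C (v : AbsoluteValue K ℝ) {a : K} {B : ℝ} (ha : v a ≤ B) :
    CoeffLE v (C a : MvPolynomial σ K) B := by
  classical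
  intro e
  rw [coeff_C]
  split_ifs
  · exact ha
  · rw [map_zero]
    exact (v.nonneg a).trans ha

theorem coeffLE_X (v : AbsoluteValue K ℝ) (h : σ) {B : ℝ} (hB : 1 ≤ B) :
    CoeffLE v (X h : MvPolynomial σ K) B := by
  classical
  intro e
  rw [coeff_X]
  split_ifs
  · simpa using hB
  · simpa using zero_le_one.trans hB

variable {v : AbsoluteValue K ℝ}

theorem CoeffLE.sum (hv : IsNonarchimedean v) {α : Type*} (s : Finset α)
    {f : α → MvPolynomial σ K} {B : ℝ} (hB : 0 ≤ B) (hf : ∀ i ∈ s, CoeffLE v (f i) B) :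
    CoeffLE v (∑ i ∈ s, f i) B := by
  classical
  induction s using Finset.induction_on with
  | empty => intro e; simpa using hB
  | insert a s ha ih =>
    rw [Finset.sum_insert ha]
    intro e
    rw [coeff_add]
    exact (hv _ _).trans (max_le (hf a (by simp) e) (ih (fun i hi => hf i (by simp [hi])) e))

theorem CoeffLE.mul (hv : IsNonarchimedean v) {f g : MvPolynomial σ K} {B B' : ℝ} (hB : 0 ≤ B)
    (hB' : 0 ≤ B') (hf : CoeffLE v f B) (hg : CoeffLE v g B') : CoeffLE v (f * g) (B * B') := by
  classical
  intro e
  rw [coeff_mul]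
  have : ∀ s : Finset ((σ →₀ ℕ) × (σ →₀ ℕ)),
      v (∑ x ∈ s, coeff x.1 f * coeff x.2 g) ≤ B * B' := by
    intro s
    induction s using Finset.induction_on with
    | empty => simpa using mul_nonneg hB hB'
    | insert a s ha ih =>
      rw [Finset.sum_insert ha]
      refine (hv _ _).trans (max_le ?_ ih)
      rw [map_mul]
      exact mul_le_mul (hf _) (hg _) (v.nonneg _) hB
  exact this _

theorem CoeffLE.pow (hv : IsNonarchimedean v) {f : MvPolynomial σ K} {B : ℝ} (hB : 0 ≤ B)
    (hf : CoeffLE v f B) (k : ℕ) : CoeffLE v (f ^ k) (B ^ k) := by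
  induction k with
  | zero =>
    rw [pow_zero, pow_zero, ← C_1]
    exact coeffLE_C v (by simp)
  | succ k ih =>
    rw [pow_succ, pow_succ]
    exact ih.mul hv (pow_nonneg hB k) hB hf

theorem CoeffLE.prod (hv : IsNonarchimedean v) {α : Type*} (s : Finset α)
    {f : α → MvPolynomial σ K} {B : α → ℝ} (hB : ∀ i, 0 ≤ B i) (hf : ∀ i, CoeffLE v (f i) (B i)) :
    CoeffLE v (∏ i ∈ s, f i) (∏ i ∈ s, B i) := by
  classical
  induction s using Finset.induction_on with
  | empty =>
    rw [Finset.prod_empty, Finset.prod_empty, ← C_1]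
    exact coeffLE_C v (by simp)
  | insert a s ha ih =>
    rw [Finset.prod_insert ha, Finset.prod_insert ha]
    exact (hf a).mul hv (hB a) (Finset.prod_nonneg fun _ _ => hB _) ih

theorem coeffLE_aeval [Fintype τ] (hv : IsNonarchimedean v)
    (Y : τ → MvPolynomial σ K) (P : MvPolynomial τ ℤ) (c : τ → ℝ) (hc0 : ∀ i, 0 ≤ c i)
    (hc : ∀ i, CoeffLE v (Y i) (c i)) (B : ℝ) (hB0 : 0 ≤ B)
    (hB : ∀ e, coeff e P ≠ 0 → ∏ i, c i ^ e i ≤ B) : CoeffLE v (aeval Y P) B := by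
  rw [aeval_int_eq_sum]
  refine CoeffLE.sum hv _ hB0 fun e he e' => ?_
  have h1 : CoeffLE v (C ((coeff e P : ℤ) : K) : MvPolynomial σ K) 1 :=
    coeffLE_C v hv.apply_intCast_le_one
  have h2 : CoeffLE v (∏ i, Y i ^ e i) (∏ i, c i ^ e i) :=
    CoeffLE.prod hv _ (fun i => pow_nonneg (hc0 i) _) fun i => (hc i).pow hv (hc0 i) _
  have h3 := h1.mul hv zero_le_one (Finset.prod_nonneg fun i _ => pow_nonneg (hc0 i) _) h2 e'
  rw [one_mul] at h3
  exact h3.trans (hB e (mem_support_iff.1 he))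

end EvaluationBounds

section CoefficientOrder

variable {σ τ υ K : Type*} [Field K] [Fintype σ] [Fintype υ]

/-- All coefficients have order at least `θ`. -/
def AllOrdGE (w : σ → ℝ) (F : MvPolynomial τ (MvPolynomial σ K)) (θ : ℝ) : Prop :=
  ∀ μ, OrdGE w (coeff μ F) θ

variable {w : σ → ℝ}

theorem allOrdGE_zero (hw : ∀ h, 0 ≤ w h) (F : MvPolynomial τ (MvPolynomial σ K)) :
    AllOrdGE w F 0 := fun _ => ordGE_zero hw

theorem AllOrdGE.mul {F G : MvPolynomial τ (MvPolynomial σ K)} {θ η : ℝ} (hF : AllOrdGE w F θ)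
    (hG : AllOrdGE w G η) : AllOrdGE w (F * G) (θ + η) := by
  classical
  intro μ
  rw [coeff_mul]
  exact OrdGE.sum _ fun x _ => (hF _).mul (hG _)

theorem AllOrdGE.pow (hw : ∀ h, 0 ≤ w h) {F : MvPolynomial τ (MvPolynomial σ K)} {θ : ℝ}
    (hF : AllOrdGE w F θ) (k : ℕ) : AllOrdGE w (F ^ k) (θ * k) := by
  induction k with
  | zero =>
    rw [Nat.cast_zero, mul_zero]
    exact allOrdGE_zero hw _
  | succ k ih =>
    rw [pow_succ, Nat.cast_succ, mul_add, mul_one]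
    exact ih.mul hF

theorem AllOrdGE.prod (hw : ∀ h, 0 ≤ w h) {α : Type*} (s : Finset α)
    {F : α → MvPolynomial τ (MvPolynomial σ K)} {θ : α → ℝ} (hF : ∀ i, AllOrdGE w (F i) (θ i)) :
    AllOrdGE w (∏ i ∈ s, F i) (∑ i ∈ s, θ i) := by
  classical
  induction s using Finset.induction_on with
  | empty => exact allOrdGE_zero hw _
  | insert a s ha ih =>
    rw [Finset.prod_insert ha, Finset.sum_insert ha]
    exact (hF a).mul ih

theorem OrdGE.allOrdGE_aeval (hw : ∀ h, 0 ≤ w h) {w' : υ → ℝ} {Q : MvPolynomial υ K} {θ : ℝ}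
    (hQ : OrdGE w' Q θ) (Z : υ → MvPolynomial τ (MvPolynomial σ K))
    (hZ : ∀ i, AllOrdGE w (Z i) (w' i)) : AllOrdGE w (aeval Z Q) θ := by
  classical
  rw [aeval_def, eval₂_eq']
  intro μ
  rw [coeff_sum]
  refine OrdGE.sum _ fun e he => ?_
  have h1 := (allOrdGE_zero hw (algebraMap K _ (coeff e Q))).mul
    (AllOrdGE.prod hw Finset.univ fun i => (hZ i).pow hw (e i))
  rw [zero_add] at h1
  exact (h1 μ).mono (hQ e (mem_support_iff.1 he))

end CoefficientOrder

section Contraction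

variable {m n : ℕ} {K : Type*} [Field K]

theorem monomial_filter_eq {R : Type*} [CommRing R] (a b : Fin n) (hab : a ≠ b)
    (U : Fin m → MvPolynomial (Fin m × Fin n) R) (e : Fin m × Fin n →₀ ℕ) :
    ∏ hj : Fin m × Fin n, (if hj.2 = a then 1 else if hj.2 = b then U hj.1 else X hj) ^ e hj =
      (∏ h, U h ^ e (h, b)) * monomial (e.filter fun hj => hj.2 ≠ a ∧ hj.2 ≠ b) 1 := by
  classical
  rw [monomial_eq, C_1, one_mul, Finsupp.prod_fintype _ _ fun _ => pow_zero _,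
    Fintype.prod_prod_type, Fintype.prod_prod_type, ← Finset.prod_mul_distrib]
  refine Finset.prod_congr rfl fun h _ => ?_
  have h1 : U h ^ e (h, b) = ∏ j, if j = b then U h ^ e (h, b) else 1 := by
    rw [Finset.prod_ite_eq' Finset.univ b, if_pos (Finset.mem_univ _)]
  rw [h1, ← Finset.prod_mul_distrib]
  refine Finset.prod_congr rfl fun j _ => ?_
  by_cases hja : j = a
  · subst hja
    simp [hab]
  · by_cases hjb : j = b
    · subst hjb
      simp [hja]
    · simp [hja, hjb]

theorem exists_contraction (a b : Fin n) (hab : a ≠ b) (P : MvPolynomial (Fin m × Fin n) ℤ)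
    (hP : P ≠ 0) (d : Fin m → ℕ)
    (hd : ∀ e, coeff e P ≠ 0 → ∀ h, ∑ j, e (h, j) = d h) (ξ : Fin m → K)
    (U : Fin m → MvPolynomial (Fin m × Fin n) (MvPolynomial (Fin m) K))
    (hU : ∀ h, coeff 0 (U h) = X h + C (ξ h)) :
    ∃ (μ : Fin m × Fin n →₀ ℕ) (p : MvPolynomial (Fin m) ℤ), p ≠ 0 ∧ l1norm p ≤ l1norm P ∧
      (∀ h, degreeOf h p ≤ d h) ∧
      coeff μ (aeval (fun hj : Fin m × Fin n =>
        if hj.2 = a then 1 else if hj.2 = b then U hj.1 else X hj) P) =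
        shift ξ (map (Int.castRingHom K) p) := by
  classical
  let O : (Fin m × Fin n →₀ ℕ) → (Fin m × Fin n →₀ ℕ) :=
    fun e => e.filter fun hj => hj.2 ≠ a ∧ hj.2 ≠ b
  let bp : (Fin m × Fin n →₀ ℕ) → (Fin m →₀ ℕ) :=
    fun e => Finsupp.equivFunOnFinite.symm fun h => e (h, b)
  obtain ⟨e₀, he₀, hmin⟩ := Finset.exists_min_image P.support (fun e => (O e).degree)
    (support_nonempty.2 hP)
  have hO : ∀ e ∈ P.support, O e ≤ O e₀ → O e = O e₀ := by
    intro e he hle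
    have h1 := hmin e he
    obtain ⟨c, hc⟩ := le_iff_exists_add.1 hle
    have h2 : (O e₀).degree = (O e).degree + c.degree := by rw [hc, map_add]
    have h3 : c = 0 := by
      rw [← Finsupp.degree_eq_zero_iff]
      omega
    rw [hc, h3, add_zero]
  let s := P.support.filter fun e => O e = O e₀
  let p : MvPolynomial (Fin m) ℤ := ∑ e ∈ s, monomial (bp e) (coeff e P)
  have hinj : ∀ e ∈ s, ∀ e' ∈ s, bp e = bp e' → e = e' := by
    intro e he e' he' hb
    obtain ⟨he1, he2⟩ := Finset.mem_filter.1 he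
    obtain ⟨he1', he2'⟩ := Finset.mem_filter.1 he'
    have hbv : ∀ h, e (h, b) = e' (h, b) := fun h => DFunLike.congr_fun hb h
    have hov : ∀ h j, j ≠ a → e (h, j) = e' (h, j) := by
      intro h j hja
      by_cases hjb : j = b
      · rw [hjb, hbv]
      · have := DFunLike.congr_fun (he2.trans he2'.symm) (h, j)
        simpa [O, Finsupp.filter_apply, hja, hjb] using this
    ext ⟨h, j⟩
    by_cases hja : j = a
    · subst hja
      have h1 := hd e (mem_support_iff.1 he1) h
      have h2 := hd e' (mem_support_iff.1 he1') h
      rw [← Finset.add_sum_erase _ _ (Finset.mem_univ j)] at h1 h2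
      rw [Finset.sum_congr rfl fun i hi => hov h i (Finset.ne_of_mem_erase hi)] at h1
      omega
    · exact hov h j hja
  have hcoef : ∀ e ∈ s, coeff (bp e) p = coeff e P := by
    intro e he
    simp only [p, coeff_sum, coeff_monomial]
    rw [Finset.sum_eq_single e (fun e' he' hne => if_neg fun h => hne (hinj _ he' _ he h))
      (fun h => (h he).elim), if_pos rfl]
  refine ⟨O e₀, p, ?_, ?_, ?_, ?_⟩
  · intro h
    have := hcoef e₀ (Finset.mem_filter.2 ⟨he₀, rfl⟩)
    rw [h, coeff_zero] at this
    exact mem_support_iff.1 he₀ this.symm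
  · refine (gnorm_sum_le _ (fun _ => zero_le_one) _ _).trans ?_
    rw [l1norm_eq]
    refine le_trans (Finset.sum_le_sum fun e _ => ?_) (Finset.sum_le_sum_of_subset_of_nonneg
      (Finset.filter_subset _ _) fun _ _ _ => abs_nonneg _)
    rw [gnorm_monomial]
    simp [Finsupp.prod]
  · intro h
    refine (degreeOf_sum_le _ _ _).trans (Finset.sup_le fun e he => ?_)
    have hne := mem_support_iff.1 (Finset.mem_filter.1 he).1
    rw [degreeOf_monomial_eq _ _ hne, ← hd e hne h]
    exact Finset.single_le_sum (f := fun j => e (h, j)) (fun _ _ => Nat.zero_le _)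
      (Finset.mem_univ b)
  · rw [aeval_def, eval₂_eq', coeff_sum]
    simp only [p, map_sum]
    rw [Finset.sum_filter]
    refine Finset.sum_congr rfl fun e he => ?_
    rw [monomial_filter_eq a b hab, ← mul_assoc, coeff_mul_monomial', mul_one]
    have hiff : O e ≤ O e₀ ↔ O e = O e₀ := ⟨hO e he, fun h => h.le⟩
    change (if O e ≤ O e₀ then _ else _) = _
    rw [if_congr hiff rfl rfl]
    split_ifs with h
    · change coeff (O e₀ - O e) _ = _
      rw [h, tsub_self, ← constantCoeff_eq, map_mul, map_prod]
      simp only [map_pow, constantCoeff_eq, hU]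
      rw [map_monomial, monomial_eq, map_mul, Finsupp.prod_fintype _ _ fun _ => pow_zero _,
        map_prod]
      simp only [map_pow, shift_X]
      congr 1
      rw [eq_intCast, ← constantCoeff_eq, map_intCast]
      simp
    · rfl

end Contraction

section LocalBounds

variable {m n q : ℕ} {K : Type*} [Field K]

theorem sum_exponent_le {κ ε δ D : ℝ} (β : Fin n → ℝ) (hβ : ∀ j, |β j| ≤ κ)
    (r : Fin m → Fin n → ℝ) (hr : ∀ h j, 0 ≤ r h j) (hsum : ∀ h, ∑ j, r h j = 1)
    (hdev : ∀ j, |∑ h, r h j - m / n| ≤ ε * m) (T : Fin m → ℝ) (hT : ∀ h, D ≤ T h)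
    (hT' : ∀ h, T h ≤ (1 + δ) * D) (hD : 0 ≤ D) :
    ∑ h, ∑ j, r h j * T h * β j ≤ D * (m / n * ∑ j, β j + n * κ * ε * m + κ * δ * m) := by
  have h1 : ∑ h, ∑ j, r h j * T h * β j =
      D * (m / n * ∑ j, β j) + D * ∑ j, β j * (∑ h, r h j - m / n) +
        ∑ h, ∑ j, r h j * ((T h - D) * β j) := by
    have h0 : m / n * ∑ j, β j + ∑ j, β j * (∑ h, r h j - m / n) = ∑ h, ∑ j, β j * r h j := by
      rw [Finset.mul_sum, ← Finset.sum_add_distrib, Finset.sum_comm]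
      refine Finset.sum_congr rfl fun j _ => ?_
      rw [← Finset.mul_sum]
      ring
    rw [← mul_add, h0, Finset.mul_sum, ← Finset.sum_add_distrib]
    refine Finset.sum_congr rfl fun h _ => ?_
    rw [Finset.mul_sum, ← Finset.sum_add_distrib]
    exact Finset.sum_congr rfl fun j _ => by ring
  have h2 : ∑ j, β j * (∑ h, r h j - m / n) ≤ n * κ * ε * m := by
    refine (Finset.sum_le_card_nsmul _ _ (κ * (ε * m)) fun j _ => ?_).trans (le_of_eq ?_)
    · refine (le_abs_self _).trans ?_
      rw [abs_mul]
      exact mul_le_mul (hβ j) (hdev j) (abs_nonneg _) ((abs_nonneg _).trans (hβ j))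
    · simp
      ring
  have h3 : ∑ h, ∑ j, r h j * ((T h - D) * β j) ≤ D * (κ * δ * m) := by
    refine (Finset.sum_le_card_nsmul _ _ (D * (κ * δ)) fun h _ => ?_).trans (le_of_eq ?_)
    · have : D * (κ * δ) = ∑ j, r h j * (D * (κ * δ)) := by rw [← Finset.sum_mul, hsum, one_mul]
      rw [this]
      refine Finset.sum_le_sum fun j _ => mul_le_mul_of_nonneg_left ?_ (hr h j)
      have h4 : 0 ≤ T h - D := by linarith [hT h]
      have h5 : T h - D ≤ δ * D := by linarith [hT' h]
      have h6 := le_abs_self (β j)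
      have h7 : 0 ≤ κ := (abs_nonneg _).trans (hβ j)
      calc (T h - D) * β j ≤ (T h - D) * κ := mul_le_mul_of_nonneg_left (h6.trans (hβ j)) h4
        _ ≤ δ * D * κ := mul_le_mul_of_nonneg_right h5 h7
        _ = _ := by ring
    · simp
      ring
  rw [h1]
  have := mul_le_mul_of_nonneg_left h2 hD
  linarith

/-- The generic point of the product of the spans, moved in the direction `b`. -/
noncomputable def movedPoint (b : Fin n) (L : Fin m → Fin q → Fin n → K) (h : Fin m) (j : Fin n) :
    MvPolynomial (Fin m × Fin q ⊕ Fin m) K :=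
  ∑ s, C (L h s j) * X (Sum.inl (h, s)) + C ((Pi.single b 1 : Fin n → K) j) * X (Sum.inr h)

theorem sysMap_movedPoint (k : Option (Fin n)) (b : Fin n) (L : Fin m → Fin q → Fin n → K)
    (h : Fin m) (j : Fin n) : sysMap k (movedPoint b L h) j =
      ∑ s, C (sysMap k (L h s) j) * X (Sum.inl (h, s)) +
        C (sysMap k (Pi.single b 1 : Fin n → K) j) * X (Sum.inr h) := by
  cases k with
  | none => rfl
  | some k =>
    by_cases hjk : j = k
    · simp only [sysMap, hjk, if_true, movedPoint, map_neg, neg_mul, Finset.sum_neg_distrib]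
      ring
    · simp only [sysMap, hjk, if_false, movedPoint, map_sub, sub_mul, Finset.sum_sub_distrib]
      ring

theorem sysMap_single (k : Option (Fin n)) (b j : Fin n) :
    sysMap k (Pi.single b 1 : Fin n → K) j = 0 ∨ sysMap k (Pi.single b 1 : Fin n → K) j = 1 ∨
      sysMap k (Pi.single b 1 : Fin n → K) j = -1 := by
  cases k with
  | none =>
    by_cases h : j = b
    · subst h
      simp [sysMap]
    · simp [sysMap, h]
  | some k =>
    by_cases hjk : j = k
    · subst hjk
      by_cases h : j = b
      · subst h
        simp [sysMap]
      · simp [sysMap, h]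
    · by_cases h : j = b
      · subst h
        simp [sysMap, hjk, Ne.symm hjk]
      · by_cases h' : k = b
        · subst h'
          simp [sysMap, h]
        · simp [sysMap, hjk, h, h']

theorem abs_sysMap_single_le (v : AbsoluteValue K ℝ) (k : Option (Fin n)) (b j : Fin n) :
    v (sysMap k (Pi.single b 1 : Fin n → K) j) ≤ 1 := by
  rcases sysMap_single (K := K) k b j with h | h | h <;> simp [h]

theorem coeff_aeval_movedPoint_le (v : AbsoluteValue K ℝ) (k : Option (Fin n)) (b : Fin n)
    (L : Fin m → Fin q → Fin n → K) {κ ε δ D θ : ℝ} (hδ : 0 ≤ δ) (β : Fin n → ℝ)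
    (hβ : ∀ j, |β j| ≤ κ)
    (H : Fin m → ℝ) (hH : ∀ h, 0 ≤ H h)
    (hL : ∀ h s j, v (sysMap k (L h s) j) ≤ Real.exp (β j * H h))
    (P : MvPolynomial (Fin m × Fin n) ℤ) (d : Fin m → ℕ) (hd : ∀ h, 0 < d h)
    (hP : ∀ e, coeff e (sysHom k P) ≠ 0 → (∀ h, ∑ j, e (h, j) = d h) ∧
        ∀ j, |∑ h, (e (h, j) / d h : ℝ) - m / n| ≤ ε * m)
    (hD : 0 ≤ D) (hT : ∀ h, D ≤ d h * H h) (hT' : ∀ h, d h * H h ≤ (1 + δ) * D) (hκ : 0 ≤ κ)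
    (e : Fin m × Fin q ⊕ Fin m →₀ ℕ) (he : ∑ h, (1 / d h : ℝ) * e (Sum.inr h) ≤ θ) :
    v (coeff e (aeval (fun hj : Fin m × Fin n => movedPoint b L hj.1 hj.2) P)) ≤
      l1norm (sysHom k P) * ((q + 1) ^ (∑ h, d h) *
        Real.exp (D * (m / n * ∑ j, β j + n * κ * ε * m + κ * δ * m))) *
        Real.exp (κ * ((1 + δ) * D * θ)) := by
  let ρ : Fin m × Fin q ⊕ Fin m → ℝ := Sum.elim (fun _ => 1) fun h => Real.exp (-(κ * H h))
  have hρ : ∀ i, 0 ≤ ρ i := by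
    rintro (i | i)
    · exact zero_le_one
    · exact (Real.exp_pos _).le
  have hd' : ∀ h, (0 : ℝ) < d h := fun h => by exact_mod_cast hd h
  rw [← aeval_sysHom k (movedPoint b L)]
  have h1 := gnorm_aeval_le v hρ
    (fun hj : Fin m × Fin n => sysMap k (movedPoint b L hj.1) hj.2) (sysHom k P)
    (fun hj => (q + 1) * Real.exp (β hj.2 * H hj.1)) ?_
    ((q + 1) ^ (∑ h, d h) * Real.exp (D * (m / n * ∑ j, β j + n * κ * ε * m + κ * δ * m))) ?_
  · have h2 := (coeff_mul_weight_le_gnorm v hρ _ e).trans h1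
    have h3 : (e.prod fun h k => ρ h ^ k) = Real.exp (-(κ * ∑ h, H h * e (Sum.inr h))) := by
      rw [Finsupp.prod_fintype _ _ fun _ => pow_zero _, Fintype.prod_sum_type]
      simp only [ρ, Sum.elim_inl, Sum.elim_inr, one_pow, Finset.prod_const_one, one_mul]
      simp only [← Real.exp_nat_mul]
      rw [← Real.exp_sum, Finset.mul_sum, ← Finset.sum_neg_distrib]
      congr 1
      exact Finset.sum_congr rfl fun h _ => by ring
    have h4 : ∑ h, H h * e (Sum.inr h) ≤ (1 + δ) * D * θ := by
      refine le_trans ?_ (mul_le_mul_of_nonneg_left he (by positivity))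
      rw [Finset.mul_sum]
      refine Finset.sum_le_sum fun h _ => ?_
      have h5 : H h * e (Sum.inr h) = d h * H h * (1 / d h * e (Sum.inr h)) := by
        field_simp [(hd' h).ne']
      rw [h5]
      exact mul_le_mul_of_nonneg_right (hT' h) (by positivity)
    rw [h3, Real.exp_neg, ← div_eq_mul_inv, div_le_iff₀ (Real.exp_pos _)] at h2
    refine h2.trans (mul_le_mul_of_nonneg_left (Real.exp_le_exp.2
      (mul_le_mul_of_nonneg_left h4 hκ)) ?_)
    have := l1norm_nonneg (sysHom k P)
    positivity
  · rintro ⟨h, j⟩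
    dsimp only
    rw [sysMap_movedPoint]
    refine (gnorm_add_le v hρ _ _).trans ?_
    rw [add_mul, one_mul]
    refine add_le_add ?_ ?_
    · refine (gnorm_sum_le v hρ _ _).trans ((Finset.sum_le_card_nsmul _ _
        (Real.exp (β j * H h)) fun s _ => ?_).trans (le_of_eq (by simp)))
      refine (gnorm_mul_le v hρ _ _).trans ?_
      rw [gnorm_C, gnorm_X]
      simpa [ρ] using hL h s j
    · refine (gnorm_mul_le v hρ _ _).trans ?_
      rw [gnorm_C, gnorm_X]
      refine (mul_le_mul_of_nonneg_right (abs_sysMap_single_le v k b j) (hρ _)).trans ?_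
      rw [one_mul]
      refine Real.exp_le_exp.2 ?_
      have := mul_le_mul_of_nonneg_right (abs_le.1 (hβ j)).1 (hH h)
      linarith
  · intro f hf
    obtain ⟨hf1, hf2⟩ := hP f hf
    simp only [mul_pow, ← Real.exp_nat_mul]
    rw [Finset.prod_mul_distrib, Finset.prod_pow_eq_pow_sum, ← Real.exp_sum,
      Fintype.sum_prod_type, Fintype.sum_prod_type, Finset.sum_congr rfl fun h _ => hf1 h]
    refine mul_le_mul_of_nonneg_left (Real.exp_le_exp.2 ?_) (by positivity)
    refine le_trans (le_of_eq ?_) (sum_exponent_le β hβ (fun h j => (f (h, j) / d h : ℝ))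
      (fun h j => by positivity) ?_ hf2 (fun h => d h * H h) hT hT' hD)
    · refine Finset.sum_congr rfl fun h _ => Finset.sum_congr rfl fun j _ => ?_
      field_simp [(hd' h).ne']
    · intro h
      rw [← Finset.sum_div, div_eq_one_iff_eq (hd' h).ne']
      exact_mod_cast hf1 h

theorem coeff_aeval_movedPoint_le_of_isNonarchimedean {v : AbsoluteValue K ℝ}
    (hv : IsNonarchimedean v) (b : Fin n)
    (L : Fin m → Fin q → Fin n → K) (μ : Fin m → ℝ) (hμ : ∀ h, 0 ≤ μ h)
    (hL : ∀ h s j, v (L h s j) ≤ Real.exp (μ h))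
    (P : MvPolynomial (Fin m × Fin n) ℤ) (d : Fin m → ℕ)
    (hP : ∀ e, coeff e P ≠ 0 → (∀ h, ∑ j, e (h, j) = d h))
    (e : Fin m × Fin q ⊕ Fin m →₀ ℕ) :
    v (coeff e (aeval (fun hj : Fin m × Fin n => movedPoint b L hj.1 hj.2) P)) ≤
      Real.exp (∑ h, d h * μ h) := by
  refine coeffLE_aeval hv _ P (fun hj => Real.exp (μ hj.1)) (fun _ => (Real.exp_pos _).le) ?_ _
    (Real.exp_pos _).le ?_ e
  · rintro ⟨h, j⟩
    have hone : 1 ≤ Real.exp (μ h) := Real.one_le_exp (hμ h)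
    have hX : ∀ i, CoeffLE v (X i : MvPolynomial (Fin m × Fin q ⊕ Fin m) K) 1 := fun i =>
      coeffLE_X v i le_rfl
    have h1 : CoeffLE v (∑ s, C (L h s j) * X (Sum.inl (h, s)) :
        MvPolynomial (Fin m × Fin q ⊕ Fin m) K) (Real.exp (μ h)) := by
      refine CoeffLE.sum hv _ (Real.exp_pos _).le fun s _ => ?_
      simpa using (coeffLE_C v (hL h s j)).mul hv (Real.exp_pos _).le zero_le_one (hX _)
    have h2 : CoeffLE v (C ((Pi.single b 1 : Fin n → K) j) * X (Sum.inr h) :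
        MvPolynomial (Fin m × Fin q ⊕ Fin m) K) (Real.exp (μ h)) := by
      have h3 : v ((Pi.single b 1 : Fin n → K) j) ≤ Real.exp (μ h) :=
        (abs_sysMap_single_le (K := K) v none b j).trans hone
      simpa using (coeffLE_C v h3).mul hv (Real.exp_pos _).le zero_le_one (hX _)
    intro f
    rw [movedPoint, coeff_add]
    exact (hv _ _).trans (max_le (h1 f) (h2 f))
  · intro f hf
    simp only [← Real.exp_nat_mul]
    rw [← Real.exp_sum, Fintype.sum_prod_type]
    refine Real.exp_le_exp.2 (le_of_eq (Finset.sum_congr rfl fun h _ => ?_))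
    dsimp only
    rw [← Finset.sum_mul, ← hP f hf h]
    push_cast
    rfl

end LocalBounds

section ProductFormula

variable {K : Type*} [Field K] [NumberField K]

theorem nonneg_of_logAbs_le {c : K} (hc : c ≠ 0) (S : Finset (AllPlaces K)) (A : ℝ)
    (hA : ∑ v ∈ S, logAbs v c ≤ A) (M : AllPlaces K → ℝ) (hM0 : ∀ v, 0 ≤ M v)
    (hMfin : M.support.Finite) (hM : ∀ v ∉ S, logAbs v c ≤ M v) : 0 ≤ A + ∑ᶠ v, M v := by
  classical
  have hfin := finite_logAbs_ne_zero hc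
  let T : Finset (AllPlaces K) := S ∪ (hfin.toFinset ∪ hMfin.toFinset)
  have h1 : ∑ v ∈ T, logAbs v c = 0 := by
    rw [← finsum_logAbs hc, finsum_eq_sum_of_support_subset]
    intro v hv
    simpa [T] using Or.inr (Or.inl hv)
  have h2 : ∑ᶠ v, M v = ∑ v ∈ T, M v := by
    rw [finsum_eq_sum_of_support_subset]
    intro v hv
    simpa [T] using Or.inr (Or.inr hv)
  have hST : S ⊆ T := Finset.subset_union_left
  rw [← Finset.sum_sdiff hST] at h1
  have h3 : ∑ v ∈ T \ S, logAbs v c ≤ ∑ v ∈ T \ S, M v :=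
    Finset.sum_le_sum fun v hv => hM v (Finset.mem_sdiff.1 hv).2
  have h4 : ∑ v ∈ T \ S, M v ≤ ∑ v ∈ T, M v :=
    Finset.sum_le_sum_of_subset_of_nonneg Finset.sdiff_subset fun v _ _ => hM0 v
  linarith

end ProductFormula

section Contraction

variable {m n q : ℕ} {K : Type*} [Field K]

theorem exists_ordGE_of_ordGE_movedPoint (a b : Fin n) (hab : a ≠ b)
    (P : MvPolynomial (Fin m × Fin n) ℤ) (hP : P ≠ 0) (d : Fin m → ℕ)
    (hd : ∀ e, coeff e P ≠ 0 → ∀ h, ∑ j, e (h, j) = d h) (y : Fin m → Fin n → K)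
    (L : Fin m → Fin q → Fin n → K) (hy : ∀ h j, y h j ≠ 0)
    (hspan : ∀ h x, ∑ j, y h j * x j = 0 → x ∈ Submodule.span K (Set.range (L h))) {θ : ℝ}
    (hQ : OrdGE (Sum.elim (fun _ => 0) fun h => 1 / (d h : ℝ))
      (aeval (fun hj : Fin m × Fin n => movedPoint b L hj.1 hj.2) P) θ) :
    ∃ p : MvPolynomial (Fin m) ℤ, p ≠ 0 ∧ l1norm p ≤ l1norm P ∧ (∀ h, degreeOf h p ≤ d h) ∧
      OrdGE (fun h => 1 / (d h : ℝ))
        (shift (fun h => -(y h a / y h b)) (map (Int.castRingHom K) p)) θ := by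
  classical
  have hc : ∀ h o, ∃ c : Fin q → K, ∑ s, c s • L h s =
      Pi.single o 1 - (y h o / y h b) • (Pi.single b 1 : Fin n → K) := by
    intro h o
    refine (Submodule.mem_span_range_iff_exists_fun K).1 (hspan h _ ?_)
    simp only [Pi.sub_apply, Pi.smul_apply, smul_eq_mul, mul_sub, Finset.sum_sub_distrib]
    simp [Pi.single_apply, mul_div_cancel₀ _ (hy h b)]
  choose c hc using hc
  let W : Fin m → Fin n → MvPolynomial (Fin m × Fin n) (MvPolynomial (Fin m) K) :=
    fun h o => if o = a then 1 else if o = b then 0 else X (h, o)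
  let U : Fin m → MvPolynomial (Fin m × Fin n) (MvPolynomial (Fin m) K) :=
    fun h => C (X h) - ∑ o, C (C (y h o / y h b)) * W h o
  let Z : Fin m × Fin q ⊕ Fin m → MvPolynomial (Fin m × Fin n) (MvPolynomial (Fin m) K) :=
    Sum.elim (fun hs => ∑ o, C (C (c hs.1 o hs.2)) * W hs.1 o) fun h => C (X h)
  have hW : ∀ h o, coeff 0 (W h o) = if o = a then 1 else 0 := by
    intro h o
    by_cases h1 : o = a
    · simp [W, h1]
    · by_cases h2 : o = b <;> simp [W, h1, h2, hab.symm]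
  have hU : ∀ h, coeff 0 (U h) = X h + C (-(y h a / y h b)) := by
    intro h
    simp only [U, coeff_sub, coeff_sum, coeff_C_mul, hW, coeff_zero_C]
    simp [sub_eq_add_neg]
  obtain ⟨μ, p, hp0, hpl, hpd, hpμ⟩ := exists_contraction a b hab P hP d hd _ U hU
  refine ⟨p, hp0, hpl, hpd, ?_⟩
  rw [← hpμ]
  have hw : ∀ h, (0 : ℝ) ≤ (fun h => 1 / (d h : ℝ)) h := fun h => by positivity
  have hZ : ∀ i, AllOrdGE (fun h => 1 / (d h : ℝ)) (Z i)
      (Sum.elim (fun _ => 0) (fun h => 1 / (d h : ℝ)) i) := by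
    rintro (i | h)
    · exact allOrdGE_zero hw _
    · intro ν e he
      simp only [Z, Sum.elim_inr, coeff_C] at he
      split_ifs at he with h0
      · rw [coeff_X] at he
        split_ifs at he with h1
        · rw [← h1]
          simp [Finsupp.single_apply]
        · exact (he rfl).elim
      · exact (he (coeff_zero _)).elim
  have himg : aeval Z (aeval (fun hj : Fin m × Fin n => movedPoint b L hj.1 hj.2) P) =
      aeval (fun hj : Fin m × Fin n =>
        if hj.2 = a then 1 else if hj.2 = b then U hj.1 else X hj) P := by
    have h1 := comp_aeval_apply (fun hj : Fin m × Fin n => movedPoint b L hj.1 hj.2)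
      ((aeval Z : MvPolynomial _ K →ₐ[K] _).restrictScalars ℤ) P
    refine Eq.trans h1 ?_
    congr 2
    funext hj
    obtain ⟨h, j⟩ := hj
    change aeval Z (movedPoint b L h j) = _
    have h2 : ∀ o, (∑ s, L h s j * c h o s) =
        (Pi.single o 1 : Fin n → K) j - y h o / y h b * (Pi.single b 1 : Fin n → K) j := by
      intro o
      have := congrFun (hc h o) j
      simp only [Finset.sum_apply, Pi.smul_apply, smul_eq_mul, Pi.sub_apply] at this
      rw [← this]
      exact Finset.sum_congr rfl fun s _ => mul_comm _ _
    have h3 : ∑ s, C (C (L h s j)) * ∑ o, C (C (c h o s)) * W h o =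
        ∑ o, C (C ((Pi.single o 1 : Fin n → K) j -
          y h o / y h b * (Pi.single b 1 : Fin n → K) j)) * W h o := by
      simp only [Finset.mul_sum]
      rw [Finset.sum_comm]
      refine Finset.sum_congr rfl fun o _ => ?_
      rw [← h2 o, map_sum, map_sum, Finset.sum_mul]
      refine Finset.sum_congr rfl fun s _ => ?_
      rw [map_mul, map_mul]
      ring
    have hC : ∀ x : K, aeval Z (C x) = C (C x) := fun x => by
      rw [algHom_C]
      rfl
    simp only [movedPoint, map_add, map_sum, map_mul, aeval_X, hC]
    simp only [Z, Sum.elim_inl, Sum.elim_inr]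
    rw [h3]
    have h4 : ∑ o, C (C ((Pi.single o 1 : Fin n → K) j)) * W h o = W h j := by
      rw [Finset.sum_eq_single j]
      · simp
      · intro o _ ho
        simp [Pi.single_eq_of_ne ho.symm]
      · simp
    simp only [map_sub, sub_mul, Finset.sum_sub_distrib]
    rw [h4]
    by_cases hjb : j = b
    · subst hjb
      simp [U, W, hab.symm, sub_eq_neg_add]
    · simp [W, hjb]
  rw [← himg]
  exact hQ.allOrdGE_aeval hw Z hZ μ

end Contraction

section GoodPoints

variable {n q : ℕ} {K : Type*} [Field K] [NumberField K]

/-- A point of large height whose orthogonal space is spanned by small vectors. -/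
structure GoodPoint (S : Finset (AllPlaces K)) (k : AllPlaces K → Option (Fin n))
    (β : AllPlaces K → Fin n → ℝ) (η' : ℝ) (a b : Fin n) (δ H : ℝ) (y : Fin n → K)
    (L : Fin q → Fin n → K) : Prop where
  ne_zero : ∀ j, y j ≠ 0
  span : ∀ x, ∑ j, y j * x j = 0 → x ∈ Submodule.span K (Set.range L)
  abs_le : ∀ v ∈ S, ∀ s j, placeAbs v (sysMap (k v) (L s) j) ≤ Real.exp (β v j * H)
  abs_le_outside : ∃ μ : AllPlaces K → ℝ, (∀ v, 0 ≤ μ v) ∧ μ.support.Finite ∧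
    ∑ᶠ v, μ v ≤ δ * H ∧ ∀ v ∉ S, ∀ s j, placeAbs v (L s j) ≤ Real.exp (μ v)
  height : η' * H ≤ logHeight₁ (y a / y b)

variable {S : Finset (AllPlaces K)} {k : AllPlaces K → Option (Fin n)}
  {β : AllPlaces K → Fin n → ℝ} {η' : ℝ} {a b : Fin n} {δ : ℝ}

theorem GoodPoint.ordGE_movedPoint {m : ℕ} (hS : ∀ v : InfinitePlace K, Sum.inl v ∈ S)
    {κ ε D θ η σ A : ℝ} (hδ : 0 ≤ δ) (hβ : ∀ v j, |β v j| ≤ κ) (hκ : 0 ≤ κ) (hε : 0 ≤ ε)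
    (hη : ∑ v ∈ S, (placeMult v : ℝ) * ∑ j, β v j ≤ -η)
    (hσ : ∑ v ∈ S, (placeMult v : ℝ) ≤ σ)
    (H : Fin m → ℝ) (hH : ∀ h, 0 ≤ H h) (y : Fin m → Fin n → K) (L : Fin m → Fin q → Fin n → K)
    (hgood : ∀ h, GoodPoint S k β η' a b δ (H h) (y h) (L h))
    (P : MvPolynomial (Fin m × Fin n) ℤ) (d : Fin m → ℕ) (hd : ∀ h, 0 < d h)
    (hP : ∀ k e, coeff e (sysHom k P) ≠ 0 → (∀ h, ∑ j, e (h, j) = d h) ∧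
        ∀ j, |∑ h, (e (h, j) / d h : ℝ) - m / n| ≤ ε * m)
    (hA0 : 0 ≤ A) (hA : ∀ k, l1norm (sysHom k P) ≤ Real.exp A)
    (hD : 0 ≤ D) (hT : ∀ h, D ≤ d h * H h) (hT' : ∀ h, d h * H h ≤ (1 + δ) * D) (hθ : 0 ≤ θ)
    (hneg : σ * (A + (∑ h, d h : ℕ) * Real.log (q + 1)) + D * (m / n * -η +
      σ * (n * κ * ε * m + κ * δ * m)) + σ * (κ * ((1 + δ) * D * θ)) + m * (δ * ((1 + δ) * D)) < 0) :
    OrdGE (Sum.elim (fun _ => 0) fun h => 1 / (d h : ℝ))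
      (aeval (fun hj : Fin m × Fin n => movedPoint b L hj.1 hj.2) P) θ := by
  intro e he
  by_contra hcon
  rw [Fintype.sum_sum_type] at hcon
  simp only [Sum.elim_inl, Sum.elim_inr, zero_mul, Finset.sum_const_zero, zero_add,
    not_le] at hcon
  choose μ hμ0 hμfin hμsum hμ using fun h => (hgood h).abs_le_outside
  set c := coeff e (aeval (fun hj : Fin m × Fin n => movedPoint b L hj.1 hj.2) P) with hc
  have hq : (0 : ℝ) < q + 1 := by positivity
  have hlogq : 0 ≤ Real.log ((q : ℝ) + 1) := Real.log_nonneg (by simp)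
  set X : ℝ := (A + (∑ h, d h : ℕ) * Real.log (q + 1)) +
    D * (n * κ * ε * m + κ * δ * m) + κ * ((1 + δ) * D * θ) with hX
  have hX0 : 0 ≤ X := by positivity
  have hin : ∀ v ∈ S, logAbs v c ≤ placeMult v * X + D * (m / n) *
      (placeMult v * ∑ j, β v j) := by
    intro v hv
    have h1 := coeff_aeval_movedPoint_le (placeAbs v) (k v) b L hδ (β v) (hβ v) H hH
      (fun h => (hgood h).abs_le v hv) P d hd (hP (k v)) hD hT hT' hκ e hcon.le
    have h2 : placeAbs v c ≤ Real.exp (X + D * (m / n) * ∑ j, β v j) := by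
      refine h1.trans ?_
      have h3 : ((q : ℝ) + 1) ^ (∑ h, d h) =
          Real.exp ((∑ h, d h : ℕ) * Real.log (q + 1)) := by
        rw [Real.exp_nat_mul, Real.exp_log hq]
      rw [h3]
      refine (mul_le_mul_of_nonneg_right (mul_le_mul_of_nonneg_right (hA (k v))
        (by positivity)) (by positivity)).trans (le_of_eq ?_)
      rw [← Real.exp_add, ← Real.exp_add, ← Real.exp_add, hX]
      congr 1
      ring
    have h4 : Real.log (placeAbs v c) ≤ X + D * (m / n) * ∑ j, β v j := by
      rw [← Real.log_exp (X + D * (m / n) * ∑ j, β v j)]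
      exact Real.log_le_log (placeAbs_pos v he) h2
    rw [logAbs]
    refine (mul_le_mul_of_nonneg_left h4 (Nat.cast_nonneg _)).trans (le_of_eq ?_)
    ring
  have hinsum : ∑ v ∈ S, logAbs v c ≤ σ * X + D * (m / n) * -η := by
    refine (Finset.sum_le_sum hin).trans ?_
    rw [Finset.sum_add_distrib, ← Finset.sum_mul, ← Finset.mul_sum]
    exact add_le_add (mul_le_mul_of_nonneg_right hσ hX0)
      (mul_le_mul_of_nonneg_left hη (by positivity))
  have hout : ∀ v ∉ S, logAbs v c ≤ ∑ h, d h * μ h v := by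
    rintro (v | v) hv
    · exact (hv (hS v)).elim
    · have h1 := coeff_aeval_movedPoint_le_of_isNonarchimedean (placeAbs_isNonarchimedean v) b L
        (fun h => μ h (Sum.inr v)) (fun h => hμ0 h _) (fun h s j => hμ h _ hv s j) P d
        (fun e he h => (hP none e (by simpa [sysHom, sysMap] using he)).1 h) e
      rw [logAbs, ← Real.log_exp (∑ h, d h * μ h (Sum.inr v))]
      simp only [placeMult, Nat.cast_one, one_mul]
      exact Real.log_le_log (placeAbs_pos _ he) h1
  have hfin : ∀ h, (Function.support fun v => (d h : ℝ) * μ h v).Finite := fun h =>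
    (hμfin h).subset fun v hv h0 => hv (by simp [h0])
  have hfsum : ∑ᶠ v, ∑ h, (d h : ℝ) * μ h v ≤ m * (δ * ((1 + δ) * D)) := by
    rw [finsum_sum_comm _ _ fun h _ => hfin h]
    refine (Finset.sum_le_card_nsmul _ _ (δ * ((1 + δ) * D)) fun h _ => ?_).trans
      (le_of_eq (by simp))
    rw [← mul_finsum]
    refine (mul_le_mul_of_nonneg_left (hμsum h) (Nat.cast_nonneg _)).trans ?_
    have := mul_le_mul_of_nonneg_left (hT' h) hδ
    linarith
  have hfinal := nonneg_of_logAbs_le he S _ hinsum (fun v => ∑ h, d h * μ h v)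
    (fun v => Finset.sum_nonneg fun h _ => mul_nonneg (Nat.cast_nonneg _) (hμ0 h v)) ?_ hout
  · rw [hX] at hfinal
    linarith
  · refine (Set.finite_iUnion hfin).subset fun v hv => ?_
    by_contra hcon'
    simp only [Set.mem_iUnion, Function.mem_support, not_exists, not_not] at hcon'
    exact hv (Finset.sum_eq_zero fun h _ => hcon' h)

end GoodPoints

section GoodPoints

variable {n q : ℕ} {K : Type*} [Field K] [NumberField K]

theorem exists_seq_of_unbounded (p : ℝ → Prop) (h : ∀ x, ∃ y, x < y ∧ p y) (m : ℕ) {W B : ℝ}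
    (hB : 0 ≤ B) :
    ∃ f : Fin m → ℝ, (∀ i, B ≤ f i ∧ p (f i)) ∧ ∀ i j, i < j → W * f j ≤ f i := by
  choose g hg hp using h
  set f : ℕ → ℝ := fun k => Nat.rec (g B) (fun _ x => g (max W 1 * x)) k with hf
  have hsucc : ∀ k, f (k + 1) = g (max W 1 * f k) := fun k => rfl
  have hfB : ∀ k, B ≤ f k := by
    intro k
    induction k with
    | zero => exact (hg B).le
    | succ k ih =>
      rw [hsucc]
      refine le_trans ?_ (hg _).le
      nlinarith [le_max_right W 1]
  have hstep : ∀ k, max W 1 * f k ≤ f (k + 1) := fun k => by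
    rw [hsucc]; exact (hg _).le
  have hmono : Monotone f := monotone_nat_of_le_succ fun k => by
    have := hstep k
    nlinarith [le_max_right W 1, hfB k]
  have hpf : ∀ k, p (f k) := by
    rintro (_ | k)
    · exact hp _
    · rw [hsucc]; exact hp _
  refine ⟨fun i => f (m - 1 - i), fun i => ⟨hfB _, hpf _⟩, fun i j hij => ?_⟩
  have h1 : m - 1 - (j : ℕ) + 1 ≤ m - 1 - (i : ℕ) := by
    have := i.2; have := j.2; have : (i : ℕ) < j := hij; omega
  refine le_trans ?_ ((hstep _).trans (hmono h1))
  exact mul_le_mul_of_nonneg_right (le_max_left _ _) (hB.trans (hfB _))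

set_option maxHeartbeats 600000 in
theorem GoodPoint.exists_bound (hn : 0 < n) {S : Finset (AllPlaces K)}
    (hS : ∀ v : InfinitePlace K, Sum.inl v ∈ S) (k : AllPlaces K → Option (Fin n))
    {β : AllPlaces K → Fin n → ℝ} {η' η κ : ℝ} {a b : Fin n} (hab : a ≠ b)
    (hη' : 0 < η') (hη0 : 0 < η) (hβ : ∀ v j, |β v j| ≤ κ)
    (hη : ∑ v ∈ S, (placeMult v : ℝ) * ∑ j, β v j ≤ -η) :
    ∃ δ : ℝ, 0 < δ ∧ ∃ H₀ : ℝ, ∀ H (y : Fin n → K) (L : Fin q → Fin n → K),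
      GoodPoint S k β η' a b δ H y L → H ≤ H₀ := by
  set κ' := max κ 1 with hκ'
  have hκ1 : 1 ≤ κ' := le_max_right _ _
  have hβ' : ∀ v j, |β v j| ≤ κ' := fun v j => (hβ v j).trans (le_max_left _ _)
  set σ := max (∑ v ∈ S, (placeMult v : ℝ)) 1 with hσ
  have hσ1 : 1 ≤ σ := le_max_right _ _
  have hn' : (0 : ℝ) < n := Nat.cast_pos.2 hn
  set ε := η / (4 * n ^ 2 * σ * κ') with hε
  have hε0 : 0 < ε := by positivity
  obtain ⟨m, hm⟩ := exists_nat_ge (2 * n * (n + 1) / ε ^ 2 : ℝ)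
  have hm' : (2 * n * (n + 1) : ℝ) ≤ ε ^ 2 * m := by
    rw [div_le_iff₀ (by positivity)] at hm
    linarith
  have hm0 : (0 : ℝ) < m := lt_of_lt_of_le (by positivity) hm
  set θ := m * η / (8 * n * σ * κ') with hθ
  have hθ0 : 0 < θ := by positivity
  obtain ⟨A, ω, hA, hω, hroth⟩ := roth_lemma (K := K) m θ hθ0
  set c : ℝ := (2 * n + 2) * Real.log 2 with hc
  have hc0 : 0 < c := mul_pos (by positivity) (Real.log_pos one_lt_two)
  have hlq : 0 ≤ Real.log ((q : ℝ) + 1) := Real.log_nonneg (by simp)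
  set X := 2 * σ * (c + Real.log (q + 1)) + σ * κ' + 2 with hX
  have hX0 : 0 < X := by positivity
  set Y := A * (1 + c) * 2 * m with hY
  have hY0 : 0 < Y := by positivity
  set δ := min 1 (min (η / (4 * n) / X) (η' / Y)) with hδ
  have hδ0 : 0 < δ := by positivity
  have hδ1 : δ ≤ 1 := min_le_left _ _
  have hδX : δ * X ≤ η / (4 * n) := by
    rw [← le_div_iff₀ hX0]
    exact (min_le_right _ _).trans (min_le_left _ _)
  have hδY : δ * Y ≤ η' := by
    rw [← le_div_iff₀ hY0]
    exact (min_le_right _ _).trans (min_le_right _ _)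
  refine ⟨δ, hδ0, ?_⟩
  by_contra! hcon
  obtain ⟨H, hH, hHW⟩ := exists_seq_of_unbounded
    (fun H => ∃ (y : Fin n → K) (L : Fin q → Fin n → K), GoodPoint S k β η' a b δ H y L)
    (fun x => by obtain ⟨H, y, L, h1, h2⟩ := hcon x; exact ⟨H, h2, y, L, h1⟩) m
    (W := 2 / ω) (B := 1 / δ) (by positivity)
  have hHδ : ∀ h, 1 / δ ≤ H h := fun h => (hH h).1
  have hH0 : ∀ h, 0 < H h := fun h => lt_of_lt_of_le (by positivity) (hHδ h)
  choose y L hgood using fun h => (hH h).2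
  set D : ℝ := 1 + ∑ h, H h / δ with hD
  have hHd : ∀ h, 0 ≤ H h / δ := fun h => div_nonneg (hH0 h).le hδ0.le
  have hD0 : 0 < D := by
    have := Finset.sum_nonneg fun h (_ : h ∈ Finset.univ) => hHd h
    linarith
  have hDH : ∀ h, H h ≤ δ * D := by
    intro h
    have h1 := Finset.single_le_sum (fun h _ => hHd h) (Finset.mem_univ h)
    rw [← div_le_iff₀' hδ0]
    linarith
  set d : Fin m → ℕ := fun h => ⌈D / H h⌉₊ with hd
  have hdpos : ∀ h, 0 < d h := fun h => Nat.ceil_pos.2 (div_pos hD0 (hH0 h))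
  have hT : ∀ h, D ≤ d h * H h := fun h => by
    rw [← div_le_iff₀ (hH0 h)]; exact Nat.le_ceil _
  have hT' : ∀ h, d h * H h ≤ (1 + δ) * D := fun h => by
    have h1 : (d h : ℝ) < D / H h + 1 := Nat.ceil_lt_add_one (div_pos hD0 (hH0 h)).le
    have h2 : (d h : ℝ) * H h ≤ (D / H h + 1) * H h :=
      mul_le_mul_of_nonneg_right h1.le (hH0 h).le
    rw [add_mul, div_mul_cancel₀ _ (hH0 h).ne'] at h2
    linarith [hDH h]
  have hT2 : ∀ h, d h * H h ≤ 2 * D := fun h => (hT' h).trans (by nlinarith)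
  have hdle : ∀ h, (d h : ℝ) ≤ 2 * D * δ := fun h => by
    have h1 := hT2 h
    have h2 := hHδ h
    rw [div_le_iff₀ hδ0] at h2
    have h3 : (0 : ℝ) ≤ d h := Nat.cast_nonneg _
    nlinarith [mul_le_mul_of_nonneg_left h2 h3, mul_le_mul_of_nonneg_right h1 hδ0.le]
  have hsum : ((∑ h, d h : ℕ) : ℝ) ≤ m * (2 * D * δ) := by
    push_cast
    refine (Finset.sum_le_sum fun h _ => hdle h).trans ?_
    simp
  have hsum0 : (0 : ℝ) ≤ (∑ h, d h : ℕ) := Nat.cast_nonneg _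
  obtain ⟨P, hP0, hP⟩ := exists_auxiliary_polynomial (n := n) hn hε0 hm' d hdpos
  have hl1 : ∀ k, l1norm (sysHom k P) ≤ Real.exp (c * (∑ h, d h : ℕ)) := by
    intro k
    refine (hP k).2.trans (le_of_eq ?_)
    rw [hc, show (2 * (n : ℝ) + 2) * Real.log 2 * ((∑ h, d h : ℕ) : ℝ) =
      (((2 * n + 2) * ∑ h, d h : ℕ) : ℝ) * Real.log 2 by push_cast; ring, Real.exp_nat_mul,
      Real.exp_log two_pos]
  have hPnone : sysHom none P = P := by simp [sysHom, sysMap]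
  have hord := GoodPoint.ordGE_movedPoint hS hδ0.le hβ' (zero_le_one.trans hκ1) hε0.le hη
    (σ := σ) (le_max_left _ _) H (fun h => (hH0 h).le) y L hgood P d hdpos (fun k => (hP k).1)
    (A := c * (∑ h, d h : ℕ)) (by positivity) hl1 hD0.le hT hT' hθ0.le (by
      have e1 : σ * (c * (∑ h, d h : ℕ) + (∑ h, d h : ℕ) * Real.log (q + 1)) ≤
          m * D * (δ * (2 * σ * (c + Real.log (q + 1)))) := by
        calc σ * (c * (∑ h, d h : ℕ) + (∑ h, d h : ℕ) * Real.log (q + 1))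
            = σ * (c + Real.log (q + 1)) * (∑ h, d h : ℕ) := by ring
          _ ≤ σ * (c + Real.log (q + 1)) * (m * (2 * D * δ)) :=
              mul_le_mul_of_nonneg_left hsum (by positivity)
          _ = _ := by ring
      have e2 : σ * (n * κ' * ε * m) = m * (η / (4 * n)) := by
        rw [hε]; field_simp
      have e3 : σ * (κ' * ((1 + δ) * D * θ)) ≤ m * D * (η / (4 * n)) := by
        have : σ * (κ' * ((1 + δ) * D * θ)) = m * D * (η / (4 * n)) * ((1 + δ) / 2) := by
          rw [hθ]; field_simp; ring
        rw [this]
        exact mul_le_of_le_one_right (by positivity) (by linarith)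
      have e4 : m * (δ * ((1 + δ) * D)) ≤ m * D * (δ * 2) := by
        have : m * (δ * ((1 + δ) * D)) = m * D * (δ * (1 + δ)) := by ring
        rw [this]
        gcongr
        linarith
      have e5 : m * D * (δ * X) ≤ m * D * (η / (4 * n)) :=
        mul_le_mul_of_nonneg_left hδX (by positivity)
      have e6 : (m : ℝ) / n * -η = m * (-4 * (η / (4 * n))) := by field_simp
      rw [hX] at e5
      have e7 : 0 < m * D * (η / (4 * n)) := by positivity
      rw [mul_add σ (n * κ' * ε * m), e2, e6]
      linarith)
  obtain ⟨p, hp0, hpl, hpd, hpo⟩ := exists_ordGE_of_ordGE_movedPoint a b hab P hP0 d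
    (fun e he => ((hP none).1 e (by rwa [hPnone])).1) y L (fun h => (hgood h).ne_zero)
    (fun h => (hgood h).span) hord
  refine hroth p d _ hp0 hdpos hpd (fun i j hij => ?_) (fun h => ?_) hpo
  · have h1 := hHW i j hij
    rw [div_mul_eq_mul_div, div_le_iff₀ hω] at h1
    have h2 := hT2 i
    have h3 := hT j
    have h4 : (0 : ℝ) ≤ d i := Nat.cast_nonneg _
    have h5 : (0 : ℝ) ≤ d j := Nat.cast_nonneg _
    have h6 : (d i : ℝ) * (2 * H j) ≤ d i * (H i * ω) := mul_le_mul_of_nonneg_left h1 h4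
    have h7 : (d i : ℝ) * H j ≤ ω * d j * H j := by nlinarith
    exact le_of_mul_le_mul_right h7 (hH0 j)
  · have h1 : logHeight₁ (-(y h a / y h b)) = logHeight₁ (y h a / y h b) := by
      rw [logHeight₁_neg]
    rw [h1]
    have h2 : Real.log (l1norm p) ≤ c * (∑ h, d h : ℕ) := by
      have h3 := hl1 none
      rw [hPnone] at h3
      rw [← Real.log_exp (c * (∑ h, d h : ℕ))]
      exact Real.log_le_log (zero_lt_one.trans_le (one_le_l1norm hp0)) (hpl.trans h3)
    have h3 := (hgood h).height
    have h4 : (d h : ℝ) * (η' * H h) ≤ d h * logHeight₁ (y h a / y h b) :=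
      mul_le_mul_of_nonneg_left h3 (Nat.cast_nonneg _)
    refine le_trans ?_ h4
    calc A * (∑ h, (d h : ℝ) + Real.log (l1norm p)) ≤ A * ((1 + c) * (∑ h, d h : ℕ)) := by
          refine mul_le_mul_of_nonneg_left ?_ hA.le
          push_cast at h2 ⊢
          linarith
      _ ≤ A * ((1 + c) * (m * (2 * D * δ))) := by gcongr
      _ = δ * Y * D := by rw [hY]; ring
      _ ≤ η' * D := mul_le_mul_of_nonneg_right hδY hD0.le
      _ ≤ η' * (d h * H h) := mul_le_mul_of_nonneg_left (hT h) hη'.le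
      _ = _ := by ring

end GoodPoints

end

section DualFamily

theorem exists_dual_family (r : ℕ) : ∃ C : ℝ, 0 < C ∧ ∀ (E : Type*) [NormedAddCommGroup E]
    [NormedSpace ℝ E] [FiniteDimensional ℝ E], Module.finrank ℝ E = r →
    ∀ (Λ : AddSubgroup E) (l : ℝ), 0 < l → (∀ x ∈ Λ, x ≠ 0 → l ≤ ‖x‖) →
    ∃ b : Fin r → E, ∃ f : Fin r → (E →L[ℝ] ℝ), (∀ i, b i ∈ Λ) ∧
      (∀ x ∈ Λ, ∃ c : Fin r → ℤ, x = ∑ i, c i • b i ∧ ∀ i, f i x = c i) ∧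
      ∀ i x, |f i x| ≤ C / l * ‖x‖ := by
  induction r with
  | zero =>
    refine ⟨1, one_pos, fun E _ _ _ hE Λ l hl hΛ => ⟨Fin.elim0, Fin.elim0, fun i => i.elim0,
      fun x _ => ⟨Fin.elim0, ?_, fun i => i.elim0⟩, fun i => i.elim0⟩⟩
    have := Module.finrank_zero_iff.1 hE
    exact Subsingleton.elim _ _
  | succ r ih =>
    obtain ⟨C, hC, ih⟩ := ih
    refine ⟨max (6 * C) (1 + r * (1 / 2) * (6 * C)), by positivity,
      fun E _ _ _ hE Λ l hl hΛ => ?_⟩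
    set C' := max (6 * C) (1 + r * (1 / 2) * (6 * C)) with hC'
    by_cases hbot : ∀ x ∈ Λ, x = 0
    · refine ⟨0, 0, fun i => Λ.zero_mem, fun x hx => ⟨0, by simpa using hbot x hx, by simp⟩,
        fun i x => ?_⟩
      have : 0 < C' := by positivity
      simp only [Pi.zero_apply, zero_apply, abs_zero]
      positivity
    push Not at hbot
    obtain ⟨x₀, hx₀, hx₀0⟩ := hbot
    obtain ⟨b₀, hb₀, hb₀0, hmin⟩ : ∃ b₀ ∈ Λ, b₀ ≠ 0 ∧ ∀ x ∈ Λ, x ≠ 0 → 2 / 3 * ‖b₀‖ ≤ ‖x‖ := by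
      set T : Set ℝ := (fun x : E => ‖x‖) '' {x | x ∈ Λ ∧ x ≠ 0}
      have hT : T.Nonempty := ⟨_, x₀, ⟨hx₀, hx₀0⟩, rfl⟩
      have hbdd : BddBelow T := ⟨l, by rintro _ ⟨x, hx, rfl⟩; exact hΛ x hx.1 hx.2⟩
      have hlT : l ≤ sInf T := le_csInf hT (by rintro _ ⟨x, hx, rfl⟩; exact hΛ x hx.1 hx.2)
      obtain ⟨_, ⟨b, hb, rfl⟩, hlt⟩ := exists_lt_of_csInf_lt hT
        (show sInf T < 3 / 2 * sInf T by linarith)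
      refine ⟨b, hb.1, hb.2, fun x hx hx0 => ?_⟩
      have := csInf_le hbdd ⟨x, ⟨hx, hx0⟩, rfl⟩
      simp only at hlt this
      linarith
    have hb₀l := hΛ b₀ hb₀ hb₀0
    have hb₀n : 0 < ‖b₀‖ := norm_pos_iff.2 hb₀0
    set W : Submodule ℝ E := Submodule.span ℝ {b₀} with hW
    have : IsClosed (W : Set E) := Submodule.closed_of_finiteDimensional W
    have hfin : Module.finrank ℝ (E ⧸ W) = r := by
      have h1 := Submodule.finrank_quotient_add_finrank W
      rw [hE, finrank_span_singleton hb₀0] at h1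
      omega
    have hround : ∀ x ∈ Λ, ∀ t : ℝ, x + (round t : ℤ) • b₀ ≠ 0 → l / 6 ≤ ‖x + t • b₀‖ := by
      intro x hx t hne
      have h1 := hmin _ (Λ.add_mem hx (Λ.zsmul_mem hb₀ (round t))) hne
      have h2 : x + (round t : ℤ) • b₀ = (x + t • b₀) - (t - round t) • b₀ := by
        rw [sub_smul, Int.cast_smul_eq_zsmul]; abel
      have h3 : ‖(t - round t) • b₀‖ ≤ 1 / 2 * ‖b₀‖ := by
        rw [norm_smul]
        exact mul_le_mul_of_nonneg_right (abs_sub_round t) (norm_nonneg _)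
      have h4 := norm_sub_le (x + t • b₀) ((t - round t) • b₀)
      rw [← h2] at h4
      linarith
    have hker : ∀ x ∈ Λ, x ∈ W → ∃ k : ℤ, x = k • b₀ := by
      intro x hx hxW
      obtain ⟨t, rfl⟩ := Submodule.mem_span_singleton.1 hxW
      refine ⟨round t, ?_⟩
      by_contra hne
      have h1 := hmin _ (Λ.sub_mem hx (Λ.zsmul_mem hb₀ (round t))) (sub_ne_zero.2 hne)
      rw [← Int.cast_smul_eq_zsmul ℝ, ← sub_smul, norm_smul] at h1
      have h2 := mul_le_mul_of_nonneg_right (abs_sub_round t) (norm_nonneg b₀)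
      rw [Real.norm_eq_abs] at h1
      linarith
    set Λ' : AddSubgroup (E ⧸ W) := Λ.map W.mkQ.toAddMonoidHom with hΛ'
    have hΛ'min : ∀ x ∈ Λ', x ≠ 0 → l / 6 ≤ ‖x‖ := by
      rintro _ ⟨x, hx, rfl⟩ hne
      refine le_of_forall_pos_le_add fun ε hε => ?_
      obtain ⟨m, hm, hmn⟩ := Submodule.Quotient.norm_mk_lt (W.mkQ x) hε
      rw [Submodule.mkQ_apply, Submodule.Quotient.eq, hW, Submodule.mem_span_singleton] at hm
      obtain ⟨t, ht⟩ := hm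
      have h1 : m = x + t • b₀ := by rw [ht]; abel
      refine le_trans ?_ hmn.le
      rw [h1]
      refine hround x hx t fun h0 => hne ?_
      change W.mkQ x = 0
      rw [Submodule.mkQ_apply, Submodule.Quotient.mk_eq_zero, eq_neg_of_add_eq_zero_left h0]
      exact W.neg_mem (by
        rw [← Int.cast_smul_eq_zsmul ℝ]
        exact W.smul_mem _ (Submodule.mem_span_singleton_self _))
    obtain ⟨b', f', hb', hf', hbd⟩ := ih (E ⧸ W) hfin Λ' (l / 6) (by positivity) hΛ'min
    obtain ⟨g, hg1, hgb⟩ := exists_dual_vector ℝ b₀ hb₀n.ne'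
    set g' : E →L[ℝ] ℝ := ‖b₀‖⁻¹ • g with hg'
    have hg'b : g' b₀ = 1 := by
      rw [hg', smul_apply, hgb, smul_eq_mul]
      exact inv_mul_cancel₀ hb₀n.ne'
    have hg'n : ∀ x, |g' x| ≤ 1 / l * ‖x‖ := by
      intro x
      rw [hg', smul_apply, smul_eq_mul, abs_mul, abs_of_pos (inv_pos.2 hb₀n),
        ← one_div]
      refine mul_le_mul (one_div_le_one_div_of_le hl hb₀l) ?_ (abs_nonneg _) (by positivity)
      have := g.le_opNorm x
      rwa [hg1, one_mul] at this
    have hlift : ∀ i, ∃ b ∈ Λ, W.mkQ b = b' i ∧ |g' b| ≤ 1 / 2 := by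
      intro i
      obtain ⟨x, hx, hxb⟩ := hb' i
      refine ⟨x - round (g' x) • b₀, Λ.sub_mem hx (Λ.zsmul_mem hb₀ _), ?_, ?_⟩
      · rw [map_sub, ← Int.cast_smul_eq_zsmul ℝ, map_smul, Submodule.mkQ_apply W b₀,
          (Submodule.Quotient.mk_eq_zero W).2 (Submodule.mem_span_singleton_self _), smul_zero,
          sub_zero]
        exact hxb
      · rw [map_sub, map_zsmul, hg'b, zsmul_eq_mul, mul_one]
        exact abs_sub_round _
    choose b hbΛ hbq hbg using hlift
    set f : Fin r → (E →L[ℝ] ℝ) := fun i => (f' i).comp W.mkQL with hf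
    have hfapp : ∀ i x, f i x = f' i (W.mkQ x) := fun i x => rfl
    have hfn : ∀ i x, |f i x| ≤ 6 * C / l * ‖x‖ := by
      intro i x
      rw [hfapp]
      refine (hbd i _).trans ?_
      rw [div_div_eq_mul_div, mul_comm C 6]
      exact mul_le_mul_of_nonneg_left (Submodule.Quotient.norm_mk_le _ _) (by positivity)
    refine ⟨Fin.cons b₀ b, Fin.cons (g' - ∑ i, g' (b i) • f i) f, ?_, ?_, ?_⟩
    · intro i
      refine Fin.cases hb₀ (fun i => ?_) i
      simpa using hbΛ i
    · intro x hx
      obtain ⟨c, hc, hcf⟩ := hf' (W.mkQ x) ⟨x, hx, rfl⟩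
      obtain ⟨k, hk⟩ := hker (x - ∑ i, c i • b i)
        (Λ.sub_mem hx (Λ.sum_mem fun i _ => Λ.zsmul_mem (hbΛ i) _)) (by
          rw [← Submodule.Quotient.mk_eq_zero, ← Submodule.mkQ_apply, map_sub, map_sum, hc,
            sub_eq_zero]
          exact Finset.sum_congr rfl fun i _ => by rw [map_zsmul, hbq])
      refine ⟨Fin.cons k c, ?_, ?_⟩
      · rw [Fin.sum_univ_succ]
        simp only [Fin.cons_zero, Fin.cons_succ]
        rw [← hk]; abel
      · intro i
        refine Fin.cases ?_ (fun i => ?_) i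
        · have h1 := congrArg g' hk
          rw [map_sub, map_sum, map_zsmul, hg'b, zsmul_eq_mul, mul_one] at h1
          simp only [Fin.cons_zero, sub_apply, sum_apply,
            smul_apply, smul_eq_mul]
          rw [← h1]
          congr 1
          exact Finset.sum_congr rfl fun i _ => by
            rw [hfapp, hcf, map_zsmul, zsmul_eq_mul, mul_comm]
        · simpa [hfapp] using hcf i
    · intro i x
      refine Fin.cases ?_ (fun i => ?_) i
      · simp only [Fin.cons_zero, sub_apply, sum_apply,
          smul_apply, smul_eq_mul]
        have h1 : |∑ i, g' (b i) * f i x| ≤ ∑ i : Fin r, 1 / 2 * (6 * C / l * ‖x‖) := by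
          refine (Finset.abs_sum_le_sum_abs _ _).trans (Finset.sum_le_sum fun i _ => ?_)
          rw [abs_mul]
          exact mul_le_mul (hbg i) (hfn i x) (abs_nonneg _) (by norm_num)
        rw [Finset.sum_const, Finset.card_univ, Fintype.card_fin, nsmul_eq_mul] at h1
        have h2 := abs_sub (g' x) (∑ i, g' (b i) * f i x)
        refine h2.trans ((add_le_add (hg'n x) h1).trans ?_)
        have h3 : 1 / l * ‖x‖ + r * (1 / 2 * (6 * C / l * ‖x‖)) =
          (1 + r * (1 / 2) * (6 * C)) / l * ‖x‖ := by ring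
        rw [h3]
        gcongr
        exact le_max_right _ _
      · rw [Fin.cons_succ]
        refine (hfn i x).trans ?_
        gcongr
        exact le_max_left _ _

end DualFamily

section

open NumberField

section NumberFieldTools

variable {K : Type*} [Field K] [NumberField K]

theorem FinitePlace.apply_integer_le_one (v : FinitePlace K) (x : 𝓞 K) : v (x : K) ≤ 1 := by
  rw [← FinitePlace.norm_embedding_eq]
  exact FinitePlace.norm_le_one K _ x

theorem FinitePlace.apply_integer_lt_one_iff (v : FinitePlace K) (x : 𝓞 K) :
    v (x : K) < 1 ↔ x ∈ v.maximalIdeal.asIdeal := by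
  rw [← FinitePlace.norm_embedding_eq]
  exact FinitePlace.norm_lt_one_iff_mem K _ x

theorem exists_integer_of_forall_finitePlace_le_one {x : K} (h : ∀ v : FinitePlace K, v x ≤ 1) :
    ∃ a : 𝓞 K, (a : K) = x := by
  obtain ⟨a, ha⟩ := IsDedekindDomain.HeightOneSpectrum.mem_integers_of_valuation_le_one
    (R := 𝓞 K) K x (fun v => by
      have h1 := h (FinitePlace.mk v)
      rw [FinitePlace.mk_apply, FinitePlace.norm_embedding] at h1
      rw [NumberField.HeightOneSpectrum.adicAbv_def] at h1
      exact (WithZeroMulInt.toNNReal_le_one_iff (NumberField.HeightOneSpectrum.one_lt_absNorm_nnreal v)).1 (by exact_mod_cast h1))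
  exact ⟨a, ha⟩

theorem exists_integer_finitePlace_small (v : FinitePlace K) (T : Finset (FinitePlace K))
    (c : FinitePlace K → ℝ) (hc : ∀ u, 0 < c u) :
    ∃ a : 𝓞 K, v (a : K) = 1 ∧ ∀ u ∈ T, u ≠ v → u (a : K) ≤ c u := by
  classical
  obtain ⟨b, hb, hbv⟩ : ∃ b ∈ ∏ u ∈ T.erase v, u.maximalIdeal.asIdeal,
      b ∉ v.maximalIdeal.asIdeal := by
    by_contra! hcon
    obtain ⟨u, hu, hle⟩ := (Ideal.IsPrime.prod_le v.maximalIdeal.isPrime).1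
      (show ∏ u ∈ T.erase v, u.maximalIdeal.asIdeal ≤ v.maximalIdeal.asIdeal from hcon)
    have h1 : u.maximalIdeal.asIdeal = v.maximalIdeal.asIdeal :=
      (u.maximalIdeal.isMaximal).eq_of_le v.maximalIdeal.isPrime.ne_top hle
    exact (Finset.ne_of_mem_erase hu)
      (FinitePlace.maximalIdeal_injective (IsDedekindDomain.HeightOneSpectrum.ext h1))
  have hv1 : v (b : K) = 1 := le_antisymm (FinitePlace.apply_integer_le_one v b)
    (not_lt.1 fun h => hbv ((FinitePlace.apply_integer_lt_one_iff v b).1 h))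
  have hu1 : ∀ u ∈ T, u ≠ v → u (b : K) < 1 := fun u hu huv =>
    (FinitePlace.apply_integer_lt_one_iff u b).2
      (Ideal.prod_le_inf.trans (Finset.inf_le (Finset.mem_erase.2 ⟨huv, hu⟩)) hb)
  have hN : ∀ u ∈ T, ∃ N : ℕ, u ≠ v → ∀ M, N ≤ M → u (b : K) ^ M ≤ c u := by
    intro u hu
    by_cases huv : u = v
    · exact ⟨0, fun h => (h huv).elim⟩
    · obtain ⟨N, hN⟩ := exists_pow_lt_of_lt_one (hc u) (hu1 u hu huv)
      exact ⟨N, fun _ M hM => (pow_le_pow_of_le_one (apply_nonneg u _) (hu1 u hu huv).le hM).trans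
        hN.le⟩
  choose! N hN using hN
  refine ⟨b ^ T.sup N, ?_, fun u hu huv => ?_⟩
  · push_cast
    rw [map_pow, hv1, one_pow]
  · push_cast
    rw [map_pow]
    exact hN u hu huv _ (Finset.le_sup hu)

variable (K) in
theorem exists_linearMap_of_ratFunctional :
    ∃ C : ℝ, 0 < C ∧ ∀ (V : Type*) [AddCommGroup V] [Module K V] (q : V →+ ℚ),
      ∃ L : V →ₗ[K] K, (∀ x, L x = 0 → q x = 0) ∧
        (∀ x, (∀ α : 𝓞 K, ∃ m : ℤ, q ((α : K) • x) = m) → ∃ a : 𝓞 K, (a : K) = L x) ∧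
        ∀ x M, (∀ i, |(q (((RingOfIntegers.basis K i : 𝓞 K) : K) • x) : ℝ)| ≤ M) →
          ∀ v : InfinitePlace K, v (L x) ≤ C * M := by
  classical
  set ω := integralBasis K with hω
  set ω' := ω.traceDual with hω'
  obtain ⟨D, hD0, hD⟩ : ∃ D : ℤ, D ≠ 0 ∧ ∀ i, IsIntegral ℤ ((D : K) * ω' i) := by
    have h1 : ∀ i, ∃ D : ℤ, D ≠ 0 ∧ IsIntegral ℤ ((D : K) * ω' i) := by
      intro i
      obtain ⟨y, hy, hint⟩ := IsAlgebraic.exists_integral_multiple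
        ((IsFractionRing.isAlgebraic_iff ℤ ℚ K).2 (Algebra.IsAlgebraic.isAlgebraic (ω' i)))
      refine ⟨y, hy, ?_⟩
      simpa using hint
    choose D hD0 hD using h1
    refine ⟨∏ i, D i, Finset.prod_ne_zero_iff.2 fun i _ => hD0 i, fun i => ?_⟩
    rw [← Finset.mul_prod_erase Finset.univ D (Finset.mem_univ i)]
    push_cast
    rw [mul_right_comm]
    refine (hD i).mul (IsIntegral.prod _ fun j _ => isIntegral_algebraMap (x := D j))
  set C : ℝ := 1 + ∑ v : InfinitePlace K, ∑ i, v ((D : K) * ω' i) with hC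
  have hC0 : 0 < C := by
    have : 0 ≤ ∑ v : InfinitePlace K, ∑ i, v ((D : K) * ω' i) :=
      Finset.sum_nonneg fun v _ => Finset.sum_nonneg fun i _ => apply_nonneg v _
    linarith
  refine ⟨C, hC0, fun V _ _ q => ?_⟩
  set φ : V → Module.Dual ℚ K := fun x => AddMonoidHom.toRatLinearMap
    (q.comp ((AddMonoidHom.flip (AddMonoidHom.smul : K →+ V →+ V)) x)) with hφ
  have hφapp : ∀ x α, φ x α = q (α • x) := fun x α => rfl
  set B := Algebra.traceForm ℚ K with hB
  have hBn : B.Nondegenerate := traceForm_nondegenerate ℚ K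
  set e := B.toDual hBn with he
  have heapp : ∀ x y, e x y = B x y := fun x y => rfl
  have hsymm : ∀ x α, B (e.symm (φ x)) α = q (α • x) := fun x α => by
    rw [← heapp, LinearEquiv.apply_symm_apply, hφapp]
  let L₀ : V →ₗ[K] K :=
    { toFun := fun x => e.symm (φ x)
      map_add' := fun x y => by
        rw [← map_add]
        congr 1
        ext α
        simp [hφapp]
      map_smul' := fun c x => by
        apply e.injective
        ext α
        rw [LinearEquiv.apply_symm_apply, hφapp, heapp, RingHom.id_apply, smul_eq_mul, smul_smul,
          hB, Algebra.traceForm_apply, mul_assoc, mul_left_comm, ← Algebra.traceForm_apply, ← hB,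
          hsymm, mul_comm] }
  have hL₀ : ∀ x α, B (L₀ x) α = q (α • x) := hsymm
  have hexp : ∀ x, (D : K) * L₀ x = ∑ i, ((q (ω i • x) : ℚ) : K) * ((D : K) * ω' i) := by
    intro x
    conv_lhs => rw [← ω'.sum_repr (L₀ x)]
    rw [Finset.mul_sum]
    refine Finset.sum_congr rfl fun i _ => ?_
    rw [hω', Module.Basis.traceDual_repr_apply, ← hB, hL₀, Algebra.smul_def, eq_ratCast]
    ring
  have hωi : ∀ i, ω i = ((RingOfIntegers.basis K i : 𝓞 K) : K) := fun i => integralBasis_apply K i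
  refine ⟨(D : K) • L₀, fun x hx => ?_, fun x hx => ?_, fun x M hM v => ?_⟩
  · rw [LinearMap.smul_apply, smul_eq_mul, mul_eq_zero, Int.cast_eq_zero] at hx
    have h1 := hL₀ x 1
    rw [hx.resolve_left hD0, map_zero, LinearMap.zero_apply, one_smul] at h1
    exact h1.symm
  · refine ⟨⟨_, ?_⟩, rfl⟩
    change IsIntegral ℤ ((D : K) * L₀ x)
    rw [hexp]
    refine IsIntegral.sum _ fun i _ => IsIntegral.mul ?_ (hD i)
    obtain ⟨m, hm⟩ := hx (RingOfIntegers.basis K i)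
    rw [hωi, hm, Rat.cast_intCast]
    exact isIntegral_algebraMap (x := m)
  · rw [LinearMap.smul_apply, smul_eq_mul, hexp]
    have h1 : v (∑ i, ((q (ω i • x) : ℚ) : K) * ((D : K) * ω' i)) ≤
        ∑ i, M * v ((D : K) * ω' i) := by
      refine (AbsoluteValue.sum_le v.1 _ _).trans (Finset.sum_le_sum fun i _ => ?_)
      rw [map_mul]
      refine mul_le_mul_of_nonneg_right ?_ (apply_nonneg v.1 _)
      have h2 : v ((q (ω i • x) : ℚ) : K) = |((q (ω i • x) : ℚ) : ℝ)| := by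
        rw [← InfinitePlace.norm_embedding_eq, map_ratCast]
        simp
      change v _ ≤ M
      rw [h2, hωi]
      exact hM i
    have hM0 : 0 ≤ M := (abs_nonneg _).trans (hM (Classical.arbitrary _))
    refine h1.trans ?_
    rw [← Finset.mul_sum, mul_comm]
    refine mul_le_mul_of_nonneg_right ?_ hM0
    have h3 := Finset.single_le_sum (f := fun v : InfinitePlace K => ∑ i, v ((D : K) * ω' i))
      (fun v _ => Finset.sum_nonneg fun i _ => apply_nonneg v _) (Finset.mem_univ v)
    linarith

end NumberFieldTools

section MinimaFlag

variable {K V : Type*} [Field K] [AddCommGroup V] [Module K V] [FiniteDimensional K V]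

theorem exists_minima_flag (X : Submodule K V) (I : Set V)
    (hI : ∀ x ∈ X, ∃ c : K, c ≠ 0 ∧ c • x ∈ I) (N : V → ℝ) (hN : ∀ x ∈ I, x ≠ 0 → 1 ≤ N x) :
    ∃ (z : ℕ → V) (l : ℕ → ℝ) (W : ℕ → Submodule K V), W 0 = ⊥ ∧
      (∀ k, W k = Submodule.span K (z '' Set.Iio k)) ∧
      (∀ k < Module.finrank K X, z k ∈ I ∧ z k ∈ X ∧ z k ∉ W k ∧ N (z k) ≤ 2 * l k ∧ 1 ≤ l k ∧
        ∀ x ∈ I, x ∈ X → x ∉ W k → l k ≤ N x) ∧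
      (∀ i j, i ≤ j → j < Module.finrank K X → l i ≤ l j) ∧
      (∀ k ≤ Module.finrank K X, W k ≤ X ∧ Module.finrank K (W k) = k) := by
  classical
  set A : Submodule K V → Set V := fun W => {x | x ∈ I ∧ x ∈ X ∧ x ∉ W} with hA
  set l' : Submodule K V → ℝ := fun W => sInf (N '' A W) with hl'
  have hne0 : ∀ W, ∀ x ∈ A W, x ≠ 0 := fun W x hx h0 => hx.2.2 (h0 ▸ W.zero_mem)
  have hbdd : ∀ W, BddBelow (N '' A W) := fun W =>
    ⟨1, by rintro _ ⟨x, hx, rfl⟩; exact hN x hx.1 (hne0 W x hx)⟩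
  have hg : ∀ W : Submodule K V, ∃ x, (A W).Nonempty → x ∈ A W ∧ N x ≤ 2 * l' W := by
    intro W
    by_cases h : (A W).Nonempty
    · have h1 : 1 ≤ l' W := le_csInf (h.image N)
        (by rintro _ ⟨x, hx, rfl⟩; exact hN x hx.1 (hne0 W x hx))
      obtain ⟨_, ⟨x, hx, rfl⟩, hlt⟩ := exists_lt_of_csInf_lt (h.image N)
        (show l' W < 2 * l' W by linarith)
      exact ⟨x, fun _ => ⟨hx, hlt.le⟩⟩
    · exact ⟨0, fun h' => (h h').elim⟩
  choose g hg using hg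
  obtain ⟨W, hW0, hWs⟩ : ∃ W : ℕ → Submodule K V, W 0 = ⊥ ∧
      ∀ k, W (k + 1) = W k ⊔ Submodule.span K {g (W k)} :=
    ⟨fun k => Nat.rec ⊥ (fun _ W => W ⊔ Submodule.span K {g W}) k, rfl, fun _ => rfl⟩
  have hWspan : ∀ k, W k = Submodule.span K ((fun i => g (W i)) '' Set.Iio k) := by
    intro k
    induction k with
    | zero => simp [hW0]
    | succ k ih =>
      rw [hWs, ← Nat.succ_eq_add_one, ← Nat.succ_eq_succ, Order.Iio_succ_eq_insert,
        Set.image_insert_eq, Submodule.span_insert, ← ih, sup_comm]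
  have hfin : ∀ k, Module.finrank K (W k) ≤ k := by
    intro k
    rw [hWspan]
    have h1 := finrank_span_finset_le_card (R := K) ((Finset.range k).image fun i => g (W i))
    rw [Finset.coe_image, Finset.coe_range] at h1
    exact h1.trans (Finset.card_image_le.trans (by simp))
  have hnonempty : ∀ k < Module.finrank K X, (A (W k)).Nonempty := by
    intro k hk
    by_contra hcon
    have hle : X ≤ W k := by
      intro x hx
      by_contra hxW
      obtain ⟨c, hc, hcI⟩ := hI x hx
      refine hcon ⟨c • x, hcI, X.smul_mem c hx, fun h => hxW ?_⟩
      exact (Submodule.smul_mem_iff _ hc).1 h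
    have := Submodule.finrank_mono hle
    have := hfin k
    omega
  have hmono : ∀ i j, i ≤ j → W i ≤ W j := fun i j hij =>
    (monotone_nat_of_le_succ (f := W) fun k => by rw [hWs]; exact le_sup_left) hij
  refine ⟨fun k => g (W k), fun k => l' (W k), W, hW0, hWspan, fun k hk => ?_,
    fun i j hij hj => ?_, fun k hk => ?_⟩
  · obtain ⟨h1, h2⟩ := hg (W k) (hnonempty k hk)
    refine ⟨h1.1, h1.2.1, h1.2.2, h2, ?_, fun x hx hxX hxW => ?_⟩
    · exact le_csInf ((hnonempty k hk).image N)
        (by rintro _ ⟨x, hx, rfl⟩; exact hN x hx.1 (hne0 _ x hx))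
    · exact csInf_le (hbdd _) ⟨x, ⟨hx, hxX, hxW⟩, rfl⟩
  · refine csInf_le_csInf (hbdd _) ((hnonempty j hj).image N) (Set.image_mono ?_)
    exact fun x hx => ⟨hx.1, hx.2.1, fun h => hx.2.2 (hmono i j hij h)⟩
  · induction k with
    | zero => simp [hW0]
    | succ k ih =>
      obtain ⟨h1, h2⟩ := ih (by omega)
      obtain ⟨h3, -⟩ := hg (W k) (hnonempty k (by omega))
      refine ⟨?_, le_antisymm (hfin _) ?_⟩
      · rw [hWs]
        exact sup_le h1 ((Submodule.span_singleton_le_iff_mem _ _).2 h3.2.1)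
      · have hlt : W k < W (k + 1) := by
          refine lt_of_le_of_ne (hmono _ _ (Nat.le_succ k)) fun h => h3.2.2 ?_
          have h5 : g (W k) ∈ W (k + 1) := by
            rw [hWs]
            exact Submodule.mem_sup_right (Submodule.mem_span_singleton_self _)
          rwa [← h] at h5
        have := Submodule.finrank_lt_finrank_of_lt hlt
        omega

end MinimaFlag

theorem apply_sum_le_of_forall_le {K ι : Type*} [Field K] (v : AbsoluteValue K ℝ) (hv : IsNonarchimedean v)
    (s : Finset ι) (f : ι → K) {B : ℝ} (hB : 0 ≤ B) (h : ∀ i ∈ s, v (f i) ≤ B) :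
    v (∑ i ∈ s, f i) ≤ B := by
  rcases s.eq_empty_or_nonempty with rfl | hs
  · simpa using hB
  · exact (IsNonarchimedean.apply_sum_le_sup hv hs).trans (Finset.sup'_le hs _ h)

section DominatingCoordinates

variable {K ι : Type*} [Field K] [Fintype ι] [DecidableEq ι]

theorem exists_relation_of_finrank_lt (W : Submodule K (ι → K)) (J : Finset ι)
    (h : Module.finrank K W < J.card) :
    ∃ c : ι → K, (∃ i ∈ J, c i ≠ 0) ∧ ∀ z ∈ W, ∑ i ∈ J, c i * z i = 0 := by
  set π : (ι → K) →ₗ[K] (J → K) := LinearMap.funLeft K K (Subtype.val : J → ι) with hπ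
  have hlt : W.map π < ⊤ := by
    refine lt_top_iff_ne_top.2 fun htop => ?_
    have h1 := Submodule.finrank_map_le π W
    rw [htop, finrank_top, Module.finrank_fintype_fun_eq_card, Fintype.card_coe] at h1
    omega
  obtain ⟨f, hf0, hf⟩ := Submodule.exists_le_ker_of_lt_top _ hlt
  have hsum : ∀ x : J → K, f x = ∑ i, x i * f (Pi.single i 1) := by
    intro x
    conv_lhs => rw [← Finset.univ_sum_single x, map_sum]
    refine Finset.sum_congr rfl fun i _ => ?_
    rw [← smul_eq_mul, ← map_smul, ← Pi.single_smul, smul_eq_mul, mul_one]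
  refine ⟨fun i => if hi : i ∈ J then f (Pi.single ⟨i, hi⟩ 1) else 0, ?_, fun z hz => ?_⟩
  · by_contra! hcon
    refine hf0 (LinearMap.ext fun x => ?_)
    rw [hsum, LinearMap.zero_apply]
    refine Finset.sum_eq_zero fun i _ => ?_
    have := hcon i i.2
    rw [dif_pos i.2] at this
    rw [this, mul_zero]
  · have h1 : f (π z) = 0 := hf ⟨z, hz, rfl⟩
    rw [hsum] at h1
    rw [← Finset.sum_coe_sort J, ← h1]
    refine Finset.sum_congr rfl fun i _ => ?_
    dsimp only
    rw [dif_pos i.2, mul_comm]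
    rfl

theorem exists_dominating_erase (v : AbsoluteValue K ℝ) (hv : IsNonarchimedean v)
    (W : Submodule K (ι → K)) (J : Finset ι) (h : Module.finrank K W < J.card)
    (hJ : ∀ z ∈ W, ∀ B, 0 ≤ B → (∀ i ∈ J, v (z i) ≤ B) → ∀ j, v (z j) ≤ B) :
    ∃ i₀ ∈ J, ∀ z ∈ W, ∀ B, 0 ≤ B → (∀ i ∈ J.erase i₀, v (z i) ≤ B) → ∀ j, v (z j) ≤ B := by
  obtain ⟨c, ⟨i₁, hi₁, hci₁⟩, hc⟩ := exists_relation_of_finrank_lt W J h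
  obtain ⟨i₀, hi₀, hmax⟩ := J.exists_max_image (fun i => v (c i)) ⟨i₁, hi₁⟩
  have hci₀ : 0 < v (c i₀) := (v.pos hci₁).trans_le (hmax i₁ hi₁)
  refine ⟨i₀, hi₀, fun z hz B hB hle => hJ z hz B hB fun i hi => ?_⟩
  by_cases hii : i = i₀
  · subst hii
    have h1 := hc z hz
    rw [← Finset.add_sum_erase J _ hi] at h1
    have h2 : v (c i * z i) ≤ v (c i) * B := by
      rw [eq_neg_of_add_eq_zero_left h1, map_neg_eq_map]
      refine apply_sum_le_of_forall_le v hv _ _ (mul_nonneg (apply_nonneg v _) hB) fun k hk => ?_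
      rw [map_mul]
      exact mul_le_mul (hmax k (Finset.mem_of_mem_erase hk)) (hle k hk) (apply_nonneg v _)
        (apply_nonneg v _)
    rw [map_mul] at h2
    exact le_of_mul_le_mul_left h2 hci₀
  · exact hle i (Finset.mem_erase.2 ⟨hii, hi⟩)

theorem exists_dominating_enumeration [Nonempty ι] (v : AbsoluteValue K ℝ)
    (hv : IsNonarchimedean v) (W : ℕ → Submodule K (ι → K)) (m : ℕ) (J : Finset ι)
    (hcard : J.card = m) (hW : ∀ k ≤ m, Module.finrank K (W k) ≤ k)
    (hmono : ∀ k < m, W k ≤ W (k + 1))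
    (hJ : ∀ z ∈ W m, ∀ B, 0 ≤ B → (∀ i ∈ J, v (z i) ≤ B) → ∀ j, v (z j) ≤ B) :
    ∃ e : ℕ → ι, Set.InjOn e (Set.Iio m) ∧ (∀ i < m, e i ∈ J) ∧ (∀ i ∈ J, ∃ k < m, e k = i) ∧
      ∀ k ≤ m, ∀ z ∈ W k, ∀ B, 0 ≤ B → (∀ i < k, v (z (e i)) ≤ B) → ∀ j, v (z j) ≤ B := by
  induction m generalizing J with
  | zero =>
    rw [Finset.card_eq_zero] at hcard
    subst hcard
    refine ⟨fun _ => Classical.arbitrary ι, by simp, by simp, by simp,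
      fun k hk z hz B hB _ => hJ z ?_ B hB (by simp)⟩
    rwa [Nat.le_zero.1 hk] at hz
  | succ m ih =>
    obtain ⟨i₀, hi₀, hdom⟩ := exists_dominating_erase v hv (W m) J
      (by have := hW m (Nat.le_succ m); omega)
      (fun z hz => hJ z (hmono m (Nat.lt_succ_self m) hz))
    obtain ⟨e, hinj, heJ, hsurj, he⟩ := ih (J.erase i₀)
      (by rw [Finset.card_erase_of_mem hi₀, hcard]; rfl)
      (fun k hk => hW k (hk.trans (Nat.le_succ m))) (fun k hk => hmono k (hk.trans
        (Nat.lt_succ_self m))) hdom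
    have h1 : ∀ k < m, Function.update e m i₀ k = e k := fun k hk =>
      Function.update_of_ne hk.ne _ _
    have h2 : Function.update e m i₀ m = i₀ := Function.update_self _ _ _
    have h3 : ∀ i ∈ J, ∃ k < m + 1, Function.update e m i₀ k = i := by
      intro i hi
      by_cases hii : i = i₀
      · exact ⟨m, Nat.lt_succ_self m, h2.trans hii.symm⟩
      · obtain ⟨k, hk, rfl⟩ := hsurj i (Finset.mem_erase.2 ⟨hii, hi⟩)
        exact ⟨k, hk.trans (Nat.lt_succ_self m), h1 k hk⟩
    refine ⟨Function.update e m i₀, ?_, ?_, h3, ?_⟩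
    · have h4 : ∀ a < m, e a ≠ i₀ := fun a ha => (Finset.mem_erase.1 (heJ a ha)).1
      intro a ha b hb hab
      rcases Nat.lt_succ_iff_lt_or_eq.1 ha with ha | rfl <;>
        rcases Nat.lt_succ_iff_lt_or_eq.1 hb with hb | rfl
      · rw [h1 a ha, h1 b hb] at hab
        exact hinj ha hb hab
      · rw [h1 a ha, h2] at hab
        exact (h4 a ha hab).elim
      · rw [h1 b hb, h2] at hab
        exact (h4 b hb hab.symm).elim
      · rfl
    · intro a ha
      rcases Nat.lt_succ_iff_lt_or_eq.1 ha with ha | rfl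
      · rw [h1 a ha]
        exact Finset.mem_of_mem_erase (heJ a ha)
      · rwa [h2]
    · intro k hk z hz B hB hle
      rcases Nat.le_succ_iff.1 hk with hk | rfl
      · exact he k hk z hz B hB fun i hi => h1 i (hi.trans_le hk) ▸ hle i hi
      · refine hJ z hz B hB fun i hi => ?_
        obtain ⟨k, hk, rfl⟩ := h3 i hi
        exact hle k hk

end DominatingCoordinates

theorem apply_det_le {R : Type*} [CommRing R] [IsDomain R] (v : AbsoluteValue R ℝ) {n : ℕ}
    (M : Matrix (Fin n) (Fin n) R) (A : Fin n → ℝ) (h : ∀ i j, v (M i j) ≤ A i) :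
    v M.det ≤ n.factorial * ∏ i, A i := by
  rw [← Matrix.det_transpose, Matrix.det_apply]
  refine (v.sum_le _ _).trans ?_
  have h1 : ∀ σ ∈ (Finset.univ : Finset (Equiv.Perm (Fin n))),
      v (Equiv.Perm.sign σ • ∏ i, M.transpose (σ i) i) ≤ ∏ i, A i := by
    intro σ _
    have h2 : v (Equiv.Perm.sign σ • ∏ i, M.transpose (σ i) i) = ∏ i, v (M i (σ i)) := by
      rcases Int.units_eq_one_or (Equiv.Perm.sign σ) with hs | hs <;> simp [hs, map_prod]
    rw [h2]
    exact Finset.prod_le_prod (fun i _ => apply_nonneg v _) fun i _ => h i _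
  refine (Finset.sum_le_card_nsmul _ _ _ h1).trans ?_
  rw [Finset.card_univ, Fintype.card_perm, Fintype.card_fin, nsmul_eq_mul]

/-- The vector of maximal minors of a basis of the orthogonal complement of `y` is a multiple
of `y`. -/
theorem exists_smul_integral_of_linearIndependent {K : Type*} [Field K] [NumberField K] {n : ℕ}
    (y : Fin (n + 1) → K) (hy : y 0 ≠ 0) (z : Fin n → Fin (n + 1) → K)
    (hz : LinearIndependent K z) (hzy : ∀ i, ∑ j, z i j * y j = 0)
    (hint : ∀ i j, ∃ a : 𝓞 K, (a : K) = z i j) (A : Fin n → ℝ)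
    (hA : ∀ i j, ∀ v : InfinitePlace K, v (z i j) ≤ A i) :
    ∃ c : K, c ≠ 0 ∧ ∀ j, (∃ a : 𝓞 K, (a : K) = c * y j) ∧
      ∀ v : InfinitePlace K, v (c * y j) ≤ n.factorial * ∏ i, A i := by
  set D : Fin (n + 1) → K := fun j =>
    (-1) ^ (j : ℕ) * (Matrix.of z |>.submatrix id j.succAbove).det with hD
  have hdet : ∀ x : Fin (n + 1) → K, (Matrix.of (Fin.cons x z : Fin (n + 1) → Fin (n + 1) → K)).det
      = ∑ j, x j * D j := by
    intro x
    rw [Matrix.det_succ_row_zero]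
    refine Finset.sum_congr rfl fun j _ => ?_
    have : (Matrix.of (Fin.cons x z : Fin (n + 1) → Fin (n + 1) → K)).submatrix Fin.succ
        j.succAbove = (Matrix.of z).submatrix id j.succAbove := by
      ext a b
      simp
    rw [this, hD]
    simp only [Matrix.of_apply, Fin.cons_zero]
    ring
  have hDz : ∀ i, ∑ j, z i j * D j = 0 := by
    intro i
    rw [← hdet]
    refine Matrix.det_zero_of_row_eq (Fin.succ_ne_zero i).symm ?_
    ext j
    simp
  set e : Fin (n + 1) → K := Pi.single 0 1 with he
  have hindep : LinearIndependent K (Fin.cons e z : Fin (n + 1) → Fin (n + 1) → K) := by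
    refine linearIndependent_finCons.2 ⟨hz, fun hmem => hy ?_⟩
    have h1 : Submodule.span K (Set.range z) ≤
        LinearMap.ker (∑ j, (LinearMap.proj j : (Fin (n + 1) → K) →ₗ[K] K).smulRight (y j)) := by
      rw [Submodule.span_le]
      rintro _ ⟨i, rfl⟩
      simpa [LinearMap.mem_ker, LinearMap.sum_apply] using hzy i
    have h2 := h1 hmem
    simpa [LinearMap.mem_ker, LinearMap.sum_apply, he, Pi.single_apply] using h2
  have hdet0 : (Matrix.of (Fin.cons e z : Fin (n + 1) → Fin (n + 1) → K)).det ≠ 0 := by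
    have h1 : IsUnit (Matrix.of (Fin.cons e z : Fin (n + 1) → Fin (n + 1) → K)) :=
      Matrix.linearIndependent_rows_iff_isUnit.1 hindep
    exact ((Matrix.isUnit_iff_isUnit_det _).1 h1).ne_zero
  have hD0 : D 0 ≠ 0 := by
    have := hdet0
    rw [hdet] at this
    simpa [he, Pi.single_apply] using this
  set c : K := D 0 / y 0 with hc
  have hDy : D - c • y = 0 := by
    refine Matrix.eq_zero_of_mulVec_eq_zero hdet0 ?_
    ext i
    refine Fin.cases ?_ (fun i => ?_) i
    · simp [Matrix.mulVec, dotProduct, he, Pi.single_apply, hc, hy]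
    · simp only [Matrix.mulVec, dotProduct, Matrix.of_apply, Fin.cons_succ, Pi.sub_apply,
        Pi.smul_apply, smul_eq_mul, mul_sub, Finset.sum_sub_distrib, hDz i, Pi.zero_apply,
        zero_sub, neg_eq_zero]
      rw [← mul_zero c, ← hzy i, Finset.mul_sum]
      exact Finset.sum_congr rfl fun j _ => by ring
  have hDj : ∀ j, D j = c * y j := fun j => by
    have := congrFun hDy j
    simpa [sub_eq_zero] using this
  refine ⟨c, div_ne_zero hD0 hy, fun j => ⟨?_, fun v => ?_⟩⟩
  · choose a ha using hint
    refine ⟨(-1) ^ (j : ℕ) * ((Matrix.of a).submatrix id j.succAbove).det, ?_⟩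
    rw [← hDj, hD]
    have h1 : ((Matrix.of z).submatrix id j.succAbove) =
        (algebraMap (𝓞 K) K).mapMatrix ((Matrix.of a).submatrix id j.succAbove) := by
      ext i k
      exact (ha i _).symm
    simp only [h1, ← RingHom.map_det, map_mul, map_pow, map_neg, map_one]
  · rw [← hDj, hD]
    have h1 : v ((-1 : K) ^ (j : ℕ)) = 1 := by
      rw [map_pow]
      have : v (-1 : K) = 1 := by
        exact (v.1.map_neg 1).trans (map_one v)
      rw [this, one_pow]
    simp only [map_mul, h1, one_mul]
    exact apply_det_le v.1 _ A fun i k => hA i _ v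

theorem exists_functionals_mod_submodule (ρ : ℕ) : ∃ C : ℝ, 0 < C ∧
    ∀ (E : Type*) [NormedAddCommGroup E] [NormedSpace ℝ E] [FiniteDimensional ℝ E]
      (V : Submodule ℝ E), Module.finrank ℝ (E ⧸ V) = ρ →
    ∀ (A : Type*) [AddCommGroup A] (emb : A →+ E) (Λ : AddSubgroup A) (l M : ℝ), 0 < l →
      2 * M ≤ l → (∀ w ∈ V, ∃ a ∈ Λ, emb a ∈ V ∧ ‖w - emb a‖ ≤ M) →
      (∀ x ∈ Λ, emb x ∉ V → l ≤ ‖emb x‖) →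
      ∃ g : Fin ρ → A →+ ℝ, (∀ s, ∀ x ∈ Λ, ∃ m : ℤ, g s x = m) ∧
        (∀ s x, emb x ∈ V → g s x = 0) ∧ (∀ x ∈ Λ, (∀ s, g s x = 0) → emb x ∈ V) ∧
        ∀ s x, |g s x| ≤ C / l * ‖emb x‖ := by
  obtain ⟨C, hC, hdual⟩ := exists_dual_family ρ
  refine ⟨2 * C, by positivity, fun E _ _ _ V hρ A _ emb Λ l M hl hM hround hΛ => ?_⟩
  have hclosed : IsClosed (V : Set E) := V.closed_of_finiteDimensional
  set φ : A →+ E ⧸ V := V.mkQ.toAddMonoidHom.comp emb with hφ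
  have hφ0 : ∀ x, φ x = 0 ↔ emb x ∈ V := fun x => Submodule.Quotient.mk_eq_zero V
  have hlow : ∀ x ∈ Λ, φ x ≠ 0 → l / 2 ≤ ‖φ x‖ := by
    intro x hx hx0
    refine le_of_forall_pos_le_add fun ε hε => ?_
    obtain ⟨m, hm, hmn⟩ := Submodule.Quotient.norm_mk_lt (S := V) (φ x) hε
    have h1 : emb x - m ∈ V :=
      (Submodule.Quotient.eq V).1 (hm.symm : V.mkQ (emb x) = _)
    obtain ⟨a, haΛ, haV, ha⟩ := hround _ h1
    have h2 : emb (x - a) ∉ V := by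
      rw [map_sub]
      exact fun h => hx0 ((hφ0 x).2 ((V.sub_mem_iff_left haV).1 h))
    have h3 := hΛ _ (Λ.sub_mem hx haΛ) h2
    rw [map_sub] at h3
    have h4 : emb x - emb a = m + (emb x - m - emb a) := by abel
    rw [h4] at h3
    have h5 := norm_add_le m (emb x - m - emb a)
    linarith
  obtain ⟨b, f, -, hf, hbound⟩ := hdual (E ⧸ V) hρ (Λ.map φ) (l / 2) (by positivity)
    (by rintro _ ⟨x, hx, rfl⟩ h0; exact hlow x hx h0)
  refine ⟨fun s => (f s).toLinearMap.toAddMonoidHom.comp φ, fun s x hx => ?_, fun s x hx => ?_,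
    fun x hx h0 => ?_, fun s x => ?_⟩
  · obtain ⟨c, -, hc⟩ := hf _ ⟨x, hx, rfl⟩
    exact ⟨c s, hc s⟩
  · simp [(hφ0 x).2 hx]
  · obtain ⟨c, hc, hc'⟩ := hf _ ⟨x, hx, rfl⟩
    have h1 : ∀ i, c i = 0 := fun i => by
      have h2 : f i (φ x) = 0 := h0 i
      rw [hc' i] at h2
      exact_mod_cast h2
    rw [← hφ0, hc]
    simp [h1]
  · refine (hbound s (φ x)).trans ?_
    have h1 : ‖φ x‖ ≤ ‖emb x‖ := Submodule.Quotient.norm_mk_le V (emb x)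
    have h2 : C / (l / 2) = 2 * C / l := by
      field_simp
    rw [h2]
    exact mul_le_mul_of_nonneg_left h1 (by positivity)

section ConstantQuotient

variable (K : Type*) [Field K] [NumberField K] (n : ℕ)

noncomputable def archEmbedding :
    (Fin (n + 1) → K) →+ (Fin (n + 1) → InfinitePlace K → ℂ) where
  toFun z j v := v.embedding (z j)
  map_zero' := by ext; simp
  map_add' x y := by ext; simp

variable {K n}

theorem norm_archEmbedding_le_iff {x : Fin (n + 1) → K} {M : ℝ} :
    ‖archEmbedding K n x‖ ≤ M ↔ ∀ j, ∀ v : InfinitePlace K, v (x j) ≤ M := by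
  have h0 : ∀ v : InfinitePlace K, ∀ a : K, ‖v.embedding a‖ = v a := fun v a =>
    InfinitePlace.norm_embedding_eq v a
  constructor
  · intro h j v
    rw [← h0]
    exact (norm_le_pi_norm (archEmbedding K n x j) v).trans
      ((norm_le_pi_norm (archEmbedding K n x) j).trans h)
  · intro h
    have hM : 0 ≤ M := (apply_nonneg _ _).trans (h 0 (Classical.arbitrary (InfinitePlace K)))
    refine (pi_norm_le_iff_of_nonneg hM).2 fun j => (pi_norm_le_iff_of_nonneg hM).2 fun v => ?_
    exact (h0 v _).trans_le (h j v)

variable (K n) in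
/-- Integer-valued functionals on a lattice, vanishing on the constant vectors. -/
theorem exists_functionals_vanishing_const :
    ∃ (ρ : ℕ) (C : ℝ), 0 < C ∧ ∀ (Λ : AddSubgroup (Fin (n + 1) → K)) (l : ℝ) (R : ℕ), 0 < l →
      (∀ a : 𝓞 K, (fun _ => (R : K) * a) ∈ Λ) →
      (∀ x ∈ Λ, (¬ ∃ c, x = fun _ => c) → l ≤ ‖archEmbedding K n x‖) → 0 < R → C * R ≤ l →
      ∃ g : Fin ρ → (Fin (n + 1) → K) →+ ℝ, (∀ s, ∀ x ∈ Λ, ∃ m : ℤ, g s x = m) ∧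
        (∀ s c, g s (fun _ => c) = 0) ∧
        (∀ x ∈ Λ, (∀ s, g s x = 0) → ∃ c, x = fun _ => c) ∧
        ∀ s x, |g s x| ≤ C / l * ‖archEmbedding K n x‖ := by
  set ω := integralBasis K with hω
  set u : Module.Free.ChooseBasisIndex ℤ (𝓞 K) → Fin (n + 1) → InfinitePlace K → ℂ :=
    fun i => archEmbedding K n fun _ => ω i with hu
  set V₁ : Submodule ℝ (Fin (n + 1) → InfinitePlace K → ℂ) := Submodule.span ℝ (Set.range u)
    with hV₁
  obtain ⟨ρ, hρ⟩ : ∃ ρ, Module.finrank ℝ ((Fin (n + 1) → InfinitePlace K → ℂ) ⧸ V₁) = ρ :=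
    ⟨_, rfl⟩
  obtain ⟨C, hC, hfun⟩ := exists_functionals_mod_submodule ρ
  set C₁ : ℝ := ∑ i, ‖u i‖ with hC₁
  have hC₁0 : 0 ≤ C₁ := Finset.sum_nonneg fun i _ => norm_nonneg _
  have hmemconst : ∀ c : K, archEmbedding K n (fun _ => c) ∈ V₁ := by
    intro c
    have h1 : archEmbedding K n (fun _ => c) = ∑ i, ((ω.repr c i : ℚ) : ℝ) • u i := by
      ext j v
      have h2 := congrArg v.embedding (ω.sum_repr c)
      rw [map_sum] at h2
      simp only [Finset.sum_apply, Pi.smul_apply, hu, archEmbedding, AddMonoidHom.coe_mk,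
        ZeroHom.coe_mk]
      rw [← h2]
      refine Finset.sum_congr rfl fun i _ => ?_
      rw [Algebra.smul_def, map_mul, Complex.real_smul]
      simp
    rw [h1]
    exact Submodule.sum_mem _ fun i _ => Submodule.smul_mem _ _
      (Submodule.subset_span (Set.mem_range_self i))
  have hconstmem : ∀ x : Fin (n + 1) → K, archEmbedding K n x ∈ V₁ → ∃ c, x = fun _ => c := by
    intro x hx
    have h1 : V₁ ≤ LinearMap.range (LinearMap.funLeft ℝ (InfinitePlace K → ℂ)
        (fun _ : Fin (n + 1) => (0 : Fin 1))) := by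
      rw [hV₁, Submodule.span_le]
      rintro _ ⟨i, rfl⟩
      exact ⟨fun _ v => v.embedding (ω i), rfl⟩
    obtain ⟨w, hw⟩ := h1 hx
    refine ⟨x 0, funext fun j => ?_⟩
    set v : InfinitePlace K := Classical.arbitrary _
    have h2 : ∀ j, v.embedding (x j) = w 0 v := fun j => (congrFun (congrFun hw j) v).symm
    exact v.embedding.injective ((h2 j).trans (h2 0).symm)
  have hround : ∀ w ∈ V₁, ∀ R : ℕ, 0 < R → ∃ a : 𝓞 K,
      ‖w - archEmbedding K n (fun _ => (R : K) * a)‖ ≤ R * C₁ := by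
    intro w hw R hR
    have hR' : (0 : ℝ) < R := by exact_mod_cast hR
    obtain ⟨t, rfl⟩ := (Submodule.mem_span_range_iff_exists_fun ℝ).1 hw
    refine ⟨∑ i, round (t i / R) • RingOfIntegers.basis K i, ?_⟩
    have h1 : archEmbedding K n (fun _ => (R : K) * ((∑ i, round (t i / R) •
        RingOfIntegers.basis K i : 𝓞 K) : K)) = ∑ i, ((R * round (t i / R) : ℝ)) • u i := by
      ext j v
      simp [hu, archEmbedding, Finset.mul_sum, mul_assoc, hω, integralBasis_apply]
    rw [h1, ← Finset.sum_sub_distrib]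
    refine (norm_sum_le _ _).trans ?_
    rw [hC₁, Finset.mul_sum]
    refine Finset.sum_le_sum fun i _ => ?_
    rw [← sub_smul, norm_smul]
    refine mul_le_mul_of_nonneg_right ?_ (norm_nonneg _)
    have h2 := abs_sub_round (t i / R)
    have h3 : t i - R * round (t i / R) = R * (t i / R - round (t i / R)) := by
      field_simp
    rw [h3, Real.norm_eq_abs, abs_mul, abs_of_pos hR']
    nlinarith
  refine ⟨ρ, C + 2 * C₁, by positivity, fun Λ l R hl hR hΛ hR0 hRl => ?_⟩
  have hR0' : (0 : ℝ) < R := by exact_mod_cast hR0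
  obtain ⟨g, hg1, hg2, hg3, hg4⟩ := hfun _ V₁ hρ _ (archEmbedding K n) Λ l (R * C₁) hl
    (by nlinarith) (fun w hw => by
      obtain ⟨a, ha⟩ := hround w hw R hR0
      exact ⟨_, hR a, hmemconst _, ha⟩)
    (fun x hx hxV => hΛ x hx fun ⟨c, hc⟩ => hxV (hc ▸ hmemconst c))
  refine ⟨g, hg1, fun s c => hg2 s _ (hmemconst c), fun x hx h0 => hconstmem x (hg3 x hx h0),
    fun s x => (hg4 s x).trans ?_⟩
  gcongr
  linarith

end ConstantQuotient

section LocalFunctionals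

variable {K : Type*} [Field K] [NumberField K]

theorem InfinitePlace.exists_one_lt_lt_one (v : InfinitePlace K) :
    ∃ a : K, 1 < v a ∧ ∀ w : InfinitePlace K, w ≠ v → w a < 1 :=
  AbsoluteValue.exists_one_lt_lt_one_pi_of_not_isEquiv
    (v := fun w : InfinitePlace K => w.1) (fun w => InfinitePlace.isNontrivial w)
    (fun _ _ h => (InfinitePlace.eq_iff_isEquiv (K := K)).not.mp h) v

theorem exists_nat_mul_integral {ι : Type*} [Fintype ι] (x : ι → K) :
    ∃ N : ℕ, N ≠ 0 ∧ ∀ j, ∃ a : 𝓞 K, (a : K) = N * x j := by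
  have h1 : ∀ j, ∃ N : ℕ, N ≠ 0 ∧ IsIntegral ℤ ((N : K) * x j) := fun j => by
    obtain ⟨N, hN, -, h⟩ := NumberField.exists_nat_le_mulHeight₁ (x j)
    exact ⟨N, hN, h⟩
  choose N hN h using h1
  refine ⟨∏ j, N j, Finset.prod_ne_zero_iff.2 fun j _ => hN j, fun j => ?_⟩
  classical
  have h2 : IsIntegral ℤ (((∏ j, N j : ℕ) : K) * x j) := by
    rw [← Finset.prod_erase_mul _ _ (Finset.mem_univ j), Nat.cast_mul, mul_assoc]
    refine IsIntegral.mul ?_ (h j)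
    simpa using isIntegral_algebraMap (R := ℤ) (A := K)
      (x := ((∏ i ∈ Finset.univ.erase j, N i : ℕ) : ℤ))
  exact ⟨⟨_, h2⟩, rfl⟩

variable (K) in
theorem exists_local_functionals (n : ℕ) :
    ∃ (ρ : ℕ) (C : ℝ), 0 < C ∧ ∀ (X : Submodule K (Fin (n + 1) → K))
      (e : FinitePlace K → Fin n → Fin (n + 1)) (t : Fin n → ℕ) (R : ℕ) (l : ℝ),
      (∀ i, t i ∣ R) → 0 < R → 0 < l → C * R ≤ l → (fun _ => 1) ∈ X →
      (∀ x ∈ X, (∀ v : FinitePlace K, ∀ i, v (x (e v i)) ≤ v (t i : K)) →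
        (¬ ∃ c, x = fun _ => c) → l ≤ ‖archEmbedding K n x‖) →
      ∃ L : Fin ρ → X →ₗ[K] K,
        (∀ s (x : X), (∃ c, (x : Fin (n + 1) → K) = fun _ => c) → L s x = 0) ∧
        (∀ x : X, (∀ s, L s x = 0) → ∃ c, (x : Fin (n + 1) → K) = fun _ => c) ∧
        (∀ s (v : FinitePlace K) (x : X), (∀ i, v (x.1 (e v i)) ≤ v (t i : K)) →
          v (L s x) ≤ 1) ∧
        ∀ s (v : InfinitePlace K) (x : X) B, (∀ j, v (x.1 j) ≤ B) → v (L s x) ≤ C / l * B := by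
  obtain ⟨ρ, C, hC, hfun⟩ := exists_functionals_vanishing_const K n
  obtain ⟨C₁, hC₁, hlin⟩ := exists_linearMap_of_ratFunctional (K := K)
  set Ω : ℝ := ∑ i, ∑ v : InfinitePlace K, v ((RingOfIntegers.basis K i : 𝓞 K) : K) with hΩ
  have hΩ0 : 0 ≤ Ω := Finset.sum_nonneg fun i _ => Finset.sum_nonneg fun v _ => apply_nonneg v _
  have hΩle : ∀ i (v : InfinitePlace K), v ((RingOfIntegers.basis K i : 𝓞 K) : K) ≤ Ω :=
    fun i v => (Finset.single_le_sum (f := fun v : InfinitePlace K =>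
      v ((RingOfIntegers.basis K i : 𝓞 K) : K)) (fun v _ => apply_nonneg v _)
      (Finset.mem_univ v)).trans (Finset.single_le_sum
        (f := fun i => ∑ v : InfinitePlace K, v ((RingOfIntegers.basis K i : 𝓞 K) : K))
        (fun i _ => Finset.sum_nonneg fun v _ => apply_nonneg v _) (Finset.mem_univ i))
  refine ⟨ρ, C + C₁ * (C * Ω), by positivity, fun X e t R l ht hR hl hRl hone hlow => ?_⟩
  have ht0 : ∀ i, t i ≠ 0 := fun i h => hR.ne' (Nat.eq_zero_of_zero_dvd (h ▸ ht i))
  set Λ : AddSubgroup (Fin (n + 1) → K) :=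
    { carrier := {x | x ∈ X ∧ ∀ v : FinitePlace K, ∀ i, v (x (e v i)) ≤ v (t i : K)}
      zero_mem' := ⟨X.zero_mem, fun v i => by simp⟩
      add_mem' := fun {x y} hx hy => ⟨X.add_mem hx.1 hy.1, fun v i =>
        (placeAbs_isNonarchimedean v _ _).trans (max_le (hx.2 v i) (hy.2 v i))⟩
      neg_mem' := fun {x} hx => ⟨X.neg_mem hx.1, fun v i => by
        rw [Pi.neg_apply, show v (-x (e v i)) = v (x (e v i)) from v.1.map_neg _]
        exact hx.2 v i⟩ } with hΛ
  have hmemΛ : ∀ x, x ∈ Λ ↔ x ∈ X ∧ ∀ v : FinitePlace K, ∀ i, v (x (e v i)) ≤ v (t i : K) :=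
    fun x => Iff.rfl
  have hsmulΛ : ∀ x ∈ Λ, ∀ a : 𝓞 K, (a : K) • x ∈ Λ := fun x hx a =>
    ⟨X.smul_mem _ hx.1, fun v i => by
      rw [Pi.smul_apply, smul_eq_mul, map_mul]
      exact (mul_le_of_le_one_left (apply_nonneg v _) (FinitePlace.apply_integer_le_one v a)).trans
        (hx.2 v i)⟩
  have hnat : ∀ (v : FinitePlace K) (m : ℕ), v (m : K) ≤ 1 := fun v m => by
    simpa using FinitePlace.apply_integer_le_one v (m : 𝓞 K)
  have hRt : ∀ (v : FinitePlace K) i, v (R : K) ≤ v (t i : K) := fun v i => by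
    obtain ⟨m, hm⟩ := ht i
    rw [hm, Nat.cast_mul, map_mul]
    exact mul_le_of_le_one_right (apply_nonneg v _) (hnat v m)
  have hconst : ∀ a : 𝓞 K, (fun _ => (R : K) * a) ∈ Λ := fun a => by
    refine ⟨?_, fun v i => ?_⟩
    · have := X.smul_mem ((R : K) * a) hone
      convert this using 1
      ext
      simp
    · rw [map_mul]
      exact (mul_le_of_le_one_right (apply_nonneg v _)
        (FinitePlace.apply_integer_le_one v a)).trans (hRt v i)
  have habsorb : ∀ x ∈ X, ∃ N : ℕ, N ≠ 0 ∧ (N : K) • x ∈ Λ := by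
    intro x hx
    obtain ⟨N, hN, h⟩ := exists_nat_mul_integral x
    refine ⟨R * N, mul_ne_zero hR.ne' hN, X.smul_mem _ hx, fun v i => ?_⟩
    obtain ⟨a, ha⟩ := h (e v i)
    rw [Pi.smul_apply, smul_eq_mul, Nat.cast_mul, mul_assoc, ← ha, map_mul]
    exact (mul_le_of_le_one_right (apply_nonneg v _)
        (FinitePlace.apply_integer_le_one v a)).trans (hRt v i)
  obtain ⟨g, hg1, hg2, hg3, hg4⟩ := hfun Λ l R hl hconst (fun x hx => hlow x hx.1 hx.2) hR
    (hRl.trans' (by gcongr; nlinarith [mul_nonneg hC.le hΩ0]))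
  have hrat : ∀ s (x : X), ∃ q : ℚ, (q : ℝ) = g s x := by
    intro s x
    obtain ⟨N, hN, h⟩ := habsorb x x.2
    obtain ⟨m, hm⟩ := hg1 s _ h
    refine ⟨m / N, ?_⟩
    have h1 : (N : K) • (x : Fin (n + 1) → K) = N • (x : Fin (n + 1) → K) := Nat.cast_smul_eq_nsmul K _ _
    rw [h1, map_nsmul, nsmul_eq_mul] at hm
    have : (N : ℝ) ≠ 0 := by exact_mod_cast hN
    push_cast
    rw [← hm]
    field_simp
  choose q hq using hrat
  set Q : Fin ρ → X →+ ℚ := fun s =>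
    { toFun := q s
      map_zero' := by
        have := hq s 0
        rw [X.coe_zero, map_zero] at this
        exact_mod_cast this
      map_add' := fun x y => by
        have := hq s (x + y)
        rw [X.coe_add, map_add, ← hq, ← hq] at this
        exact_mod_cast this } with hQ
  have hQq : ∀ s (x : X), (Q s x : ℝ) = g s x := fun s x => hq s x
  choose L hL1 hL2 hL3 using fun s => hlin X (Q s)
  have hbound : ∀ s (x : X) (v : InfinitePlace K),
      v (L s x) ≤ C₁ * (C * Ω) / l * ‖archEmbedding K n x‖ := by
    intro s x v
    have h1 := hL3 s x (C / l * (Ω * ‖archEmbedding K n x‖)) (fun i => ?_) v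
    · refine h1.trans (le_of_eq ?_)
      ring
    · rw [hQq]
      refine (hg4 s _).trans ?_
      gcongr
      refine norm_archEmbedding_le_iff.2 fun j w => ?_
      rw [X.coe_smul, Pi.smul_apply, smul_eq_mul, map_mul]
      exact mul_le_mul (hΩle i w) (norm_archEmbedding_le_iff.1 le_rfl j w) (apply_nonneg w _) hΩ0
  have hintL : ∀ s (x : X), (x : Fin (n + 1) → K) ∈ Λ → ∃ a : 𝓞 K, (a : K) = L s x := by
    intro s x hx
    refine hL2 s x fun α => ?_
    obtain ⟨m, hm⟩ := hg1 s _ (hsmulΛ _ hx α)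
    refine ⟨m, ?_⟩
    have h1 := hQq s ((α : K) • x)
    rw [X.coe_smul, hm] at h1
    exact_mod_cast h1
  refine ⟨L, fun s x hx => ?_, fun x hx => ?_, fun s v x hx => ?_, fun s v x B hB => ?_⟩
  · obtain ⟨c, hc⟩ := hx
    have h1 := hL3 s x 0 (fun i => ?_) (Classical.arbitrary _)
    · rw [mul_zero] at h1
      exact (map_eq_zero (Classical.arbitrary (InfinitePlace K))).1
        (le_antisymm h1 (apply_nonneg _ _))
    · rw [hQq, X.coe_smul, hc]
      have : (((RingOfIntegers.basis K i : 𝓞 K) : K) • fun _ : Fin (n + 1) => c) =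
        fun _ => ((RingOfIntegers.basis K i : 𝓞 K) : K) * c := rfl
      rw [this, hg2, abs_zero]
  · obtain ⟨N, hN, h⟩ := habsorb x x.2
    have hNK : (N : K) ≠ 0 := by exact_mod_cast hN
    obtain ⟨c, hc⟩ := hg3 _ h fun s => by
      have h1 : Q s ((N : K) • x) = 0 := hL1 s _ (by rw [map_smul, hx s, smul_zero])
      rw [← X.coe_smul, ← hQq, h1, Rat.cast_zero]
    refine ⟨(N : K)⁻¹ * c, ?_⟩
    funext j
    have := congrFun hc j
    rw [Pi.smul_apply, smul_eq_mul] at this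
    rw [← this, inv_mul_cancel_left₀ hNK]
  · obtain ⟨N, hN, h⟩ := habsorb x x.2
    have hNK : (N : K) ≠ 0 := by exact_mod_cast hN
    have hfin : {u : FinitePlace K | u (N : K) ≠ 1}.Finite := FinitePlace.hasFiniteMulSupport hNK
    obtain ⟨a, hva, hua⟩ := exists_integer_finitePlace_small v hfin.toFinset (fun u => u (N : K))
      (fun u => (u.1.pos hNK : 0 < u.1 (N : K)))
    have hmem : ((a : K) • (x : Fin (n + 1) → K)) ∈ Λ := by
      refine ⟨X.smul_mem _ x.2, fun u i => ?_⟩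
      rw [Pi.smul_apply, smul_eq_mul, map_mul]
      by_cases huv : u = v
      · subst huv
        rw [hva, one_mul]
        exact hx i
      · have h1 : u (a : K) ≤ u (N : K) := by
          by_cases hu : u (N : K) = 1
          · rw [hu]
            exact FinitePlace.apply_integer_le_one u a
          · exact hua u (hfin.mem_toFinset.2 hu) huv
        refine (mul_le_mul_of_nonneg_right h1 (apply_nonneg u _)).trans ?_
        rw [← map_mul]
        exact h.2 u i
    obtain ⟨b, hb⟩ := hintL s ((a : K) • x) hmem
    have h1 := FinitePlace.apply_integer_le_one v b
    rwa [hb, map_smul, smul_eq_mul, map_mul, hva, one_mul] at h1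
  · obtain ⟨a, hva, hwa⟩ := InfinitePlace.exists_one_lt_lt_one v
    have hB0 : 0 ≤ B := (apply_nonneg v _).trans (hB 0)
    suffices hs : v (L s x) ≤ C₁ * (C * Ω) / l * B by
      refine hs.trans ?_
      gcongr
      linarith
    rcases hB0.eq_or_lt with rfl | hBpos
    · have hx0 : x = 0 := by
        ext j
        exact (map_eq_zero v).1 (le_antisymm (hB j) (apply_nonneg v _))
      rw [hx0, map_zero, map_zero, mul_zero]
    set M := ‖archEmbedding K n x‖ with hM
    obtain ⟨N, hN⟩ := pow_unbounded_of_one_lt (M / B) hva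
    have hpos : 0 < v a ^ N := by positivity
    have h1 := hbound s (a ^ N • x) v
    rw [map_smul, smul_eq_mul, map_mul, map_pow] at h1
    have h2 : ‖archEmbedding K n ((a ^ N • x : X) : Fin (n + 1) → K)‖ ≤ v a ^ N * B := by
      refine norm_archEmbedding_le_iff.2 fun j w => ?_
      rw [X.coe_smul, Pi.smul_apply, smul_eq_mul, map_mul, map_pow]
      by_cases hwv : w = v
      · subst hwv
        exact mul_le_mul_of_nonneg_left (hB j) hpos.le
      · have h3 : w a ^ N ≤ 1 := pow_le_one₀ (apply_nonneg w _) (hwa w hwv).le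
        have h4 : w (x.1 j) ≤ M := norm_archEmbedding_le_iff.1 le_rfl j w
        have h5 : M ≤ v a ^ N * B := by
          rw [div_lt_iff₀ hBpos] at hN
          exact hN.le
        calc w a ^ N * w (x.1 j) ≤ 1 * M := mul_le_mul h3 h4 (apply_nonneg w _) zero_le_one
          _ ≤ _ := by rwa [one_mul]
    have h6 := h1.trans (mul_le_mul_of_nonneg_left h2 (by positivity))
    refine le_of_mul_le_mul_left (h6.trans (le_of_eq ?_)) hpos
    ring

end LocalFunctionals

end

section

open NumberField Height

/-- The hyperplane orthogonal to `y`. -/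
def orthHyperplane {K : Type*} [Field K] {n : ℕ} (y : Fin (n + 1) → K) : Submodule K (Fin (n + 1) → K) :=
  LinearMap.ker (∑ j, y j • (LinearMap.proj j : (Fin (n + 1) → K) →ₗ[K] K))

theorem mem_orthHyperplane {K : Type*} [Field K] {n : ℕ} {y x : Fin (n + 1) → K} :
    x ∈ orthHyperplane y ↔ ∑ j, x j * y j = 0 := by
  simp [orthHyperplane, LinearMap.mem_ker, LinearMap.sum_apply, mul_comm]

theorem finrank_orthHyperplane {K : Type*} [Field K] {n : ℕ} {y : Fin (n + 1) → K} (hy : y 0 ≠ 0) :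
    Module.finrank K (orthHyperplane y) = n := by
  have h0 : (∑ j, y j • (LinearMap.proj j : (Fin (n + 1) → K) →ₗ[K] K)) ≠ 0 := fun h => by
    have := LinearMap.congr_fun h (Pi.single 0 1)
    simp [LinearMap.sum_apply, Pi.single_apply] at this
    exact hy this
  have := Module.Dual.finrank_ker_add_one_of_ne_zero h0
  rw [Module.finrank_fin_fun] at this
  exact Nat.succ_injective this

section ReducedSystem

variable {K : Type*} [Field K] [NumberField K] {n : ℕ}

theorem abs_log_placeAbs_le (v : AllPlaces K) (x : K) :
    |Real.log (placeAbs v x)| ≤ logHeight₁ x := by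
  refine le_trans ?_ (abs_logAbs_le v x)
  have h : (1 : ℝ) ≤ placeMult v := by exact_mod_cast placeMult_pos v
  rw [logAbs, abs_mul, abs_of_pos (zero_lt_one.trans_le h)]
  exact le_mul_of_one_le_left (abs_nonneg _) h

theorem placeAbs_le_exp_logHeight₁ (v : AllPlaces K) (x : K) :
    placeAbs v x ≤ Real.exp (logHeight₁ x) :=
  (Real.le_exp_log _).trans (Real.exp_le_exp.2 ((le_abs_self _).trans (abs_log_placeAbs_le v x)))

theorem one_le_norm_archEmbedding {x : Fin (n + 1) → K} (hx : ∀ j, ∃ a : 𝓞 K, (a : K) = x j)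
    (hx0 : x ≠ 0) : 1 ≤ ‖archEmbedding K n x‖ := by
  obtain ⟨j, hj⟩ := Function.ne_iff.1 hx0
  obtain ⟨a, ha⟩ := hx j
  by_contra! h
  have h1 : ∀ v : InfinitePlace K, v (x j) < 1 := fun v =>
    (norm_archEmbedding_le_iff.1 le_rfl j v).trans_lt h
  have ha0 : a ≠ 0 := by
    rintro rfl
    exact hj (by simpa using ha.symm)
  have h2 := InfinitePlace.one_le_of_lt_one (w := Classical.arbitrary (InfinitePlace K)) ha0
    (fun z _ => by rw [ha]; exact h1 z)
  rw [ha] at h2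
  exact (h1 _).not_ge h2

theorem exists_integral_notMem_of_finrank_lt {y : Fin (n + 1) → K} (hy : ∀ j, y j ≠ 0) {Y : ℝ}
    (hY : ∀ j, logHeight₁ (y j) ≤ Y) (W : Submodule K (Fin (n + 1) → K))
    (hW : Module.finrank K W < n) : ∃ x ∈ orthHyperplane y, x ∉ W ∧
      (∀ j, ∃ a : 𝓞 K, (a : K) = x j) ∧ ‖archEmbedding K n x‖ ≤ Real.exp (3 * Y) := by
  have h1 : ∀ j, ∃ N : ℕ, N ≠ 0 ∧ (N : ℝ) ≤ Real.exp Y ∧ IsIntegral ℤ ((N : K) * y j) :=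
    fun j => by
      obtain ⟨N, hN, hle, h⟩ := NumberField.exists_nat_le_mulHeight₁ (y j)
      refine ⟨N, hN, hle.trans ?_, h⟩
      rw [← Real.exp_log (mulHeight₁_pos (y j)), ← logHeight₁_eq_log_mulHeight₁]
      exact Real.exp_le_exp.2 (hY j)
  choose N hN0 hNle hNint using h1
  have hNK : ∀ j, (N j : K) ≠ 0 := fun j => by exact_mod_cast hN0 j
  set u : Fin (n + 1) → Fin (n + 1) → K := fun j =>
    ((N 0 : K) * N j) • (y 0 • Pi.single j 1 - y j • Pi.single 0 1) with hu
  have huX : ∀ j, u j ∈ orthHyperplane y := fun j => by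
    refine Submodule.smul_mem _ _ (mem_orthHyperplane.2 ?_)
    simp [Pi.single_apply, sub_mul, Finset.sum_sub_distrib, mul_comm (y 0)]
  obtain ⟨j, hj⟩ : ∃ j, u j ∉ W := by
    by_contra! hcon
    have hle : orthHyperplane y ≤ W := by
      intro x hx
      have h2 : x = ∑ j, (x j / ((N 0 : K) * N j * y 0)) • u j := by
        have h3 : ∀ j, (x j / ((N 0 : K) * N j * y 0)) • u j =
            x j • Pi.single j (1 : K) - ((x j * y j) / y 0) • Pi.single 0 (1 : K) := by
          intro j
          rw [hu]
          simp only [smul_sub, smul_smul]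
          have := hNK 0
          have := hNK j
          have := hy 0
          congr 2
          · field_simp
          · field_simp
        simp_rw [h3]
        rw [Finset.sum_sub_distrib, ← Finset.sum_smul, ← Finset.sum_div,
          mem_orthHyperplane.1 hx, zero_div, zero_smul, sub_zero]
        simp_rw [← Pi.single_smul, smul_eq_mul, mul_one]
        exact (Finset.univ_sum_single x).symm
      rw [h2]
      exact Submodule.sum_mem _ fun j _ => W.smul_mem _ (hcon j)
    have := Submodule.finrank_mono hle
    rw [finrank_orthHyperplane (hy 0)] at this
    omega
  have hj0 : j ≠ 0 := by
    rintro rfl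
    exact hj (by simp [hu])
  have hval : ∀ k, u j k = N j * (N 0 * y 0) ∧ k = j ∨ u j k = -(N 0 * (N j * y j)) ∧ k = 0 ∨
      u j k = 0 := by
    intro k
    by_cases hkj : k = j
    · subst hkj
      left
      refine ⟨?_, rfl⟩
      simp [hu, hj0]
      ring
    · by_cases hk0 : k = 0
      · subst hk0
        right; left
        refine ⟨?_, rfl⟩
        simp [hu, Ne.symm hj0]
        ring
      · right; right
        simp [hu, hkj, hk0]
  have hnatint : ∀ m : ℕ, IsIntegral ℤ (m : K) := fun m => by
    simpa using isIntegral_algebraMap (R := ℤ) (A := K) (x := (m : ℤ))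
  refine ⟨u j, huX j, hj, fun k => ?_, norm_archEmbedding_le_iff.2 fun k v => ?_⟩
  · have h2 : IsIntegral ℤ (u j k) := by
      rcases hval k with ⟨h, -⟩ | ⟨h, -⟩ | h <;> rw [h]
      · exact (hnatint _).mul (hNint 0)
      · exact ((hnatint _).mul (hNint j)).neg
      · exact isIntegral_zero
    exact ⟨⟨_, h2⟩, rfl⟩
  · have hvN : ∀ m : ℕ, v (m : K) = m := fun m => by simp
    have hvy : ∀ i, v (y i) ≤ Real.exp Y := fun i =>
      (placeAbs_le_exp_logHeight₁ (Sum.inl v) (y i)).trans (Real.exp_le_exp.2 (hY i))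
    have h3 : Real.exp (3 * Y) = Real.exp Y * (Real.exp Y * Real.exp Y) := by
      rw [← Real.exp_add, ← Real.exp_add]
      ring_nf
    have hb : ∀ i k m : Fin (n + 1), (N i : ℝ) * (N k * v (y m)) ≤ Real.exp (3 * Y) := by
      intro i k m
      rw [h3]
      have := hNle i
      have := hNle k
      have := hvy m
      have := apply_nonneg v (y m)
      gcongr
    rcases hval k with ⟨h, -⟩ | ⟨h, -⟩ | h <;> rw [h]
    · rw [map_mul, map_mul, hvN, hvN]
      exact hb _ _ _
    · rw [show v (-(N 0 * (N j * y j))) = v (N 0 * (N j * y j)) from v.1.map_neg _, map_mul,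
        map_mul, hvN, hvN]
      exact hb _ _ _
    · rw [map_zero]
      positivity

end ReducedSystem

theorem exists_monotone_exponents {n : ℕ} (l : ℕ → ℝ) (hl : ∀ k < n, 1 ≤ l k)
    (hmono : ∀ i j, i ≤ j → j < n → l i ≤ l j) (hn : 2 ≤ n) :
    ∃ r : ℕ → ℕ, (∀ k < n, 1 ≤ k → l (n - 1) ≤ l k * 2 ^ r k) ∧
      (∀ k < n, (2 : ℝ) ^ r k ≤ 2 * (l (n - 1) / l (max k 1))) ∧
      ∀ i j, i ≤ j → j < n → r j ≤ r i := by
  have hmax : ∀ k < n, max k 1 < n := fun k hk => max_lt hk (by omega)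
  have hpos : ∀ k < n, 0 < l (max k 1) := fun k hk => zero_lt_one.trans_le (hl _ (hmax k hk))
  have h1 : ∀ k < n, 1 ≤ l (n - 1) / l (max k 1) := fun k hk => by
    rw [le_div_iff₀ (hpos k hk), one_mul]
    exact hmono _ _ (by have := hmax k hk; omega) (by omega)
  refine ⟨fun k => ⌈Real.logb 2 (l (n - 1) / l (max k 1))⌉₊, fun k hk hk1 => ?_, fun k hk => ?_,
    fun i j hij hj => ?_⟩
  · have h2 : l (n - 1) / l (max k 1) ≤ 2 ^ ⌈Real.logb 2 (l (n - 1) / l (max k 1))⌉₊ := by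
      rw [← Real.rpow_natCast, ← Real.logb_le_iff_le_rpow (by norm_num)
        (zero_lt_one.trans_le (h1 k hk))]
      exact Nat.le_ceil _
    rw [div_le_iff₀ (hpos k hk), mul_comm] at h2
    simp only [max_eq_left hk1] at h2 ⊢
    exact h2
  · have h3 := Nat.ceil_lt_add_one (Real.logb_nonneg (b := 2) (by norm_num) (h1 k hk))
    rw [← Real.rpow_natCast]
    refine (Real.rpow_le_rpow_of_exponent_le (by norm_num) h3.le).trans ?_
    rw [Real.rpow_add (by norm_num), Real.rpow_one, Real.rpow_logb (by norm_num) (by norm_num)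
      (zero_lt_one.trans_le (h1 k hk)), mul_comm]
  · refine Nat.ceil_mono (Real.logb_le_logb_of_le (by norm_num)
      (zero_lt_one.trans_le (h1 j hj)) ?_)
    have := hl (n - 1) (by omega)
    have h4 := hpos i (by omega)
    have h5 := hmono (max i 1) (max j 1) (by omega) (hmax j hj)
    gcongr

section ReducedSystem

variable {K : Type*} [Field K] [NumberField K] {n : ℕ}

/-- Successive minima of the integral points of the hyperplane orthogonal to `y`, with
coordinates adapted to the corresponding flag at every finite place. -/
theorem exists_reduced_system (hn : 2 ≤ n) {y : Fin (n + 1) → K} (hy : ∀ j, y j ≠ 0)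
    (hsum : ∑ j, y j = 0) {Y G : ℝ} (hY : ∀ j, logHeight₁ (y j) ≤ Y) (hG : 2 < Real.exp G)
    (hgap : ∀ x ∈ orthHyperplane y, (∀ j, ∃ a : 𝓞 K, (a : K) = x j) →
      ‖archEmbedding K n x‖ < Real.exp G → ∃ c, x = fun _ => c) :
    ∃ (l : ℕ → ℝ) (r : ℕ → ℕ) (e : FinitePlace K → Fin n → Fin (n + 1)) (c : K),
      (∀ k < n, 1 ≤ l k) ∧ l 0 ≤ 1 ∧ Real.exp G ≤ 2 * l 1 ∧ l (n - 1) ≤ Real.exp (3 * Y) ∧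
      (∀ k < n, (2 : ℝ) ^ r k ≤ 2 * (l (n - 1) / l (max k 1))) ∧ (∀ k < n, r k ≤ r 0) ∧
      (∀ v, Function.Injective (e v)) ∧ c ≠ 0 ∧ (∀ j, ∃ a : 𝓞 K, (a : K) = c * y j) ∧
      (∀ j, ∀ v : InfinitePlace K, v (c * y j) ≤ n.factorial * ∏ i : Fin n, (2 * l i)) ∧
      ∀ x ∈ orthHyperplane y,
        (∀ v : FinitePlace K, ∀ i : Fin n, v (x (e v i)) ≤ v ((2 ^ r i : ℕ) : K)) →
        (¬ ∃ c, x = fun _ => c) → l (n - 1) ≤ ‖archEmbedding K n x‖ := by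
  set X := orthHyperplane y with hX
  set I : Set (Fin (n + 1) → K) := {x | ∀ j, ∃ a : 𝓞 K, (a : K) = x j} with hI
  have hone : (fun _ => 1 : Fin (n + 1) → K) ∈ X := mem_orthHyperplane.2 (by simpa using hsum)
  have hone0 : (fun _ => 1 : Fin (n + 1) → K) ≠ 0 := fun h => one_ne_zero (congrFun h 0)
  have hfr : Module.finrank K X = n := finrank_orthHyperplane (hy 0)
  obtain ⟨z, l, W, hW0, hWspan, hz, hmono, hW⟩ := exists_minima_flag X I
    (fun x _ => by
      obtain ⟨N, hN, h⟩ := exists_nat_mul_integral x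
      exact ⟨N, by exact_mod_cast hN, h⟩) (fun x => ‖archEmbedding K n x‖)
    (fun x hx hx0 => one_le_norm_archEmbedding hx hx0)
  rw [hfr] at hz hmono hW
  have hWmono : ∀ i j, i ≤ j → W i ≤ W j := fun i j hij => by
    rw [hWspan, hWspan]
    exact Submodule.span_mono (Set.image_mono (Set.Iio_subset_Iio hij))
  have hzW : ∀ i j, i < j → z i ∈ W j := fun i j hij => by
    rw [hWspan]
    exact Submodule.subset_span ⟨i, hij, rfl⟩
  have hl1 : ∀ k < n, 1 ≤ l k := fun k hk => (hz k hk).2.2.2.2.1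
  have hl0 : l 0 ≤ 1 := by
    refine ((hz 0 (by omega)).2.2.2.2.2 _ (fun j => ⟨1, by simp⟩) hone ?_).trans
      (norm_archEmbedding_le_iff.2 fun j v => by simp)
    rw [hW0]
    exact hone0
  have hz0 : ∃ c, z 0 = fun _ => c := by
    obtain ⟨h1, h2, -, h4, -⟩ := hz 0 (by omega)
    exact hgap _ h2 h1 (by linarith)
  have hWone : (fun _ => 1 : Fin (n + 1) → K) ∈ W 1 := by
    obtain ⟨c, hc⟩ := hz0
    have hc0 : c ≠ 0 := by
      rintro rfl
      refine (hz 0 (by omega)).2.2.1 ?_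
      rw [hc]
      exact (W 0).zero_mem
    have h1 := (W 1).smul_mem c⁻¹ (hzW 0 1 one_pos)
    rw [hc] at h1
    convert h1 using 1
    ext
    simp [hc0]
  have hconstW : ∀ c : K, (fun _ => c : Fin (n + 1) → K) ∈ W 1 := fun c => by
    convert (W 1).smul_mem c hWone using 1
    ext
    simp
  have hW1const : ∀ x ∈ W 1, ∃ c, x = fun _ => c := by
    intro x hx
    obtain ⟨c, hc⟩ := hz0
    rw [hWspan, show z '' Set.Iio 1 = {z 0} by
      rw [show (Set.Iio 1 : Set ℕ) = {0} by ext; simp, Set.image_singleton], hc] at hx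
    obtain ⟨a, rfl⟩ := Submodule.mem_span_singleton.1 hx
    exact ⟨a * c, rfl⟩
  have hl1G : Real.exp G ≤ 2 * l 1 := by
    obtain ⟨h1, h2, h3, h4, -⟩ := hz 1 (by omega)
    by_contra! hlt
    obtain ⟨c, hc⟩ := hgap _ h2 h1 (h4.trans_lt hlt)
    exact h3 (hc ▸ hconstW c)
  have hlast : l (n - 1) ≤ Real.exp (3 * Y) := by
    obtain ⟨x, hxX, hxW, hxI, hxn⟩ := exists_integral_notMem_of_finrank_lt hy hY (W (n - 1))
      (by rw [(hW (n - 1) (by omega)).2]; omega)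
    exact ((hz (n - 1) (by omega)).2.2.2.2.2 x hxI hxX hxW).trans hxn
  obtain ⟨r, hr1, hr2, hr3⟩ := exists_monotone_exponents l hl1 hmono hn
  have hdom : ∀ v : FinitePlace K, ∃ e : Fin n → Fin (n + 1), Function.Injective e ∧
      ∀ k ≤ n, ∀ x ∈ W k, ∀ B, 0 ≤ B → (∀ i : Fin n, (i : ℕ) < k → v (x (e i)) ≤ B) →
        ∀ j, v (x j) ≤ B := by
    intro v
    obtain ⟨i₀, -, h1⟩ := exists_dominating_erase (placeAbs (Sum.inr v))
      (placeAbs_isNonarchimedean v) (W n) Finset.univ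
      (by rw [(hW n le_rfl).2, Finset.card_univ, Fintype.card_fin]; omega)
      (fun z _ B _ h j => h j (Finset.mem_univ j))
    obtain ⟨e, he1, -, -, he⟩ := exists_dominating_enumeration (placeAbs (Sum.inr v))
      (placeAbs_isNonarchimedean v) W n (Finset.univ.erase i₀)
      (by rw [Finset.card_erase_of_mem (Finset.mem_univ _), Finset.card_univ, Fintype.card_fin,
        Nat.add_sub_cancel]) (fun k hk => (hW k hk).2.le) (fun k _ => hWmono k _ k.le_succ) h1
    exact ⟨fun i => e i, fun i j hij => Fin.ext (he1 i.2 j.2 hij), fun k hk x hx B hB h =>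
      he k hk x hx B hB fun i hi => h ⟨i, hi.trans_le hk⟩ hi⟩
  choose e he1 he2 using hdom
  have hWn : W n = X := Submodule.eq_of_le_of_finrank_eq (hW n le_rfl).1
    ((hW n le_rfl).2.trans hfr.symm)
  have hzind : LinearIndependent K fun i : Fin n => z i := by
    rw [linearIndependent_iff_card_eq_finrank_span, Fintype.card_fin, Set.finrank]
    have : Set.range (fun i : Fin n => z i) = z '' Set.Iio n := by
      ext x
      constructor
      · rintro ⟨i, rfl⟩
        exact ⟨i, i.2, rfl⟩
      · rintro ⟨i, hi, rfl⟩
        exact ⟨⟨i, hi⟩, rfl⟩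
    rw [this, ← hWspan, (hW n le_rfl).2]
  obtain ⟨c, hc0, hc⟩ := exists_smul_integral_of_linearIndependent y (hy 0) (fun i : Fin n => z i)
    hzind (fun i => mem_orthHyperplane.1 (hz i i.2).2.1) (fun i => (hz i i.2).1)
    (fun i => 2 * l i) (fun i j v => norm_archEmbedding_le_iff.1 (hz i i.2).2.2.2.1 j v)
  refine ⟨l, r, e, c, hl1, hl0, hl1G, hlast, hr2, fun k hk => hr3 0 k (Nat.zero_le k) hk, he1, hc0,
    fun j => (hc j).1, fun j => (hc j).2, fun x hx hloc hnc => ?_⟩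
  have hex : ∃ k, x ∈ W k := ⟨n, hWn ▸ hx⟩
  classical
  set k := Nat.find hex with hk
  have hkn : k ≤ n := Nat.find_min' hex (hWn ▸ hx)
  have hkx : x ∈ W k := Nat.find_spec hex
  have hk2 : 2 ≤ k := by
    by_contra! hlt
    exact hnc (hW1const x (hWmono k 1 (by omega) hkx))
  obtain ⟨k', hk'⟩ : ∃ k', k = k' + 1 := ⟨k - 1, by omega⟩
  have hk'x : x ∉ W k' := Nat.find_min hex (by omega)
  have h2K : (((2 ^ r k' : ℕ)) : K) ≠ 0 := Nat.cast_ne_zero.2 (by positivity)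
  have hnat : ∀ (v : FinitePlace K) (m : ℕ), v (m : K) ≤ 1 := fun v m => by
    simpa using FinitePlace.apply_integer_le_one v (m : 𝓞 K)
  have hxint : (((2 ^ r k' : ℕ) : K)⁻¹ • x) ∈ I := by
    intro j
    refine exists_integer_of_forall_finitePlace_le_one fun v => ?_
    have hvpos : 0 < v (((2 ^ r k' : ℕ)) : K) := v.1.pos h2K
    rw [Pi.smul_apply, smul_eq_mul, map_mul, map_inv₀, inv_mul_le_one₀ hvpos]
    refine he2 v k hkn x hkx _ hvpos.le (fun i hi => (hloc v i).trans ?_) j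
    have h3 : r k' ≤ r i := hr3 i k' (by omega) (by omega)
    rw [← Nat.add_sub_of_le h3, pow_add, Nat.cast_mul, map_mul]
    exact mul_le_of_le_one_right hvpos.le (hnat v _)
  have h4 := (hz k' (by omega)).2.2.2.2.2 _ hxint (X.smul_mem _ hx) fun hmem =>
    hk'x ((Submodule.smul_mem_iff _ (inv_ne_zero h2K)).1 hmem)
  have h5 : ‖archEmbedding K n (((2 ^ r k' : ℕ) : K)⁻¹ • x)‖ ≤
      ((2 : ℝ) ^ r k')⁻¹ * ‖archEmbedding K n x‖ := by
    refine norm_archEmbedding_le_iff.2 fun j v => ?_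
    rw [Pi.smul_apply, smul_eq_mul, map_mul, map_inv₀]
    have h6 : ∀ m : ℕ, v (m : K) = m := fun m => by simp
    rw [h6, Nat.cast_pow, Nat.cast_two]
    exact mul_le_mul_of_nonneg_left (norm_archEmbedding_le_iff.1 le_rfl j v) (by positivity)
  have h7 := hr1 k' (by omega) (by omega)
  have h8 : (0 : ℝ) < 2 ^ r k' := by positivity
  have h9 := h4.trans h5
  rw [le_inv_mul_iff₀ h8, mul_comm] at h9
  exact h7.trans h9

end ReducedSystem

section OutMass

variable {K : Type*} [Field K] [NumberField K]

open scoped Classical in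
/-- The total logarithmic size of `x` at the places outside `S`. -/
noncomputable def outMass (S : Finset (AllPlaces K)) (x : K) : ℝ :=
  ∑ᶠ v, if v ∈ S then 0 else |logAbs v x|

open scoped Classical in
theorem support_outMass_finite (S : Finset (AllPlaces K)) (x : K) :
    (fun v => if v ∈ S then 0 else |logAbs v x|).support.Finite := by
  rcases eq_or_ne x 0 with rfl | hx
  · simp [logAbs]
  · refine (finite_logAbs_ne_zero hx).subset fun v hv h => hv ?_
    simp [h]

theorem outMass_nonneg (S : Finset (AllPlaces K)) (x : K) : 0 ≤ outMass S x :=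
  finsum_nonneg fun v => by split_ifs <;> positivity

theorem outMass_inv (S : Finset (AllPlaces K)) (x : K) : outMass S x⁻¹ = outMass S x := by
  simp [outMass, logAbs_inv]

theorem outMass_one (S : Finset (AllPlaces K)) : outMass S (1 : K) = 0 := by
  simp [outMass]

theorem outMass_mul_le (S : Finset (AllPlaces K)) {x y : K} (hx : x ≠ 0) (hy : y ≠ 0) :
    outMass S (x * y) ≤ outMass S x + outMass S y := by
  classical
  rw [outMass, outMass, outMass, ← finsum_add_distrib (support_outMass_finite S x)
    (support_outMass_finite S y)]
  refine finsum_le_finsum' (support_outMass_finite S _) (((support_outMass_finite S x).union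
    (support_outMass_finite S y)).subset (Function.support_add _ _)) fun v => ?_
  dsimp only
  split_ifs
  · simp
  · rw [logAbs_mul v hx hy]
    exact abs_add_le _ _

theorem outMass_le (S : Finset (AllPlaces K)) (x : K) : outMass S x ≤ 2 * logHeight₁ x := by
  classical
  rw [outMass, finsum_eq_sum _ (support_outMass_finite S x)]
  refine (Finset.sum_le_sum fun v _ => ?_).trans (sum_abs_logAbs_le x _)
  split_ifs
  · exact abs_nonneg _
  · exact le_rfl

theorem outMass_eq_zero (S : Finset (AllPlaces K)) {x : K} (h : ∀ v ∉ S, logAbs v x = 0) :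
    outMass S x = 0 := by
  refine (finsum_congr fun v => ?_).trans finsum_zero
  split_ifs with hv
  · rfl
  · rw [h v hv, abs_zero]

/-- Product formula with a comparison outside `S`. -/
theorem neg_sum_logAbs_le_outMass (S : Finset (AllPlaces K)) {x y : K} (hx : x ≠ 0)
    (h : ∀ v ∉ S, logAbs v x ≤ |logAbs v y|) : -∑ v ∈ S, logAbs v x ≤ outMass S y := by
  classical
  have h1 := finsum_logAbs hx
  have h2 : (fun v => if v ∈ S then logAbs v x else 0).support.Finite :=
    S.finite_toSet.subset fun v hv => by
      by_contra hvS
      exact hv (if_neg hvS)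
  have h3 : (fun v => if v ∈ S then 0 else logAbs v x).support.Finite :=
    (finite_logAbs_ne_zero hx).subset fun v hv hv0 => hv (by simp [hv0])
  have h4 : ∑ᶠ v, (if v ∈ S then logAbs v x else 0) = ∑ v ∈ S, logAbs v x := by
    rw [finsum_eq_sum_of_support_subset (s := S)]
    · exact Finset.sum_congr rfl fun v hv => if_pos hv
    · intro v hv
      by_contra hvS
      exact hv (if_neg hvS)
  have h5 : ∑ᶠ v, logAbs v x = ∑ᶠ v, (if v ∈ S then logAbs v x else 0) +
      ∑ᶠ v, (if v ∈ S then 0 else logAbs v x) := by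
    rw [← finsum_add_distrib h2 h3]
    refine finsum_congr fun v => ?_
    split_ifs <;> simp
  have h6 : ∑ᶠ v, (if v ∈ S then 0 else logAbs v x) ≤ outMass S y := by
    refine finsum_le_finsum' h3 (support_outMass_finite S y) fun v => ?_
    dsimp only
    split_ifs with hv
    · exact le_rfl
    · exact h v hv
  linarith

end OutMass

theorem exists_missing_index {n : ℕ} {e : Fin n → Fin (n + 1)} (he : Function.Injective e)
    (r : Fin n → ℕ) {R : ℕ} (hr : ∀ i, r i ≤ R) : ∃ (j₀ : Fin (n + 1)) (s : Fin (n + 1) → ℕ),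
      (∀ i, e i ≠ j₀) ∧ (∀ j ≠ j₀, ∃ i, e i = j ∧ s j = r i) ∧ (∀ j, s j ≤ R) ∧
      ∑ j ∈ Finset.univ.erase j₀, s j = ∑ i, r i := by
  classical
  obtain ⟨j₀, hj₀⟩ : ∃ j₀, ∀ i, e i ≠ j₀ := by
    by_contra! h
    have := Fintype.card_le_of_surjective e h
    simp at this
  have himg : Finset.univ.image e = Finset.univ.erase j₀ := by
    refine Finset.eq_of_subset_of_card_le (fun j hj => ?_) ?_
    · obtain ⟨i, -, rfl⟩ := Finset.mem_image.1 hj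
      exact Finset.mem_erase.2 ⟨hj₀ i, Finset.mem_univ _⟩
    · rw [Finset.card_image_of_injective _ he, Finset.card_erase_of_mem (Finset.mem_univ _)]
      simp
  have hs : ∀ i, Function.extend e r 0 (e i) = r i := fun i => he.extend_apply r 0 i
  have hsurj : ∀ j ≠ j₀, ∃ i, e i = j := fun j hj => by
    have : j ∈ Finset.univ.image e := himg ▸ Finset.mem_erase.2 ⟨hj, Finset.mem_univ _⟩
    simpa using this
  refine ⟨j₀, Function.extend e r 0, hj₀, fun j hj => ?_, fun j => ?_, ?_⟩
  · obtain ⟨i, rfl⟩ := hsurj j hj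
    exact ⟨i, rfl, hs i⟩
  · by_cases hj : j = j₀
    · rw [hj, Function.extend_apply' _ _ _ fun ⟨i, hi⟩ => hj₀ i hi]
      exact Nat.zero_le _
    · obtain ⟨i, rfl⟩ := hsurj j hj
      rw [hs]
      exact hr i
  · rw [← himg, Finset.sum_image fun i _ j _ h => he h]
    exact Finset.sum_congr rfl fun i _ => hs i

section ReducedForms

variable (K : Type*) [Field K] [NumberField K]

/-- The Cramer basis vector of the hyperplane orthogonal to `y` supported on two coordinates. -/
def twoTerm {K : Type*} [Field K] {n : ℕ} (y : Fin (n + 1) → K) (i j : Fin (n + 1)) :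
    Fin (n + 1) → K :=
  (y j)⁻¹ • Pi.single j 1 - (y i)⁻¹ • Pi.single i 1

theorem twoTerm_mem {K : Type*} [Field K] {n : ℕ} {y : Fin (n + 1) → K} (hy : ∀ j, y j ≠ 0)
    (i j : Fin (n + 1)) : twoTerm y i j ∈ orthHyperplane y := by
  refine mem_orthHyperplane.2 ?_
  simp [twoTerm, Pi.single_apply, sub_mul, Finset.sum_sub_distrib, hy]

set_option maxHeartbeats 600000 in
theorem exists_reduced_forms {n : ℕ} (hn : 2 ≤ n) : ∃ (ρ : ℕ) (C : ℝ), 0 < C ∧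
    ∀ (y : Fin (n + 1) → K), (∀ j, y j ≠ 0) → ∑ j, y j = 0 → ∀ Y G : ℝ, C ≤ G →
    (∀ j, logHeight₁ (y j) ≤ Y) →
    (∀ x ∈ orthHyperplane y, (∀ j, ∃ a : 𝓞 K, (a : K) = x j) →
      ‖archEmbedding K n x‖ < Real.exp G → ∃ c, x = fun _ => c) →
    ∃ (p : AllPlaces K → Fin (n + 1)) (b : AllPlaces K → Fin (n + 1) → ℝ)
      (f : Fin ρ → Fin (n + 1) → K),
      (∀ s, f s 0 = 0) ∧
      (∀ u : Fin (n + 1) → K, (∀ s, ∑ j, u j * f s j = 0) → ∃ c, ∀ j ≠ 0, u j = c * y j) ∧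
      (∀ v s, ∀ j ≠ p v, placeAbs v (f s j - f s (p v)) ≤ Real.exp (b v j)) ∧
      (∀ (v : FinitePlace K) j, v (2 : K) = 1 →
        b (Sum.inr v) j = -Real.log (placeAbs (Sum.inr v) (y j))) ∧
      (∀ v j, |b v j| ≤ C * (1 + Y)) ∧
      ∀ S : Finset (AllPlaces K), (∀ v : InfinitePlace K, Sum.inl v ∈ S) →
        (∀ v ∉ S, placeAbs v (2 : K) = 1) →
        ∑ v ∈ S, (placeMult v : ℝ) * ∑ j ∈ Finset.univ.erase (p v), b v j ≤
          C - G + 2 * ∑ j, outMass S (y j) := by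
  obtain ⟨ρ, C₀, hC₀, hfun⟩ := exists_local_functionals K n
  set d : ℝ := (Module.finrank ℚ K : ℝ) with hd
  have hd1 : 1 ≤ d := Nat.one_le_cast.2 Module.finrank_pos
  have hlog2 : 0 < Real.log 2 := Real.log_pos one_lt_two
  set E : ℝ := n * |Real.log C₀| + 2 * (n * Real.log 2) + Real.log n.factorial + Real.log 2 with hE
  have hfact : 0 ≤ Real.log n.factorial := Real.log_natCast_nonneg _
  have hE0 : 0 ≤ E := by positivity
  have hh2 : 0 ≤ logHeight₁ (2 : K) := zero_le_logHeight₁ _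
  refine ⟨ρ, 1 + 4 * C₀ + (5 * logHeight₁ (2 : K) + 1) + (|Real.log C₀| + 4) + d * E,
    by positivity, fun y hy hsum Y G hG hY hgap => ?_⟩
  have habs : 0 ≤ |Real.log C₀| := abs_nonneg _
  have hdE : 0 ≤ d * E := by positivity
  have hG0 : 0 ≤ G := le_trans (by positivity) hG
  have hexpG : 1 + 4 * C₀ + 1 ≤ Real.exp G := by
    have := Real.add_one_le_exp G
    linarith
  have hY0 : 0 ≤ Y := (zero_le_logHeight₁ _).trans (hY 0)
  obtain ⟨l, r, e, c, hl1, hl0, hGl, hlY, hr, hr0, he, hc0, hcint, hcy, hlow⟩ :=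
    exists_reduced_system hn hy hsum hY (by linarith) hgap
  have hlpos : ∀ k < n, 0 < l k := fun k hk => zero_lt_one.trans_le (hl1 k hk)
  set Λ := l (n - 1) with hΛ
  have hΛ1 : 1 ≤ Λ := hl1 _ (by omega)
  have hΛ0 : 0 < Λ := hlpos _ (by omega)
  have hl1pos : 0 < l 1 := hlpos 1 (by omega)
  have hRΛ : C₀ * ((2 ^ r 0 : ℕ) : ℝ) ≤ Λ := by
    have h1 := hr 0 (by omega)
    rw [max_eq_right zero_le_one, ← mul_div_assoc, le_div_iff₀ hl1pos] at h1
    push_cast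
    have h2 : (0 : ℝ) < 2 ^ r 0 := by positivity
    nlinarith [mul_le_mul_of_nonneg_left (show 2 * C₀ ≤ l 1 by linarith) h2.le]
  obtain ⟨L, hLc, hLspan, hLfin, hLinf⟩ := hfun (orthHyperplane y) e (fun i => 2 ^ r i) (2 ^ r 0) Λ
    (fun i => pow_dvd_pow 2 (hr0 i i.2)) (by positivity) hΛ0 hRΛ
    (mem_orthHyperplane.2 (by simpa using hsum)) hlow
  have hmiss := fun v => exists_missing_index (he v) (fun i => r i) (fun i => hr0 i i.2)
  choose p₁ s hp₁ hs hs0 hssum using hmiss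
  have hmaxv : ∀ v : InfinitePlace K, ∃ i, ∀ j, v (y j) ≤ v (y i) := fun v =>
    Finite.exists_max fun j => v (y j)
  choose p₂ hp₂ using hmaxv
  set p : AllPlaces K → Fin (n + 1) := Sum.elim p₂ p₁ with hp
  set a : AllPlaces K → Fin (n + 1) → ℝ := Sum.elim (fun _ _ => Real.log (C₀ / Λ))
    fun v j => -(s v j * Real.log (v 2)) with ha
  set u : Fin (n + 1) → Fin (n + 1) → orthHyperplane y := fun i j => ⟨twoTerm y i j, twoTerm_mem hy i j⟩ with hu
  have husub : ∀ i j, u 0 j - u 0 i = u i j := fun i j => Subtype.ext (by simp [hu, twoTerm])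
  have hr0Y : (r 0 : ℝ) ≤ 1 + 5 * Y := by
    have h1 := hr 0 (by omega)
    rw [max_eq_right zero_le_one] at h1
    have h2 : Λ / l 1 ≤ Real.exp (3 * Y) :=
      (div_le_self hΛ0.le (hl1 1 (by omega))).trans hlY
    have h3 := Real.log_le_log (by positivity) (h1.trans (mul_le_mul_of_nonneg_left h2 zero_le_two))
    rw [Real.log_pow, Real.log_mul two_ne_zero (Real.exp_ne_zero _), Real.log_exp] at h3
    have h4 := Real.log_two_gt_d9
    by_contra! hlt
    nlinarith
  refine ⟨p, fun v j => a v j - Real.log (placeAbs v (y j)), fun k j => L k (u 0 j), fun k => ?_,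
    fun w hw => ?_, ?_, fun v j hv => ?_, ?_, fun S hS hS2 => ?_⟩
  · show L k (u 0 0) = 0
    rw [show u 0 0 = 0 from Subtype.ext (by simp [hu, twoTerm]), map_zero]
  · obtain ⟨c', hc'⟩ := hLspan (∑ j, w j • u 0 j) fun k => by simpa using hw k
    refine ⟨c', fun j hj => ?_⟩
    have h1 := congrFun hc' j
    simp only [hu, Submodule.coe_sum, Submodule.coe_smul, Finset.sum_apply, Pi.smul_apply, twoTerm,
      Pi.sub_apply, smul_eq_mul, Pi.single_apply, if_neg hj] at h1
    simp only [mul_ite, mul_one, mul_zero, sub_zero, Finset.sum_ite_eq, Finset.mem_univ,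
      if_true] at h1
    rw [← h1, mul_assoc, inv_mul_cancel₀ (hy j), mul_one]
  · intro v k j hj
    rw [← map_sub, husub]
    have hyv := placeAbs_pos v (hy j)
    rw [Real.exp_sub, Real.exp_log hyv, le_div_iff₀ hyv, ← map_mul]
    rcases v with v | v
    · rw [show a (Sum.inl v) j = Real.log (C₀ / Λ) from rfl, Real.exp_log (by positivity)]
      have h1 := hLinf k v (y j • u (p₂ v) j) 1 fun i => ?_
      · rw [map_smul, smul_eq_mul, mul_comm, mul_one] at h1
        exact h1
      · have hj' : j ≠ p₂ v := hj
        have hpos : 0 < v (y (p₂ v)) := v.1.pos (hy _)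
        simp only [hu, Submodule.coe_smul, twoTerm, Pi.smul_apply, Pi.sub_apply, smul_eq_mul,
          Pi.single_apply]
        split_ifs with h2 h3 h3
        · exact absurd (h2.symm.trans h3) hj'
        · simp [hy j]
        · rw [mul_zero, zero_sub, mul_one, mul_neg, show v (-(y j * (y (p₂ v))⁻¹)) =
            v (y j * (y (p₂ v))⁻¹) from v.1.map_neg _, map_mul, map_inv₀]
          rw [← div_eq_mul_inv, div_le_one hpos]
          exact hp₂ v j
        · simp
    · obtain ⟨i, hij, hsi⟩ := hs v j hj
      have h2pos : 0 < v (2 : K) := v.1.pos two_ne_zero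
      have h1 := hLfin k v (((2 : K) ^ r i * y j) • u (p₁ v) j) fun i' => ?_
      · rw [map_smul, smul_eq_mul, mul_assoc, map_mul, map_pow, mul_comm (y j)] at h1
        rw [show a (Sum.inr v) j = -(s v j * Real.log (v 2)) from rfl, Real.exp_neg, hsi,
          ← Real.log_pow, Real.exp_log (by positivity)]
        rw [← one_div, le_div_iff₀ (by positivity), mul_comm]
        exact h1
      · have h3 : e v i' ≠ p₁ v := hp₁ v i'
        simp only [hu, Submodule.coe_smul, twoTerm, Pi.smul_apply, Pi.sub_apply, smul_eq_mul,
          Pi.single_apply, if_neg h3]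
        split_ifs with h4
        · obtain rfl : i' = i := he v (h4.trans hij.symm)
          refine le_of_eq (congrArg v ?_)
          have := hy j
          push_cast
          field_simp
          simp
        · simp
  · simp [ha, hv]
  · intro v j
    have h1 := (abs_log_placeAbs_le v (y j)).trans (hY j)
    refine (abs_sub _ _).trans ?_
    have h2 : |a v j| ≤ (5 * logHeight₁ (2 : K) + (|Real.log C₀| + 3)) * (1 + Y) := by
      rcases v with v | v
      · rw [show a (Sum.inl v) j = Real.log (C₀ / Λ) from rfl, Real.log_div hC₀.ne' hΛ0.ne']
        have h3 : Real.log Λ ≤ 3 * Y := (Real.log_le_iff_le_exp hΛ0).2 hlY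
        have h4 := Real.log_nonneg hΛ1
        refine (abs_sub _ _).trans ?_
        rw [abs_of_nonneg h4]
        nlinarith [mul_nonneg hh2 hY0, mul_nonneg habs hY0]
      · rw [show a (Sum.inr v) j = -(s v j * Real.log (v 2)) from rfl, abs_neg, abs_mul,
          Nat.abs_cast]
        have h3 : (s v j : ℝ) ≤ 1 + 5 * Y := le_trans (by exact_mod_cast hs0 v j) hr0Y
        have h4 : |Real.log (v 2)| ≤ logHeight₁ (2 : K) := abs_log_placeAbs_le (Sum.inr v) 2
        refine (mul_le_mul h3 h4 (abs_nonneg _) (by positivity)).trans ?_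
        nlinarith [mul_nonneg hh2 hY0, mul_nonneg habs hY0]
    nlinarith [mul_nonneg hh2 hY0, mul_nonneg habs hY0, mul_nonneg hC₀.le hY0,
      mul_nonneg hdE hY0]
  · set R : ℝ := ∑ i : Fin n, (r i : ℝ) with hR
    set M : ℝ := Real.log n.factorial + (n * Real.log 2 + ∑ i : Fin n, Real.log (l i)) with hM
    set ι : AllPlaces K → ℝ := Sum.elim (fun _ => 1) (fun _ => 0) with hι
    have hcard : ∀ v, (Finset.univ.erase (p v)).card = n := fun v => by
      rw [Finset.card_erase_of_mem (Finset.mem_univ _), Finset.card_univ, Fintype.card_fin,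
        Nat.add_sub_cancel]
    have hterm : ∀ v, (placeMult v : ℝ) * ∑ j ∈ Finset.univ.erase (p v),
        (a v j - Real.log (placeAbs v (y j))) ≤
        ι v * placeMult v * (n * Real.log (C₀ / Λ) + M + R * Real.log 2) - R * logAbs v 2 -
          ∑ j, logAbs v (y j) - logAbs v c := by
      intro v
      have h1 : (placeMult v : ℝ) * ∑ j ∈ Finset.univ.erase (p v),
          (a v j - Real.log (placeAbs v (y j))) =
          placeMult v * ∑ j ∈ Finset.univ.erase (p v), a v j - ∑ j, logAbs v (y j) +
            (logAbs v (c * y (p v)) - logAbs v c) := by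
        rw [logAbs_mul v hc0 (hy _), ← Finset.sum_erase_add _ _ (Finset.mem_univ (p v)),
          Finset.sum_sub_distrib, mul_sub, Finset.mul_sum _ (fun j => Real.log _)]
        simp only [logAbs]
        ring
      rw [h1]
      rcases v with v | v
      · have h2 : logAbs (Sum.inl v) (c * y (p (Sum.inl v))) ≤ v.mult * M := by
          refine mul_le_mul_of_nonneg_left ?_ (Nat.cast_nonneg _)
          have h3 := Real.log_le_log (placeAbs_pos (Sum.inl v) (mul_ne_zero hc0 (hy _)))
            (hcy (p (Sum.inl v)) v)
          have h4 : ∀ i : Fin n, l i ≠ 0 := fun i => (hlpos i i.2).ne'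
          rw [Real.log_mul (by positivity) (Finset.prod_ne_zero_iff.2 fun i _ =>
            mul_ne_zero two_ne_zero (h4 i)), Real.log_prod fun i _ =>
            mul_ne_zero two_ne_zero (h4 i)] at h3
          simp only [Real.log_mul two_ne_zero (h4 _), Finset.sum_add_distrib, Finset.sum_const,
            Finset.card_univ, Fintype.card_fin, nsmul_eq_mul] at h3
          exact h3
        have h5 : logAbs (Sum.inl v : AllPlaces K) (2 : K) = v.mult * Real.log 2 := by
          have h6 : ∀ m : ℕ, v (m : K) = m := fun m => by simp
          show (v.mult : ℝ) * Real.log (v (2 : K)) = _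
          rw [← Nat.cast_ofNat, h6, Nat.cast_ofNat]
        have h6 : ∑ j ∈ Finset.univ.erase (p (Sum.inl v)), a (Sum.inl v) j =
            n * Real.log (C₀ / Λ) := by
          simp only [ha, Sum.elim_inl, Finset.sum_const, hcard, nsmul_eq_mul]
        rw [h5, h6, show ι (Sum.inl v) = 1 from rfl, show placeMult (Sum.inl v) = v.mult from rfl]
        linarith only [h2]
      · have h2 : logAbs (Sum.inr v) (c * y (p (Sum.inr v))) ≤ 0 := by
          obtain ⟨x, hx⟩ := hcint (p (Sum.inr v))
          rw [← hx]
          exact mul_nonpos_of_nonneg_of_nonpos (Nat.cast_nonneg _)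
            (Real.log_nonpos (apply_nonneg _ _) (FinitePlace.apply_integer_le_one v x))
        have h5 : logAbs (Sum.inr v : AllPlaces K) (2 : K) = Real.log (v 2) := by
          show ((1 : ℕ) : ℝ) * Real.log (v 2) = _
          rw [Nat.cast_one, one_mul]
        have h6 : ∑ j ∈ Finset.univ.erase (p (Sum.inr v)), a (Sum.inr v) j =
            -(R * Real.log (v 2)) := by
          simp only [ha, Sum.elim_inr, Finset.sum_neg_distrib, ← Finset.sum_mul]
          rw [hR, ← Nat.cast_sum, ← Nat.cast_sum, ← hssum v]
          rfl
        rw [h5, h6, show ι (Sum.inr v) = 0 from rfl,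
          show placeMult (Sum.inr v : AllPlaces K) = 1 from rfl]
        push_cast
        linarith only [h2]
    refine (Finset.sum_le_sum fun v _ => hterm v).trans ?_
    rw [Finset.sum_sub_distrib, Finset.sum_sub_distrib, Finset.sum_sub_distrib, ← Finset.sum_mul,
      ← Finset.mul_sum, Finset.sum_comm]
    have hιsum : ∑ v ∈ S, ι v * placeMult v = d := by
      rw [hd, ← InfinitePlace.sum_mult_eq, Nat.cast_sum]
      rw [← Finset.sum_subset (s₁ := Finset.univ.map ⟨Sum.inl, Sum.inl_injective⟩)]
      · rw [Finset.sum_map]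
        simp [ι, placeMult]
      · intro v hv
        obtain ⟨w, -, rfl⟩ := Finset.mem_map.1 hv
        exact hS w
      · rintro (v | v) - hv
        · exact absurd (Finset.mem_map.2 ⟨v, Finset.mem_univ _, rfl⟩) hv
        · simp [ι]
    have h2sum : -∑ v ∈ S, logAbs v (2 : K) ≤ 0 := by
      have := neg_sum_logAbs_le_outMass S (x := (2 : K)) (y := 1) two_ne_zero fun v hv => by
        simp [logAbs, hS2 v hv]
      rwa [outMass_one] at this
    have hysum : -∑ j, ∑ v ∈ S, logAbs v (y j) ≤ ∑ j, outMass S (y j) := by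
      rw [← Finset.sum_neg_distrib]
      exact Finset.sum_le_sum fun j _ => neg_sum_logAbs_le_outMass S (hy j) fun v _ => le_abs_self _
    have hcsum : -∑ v ∈ S, logAbs v c ≤ outMass S (y 0) := by
      refine neg_sum_logAbs_le_outMass S hc0 fun v hv => ?_
      rcases v with v | v
      · exact absurd (hS v) hv
      · obtain ⟨x, hx⟩ := hcint 0
        have h3 : logAbs (Sum.inr v) (c * y 0) ≤ 0 := by
          rw [← hx]
          exact mul_nonpos_of_nonneg_of_nonpos (Nat.cast_nonneg _)
            (Real.log_nonpos (apply_nonneg _ _) (FinitePlace.apply_integer_le_one v x))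
        rw [logAbs_mul _ hc0 (hy 0)] at h3
        linarith [neg_abs_le (logAbs (Sum.inr v) (y 0))]
    have hy0sum : outMass S (y 0) ≤ ∑ j, outMass S (y j) :=
      Finset.single_le_sum (f := fun j => outMass S (y j)) (fun j _ => outMass_nonneg S _)
        (Finset.mem_univ 0)
    have hRlog : R * Real.log 2 ≤
        n * Real.log 2 + (n * Real.log Λ - ∑ i : Fin n, Real.log (l (max i 1))) := by
      have h3 : ∀ i : Fin n, (r i : ℝ) * Real.log 2 ≤
          Real.log 2 + (Real.log Λ - Real.log (l (max i 1))) := fun i => by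
        have h4 : 0 < l (max i 1) := hlpos _ (max_lt i.2 (by omega))
        have h5 := Real.log_le_log (by positivity) (hr i i.2)
        rwa [Real.log_pow, Real.log_mul two_ne_zero (by positivity),
          Real.log_div hΛ0.ne' h4.ne'] at h5
      rw [hR, Finset.sum_mul]
      refine (Finset.sum_le_sum fun i _ => h3 i).trans (le_of_eq ?_)
      rw [Finset.sum_add_distrib, Finset.sum_sub_distrib]
      simp
    have htel : ∑ i : Fin n, Real.log (l i) - ∑ i : Fin n, Real.log (l (max i 1)) ≤
        Real.log 2 - G := by
      rw [← Finset.sum_sub_distrib, Finset.sum_eq_single (⟨0, by omega⟩ : Fin n)]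
      · have h3 : Real.log (l 0) ≤ 0 := Real.log_nonpos (hlpos 0 (by omega)).le hl0
        have h4 := Real.log_le_log (Real.exp_pos G) hGl
        rw [Real.log_exp, Real.log_mul two_ne_zero hl1pos.ne'] at h4
        simp only [max_eq_right (zero_le_one (α := ℕ))]
        linarith only [h3, h4]
      · intro i _ hi
        have h3 : (1 : ℕ) ≤ i := Nat.one_le_iff_ne_zero.2 fun h => hi (Fin.ext h)
        rw [max_eq_left h3, sub_self]
      · simp
    have hfin : d * (n * Real.log (C₀ / Λ) + M + R * Real.log 2) ≤ d * E - G := by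
      have h3 : n * Real.log (C₀ / Λ) + M + R * Real.log 2 ≤ E - G := by
        rw [Real.log_div hC₀.ne' hΛ0.ne', mul_sub]
        have h4 : (n : ℝ) * Real.log C₀ ≤ n * |Real.log C₀| :=
          mul_le_mul_of_nonneg_left (le_abs_self _) (Nat.cast_nonneg _)
        linarith only [h4, hM, hE, hRlog, htel]
      have h4 : G ≤ d * G := le_mul_of_one_le_left hG0 hd1
      have h5 := mul_le_mul_of_nonneg_left h3 (zero_le_one.trans hd1)
      linarith only [h4, h5]
    have hR0 : 0 ≤ R := Finset.sum_nonneg fun i _ => Nat.cast_nonneg _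
    have h2sum' := mul_le_mul_of_nonneg_left h2sum hR0
    rw [hιsum]
    linarith only [hfin, h2sum', hysum, hcsum, hy0sum, hC₀, hh2, habs, hdE]

end ReducedForms

theorem exists_sysMap_eq_sub {R : Type*} [CommRing R] {m : ℕ} (p : Fin (m + 1)) :
    ∃ (k : Option (Fin m)) (σ : Fin m → Fin (m + 1)), (∀ j, σ j ≠ p) ∧
      (∀ g : Fin (m + 1) → ℝ, ∑ j, g (σ j) = ∑ j ∈ Finset.univ.erase p, g j) ∧
      ∀ x : Fin (m + 1) → R, x 0 = 0 → ∀ j, sysMap k (fun i => x i.succ) j = x (σ j) - x p := by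
  have key : ∀ σ : Fin m → Fin (m + 1), Function.Injective σ → (∀ j, σ j ≠ p) →
      ∀ g : Fin (m + 1) → ℝ, ∑ j, g (σ j) = ∑ j ∈ Finset.univ.erase p, g j := by
    intro σ hσ hp g
    refine (Finset.sum_map Finset.univ ⟨σ, hσ⟩ g).symm.trans (Finset.sum_congr ?_ fun _ _ => rfl)
    refine Finset.eq_of_subset_of_card_le (fun j hj => ?_) ?_
    · obtain ⟨i, -, rfl⟩ := Finset.mem_map.1 hj
      exact Finset.mem_erase.2 ⟨hp i, Finset.mem_univ _⟩
    · rw [Finset.card_map, Finset.card_erase_of_mem (Finset.mem_univ _)]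
      simp
  rcases Fin.eq_zero_or_eq_succ p with rfl | ⟨k, rfl⟩
  · exact ⟨none, Fin.succ, Fin.succ_ne_zero, key _ (Fin.succ_injective _) Fin.succ_ne_zero,
      fun x hx j => by simp [sysMap, hx]⟩
  · have h1 : ∀ j : Fin m, (if j = k then 0 else j.succ) ≠ k.succ := fun j => by
      split_ifs with h
      · exact (Fin.succ_ne_zero k).symm
      · exact fun h2 => h (Fin.succ_injective _ h2)
    refine ⟨some k, fun j => if j = k then 0 else j.succ, h1, key _ (fun i j hij => ?_) h1,
      fun x hx j => ?_⟩
    · split_ifs at hij with h2 h3 h3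
      · exact h2.trans h3.symm
      · exact absurd hij.symm (Fin.succ_ne_zero _)
      · exact absurd hij (Fin.succ_ne_zero _)
      · exact Fin.succ_injective _ hij
    · dsimp only [sysMap]
      split_ifs with h2 <;> simp [hx]

section GoodPointOfForms

variable {K : Type*} [Field K] [NumberField K]

theorem logHeight₁_integral_le (a : 𝓞 K) {B : ℝ} (hB : 1 ≤ B)
    (h : ∀ v : InfinitePlace K, v (a : K) ≤ B) :
    logHeight₁ (a : K) ≤ Module.finrank ℚ K * Real.log B := by
  rw [logHeight₁_eq_finsum, finsum_allPlaces _ (finite_posLogAbs_ne_zero _),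
    ← InfinitePlace.sum_mult_eq, Nat.cast_sum, Finset.sum_mul]
  have h1 : ∑ᶠ v : FinitePlace K, max 0 (logAbs (Sum.inr v) (a : K)) = 0 := by
    refine (finsum_congr fun v => max_eq_left ?_).trans finsum_zero
    exact mul_nonpos_of_nonneg_of_nonpos (Nat.cast_nonneg _)
      (Real.log_nonpos (apply_nonneg _ _) (FinitePlace.apply_integer_le_one v a))
  rw [h1, add_zero]
  refine Finset.sum_le_sum fun v _ => max_le (mul_nonneg (Nat.cast_nonneg _)
    (Real.log_nonneg hB)) (mul_le_mul_of_nonneg_left ?_ (Nat.cast_nonneg _))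
  rcases eq_or_ne (a : K) 0 with h0 | h0
  · rw [h0, map_zero, Real.log_zero]
    exact Real.log_nonneg hB
  · exact Real.log_le_log (placeAbs_pos (Sum.inl v) h0) (h v)

theorem GoodPoint.of_forms {m ρ : ℕ} {S : Finset (AllPlaces K)}
    (hS : ∀ v : InfinitePlace K, Sum.inl v ∈ S) (hS2 : ∀ v ∉ S, placeAbs v (2 : K) = 1)
    {y : Fin (m + 1) → K} (hy : ∀ j, y j ≠ 0) {p : AllPlaces K → Fin (m + 1)}
    {b : AllPlaces K → Fin (m + 1) → ℝ} {f : Fin ρ → Fin (m + 1) → K} (hf0 : ∀ s, f s 0 = 0)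
    (hspan : ∀ u : Fin (m + 1) → K, (∀ s, ∑ j, u j * f s j = 0) → ∃ c, ∀ j ≠ 0, u j = c * y j)
    (hf : ∀ v s, ∀ j ≠ p v, placeAbs v (f s j - f s (p v)) ≤ Real.exp (b v j))
    (hb : ∀ (v : FinitePlace K) j, v (2 : K) = 1 →
      b (Sum.inr v) j = -Real.log (placeAbs (Sum.inr v) (y j)))
    {k : AllPlaces K → Option (Fin m)} {σ : AllPlaces K → Fin m → Fin (m + 1)}
    (hσ : ∀ v ∈ S, ∀ j, σ v j ≠ p v) (hk : ∀ v ∈ S, ∀ x : Fin (m + 1) → K, x 0 = 0 → ∀ j,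
      sysMap (k v) (fun i => x i.succ) j = x (σ v j) - x (p v))
    {β : AllPlaces K → Fin m → ℝ} {η' δ H : ℝ} {i₁ i₂ : Fin m}
    (hβ : ∀ v ∈ S, ∀ j, b v (σ v j) ≤ β v j * H) (hout : ∑ j, outMass S (y j) ≤ δ * H)
    (hheight : η' * H ≤ logHeight₁ (y i₁.succ / y i₂.succ)) :
    GoodPoint S k β η' i₁ i₂ δ H (fun j => y j.succ) (fun s j => f s j.succ) where
  ne_zero j := hy _
  span x hx := by
    by_contra hcon
    obtain ⟨φ, hφx, hφ⟩ := Submodule.exists_le_ker_of_notMem hcon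
    have hφeq : ∀ z : Fin m → K, φ z = ∑ j, φ (Pi.single j 1) * z j := fun z => by
      conv_lhs => rw [← Finset.univ_sum_single z]
      rw [map_sum]
      refine Finset.sum_congr rfl fun j _ => ?_
      rw [mul_comm, ← smul_eq_mul, ← map_smul, ← Pi.single_smul, smul_eq_mul, mul_one]
    obtain ⟨c, hc⟩ := hspan (Fin.cons 0 fun j => φ (Pi.single j 1)) fun s => by
      have h1 : φ (fun j => f s j.succ) = 0 :=
        LinearMap.mem_ker.1 (hφ (Submodule.subset_span ⟨s, rfl⟩))
      rw [hφeq] at h1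
      rw [Fin.sum_univ_succ]
      simpa using h1
    refine hφx ?_
    rw [hφeq]
    have h2 : ∀ j, φ (Pi.single j 1) = c * y j.succ := fun j => by
      simpa using hc j.succ (Fin.succ_ne_zero j)
    simp_rw [h2, mul_assoc, ← Finset.mul_sum]
    rw [hx, mul_zero]
  abs_le v hv s j := by
    rw [hk v hv (f s) (hf0 s)]
    exact (hf v s _ (hσ v hv j)).trans (Real.exp_le_exp.2 (hβ v hv j))
  abs_le_outside := by
    classical
    set μ : AllPlaces K → ℝ := fun v => ∑ j, if v ∈ S then 0 else |logAbs v (y j)| with hμ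
    have hnn : ∀ v j, 0 ≤ if v ∈ S then 0 else |logAbs v (y j)| := fun v j => by
      split_ifs <;> positivity
    have hfin : ∀ j, (fun v => if v ∈ S then 0 else |logAbs v (y j)|).support.Finite :=
      fun j => support_outMass_finite S (y j)
    refine ⟨μ, fun v => Finset.sum_nonneg fun j _ => hnn v j, ?_, ?_, fun v hv s j => ?_⟩
    · refine (Set.finite_iUnion hfin).subset fun v hv => ?_
      by_contra h
      refine hv (Finset.sum_eq_zero fun j _ => ?_)
      by_contra h2
      exact h (Set.mem_iUnion.2 ⟨j, h2⟩)
    · rw [finsum_sum_comm _ _ fun j _ => hfin j]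
      exact hout
    · rcases v with v | v
      · exact absurd (hS v) hv
      · have hle : ∀ i, placeAbs (Sum.inr v) (f s i - f s (p (Sum.inr v))) ≤
            Real.exp (μ (Sum.inr v)) := by
          intro i
          by_cases hi : i = p (Sum.inr v)
          · rw [hi, sub_self, map_zero]
            exact (Real.exp_pos _).le
          · refine (hf _ s i hi).trans (Real.exp_le_exp.2 ?_)
            rw [hb v i (hS2 _ hv)]
            have h1 : logAbs (Sum.inr v) (y i) = Real.log (placeAbs (Sum.inr v) (y i)) := by
              rw [logAbs, show placeMult (Sum.inr v : AllPlaces K) = 1 from rfl, Nat.cast_one,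
                one_mul]
            rw [← h1]
            refine (neg_le_abs _).trans ?_
            have h2 := Finset.single_le_sum (fun j _ => hnn (Sum.inr v) j) (Finset.mem_univ i)
            rwa [if_neg hv] at h2
        have h0 := hle 0
        rw [hf0, zero_sub, (placeAbs (Sum.inr v)).map_neg] at h0
        have h3 := placeAbs_isNonarchimedean v (f s j.succ - f s (p (Sum.inr v)))
          (f s (p (Sum.inr v)))
        rw [sub_add_cancel] at h3
        exact h3.trans (max_le (hle _) h0)
  height := hheight

end GoodPointOfForms

end

section

open NumberField Height Filter

section Germs

variable {K : Type*} [Field K] [NumberField K] (φ : Ultrafilter ℕ) {t : ℕ → ℝ}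
  (ht : Tendsto t φ atTop)

/-- The germs of height negligible with respect to `t`. -/
def smallSubfield : Subfield (Germ (φ : Filter ℕ) K) where
  carrier := {x | ∀ ε > 0, Germ.LiftRel (fun a s => logHeight₁ a ≤ ε * s) x
    (t : Germ (φ : Filter ℕ) ℝ)}
  mul_mem' {x y} hx hy := by
    induction x using Germ.inductionOn with | _ f
    induction y using Germ.inductionOn with | _ g
    intro ε hε
    rw [← Germ.coe_mul, Germ.liftRel_coe]
    filter_upwards [Germ.liftRel_coe.1 (hx (ε / 2) (by positivity)),
      Germ.liftRel_coe.1 (hy (ε / 2) (by positivity))] with N h1 h2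
    exact (logHeight₁_mul_le _ _).trans (by linarith)
  one_mem' ε hε := by
    rw [← Germ.coe_one, Germ.liftRel_coe]
    filter_upwards [ht.eventually_ge_atTop 0] with N hN
    simpa using mul_nonneg hε.le hN
  add_mem' {x y} hx hy := by
    induction x using Germ.inductionOn with | _ f
    induction y using Germ.inductionOn with | _ g
    intro ε hε
    rw [← Germ.coe_add, Germ.liftRel_coe]
    filter_upwards [Germ.liftRel_coe.1 (hx (ε / 3) (by positivity)),
      Germ.liftRel_coe.1 (hy (ε / 3) (by positivity)),
      ht.eventually_ge_atTop ((totalWeight K * Real.log 2) / (ε / 3))] with N h1 h2 h3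
    rw [div_le_iff₀ (by positivity)] at h3
    exact (logHeight₁_add_le _ _).trans (by linarith)
  zero_mem' ε hε := by
    rw [← Germ.coe_zero, Germ.liftRel_coe]
    filter_upwards [ht.eventually_ge_atTop 0] with N hN
    simpa using mul_nonneg hε.le hN
  neg_mem' {x} hx := by
    induction x using Germ.inductionOn with | _ f
    intro ε hε
    rw [← Germ.coe_neg, Germ.liftRel_coe]
    filter_upwards [Germ.liftRel_coe.1 (hx ε hε)] with N h1
    rwa [Pi.neg_apply, logHeight₁_neg]
  inv_mem' x hx := by
    induction x using Germ.inductionOn with | _ f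
    intro ε hε
    rw [← Germ.coe_inv, Germ.liftRel_coe]
    filter_upwards [Germ.liftRel_coe.1 (hx ε hε)] with N h1
    rwa [Pi.inv_apply, logHeight₁_inv]

theorem coe_mem_smallSubfield {f : ℕ → K} : (f : Germ (φ : Filter ℕ) K) ∈ smallSubfield φ ht ↔
    ∀ ε > 0, ∀ᶠ N in (φ : Filter ℕ), logHeight₁ (f N) ≤ ε * t N := Iff.rfl

/-- The germs of almost `S`-units whose height is bounded by a multiple of `t`. -/
def almostUnits (S : Finset (AllPlaces K)) : Subgroup (Germ (φ : Filter ℕ) K)ˣ where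
  carrier := {x | (∀ ε > 0, Germ.LiftRel (fun a s => outMass S a ≤ ε * s) (x : Germ (φ : Filter ℕ) K)
    (t : Germ (φ : Filter ℕ) ℝ)) ∧ ∃ B, Germ.LiftRel (fun a s => logHeight₁ a ≤ B * s)
      (x : Germ (φ : Filter ℕ) K) (t : Germ (φ : Filter ℕ) ℝ)}
  mul_mem' {x y} hx hy := by
    obtain ⟨hx1, A, hA⟩ := hx
    obtain ⟨hy1, B, hB⟩ := hy
    have hx0 := x.ne_zero
    have hy0 := y.ne_zero
    simp only [Set.mem_ofPred_eq, Units.val_mul]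
    generalize (x : Germ (φ : Filter ℕ) K) = x at *
    generalize (y : Germ (φ : Filter ℕ) K) = y at *
    induction x using Germ.inductionOn with | _ f
    induction y using Germ.inductionOn with | _ g
    have hx2 : ∀ᶠ N in (φ : Filter ℕ), f N ≠ 0 :=
      Ultrafilter.eventually_not.2 fun h => hx0 (Germ.coe_eq.2 h)
    have hy2 : ∀ᶠ N in (φ : Filter ℕ), g N ≠ 0 :=
      Ultrafilter.eventually_not.2 fun h => hy0 (Germ.coe_eq.2 h)
    refine ⟨fun ε hε => ?_, A + B, ?_⟩
    · rw [← Germ.coe_mul, Germ.liftRel_coe]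
      filter_upwards [Germ.liftRel_coe.1 (hx1 (ε / 2) (by positivity)),
        Germ.liftRel_coe.1 (hy1 (ε / 2) (by positivity)), hx2, hy2] with N h1 h2 h3 h4
      exact (outMass_mul_le S h3 h4).trans (by linarith)
    · rw [← Germ.coe_mul, Germ.liftRel_coe]
      filter_upwards [Germ.liftRel_coe.1 hA, Germ.liftRel_coe.1 hB] with N h1 h2
      exact (logHeight₁_mul_le _ _).trans (by linarith)
  one_mem' := by
    rw [Set.mem_ofPred_eq, Units.val_one, ← Germ.coe_one]
    refine ⟨fun ε hε => ?_, 0, ?_⟩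
    · rw [Germ.liftRel_coe]
      filter_upwards [ht.eventually_ge_atTop 0] with N hN
      rw [Pi.one_apply, outMass_one]
      exact mul_nonneg hε.le hN
    · rw [Germ.liftRel_coe]
      simp
  inv_mem' {x} hx := by
    obtain ⟨hx1, A, hA⟩ := hx
    simp only [Set.mem_ofPred_eq, Units.val_inv_eq_inv_val]
    generalize (x : Germ (φ : Filter ℕ) K) = x at *
    induction x using Germ.inductionOn with | _ f
    refine ⟨fun ε hε => ?_, A, ?_⟩
    · rw [← Germ.coe_inv, Germ.liftRel_coe]
      filter_upwards [Germ.liftRel_coe.1 (hx1 ε hε)] with N h1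
      rwa [Pi.inv_apply, outMass_inv]
    · rw [← Germ.coe_inv, Germ.liftRel_coe]
      filter_upwards [Germ.liftRel_coe.1 hA] with N h1
      rwa [Pi.inv_apply, logHeight₁_inv]

theorem mem_almostUnits {S : Finset (AllPlaces K)} {x : (Germ (φ : Filter ℕ) K)ˣ} {f : ℕ → K}
    (hf : (x : Germ (φ : Filter ℕ) K) = f) : x ∈ almostUnits φ ht S ↔
      (∀ ε > 0, ∀ᶠ N in (φ : Filter ℕ), outMass S (f N) ≤ ε * t N) ∧
        ∃ B, ∀ᶠ N in (φ : Filter ℕ), logHeight₁ (f N) ≤ B * t N := by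
  show (_ ∧ _) ↔ _
  rw [hf]
  rfl

theorem smallSubfield_le_almostUnits (S : Finset (AllPlaces K))
    (x : smallSubfield (K := K) φ ht) (hx : x ≠ 0) :
    Units.map (algebraMap (smallSubfield (K := K) φ ht) (Germ (φ : Filter ℕ) K)).toMonoidHom
      (Units.mk0 x hx) ∈ almostUnits φ ht S := by
  obtain ⟨x, hx1⟩ := x
  induction x using Germ.inductionOn with | _ f
  rw [coe_mem_smallSubfield] at hx1
  refine (mem_almostUnits φ ht (f := f) rfl).2 ⟨fun ε hε => ?_, 1, hx1 1 one_pos⟩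
  filter_upwards [hx1 (ε / 2) (by positivity)] with N h1
  exact (outMass_le S _).trans (by linarith)

end Germs

theorem exists_forall_le_two_mul {α : Type*} {A : Set α} (hA : A.Nonempty) {f : α → ℝ}
    (hf : ∀ x ∈ A, 1 ≤ f x) : ∃ x ∈ A, ∀ w ∈ A, f x ≤ 2 * f w := by
  have hne : (f '' A).Nonempty := hA.image f
  have h1 : 1 ≤ sInf (f '' A) := le_csInf hne (by rintro _ ⟨x, hx, rfl⟩; exact hf x hx)
  obtain ⟨_, ⟨x, hx, rfl⟩, hlt⟩ := exists_lt_of_csInf_lt hne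
    (show sInf (f '' A) < 2 * sInf (f '' A) by linarith)
  refine ⟨x, hx, fun w hw => hlt.le.trans ?_⟩
  have := csInf_le ⟨1, by rintro _ ⟨x, hx, rfl⟩; exact hf x hx⟩ (Set.mem_image_of_mem f hw)
  linarith

section CoreRelation

variable {K : Type*} [Field K] [NumberField K] {φ : Ultrafilter ℕ} {t : ℕ → ℝ} {m : ℕ}

/-- If every relation of negligible height is constant, then integral relations satisfy a gap. -/
theorem exists_relation_gap (ht : Tendsto t φ atTop) (f : Fin (m + 1) → ℕ → K)
    (hno : ∀ x : Fin (m + 1) → ℕ → K,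
      (∀ i, ∀ ε > 0, ∀ᶠ N in (φ : Filter ℕ), logHeight₁ (x i N) ≤ ε * t N) →
      (∀ᶠ N in (φ : Filter ℕ), ∑ i, x i N * f i N = 0) →
      ∀ i j, ∀ᶠ N in (φ : Filter ℕ), x i N = x j N) :
    ∃ η > 0, ∀ᶠ N in (φ : Filter ℕ), ∀ z ∈ orthHyperplane fun i => f i N,
      (∀ j, ∃ a : 𝓞 K, (a : K) = z j) →
      ‖archEmbedding K m z‖ < Real.exp (η * t N) → ∃ c, z = fun _ => c := by
  by_contra! hcon
  set A : ℕ → Set (Fin (m + 1) → K) := fun N => {z | z ∈ orthHyperplane (fun i => f i N) ∧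
    (∀ j, ∃ a : 𝓞 K, (a : K) = z j) ∧ ∀ c, z ≠ fun _ => c} with hA
  have hA1 : ∀ N, ∀ z ∈ A N, 1 ≤ ‖archEmbedding K m z‖ := fun N z hz =>
    one_le_norm_archEmbedding hz.2.1 (hz.2.2 0)
  have hex : ∀ N, ∃ z : Fin (m + 1) → K, (A N).Nonempty →
      z ∈ A N ∧ ∀ w ∈ A N, ‖archEmbedding K m z‖ ≤ 2 * ‖archEmbedding K m w‖ := fun N => by
    by_cases h : (A N).Nonempty
    · obtain ⟨z, hz⟩ := exists_forall_le_two_mul h (hA1 N)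
      exact ⟨z, fun _ => hz⟩
    · exact ⟨0, fun h' => absurd h' h⟩
  choose z hz using hex
  have hsmall : ∀ η > 0, ∀ᶠ N in (φ : Filter ℕ),
      z N ∈ A N ∧ ‖archEmbedding K m (z N)‖ ≤ 2 * Real.exp (η * t N) := fun η hη => by
    have h1 := hcon η hη
    filter_upwards [h1] with N hN
    obtain ⟨w, h2, h3, h4, h5⟩ := hN
    have hw : w ∈ A N := ⟨h2, h3, h5⟩
    exact ⟨(hz N ⟨w, hw⟩).1, ((hz N ⟨w, hw⟩).2 w hw).trans (by linarith)⟩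
  set d : ℝ := (Module.finrank ℚ K : ℝ) with hd
  have hd1 : 1 ≤ d := Nat.one_le_cast.2 Module.finrank_pos
  have hall := hno (fun i N => z N i) (fun i ε hε => by
    filter_upwards [hsmall (ε / (2 * d)) (by positivity),
      ht.eventually_ge_atTop (Real.log 2 / (ε / (2 * d))), ht.eventually_ge_atTop 0] with N h1 h2 h3
    obtain ⟨a, ha⟩ := h1.1.2.1 i
    have hB : 1 ≤ 2 * Real.exp (ε / (2 * d) * t N) := by
      have := Real.one_le_exp (show 0 ≤ ε / (2 * d) * t N by positivity)
      linarith
    rw [div_le_iff₀ (by positivity)] at h2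
    rw [← ha]
    refine (logHeight₁_integral_le a hB fun v => ?_).trans ?_
    · rw [ha]
      exact norm_archEmbedding_le_iff.1 h1.2 i v
    · rw [Real.log_mul two_ne_zero (Real.exp_ne_zero _), Real.log_exp]
      calc d * (Real.log 2 + ε / (2 * d) * t N) ≤ d * (2 * (t N * (ε / (2 * d)))) :=
            mul_le_mul_of_nonneg_left (by linarith) (by positivity)
        _ = ε * t N := by field_simp) (by
    filter_upwards [hsmall 1 one_pos] with N h1
    exact mem_orthHyperplane.1 h1.1.1)
  have hfin : ∀ᶠ N in (φ : Filter ℕ), ∀ i, z N i = z N 0 := eventually_all.2 fun i => hall i 0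
  obtain ⟨N, h1, h2⟩ := (hfin.and (hsmall 1 one_pos)).exists
  exact h2.1.2.2 (z N 0) (funext h1)

theorem exists_tendsto_div (ht : Tendsto t φ atTop) {b : ℕ → ℝ} {C : ℝ}
    (hb : ∀ᶠ N in (φ : Filter ℕ), |b N| ≤ C * t N) :
    ∃ β : ℝ, Tendsto (fun N => b N / t N) φ (nhds β) := by
  have h : ∀ᶠ N in (φ : Filter ℕ), b N / t N ∈ Set.Icc (-C) C := by
    filter_upwards [hb, ht.eventually_gt_atTop 0] with N h1 h2
    rw [Set.mem_Icc, ← abs_le, abs_div, abs_of_pos h2, div_le_iff₀ h2]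
    exact h1
  obtain ⟨β, -, hβ⟩ := (isCompact_Icc (a := -C) (b := C)).ultrafilter_le_nhds
    (φ.map fun N => b N / t N) (le_principal_iff.2 h)
  exact ⟨β, hβ⟩

theorem exists_eventually_eq_const {α : Type*} [Finite α] (p : ℕ → α) :
    ∃ a, ∀ᶠ N in (φ : Filter ℕ), p N = a :=
  Ultrafilter.eventually_exists_iff.1 (Eventually.of_forall fun N => ⟨p N, rfl⟩)

/-- Almost `S`-units of vanishing sum satisfy a nonconstant relation of negligible height. -/
theorem false_of_forall_relation_const (ht : Tendsto t φ atTop) (hm : 2 ≤ m)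
    {S : Finset (AllPlaces K)} (hS : ∀ v : InfinitePlace K, Sum.inl v ∈ S)
    (hS2 : ∀ v ∉ S, placeAbs v (2 : K) = 1) (f : Fin (m + 1) → ℕ → K)
    (hf0 : ∀ i, ∀ᶠ N in (φ : Filter ℕ), f i N ≠ 0)
    (hsum : ∀ᶠ N in (φ : Filter ℕ), ∑ i, f i N = 0)
    (hout : ∀ i, ∀ ε > 0, ∀ᶠ N in (φ : Filter ℕ), outMass S (f i N) ≤ ε * t N)
    (hht : ∀ i, ∃ B, ∀ᶠ N in (φ : Filter ℕ), logHeight₁ (f i N) ≤ B * t N)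
    (hno : ∀ x : Fin (m + 1) → ℕ → K,
      (∀ i, ∀ ε > 0, ∀ᶠ N in (φ : Filter ℕ), logHeight₁ (x i N) ≤ ε * t N) →
      (∀ᶠ N in (φ : Filter ℕ), ∑ i, x i N * f i N = 0) →
      ∀ i j, ∀ᶠ N in (φ : Filter ℕ), x i N = x j N) : False := by
  classical
  obtain ⟨η, hη, hgap⟩ := exists_relation_gap ht f hno
  set i₁ : Fin m := ⟨0, by omega⟩ with hi₁
  set i₂ : Fin m := ⟨1, by omega⟩ with hi₂
  have hne : i₁ ≠ i₂ := by simp [hi₁, hi₂]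
  have hout' : ∀ ε > 0, ∀ᶠ N in (φ : Filter ℕ), ∑ j, outMass S (f j N) ≤ ε * t N := by
    intro ε hε
    have h : ∀ᶠ N in (φ : Filter ℕ), ∀ j, outMass S (f j N) ≤ ε / (m + 1) * t N :=
      eventually_all.2 fun j => hout j _ (by positivity)
    filter_upwards [h] with N hN
    refine (Finset.sum_le_sum fun j _ => hN j).trans (le_of_eq ?_)
    rw [Finset.sum_const, Finset.card_univ, Fintype.card_fin, nsmul_eq_mul]
    push_cast
    field_simp
  obtain ⟨η', hη', hheight⟩ : ∃ η' > 0, ∀ᶠ N in (φ : Filter ℕ),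
      η' * t N ≤ logHeight₁ (f i₁.succ N / f i₂.succ N) := by
    by_contra! hcon
    have h1 := hno (Pi.single i₁.succ (fun N => f i₂.succ N / f i₁.succ N) -
      Pi.single i₂.succ 1) (fun i ε hε => by
        rcases eq_or_ne i i₁.succ with rfl | h1
        · filter_upwards [hcon ε hε] with N hN
          rw [← logHeight₁_inv, inv_div] at hN
          simpa [hne] using hN.le
        · filter_upwards [ht.eventually_ge_atTop 0] with N hN
          have : 0 ≤ ε * t N := by positivity
          rcases eq_or_ne i i₂.succ with rfl | h2
          · simpa [hne.symm, logHeight₁_neg] using this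
          · simpa [h1, h2] using this) (by
        filter_upwards [hf0 i₁.succ] with N hN
        simp [sub_mul, Finset.sum_sub_distrib, Pi.single_apply, ite_apply, hN]) 0 i₂.succ
    obtain ⟨N, hN⟩ := h1.exists
    simp [hne.symm, (Fin.succ_ne_zero _).symm] at hN
  choose B hB using hht
  set Bs : ℝ := ∑ i, |B i| with hBs
  have hBs0 : 0 ≤ Bs := Finset.sum_nonneg fun i _ => abs_nonneg _
  have hht' : ∀ᶠ N in (φ : Filter ℕ), ∀ j, logHeight₁ (f j N) ≤ Bs * t N :=
    eventually_all.2 fun j => by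
      filter_upwards [hB j, ht.eventually_ge_atTop 0] with N h1 h2
      refine h1.trans (mul_le_mul_of_nonneg_right ((le_abs_self _).trans ?_) h2)
      exact Finset.single_le_sum (f := fun i => |B i|) (fun i _ => abs_nonneg _)
        (Finset.mem_univ j)
  obtain ⟨ρ, C, hC, hred⟩ := exists_reduced_forms K hm
  have hf0' : ∀ᶠ N in (φ : Filter ℕ), ∀ j, f j N ≠ 0 := eventually_all.2 hf0
  have hdata := Filter.Eventually.choice (by
    filter_upwards [hf0', hsum, hgap, hht', ht.eventually_ge_atTop (C / η)] with N h1 h2 h3 h4 h5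
    rw [div_le_iff₀ hη, mul_comm] at h5
    obtain ⟨p, b, F, h⟩ := hred (fun j => f j N) h1 h2 (Bs * t N) (η * t N) h5 h4 h3
    exact (⟨(p, b, F), h⟩ : ∃ w : (AllPlaces K → Fin (m + 1)) ×
      (AllPlaces K → Fin (m + 1) → ℝ) × (Fin ρ → Fin (m + 1) → K), (∀ s, w.2.2 s 0 = 0) ∧
      (∀ u : Fin (m + 1) → K, (∀ s, ∑ j, u j * w.2.2 s j = 0) → ∃ c, ∀ j ≠ 0, u j = c * f j N) ∧
      (∀ v s, ∀ j ≠ w.1 v, placeAbs v (w.2.2 s j - w.2.2 s (w.1 v)) ≤ Real.exp (w.2.1 v j)) ∧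
      (∀ (v : FinitePlace K) j, v (2 : K) = 1 →
        w.2.1 (Sum.inr v) j = -Real.log (placeAbs (Sum.inr v) (f j N))) ∧
      (∀ v j, |w.2.1 v j| ≤ C * (1 + Bs * t N)) ∧
      ∀ S : Finset (AllPlaces K), (∀ v : InfinitePlace K, Sum.inl v ∈ S) →
        (∀ v ∉ S, placeAbs v (2 : K) = 1) →
        ∑ v ∈ S, (placeMult v : ℝ) * ∑ j ∈ Finset.univ.erase (w.1 v), w.2.1 v j ≤
          C - η * t N + 2 * ∑ j, outMass S (f j N)))
  obtain ⟨w, hw⟩ := hdata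
  choose p hp using fun v => exists_eventually_eq_const (φ := φ) fun N => (w N).1 v
  have hlim : ∀ v j, ∃ β : ℝ, Tendsto (fun N => (w N).2.1 v j / t N) φ (nhds β) := fun v j =>
    exists_tendsto_div (C := C * (1 + Bs)) ht (by
      filter_upwards [hw, ht.eventually_ge_atTop 1] with N h1 h2
      refine (h1.2.2.2.2.1 v j).trans ?_
      rw [mul_assoc]
      exact mul_le_mul_of_nonneg_left (by linarith) hC.le)
  choose β₀ hβ₀ using hlim
  have hpS : ∀ᶠ N in (φ : Filter ℕ), ∀ v ∈ S, (w N).1 v = p v :=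
    (Filter.eventually_all_finset S).2 fun v _ => hp v
  have hβsum : ∑ v ∈ S, (placeMult v : ℝ) * ∑ j ∈ Finset.univ.erase (p v), β₀ v j ≤ -η / 2 := by
    refine le_of_tendsto (tendsto_finsetSum S fun v _ => (tendsto_finsetSum
      (Finset.univ.erase (p v)) fun j _ => hβ₀ v j).const_mul (placeMult v : ℝ)) ?_
    filter_upwards [hw, hpS, ht.eventually_ge_atTop (C / (η / 4)), ht.eventually_gt_atTop 0,
      hout' (η / 8) (by positivity)] with N h1 h2 h3 h4 h5
    rw [div_le_iff₀ (by positivity)] at h3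
    have h6 := h1.2.2.2.2.2 S hS hS2
    have h7 : ∑ v ∈ S, (placeMult v : ℝ) * ∑ j ∈ Finset.univ.erase (p v), (w N).2.1 v j / t N =
        (∑ v ∈ S, (placeMult v : ℝ) * ∑ j ∈ Finset.univ.erase ((w N).1 v), (w N).2.1 v j) / t N := by
      rw [Finset.sum_div]
      refine Finset.sum_congr rfl fun v hv => ?_
      rw [h2 v hv, mul_div_assoc, Finset.sum_div]
    rw [h7, div_le_iff₀ h4]
    linarith only [h6, h5, h3]
  choose k σ hσ hσsum hk using fun v => exists_sysMap_eq_sub (R := K) (p v)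
  set M : ℝ := ∑ v ∈ S, (placeMult v : ℝ) * m with hM
  have hM0 : 0 ≤ M := Finset.sum_nonneg fun v _ => by positivity
  set ε : ℝ := η / (4 * (M + 1)) with hε
  have hε0 : 0 < ε := by positivity
  set β : AllPlaces K → Fin m → ℝ := fun v j => if v ∈ S then β₀ v (σ v j) + ε else 0 with hβ
  have hβS : ∀ v ∈ S, ∀ j, β v j = β₀ v (σ v j) + ε := fun v hv j => if_pos hv
  have hκ : ∀ v j, |β v j| ≤ ∑ v ∈ S, ∑ j, |β v j| := fun v j => by
    by_cases hv : v ∈ S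
    · exact (Finset.single_le_sum (f := fun j => |β v j|) (fun j _ => abs_nonneg _)
        (Finset.mem_univ j)).trans (Finset.single_le_sum (f := fun v => ∑ j, |β v j|)
          (fun v _ => Finset.sum_nonneg fun j _ => abs_nonneg _) hv)
    · rw [show β v j = 0 from if_neg hv, abs_zero]
      exact Finset.sum_nonneg fun v _ => Finset.sum_nonneg fun j _ => abs_nonneg _
  have hβη : ∑ v ∈ S, (placeMult v : ℝ) * ∑ j, β v j ≤ -(η / 4) := by
    have h1 : ∑ v ∈ S, (placeMult v : ℝ) * ∑ j, β v j =
        ∑ v ∈ S, (placeMult v : ℝ) * ∑ j ∈ Finset.univ.erase (p v), β₀ v j + ε * M := by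
      rw [hM, Finset.mul_sum, ← Finset.sum_add_distrib]
      refine Finset.sum_congr rfl fun v hv => ?_
      rw [Finset.sum_congr rfl fun j _ => hβS v hv j, Finset.sum_add_distrib, hσsum v (β₀ v),
        Finset.sum_const, Finset.card_univ, Fintype.card_fin, nsmul_eq_mul]
      ring
    have h2 : ε * M ≤ η / 4 := by
      rw [hε, div_mul_eq_mul_div, div_le_div_iff₀ (by positivity) (by norm_num)]
      nlinarith
    rw [h1]
    linarith only [h2, hβsum]
  obtain ⟨δ, hδ, H₀, hH₀⟩ := GoodPoint.exists_bound (q := ρ) (by omega : 0 < m) hS k hne hη'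
    (show 0 < η / 4 by positivity) hκ hβη
  have hclose : ∀ᶠ N in (φ : Filter ℕ), ∀ v ∈ S, ∀ j, (w N).2.1 v j / t N ≤ β₀ v j + ε :=
    (Filter.eventually_all_finset S).2 fun v _ => eventually_all.2 fun j =>
      (hβ₀ v j).eventually_le_const (lt_add_of_pos_right _ hε0)
  obtain ⟨N, h1, h2, h3, h4, h5, h6, h7, h8⟩ := (hw.and (hpS.and (hclose.and (hf0'.and
    ((hout' δ hδ).and (hheight.and ((ht.eventually_gt_atTop 0).and
      (ht.eventually_gt_atTop H₀)))))))).exists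
  refine absurd (hH₀ (t N) _ _ (GoodPoint.of_forms (y := fun j => f j N) (p := (w N).1)
    (b := (w N).2.1) (f := (w N).2.2) (σ := σ) hS hS2 h4 h1.1 h1.2.1 h1.2.2.1 h1.2.2.2.1
    (fun v hv j => by rw [h2 v hv]; exact hσ v j)
    (fun v hv x hx j => by rw [h2 v hv]; exact hk v x hx j) (fun v hv j => ?_) h5 h6)) h8.not_ge
  rw [hβS v hv, ← div_le_iff₀ h7]
  exact h3 v hv _

end CoreRelation

section GermRelation

variable {K : Type*} [Field K] [NumberField K] {φ : Ultrafilter ℕ} {t : ℕ → ℝ}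

theorem Filter.Germ.coe_sum_apply {ι R : Type*} [Semiring R] {l : Filter ℕ} (s : Finset ι)
    (f : ι → ℕ → R) : ((fun N => ∑ i ∈ s, f i N : ℕ → R) : Germ l R) =
      ∑ i ∈ s, (f i : Germ l R) := by
  have h := map_sum (Germ.coeRingHom (R := R) l) f s
  simp only [Germ.coe_coeRingHom] at h
  rw [← h]
  congr 1
  ext N
  simp

/-- Almost `S`-units of vanishing sum satisfy a nonconstant relation over `smallSubfield`. -/
theorem exists_nonconst_relation (ht : Tendsto t φ atTop) {S : Finset (AllPlaces K)}
    (hS : ∀ v : InfinitePlace K, Sum.inl v ∈ S) (hS2 : ∀ v ∉ S, placeAbs v (2 : K) = 1) (n : ℕ)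
    (y : Fin (n + 3) → (Germ (φ : Filter ℕ) K)ˣ) (hy : ∀ i, y i ∈ almostUnits φ ht S)
    (hsum : ∑ i, (y i : Germ (φ : Filter ℕ) K) = 0) :
    ∃ a : Fin (n + 3) → smallSubfield (K := K) φ ht, (∃ i j, a i ≠ a j) ∧
      ∑ i, a i • (y i : Germ (φ : Filter ℕ) K) = 0 := by
  by_contra! hcon
  have hrep : ∀ i, ∃ f : ℕ → K, (y i : Germ (φ : Filter ℕ) K) = f := fun i =>
    ⟨Quotient.out (y i : Germ (φ : Filter ℕ) K), (Quotient.out_eq _).symm⟩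
  choose f hf using hrep
  refine false_of_forall_relation_const (m := n + 2) ht (by omega) hS hS2 f (fun i => ?_) ?_
    (fun i => ((mem_almostUnits φ ht (hf i)).1 (hy i)).1)
    (fun i => ((mem_almostUnits φ ht (hf i)).1 (hy i)).2) fun x hx hx0 i j => ?_
  · refine Ultrafilter.eventually_not.2 fun h => (y i).ne_zero ?_
    rw [hf i]
    exact Germ.coe_eq.2 h
  · refine Germ.coe_eq.1 (?_ : ((fun N => ∑ i, f i N : ℕ → K) : Germ (φ : Filter ℕ) K) =
      ((fun _ => 0 : ℕ → K) : Germ (φ : Filter ℕ) K))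
    rw [Germ.coe_sum_apply, ← Finset.sum_congr rfl fun i _ => hf i, hsum]
    rfl
  · by_contra hne
    refine hcon (fun i => ⟨x i, (coe_mem_smallSubfield φ ht).2 (hx i)⟩) ⟨i, j, fun h => hne ?_⟩ ?_
    · exact Germ.coe_eq.1 (congrArg Subtype.val h)
    · have h : ((fun N => ∑ i, x i N * f i N : ℕ → K) : Germ (φ : Filter ℕ) K) =
          ((fun _ => 0 : ℕ → K) : Germ (φ : Filter ℕ) K) := Germ.coe_eq.2 hx0
      rw [Germ.coe_sum_apply] at h
      refine Eq.trans (Finset.sum_congr rfl fun i _ => ?_) h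
      rw [hf i]
      rfl

end GermRelation

section UnitEquation

/-- The unit equations in the group `Γ` have only finitely many nondegenerate solutions. -/
def Subgroup.HasMannProperty {F : Type*} [Field F] (Γ : Subgroup Fˣ) : Prop :=
  ∀ n : ℕ, {x : Fin n → Fˣ | (∀ i, x i ∈ Γ) ∧ ∑ i, (x i : F) = 1 ∧
    ∀ J : Finset (Fin n), J.Nonempty → ∑ i ∈ J, (x i : F) ≠ 0}.Finite

theorem sum_option_ne_zero {ι F : Type*} [Fintype ι] [Field F] {z : Option ι → F}
    (hz : ∑ i, z i = 0) (h : ∀ J : Finset ι, J.Nonempty → ∑ i ∈ J, z (some i) ≠ 0)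
    {J : Finset (Option ι)} (hJ : J.Nonempty) (hJ' : J ≠ Finset.univ) : ∑ i ∈ J, z i ≠ 0 := by
  classical
  have key : ∀ J : Finset (Option ι), J.Nonempty → none ∉ J → ∑ i ∈ J, z i ≠ 0 := by
    intro J hJ hn
    have h1 : J.eraseNone.map Function.Embedding.some = J := by
      rw [Finset.map_some_eraseNone, Finset.erase_eq_of_notMem hn]
    rw [← h1, Finset.sum_map]
    refine h _ ?_
    rw [← h1, Finset.map_nonempty] at hJ
    exact hJ
  by_cases hn : none ∈ J
  · intro h0
    refine key Jᶜ ?_ (by simpa using hn) ?_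
    · rwa [Finset.nonempty_iff_ne_empty, ne_eq, Finset.compl_eq_empty_iff]
    · rw [← hz, ← Finset.sum_add_sum_compl J, h0, zero_add]
  · exact key J hJ hn

variable {K : Type*} [Field K] [NumberField K]

theorem exists_finset_places {Γ : Subgroup Kˣ} (hΓ : Γ.FG) : ∃ S : Finset (AllPlaces K),
    (∀ v : InfinitePlace K, Sum.inl v ∈ S) ∧ (∀ v ∉ S, placeAbs v (2 : K) = 1) ∧
      ∀ γ ∈ Γ, ∀ v ∉ S, logAbs v (γ : K) = 0 := by
  classical
  obtain ⟨T, rfl⟩ := hΓ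
  have hfin : ((Set.range (Sum.inl : InfinitePlace K → AllPlaces K) ∪
      {v : AllPlaces K | logAbs v (2 : K) ≠ 0}) ∪
      ⋃ γ ∈ T, {v : AllPlaces K | logAbs v (γ : K) ≠ 0}).Finite :=
    ((Set.finite_range _).union (finite_logAbs_ne_zero two_ne_zero)).union
      (T.finite_toSet.biUnion fun γ _ => finite_logAbs_ne_zero γ.ne_zero)
  refine ⟨hfin.toFinset, fun v => by simp, fun v hv => ?_, fun γ hγ => ?_⟩
  · have h : logAbs v (2 : K) = 0 := by
      by_contra h
      exact hv (hfin.mem_toFinset.2 (Or.inl (Or.inr h)))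
    rcases mul_eq_zero.1 h with h | h
    · exact absurd h (Nat.cast_ne_zero.2 (placeMult_pos v).ne')
    · exact Real.eq_one_of_pos_of_log_eq_zero (placeAbs_pos v two_ne_zero) h
  · induction hγ using Subgroup.closure_induction with
    | mem x hx =>
      intro v hv
      by_contra h
      exact hv (hfin.mem_toFinset.2 (Or.inr (Set.mem_biUnion hx h)))
    | one => intro v _; rw [Units.val_one, logAbs_one]
    | mul x y _ _ hx hy =>
      intro v hv
      rw [Units.val_mul, logAbs_mul v x.ne_zero y.ne_zero, hx v hv, hy v hv, add_zero]
    | inv x _ hx =>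
      intro v hv
      rw [Units.val_inv_eq_inv_val, logAbs_inv, hx v hv, neg_zero]

/-- Finitely generated groups of units of number fields have the Mann property. -/
theorem NumberField.hasMannProperty {Γ : Subgroup Kˣ} (hΓ : Γ.FG) : Γ.HasMannProperty := by
  intro n
  by_contra hinf
  obtain ⟨S, hS, hS2, hΓS⟩ := exists_finset_places hΓ
  set u := Set.Infinite.natEmbedding _ hinf
  set x : ℕ → Fin n → Kˣ := fun N => (u N : Fin n → Kˣ) with hx
  have hxinj : Function.Injective x := Subtype.val_injective.comp u.injective
  have hxs := fun N => (u N).2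
  simp only [Set.mem_ofPred_eq] at hxs
  set φ : Ultrafilter ℕ := hyperfilter ℕ with hφ
  set t : ℕ → ℝ := fun N => ∑ i, logHeight₁ (x N i : K) with ht_def
  have hle : ∀ N i, logHeight₁ (x N i : K) ≤ t N := fun N i =>
    Finset.single_le_sum (f := fun i => logHeight₁ (x N i : K))
      (fun i _ => zero_le_logHeight₁ _) (Finset.mem_univ i)
  have ht : Tendsto t φ atTop := by
    refine tendsto_atTop.2 fun B => hyperfilter_le_cofinite ?_
    have hfin : {N | t N ≤ B}.Finite := by
      refine Set.Finite.of_finite_image (f := fun N i => (x N i : K)) ?_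
        fun N _ N' _ h => hxinj (funext fun i => Units.ext (congrFun h i))
      refine (Set.Finite.pi fun _ : Fin n => Northcott.finite_le (h := logHeight₁ (K := K)) B).subset ?_
      rintro _ ⟨N, hN, rfl⟩ i -
      exact (hle N i).trans hN
    refine hfin.subset fun N hN => ?_
    exact (not_le.1 (show ¬ B ≤ t N from hN)).le
  set z : Option (Fin n) → ℕ → K := fun o N => o.elim (-1) (fun i => (x N i : K)) with hz
  have hz0 : ∀ o N, z o N ≠ 0 := by
    rintro (_ | i) N
    · simp [hz]
    · exact (x N i).ne_zero
  have hzg : ∀ o, ((z o : ℕ → K) : Germ (φ : Filter ℕ) K) ≠ 0 := fun o h => by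
    obtain ⟨N, hN⟩ := (Germ.coe_eq.1 h).exists
    exact hz0 o N hN
  have hzsum : ∀ N, ∑ o, z o N = 0 := fun N => by
    rw [Fintype.sum_option, show z none N = -1 from rfl]
    exact neg_add_eq_zero.2 (hxs N).2.1.symm
  have hznd : ∀ N (J : Finset (Option (Fin n))), J.Nonempty → J ≠ Finset.univ →
      ∑ o ∈ J, z o N ≠ 0 := fun N J hJ hJ' =>
    sum_option_ne_zero (hzsum N) (hxs N).2.2 hJ hJ'
  have hratio := ratio_mem_of_exists_nonconst_relation (C := smallSubfield (K := K) φ ht)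
    (almostUnits φ ht S) (smallSubfield_le_almostUnits φ ht S)
    (exists_nonconst_relation ht hS hS2) (fun o => Units.mk0 _ (hzg o)) (fun o => by
      refine (mem_almostUnits φ ht rfl).2 ⟨fun ε hε => ?_, 1, ?_⟩
      · filter_upwards [ht.eventually_ge_atTop 0] with N hN
        rw [outMass_eq_zero]
        · positivity
        · rcases o with _ | i
          · intro v _
            rw [show z none N = -1 from rfl, logAbs_neg, logAbs_one]
          · exact hΓS _ ((hxs N).1 i)
      · filter_upwards [ht.eventually_ge_atTop 0] with N hN
        rw [one_mul]
        rcases o with _ | i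
        · rw [show z none N = -1 from rfl, logHeight₁_neg, logHeight₁_one]
          exact hN
        · exact hle N i) (by
      simp only [Units.val_mk0]
      rw [← Germ.coe_sum_apply]
      exact Germ.coe_eq.2 (Eventually.of_forall hzsum)) (fun J hJ hJ' h => by
      simp only [Units.val_mk0] at h
      rw [← Germ.coe_sum_apply] at h
      obtain ⟨N, hN⟩ := (Germ.coe_eq.1 h).exists
      exact hznd N J hJ hJ' hN)
  have hsmall : ∀ i : Fin n, ∀ ε > 0, ∀ᶠ N in (φ : Filter ℕ), logHeight₁ (x N i : K) ≤ ε * t N := by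
    intro i
    refine (coe_mem_smallSubfield φ ht).1 ?_
    obtain ⟨c, hc⟩ := hratio (some i) none
    have h : (((fun N => (x N i : K)) : ℕ → K) : Germ (φ : Filter ℕ) K) = -(c : Germ (φ : Filter ℕ) K) := by
      refine (show _ = _ from hc).trans ?_
      rw [Units.val_mk0, Subfield.smul_def, smul_eq_mul]
      exact mul_neg_one _
    rw [h]
    exact neg_mem c.2
  have hfin : ∀ᶠ N in (φ : Filter ℕ), ∀ i, logHeight₁ (x N i : K) ≤ 1 / (n + 1) * t N :=
    eventually_all.2 fun i => hsmall i _ (by positivity)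
  obtain ⟨N, h1, h2⟩ := (hfin.and (ht.eventually_gt_atTop 0)).exists
  have h3 : t N ≤ n * (1 / (n + 1) * t N) := by
    refine (Finset.sum_le_sum fun i _ => h1 i).trans (le_of_eq ?_)
    rw [Finset.sum_const, Finset.card_univ, Fintype.card_fin, nsmul_eq_mul]
  have h4 : (n : ℝ) * (1 / (n + 1) * t N) = t N - t N / (n + 1) := by
    field_simp
    ring
  have h5 : 0 < t N / (n + 1) := by positivity
  linarith

end UnitEquation

end

section

open Filter

section MannField

/-- All finitely generated groups of units of the field have the Mann property. -/
def IsMannField (F : Type*) [Field F] : Prop :=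
  ∀ Γ : Subgroup Fˣ, Γ.FG → Γ.HasMannProperty

variable {F E : Type*} [Field F] [Field E] {ι : Type*} [Fintype ι]

theorem Subgroup.HasMannProperty.map {Γ : Subgroup Fˣ} (h : Γ.HasMannProperty) (f : F →+* E) :
    (Γ.map (Units.map (f : F →* E))).HasMannProperty := by
  intro n
  refine ((h n).image fun x i => Units.map (f : F →* E) (x i)).subset ?_
  rintro x ⟨hx, hsum, hnd⟩
  choose z hz hzx using hx
  have hzx' : ∀ i, (x i : E) = f (z i) := fun i => by
    rw [← hzx i]
    rfl
  refine ⟨z, ⟨hz, f.injective ?_, fun J hJ h0 => hnd J hJ ?_⟩, funext hzx⟩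
  · rw [map_sum, map_one, ← hsum]
    exact Finset.sum_congr rfl fun i _ => (hzx' i).symm
  · rw [Finset.sum_congr rfl fun i _ => hzx' i, ← map_sum, h0, map_zero]

theorem Subgroup.HasMannProperty.mono {Γ Γ' : Subgroup Fˣ} (h : Γ'.HasMannProperty) (hle : Γ ≤ Γ') :
    Γ.HasMannProperty := fun n =>
  (h n).subset fun _ hx => ⟨fun i => hle (hx.1 i), hx.2⟩

/-- In a Mann field, nondegenerate families of sum zero are ultimately constant up to scaling. -/
theorem IsMannField.exists_eventually_eq_mul (h : IsMannField F) {Γ : Subgroup Fˣ} (hΓ : Γ.FG)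
    {φ : Ultrafilter ℕ} (u : ι → ℕ → Fˣ) (hu : ∀ i, ∀ᶠ N in (φ : Filter ℕ), u i N ∈ Γ)
    (hs : ∀ᶠ N in (φ : Filter ℕ), ∑ i, (u i N : F) = 0)
    (hnd : ∀ J : Finset ι, J.Nonempty → J ≠ Finset.univ →
      ∀ᶠ N in (φ : Filter ℕ), ∑ i ∈ J, (u i N : F) ≠ 0) (i j : ι) :
    ∃ c : F, ∀ᶠ N in (φ : Filter ℕ), (u i N : F) = c * u j N := by
  classical
  rcases eq_or_ne i j with rfl | hij
  · exact ⟨1, Eventually.of_forall fun N => (one_mul _).symm⟩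
  let e := Fintype.equivFin {k // k ≠ j}
  have hfg : (Γ ⊔ Subgroup.closure {(-1 : Fˣ)}).FG :=
    hΓ.sup ⟨{-1}, by rw [Finset.coe_singleton]⟩
  have hfin := h _ hfg (Fintype.card {k // k ≠ j})
  have hu' : ∀ᶠ N in (φ : Filter ℕ), ∀ i, u i N ∈ Γ := eventually_all.2 hu
  have hnd' : ∀ᶠ N in (φ : Filter ℕ), ∀ J : Finset ι, J.Nonempty → J ≠ Finset.univ →
      ∑ i ∈ J, (u i N : F) ≠ 0 := eventually_all.2 fun J => by
    by_cases h1 : J.Nonempty ∧ J ≠ Finset.univ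
    · filter_upwards [hnd J h1.1 h1.2] with N hN _ _ using hN
    · exact Eventually.of_forall fun N h2 h3 => absurd ⟨h2, h3⟩ h1
  set x : ℕ → Fin (Fintype.card {k // k ≠ j}) → Fˣ :=
    fun N l => -1 * u (e.symm l) N * (u j N)⁻¹ with hx
  have hxval : ∀ N l, (x N l : F) = -(u j N : F)⁻¹ * u (e.symm l) N := fun N l => by
    simp [hx, mul_comm]
  obtain ⟨c, hc⟩ : ∃ c, ∀ᶠ N in (φ : Filter ℕ), x N = c := by
    have : ∀ᶠ N in (φ : Filter ℕ), ∃ c ∈ hfin.toFinset, x N = c := by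
      filter_upwards [hu', hs, hnd'] with N h1 h2 h3
      refine ⟨x N, hfin.mem_toFinset.2 ⟨fun l => ?_, ?_, fun J hJ => ?_⟩, rfl⟩
      · refine mul_mem (mul_mem ?_ ?_) ?_
        · exact le_sup_right (a := Γ) (Subgroup.mem_closure_singleton_self _)
        · exact le_sup_left (a := Γ) (h1 _)
        · exact le_sup_left (a := Γ) (inv_mem (h1 _))
      · simp only [hxval]
        rw [← Finset.mul_sum, e.symm.sum_comp (fun k : {k // k ≠ j} => (u k N : F))]
        rw [← Finset.add_sum_erase _ _ (Finset.mem_univ j)] at h2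
        have h4 : ∑ k : {k // k ≠ j}, (u k N : F) = ∑ k ∈ Finset.univ.erase j, (u k N : F) :=
          (Finset.sum_subtype _ (fun k => by simp) fun k => (u k N : F)).symm
        rw [h4, ← neg_eq_of_add_eq_zero_right h2]
        simp
      · simp only [hxval]
        rw [← Finset.mul_sum]
        refine mul_ne_zero (by simp) ?_
        have h4 := h3 (J.map ⟨fun l => (e.symm l : ι),
          Subtype.val_injective.comp e.symm.injective⟩) (by simpa using hJ) fun h5 => by
            have := h5.symm ▸ Finset.mem_univ j
            simp only [Finset.mem_map, Function.Embedding.coeFn_mk] at this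
            obtain ⟨l, -, hl⟩ := this
            exact (e.symm l).2 hl
        rwa [Finset.sum_map] at h4
    obtain ⟨c, hc⟩ := (Ultrafilter.eventually_exists_mem_iff (Finset.finite_toSet _)).1 this
    exact ⟨c, hc.2⟩
  refine ⟨-c (e ⟨i, hij⟩), ?_⟩
  filter_upwards [hc] with N hN
  rw [← hN, hxval, Equiv.symm_apply_apply]
  field_simp

theorem Subgroup.hasMannProperty_of_forall_exists_eventually {Γ : Subgroup Fˣ} (hΓ : -1 ∈ Γ)
    (h : ∀ (n : ℕ) (u : Option (Fin n) → ℕ → Fˣ), (∀ i N, u i N ∈ Γ) →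
      (∀ N, ∑ i, (u i N : F) = 0) →
      (∀ N (J : Finset (Option (Fin n))), J.Nonempty → J ≠ Finset.univ →
        ∑ i ∈ J, (u i N : F) ≠ 0) →
      ∀ i j, ∃ c : F, ∀ᶠ N in (hyperfilter ℕ : Filter ℕ), (u i N : F) = c * u j N) :
    Γ.HasMannProperty := by
  intro n
  by_contra hinf
  set u := Set.Infinite.natEmbedding _ hinf
  set x : ℕ → Fin n → Fˣ := fun N => (u N : Fin n → Fˣ) with hx
  have hxinj : Function.Injective x := Subtype.val_injective.comp u.injective
  have hxs := fun N => (u N).2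
  simp only [Set.mem_ofPred_eq] at hxs
  set z : Option (Fin n) → ℕ → Fˣ := fun o N => o.elim (-1) (x N) with hz
  have hzsum : ∀ N, ∑ o, (z o N : F) = 0 := fun N => by
    rw [Fintype.sum_option, show z none N = -1 from rfl, Units.val_neg, Units.val_one]
    exact neg_add_eq_zero.2 (hxs N).2.1.symm
  have hconst := fun i : Fin n => h n z (by
    rintro (_ | i) N
    · exact hΓ
    · exact (hxs N).1 i) hzsum (fun N J => sum_option_ne_zero (hzsum N) (hxs N).2.2)
    (some i) none
  choose c hc using hconst
  have hmem := eventually_all.2 hc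
  refine Set.Finite.notMem_hyperfilter (Set.Subsingleton.finite fun N hN N' hN' => hxinj ?_) hmem
  funext i
  exact Units.ext ((hN i).trans (hN' i).symm)

end MannField

section BoundedGerms

variable {F : Type*} [Field F] (C : Subfield F) (φ : Ultrafilter ℕ)

/-- The germs of quotients of elements of a fixed finite-dimensional space. -/
def boundedSubfield : Subfield (Germ (φ : Filter ℕ) F) where
  carrier := {x | ∃ V : Submodule C F, V.FG ∧
    Germ.LiftPred (fun a => ∃ r ∈ V, ∃ s ∈ V, s ≠ 0 ∧ a * s = r) x}
  mul_mem' {x y} hx hy := by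
    induction x using Germ.inductionOn with | _ f
    induction y using Germ.inductionOn with | _ g
    obtain ⟨V, hV, hx⟩ := hx
    obtain ⟨W, hW, hy⟩ := hy
    refine ⟨V * W, hV.mul hW, ?_⟩
    rw [← Germ.coe_mul, Germ.liftPred_coe]
    filter_upwards [Germ.liftPred_coe.1 hx, Germ.liftPred_coe.1 hy] with N h1 h2
    obtain ⟨r, hr, s, hs, hs0, h1⟩ := h1
    obtain ⟨r', hr', s', hs', hs0', h2⟩ := h2
    exact ⟨r * r', Submodule.mul_mem_mul hr hr', s * s', Submodule.mul_mem_mul hs hs',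
      mul_ne_zero hs0 hs0', by rw [Pi.mul_apply, ← h1, ← h2]; ring⟩
  one_mem' := ⟨Submodule.span C {1}, Submodule.fg_span_singleton 1, by
    rw [← Germ.coe_one, Germ.liftPred_coe]
    exact Eventually.of_forall fun N => ⟨1, Submodule.mem_span_singleton_self 1, 1,
      Submodule.mem_span_singleton_self 1, one_ne_zero, by simp⟩⟩
  add_mem' {x y} hx hy := by
    induction x using Germ.inductionOn with | _ f
    induction y using Germ.inductionOn with | _ g
    obtain ⟨V, hV, hx⟩ := hx
    obtain ⟨W, hW, hy⟩ := hy
    refine ⟨V * W, hV.mul hW, ?_⟩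
    rw [← Germ.coe_add, Germ.liftPred_coe]
    filter_upwards [Germ.liftPred_coe.1 hx, Germ.liftPred_coe.1 hy] with N h1 h2
    obtain ⟨r, hr, s, hs, hs0, h1⟩ := h1
    obtain ⟨r', hr', s', hs', hs0', h2⟩ := h2
    exact ⟨r * s' + s * r', add_mem (Submodule.mul_mem_mul hr hs') (Submodule.mul_mem_mul hs hr'),
      s * s', Submodule.mul_mem_mul hs hs', mul_ne_zero hs0 hs0',
      by rw [Pi.add_apply, ← h1, ← h2]; ring⟩
  zero_mem' := ⟨Submodule.span C {1}, Submodule.fg_span_singleton 1, by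
    rw [← Germ.coe_zero, Germ.liftPred_coe]
    exact Eventually.of_forall fun N => ⟨0, zero_mem _, 1,
      Submodule.mem_span_singleton_self 1, one_ne_zero, by simp⟩⟩
  neg_mem' {x} hx := by
    induction x using Germ.inductionOn with | _ f
    obtain ⟨V, hV, hx⟩ := hx
    refine ⟨V, hV, ?_⟩
    rw [← Germ.coe_neg, Germ.liftPred_coe]
    filter_upwards [Germ.liftPred_coe.1 hx] with N h1
    obtain ⟨r, hr, s, hs, hs0, h1⟩ := h1
    exact ⟨-r, neg_mem hr, s, hs, hs0, by rw [Pi.neg_apply, ← h1, neg_mul]⟩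
  inv_mem' x hx := by
    induction x using Germ.inductionOn with | _ f
    obtain ⟨V, hV, hx⟩ := hx
    refine ⟨V, hV, ?_⟩
    rw [← Germ.coe_inv, Germ.liftPred_coe]
    filter_upwards [Germ.liftPred_coe.1 hx] with N h1
    obtain ⟨r, hr, s, hs, hs0, h1⟩ := h1
    rcases eq_or_ne (f N) 0 with h0 | h0
    · exact ⟨0, zero_mem _, s, hs, hs0, by simp [h0]⟩
    · refine ⟨s, hs, r, hr, ?_, ?_⟩
      · rw [← h1]
        exact mul_ne_zero h0 hs0
      · rw [Pi.inv_apply, ← h1, inv_mul_cancel_left₀ h0]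

theorem coe_mem_boundedSubfield {f : ℕ → F} :
    (f : Germ (φ : Filter ℕ) F) ∈ boundedSubfield C φ ↔ ∃ V : Submodule C F, V.FG ∧
      ∀ᶠ N in (φ : Filter ℕ), ∃ r ∈ V, ∃ s ∈ V, s ≠ 0 ∧ f N * s = r := Iff.rfl

variable {C φ}

theorem coe_mem_boundedSubfield_of_mem {f : ℕ → F} (hf : ∀ᶠ N in (φ : Filter ℕ), f N ∈ C) :
    (f : Germ (φ : Filter ℕ) F) ∈ boundedSubfield C φ := by
  refine (coe_mem_boundedSubfield C φ).2 ⟨Submodule.span C {1}, Submodule.fg_span_singleton 1, ?_⟩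
  filter_upwards [hf] with N hN
  exact ⟨f N, Submodule.mem_span_singleton.2 ⟨⟨f N, hN⟩, mul_one _⟩, 1,
    Submodule.mem_span_singleton_self 1, one_ne_zero, mul_one _⟩

theorem derivation_mem_boundedSubfield (D : Derivation C F F) {f : ℕ → F}
    (hf : (f : Germ (φ : Filter ℕ) F) ∈ boundedSubfield C φ) :
    ((fun N => D (f N) : ℕ → F) : Germ (φ : Filter ℕ) F) ∈ boundedSubfield C φ := by
  obtain ⟨V, hV, h⟩ := (coe_mem_boundedSubfield C φ).1 hf
  have hle : V * V ≤ V * (V ⊔ V.map D.toLinearMap) := mul_le_mul' le_rfl le_sup_left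
  refine (coe_mem_boundedSubfield C φ).2 ⟨V * (V ⊔ V.map D.toLinearMap), hV.mul
    (hV.sup (hV.map _)), ?_⟩
  filter_upwards [h] with N h1
  obtain ⟨r, hr, s, hs, hs0, h1⟩ := h1
  have hD : ∀ v ∈ V, D v ∈ V ⊔ V.map D.toLinearMap := fun v hv =>
    le_sup_right (a := V) (Submodule.mem_map_of_mem hv)
  refine ⟨s * D r - r * D s, sub_mem (Submodule.mul_mem_mul hs (hD r hr))
    (Submodule.mul_mem_mul hr (hD s hs)), s * s, hle (Submodule.mul_mem_mul hs hs),
    mul_ne_zero hs0 hs0, ?_⟩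
  rw [← h1, D.leibniz, smul_eq_mul, smul_eq_mul]
  ring

variable (φ) in
/-- The units whose logarithmic derivative is bounded. -/
def boundedLogDeriv (D : Derivation C F F) : Subgroup (Germ (φ : Filter ℕ) F)ˣ where
  carrier := {x | (x : Germ (φ : Filter ℕ) F).map (fun a => D a / a) ∈ boundedSubfield C φ}
  mul_mem' {x y} hx hy := by
    have hx0 := x.ne_zero
    have hy0 := y.ne_zero
    simp only [Set.mem_ofPred_eq, Units.val_mul] at *
    generalize (x : Germ (φ : Filter ℕ) F) = x at *
    generalize (y : Germ (φ : Filter ℕ) F) = y at *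
    induction x using Germ.inductionOn with | _ f
    induction y using Germ.inductionOn with | _ g
    have hx2 : ∀ᶠ N in (φ : Filter ℕ), f N ≠ 0 :=
      Ultrafilter.eventually_not.2 fun h => hx0 (Germ.coe_eq.2 h)
    have hy2 : ∀ᶠ N in (φ : Filter ℕ), g N ≠ 0 :=
      Ultrafilter.eventually_not.2 fun h => hy0 (Germ.coe_eq.2 h)
    have h := add_mem hx hy
    rw [Germ.map_coe, Germ.map_coe, ← Germ.coe_add] at h
    rw [← Germ.coe_mul, Germ.map_coe]
    convert h using 1
    refine Germ.coe_eq.2 ?_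
    filter_upwards [hx2, hy2] with N h1 h2
    simp only [Function.comp_apply, Pi.add_apply, Pi.mul_apply, D.leibniz, smul_eq_mul]
    field_simp
    ring
  one_mem' := by
    show Germ.map _ ((1 : (Germ (φ : Filter ℕ) F)ˣ) : Germ (φ : Filter ℕ) F) ∈ boundedSubfield C φ
    rw [Units.val_one, ← Germ.coe_one, Germ.map_coe]
    refine coe_mem_boundedSubfield_of_mem (Eventually.of_forall fun N => ?_)
    simp
  inv_mem' {x} hx := by
    simp only [Set.mem_ofPred_eq, Units.val_inv_eq_inv_val] at *
    generalize (x : Germ (φ : Filter ℕ) F) = x at *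
    induction x using Germ.inductionOn with | _ f
    have h := neg_mem hx
    rw [Germ.map_coe, ← Germ.coe_neg] at h
    rw [← Germ.coe_inv, Germ.map_coe]
    convert h using 1
    refine congrArg _ (funext fun N => ?_)
    simp only [Function.comp_apply, Pi.neg_apply, Pi.inv_apply, D.leibniz_inv, smul_eq_mul]
    rcases eq_or_ne (f N) 0 with h0 | h0
    · simp [h0]
    · field_simp

theorem mem_boundedLogDeriv {D : Derivation C F F} {x : (Germ (φ : Filter ℕ) F)ˣ} {f : ℕ → F}
    (hf : (x : Germ (φ : Filter ℕ) F) = f) : x ∈ boundedLogDeriv φ D ↔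
      ((fun N => D (f N) / f N : ℕ → F) : Germ (φ : Filter ℕ) F) ∈ boundedSubfield C φ := by
  show _ ∈ boundedSubfield C φ ↔ _
  rw [hf]
  rfl

theorem map_mem_boundedLogDeriv (D : Derivation C F F) (x : boundedSubfield C φ) (hx : x ≠ 0) :
    Units.map (algebraMap (boundedSubfield C φ) (Germ (φ : Filter ℕ) F)).toMonoidHom
      (Units.mk0 x hx) ∈ boundedLogDeriv φ D := by
  obtain ⟨f, hf⟩ : ∃ f : ℕ → F, (x : Germ (φ : Filter ℕ) F) = f :=
    ⟨Quotient.out (x : Germ (φ : Filter ℕ) F), (Quotient.out_eq _).symm⟩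
  refine (mem_boundedLogDeriv hf).2 ?_
  have h1 := x.2
  rw [hf] at h1
  exact div_mem (derivation_mem_boundedSubfield D h1) h1

theorem logDeriv_mem_boundedSubfield (D : Derivation C F F) {Γ : Subgroup Fˣ} (hΓ : Γ.FG)
    {u : ℕ → Fˣ} (hu : ∀ N, u N ∈ Γ) :
    ((fun N => D (u N) / u N : ℕ → F) : Germ (φ : Filter ℕ) F) ∈ boundedSubfield C φ := by
  obtain ⟨T, rfl⟩ := hΓ
  set V : Submodule C F := Submodule.span C ((fun γ : Fˣ => D γ / (γ : F)) '' T) with hV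
  have hle : ∀ γ ∈ Subgroup.closure (T : Set Fˣ), D γ / (γ : F) ∈ V := by
    intro γ hγ
    induction hγ using Subgroup.closure_induction with
    | mem x hx => exact Submodule.subset_span (Set.mem_image_of_mem _ hx)
    | one => simp
    | mul x y _ _ hx hy =>
      have h : D ((x * y : Fˣ) : F) / ((x * y : Fˣ) : F) = D x / x + D y / y := by
        rw [Units.val_mul, D.leibniz, smul_eq_mul, smul_eq_mul]
        field_simp
        ring
      rw [h]
      exact add_mem hx hy
    | inv x _ hx =>
      have h : D ((x⁻¹ : Fˣ) : F) / ((x⁻¹ : Fˣ) : F) = -(D x / x) := by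
        rw [Units.val_inv_eq_inv_val, D.leibniz_inv, smul_eq_mul]
        field_simp
      rw [h]
      exact neg_mem hx
  refine (coe_mem_boundedSubfield C φ).2 ⟨V ⊔ Submodule.span C {1},
    (Submodule.fg_span (T.finite_toSet.image _)).sup (Submodule.fg_span_singleton 1),
    Eventually.of_forall fun N => ?_⟩
  exact ⟨D (u N) / u N, Submodule.mem_sup_left (hle _ (hu N)), 1,
    Submodule.mem_sup_right (Submodule.mem_span_singleton_self 1), one_ne_zero, mul_one _⟩

/-- Nondegenerate families of sum zero in a finitely generated group have bounded ratios. -/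
theorem exists_ratio_bounded {ι : Type*} [Fintype ι] (D : Derivation C F F)
    (hD : ∀ x, D x = 0 → x ∈ C) {Γ : Subgroup Fˣ} (hΓ : Γ.FG) (u : ι → ℕ → Fˣ)
    (hu : ∀ i N, u i N ∈ Γ) (hs : ∀ N, ∑ i, (u i N : F) = 0)
    (hnd : ∀ N (J : Finset ι), J.Nonempty → J ≠ Finset.univ → ∑ i ∈ J, (u i N : F) ≠ 0)
    (i j : ι) : ((fun N => (u i N : F) / u j N : ℕ → F) : Germ (φ : Filter ℕ) F) ∈
      boundedSubfield C φ := by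
  have hg : ∀ i, ((fun N => (u i N : F) : ℕ → F) : Germ (φ : Filter ℕ) F) ≠ 0 := fun i h => by
    obtain ⟨N, hN⟩ := (Germ.coe_eq.1 h).exists
    exact (u i N).ne_zero hN
  obtain ⟨c, hc⟩ := ratio_mem_of_exists_nonconst_relation (C := boundedSubfield C φ)
    (boundedLogDeriv φ D) (map_mem_boundedLogDeriv D) (fun n y hy hsum => by
      have hrep : ∀ i, ∃ f : ℕ → F, (y i : Germ (φ : Filter ℕ) F) = f := fun i =>
        ⟨Quotient.out (y i : Germ (φ : Filter ℕ) F), (Quotient.out_eq _).symm⟩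
      choose f hf using hrep
      have hf0 : ∀ i, ∀ᶠ N in (φ : Filter ℕ), f i N ≠ 0 := fun i =>
        Ultrafilter.eventually_not.2 fun h => (y i).ne_zero (by
          rw [hf i]
          exact Germ.coe_eq.2 h)
      set a : Fin (n + 3) → boundedSubfield C φ := fun i =>
        ⟨_, (mem_boundedLogDeriv (hf i)).1 (hy i)⟩ with ha
      by_cases hex : ∃ i j, a i ≠ a j
      · refine ⟨a, hex, ?_⟩
        have h1 : ((fun N => ∑ i, f i N : ℕ → F) : Germ (φ : Filter ℕ) F) =
            ((fun _ => 0 : ℕ → F) : Germ (φ : Filter ℕ) F) := by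
          rw [Germ.coe_sum_apply, ← Finset.sum_congr rfl fun i _ => hf i, hsum]
          rfl
        have h2 : ((fun N => ∑ i, D (f i N) / f i N * f i N : ℕ → F) : Germ (φ : Filter ℕ) F) =
            ((fun _ => 0 : ℕ → F) : Germ (φ : Filter ℕ) F) := by
          refine Germ.coe_eq.2 ?_
          filter_upwards [Germ.coe_eq.1 h1, eventually_all.2 hf0] with N h3 h4
          rw [Finset.sum_congr rfl fun i _ => div_mul_cancel₀ _ (h4 i), ← map_sum, h3, map_zero]
        rw [Germ.coe_sum_apply] at h2
        refine Eq.trans (Finset.sum_congr rfl fun i _ => ?_) h2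
        rw [hf i]
        rfl
      · push Not at hex
        have hC : ((fun N => f 1 N / f 0 N : ℕ → F) : Germ (φ : Filter ℕ) F) ∈
            boundedSubfield C φ := by
          refine coe_mem_boundedSubfield_of_mem ?_
          filter_upwards [Germ.coe_eq.1 (congrArg Subtype.val (hex 1 0)), hf0 0, hf0 1]
            with N h1 h2 h3
          refine hD _ ?_
          rw [div_eq_div_iff h3 h2] at h1
          rw [div_eq_mul_inv, D.leibniz, D.leibniz_inv, smul_eq_mul, smul_eq_mul, smul_eq_mul]
          field_simp
          linear_combination h1
        refine ⟨Pi.single 0 ⟨_, hC⟩ - Pi.single 1 1, ⟨2, 1, ?_⟩, ?_⟩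
        · have h1 : (2 : Fin (n + 3)) ≠ 0 := fun h => by
            have := congrArg Fin.val h
            simp [Nat.mod_eq_of_lt (show 2 < n + 3 by omega)] at this
          have h2 : (2 : Fin (n + 3)) ≠ 1 := fun h => by
            have := congrArg Fin.val h
            simp [Nat.mod_eq_of_lt (show 2 < n + 3 by omega)] at this
          simp [h1, h2]
        · simp only [Pi.sub_apply, sub_smul, Finset.sum_sub_distrib, Pi.single_apply, ite_smul,
            zero_smul, Finset.sum_ite_eq', Finset.mem_univ, if_true, one_smul]
          rw [sub_eq_zero, hf 0, hf 1]
          refine Germ.coe_eq.2 ?_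
          filter_upwards [hf0 0] with N h1
          exact div_mul_cancel₀ _ h1)
    (fun i => Units.mk0 _ (hg i)) (fun i => (mem_boundedLogDeriv rfl).2
      (logDeriv_mem_boundedSubfield D hΓ (hu i))) (by
      simp only [Units.val_mk0]
      rw [← Germ.coe_sum_apply]
      exact Germ.coe_eq.2 (Eventually.of_forall hs)) (fun J hJ hJ' h => by
      simp only [Units.val_mk0] at h
      rw [← Germ.coe_sum_apply] at h
      obtain ⟨N, hN⟩ := (Germ.coe_eq.1 h).exists
      exact hnd N J hJ hJ' hN) i j
  have h : ((fun N => (u i N : F) / u j N : ℕ → F) : Germ (φ : Filter ℕ) F) = c := by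
    have h1 : ((fun N => (u i N : F) / u j N : ℕ → F) : Germ (φ : Filter ℕ) F) =
      ((fun N => (u i N : F) : ℕ → F) : Germ (φ : Filter ℕ) F) /
      ((fun N => (u j N : F) : ℕ → F) : Germ (φ : Filter ℕ) F) := rfl
    rw [h1, div_eq_iff (hg j)]
    exact hc
  rw [h]
  exact c.2

end BoundedGerms

section ValuationFinite

variable {F : Type*} [Field F] {C : Subfield F}

theorem ValuationSubring.valuation_eq_one_of_mem {V : ValuationSubring F}
    (hV : ∀ x ∈ C, x ∈ V) {x : F} (hx : x ∈ C) (hx0 : x ≠ 0) : V.valuation x = 1 := by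
  refine le_antisymm ((V.valuation_le_one_iff x).2 (hV x hx)) ?_
  refine (V.valuation.one_le_val_iff hx0).2 ?_
  exact (V.valuation_le_one_iff _).2 (hV _ (inv_mem hx))

theorem linearIndependent_of_injective_valuation {V : ValuationSubring F}
    (hV : ∀ x ∈ C, x ∈ V) {ι : Type*} [Fintype ι] {x : ι → F} (hx : ∀ i, x i ≠ 0)
    (hinj : Function.Injective fun i => V.valuation (x i)) : LinearIndependent C x := by
  classical
  refine Fintype.linearIndependent_iff.2 fun g hg => ?_
  by_contra! hne
  obtain ⟨i₀, hi₀⟩ := hne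
  set s := Finset.univ.filter fun i => g i ≠ 0 with hs
  obtain ⟨j, hj, hmax⟩ := s.exists_max_image (fun i => V.valuation (x i)) ⟨i₀, by simp [hs, hi₀]⟩
  have hval : ∀ i ∈ s, V.valuation (g i • x i) = V.valuation (x i) := fun i hi => by
    rw [Subfield.smul_def, smul_eq_mul, map_mul, ValuationSubring.valuation_eq_one_of_mem hV
      (g i).2 (by simpa [hs] using hi), one_mul]
  have h1 : ∑ i ∈ s, g i • x i = 0 := by
    rw [← hg, hs, Finset.sum_filter_of_ne]
    rintro i - h h0
    exact h (by rw [h0, zero_smul])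
  have h2 := V.valuation.map_sum_eq_of_lt (f := fun i => g i • x i) hj fun i hi => by
    rw [Finset.mem_sdiff, Finset.mem_singleton] at hi
    rw [hval i hi.1, hval j hj]
    exact lt_of_le_of_ne (hmax i hi.1) fun h => hi.2 (hinj h)
  rw [h1, map_zero, hval j hj] at h2
  exact hx j (V.valuation.zero_iff.1 h2.symm)

theorem finite_valuation_image {V : ValuationSubring F} (hV : ∀ x ∈ C, x ∈ V)
    {M : Submodule C F} (hM : M.FG) : {v | ∃ x ∈ M, x ≠ 0 ∧ V.valuation x = v}.Finite := by
  by_contra hinf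
  obtain ⟨t, ht, hcard⟩ := Set.Infinite.exists_subset_card_eq hinf (Module.finrank C M + 1)
  choose f hf using fun v : t => ht v.2
  have : Module.Finite C M := Module.Finite.iff_fg.2 hM
  have hli : LinearIndependent C f := linearIndependent_of_injective_valuation hV
    (fun v => (hf v).2.1) fun v w h => Subtype.ext (by
      have h' : V.valuation (f v) = V.valuation (f w) := h
      rwa [(hf v).2.2, (hf w).2.2] at h')
  have hli' : LinearIndependent C (fun v => (⟨f v, (hf v).1⟩ : M)) :=
    LinearIndependent.of_comp M.subtype hli
  have := hli'.fintype_card_le_finrank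
  rw [Fintype.card_coe, hcard] at this
  omega

/-- In a finitely generated abelian group, an intersection of subgroups with torsion-free quotients
is already a finite intersection. -/
theorem exists_finset_iInf_eq {M ι : Type*} [AddCommGroup M] [Module.Finite ℤ M]
    (K : ι → Submodule ℤ M) (hK : ∀ i (n : ℤ) x, n ≠ 0 → n • x ∈ K i → x ∈ K i) :
    ∃ s : Finset ι, ∀ x, (∀ i ∈ s, x ∈ K i) → ∀ i, x ∈ K i := by
  classical
  set L : Finset ι → Submodule ℤ M := fun s => ⨅ i ∈ s, K i with hL
  have hmem : ∀ s x, x ∈ L s ↔ ∀ i ∈ s, x ∈ K i := fun s x => by simp [hL]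
  set s := Function.argmin fun s => Module.finrank ℤ (L s) with hs
  refine ⟨s, fun x hx i => ?_⟩
  have hle : L (insert i s) ≤ L s := fun y hy =>
    (hmem _ _).2 fun k hk => (hmem _ _).1 hy k (Finset.mem_insert_of_mem hk)
  have h1 := ((L (insert i s)).submoduleOf (L s)).finrank_quotient_add_finrank
  rw [(Submodule.submoduleOfEquivOfLe hle).finrank_eq] at h1
  have h2 : Module.finrank ℤ (L s) ≤ Module.finrank ℤ (L (insert i s)) :=
    Function.argmin_le (fun s => Module.finrank ℤ (L s)) (insert i s)
  have h3 : Module.finrank ℤ (L s ⧸ (L (insert i s)).submoduleOf (L s)) = 0 := by omega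
  obtain ⟨a, ha, hax⟩ := Module.finrank_eq_zero_iff.1 h3
    (Submodule.Quotient.mk ⟨x, (hmem _ _).2 hx⟩)
  rw [← Submodule.Quotient.mk_smul, Submodule.Quotient.mk_eq_zero] at hax
  exact hK i a x ha ((hmem _ _).1 hax i (Finset.mem_insert_self _ _))

theorem exists_finset_valuationSubring [IsIntegrallyClosedIn C.toSubring F] {Γ : Subgroup Fˣ}
    (hΓ : Γ.FG) : ∃ s : Finset {V : ValuationSubring F // ∀ x ∈ C, x ∈ V},
      ∀ γ ∈ Γ, (∀ V ∈ s, V.1.valuation (γ : F) = 1) → (γ : F) ∈ C := by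
  have : Group.FG Γ := (Group.fg_iff_subgroup_fg Γ).2 hΓ
  have : Module.Finite ℤ (Additive Γ) := Module.Finite.iff_addGroup_fg.2 inferInstance
  set K : {V : ValuationSubring F // ∀ x ∈ C, x ∈ V} → Submodule ℤ (Additive Γ) := fun V =>
    AddSubgroup.toIntSubmodule (Subgroup.toAddSubgroup
      ((MonoidHom.comp V.1.valuation.toMonoidWithZeroHom.toMonoidHom ((Units.coeHom F).comp Γ.subtype)).ker)) with hK
  have hmem : ∀ V (γ : Γ), Additive.ofMul γ ∈ K V ↔ V.1.valuation ((γ : Fˣ) : F) = 1 :=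
    fun V γ => Iff.rfl
  obtain ⟨s, hs⟩ := exists_finset_iInf_eq K (fun V n x hn hx => by
    induction x using Additive.rec with | _ γ
    rw [← ofMul_zpow, hmem] at hx
    rw [hmem]
    simp only [Subgroup.coe_zpow, Units.val_zpow_eq_zpow_val, map_zpow₀] at hx
    by_contra h1
    exact hn ((zpow_eq_one_iff_right₀ zero_le h1).1 hx))
  refine ⟨s, fun γ hγ h => ?_⟩
  by_contra hC
  obtain ⟨V, hV, hγV⟩ := Subring.exists_le_valuationSubring_of_isIntegrallyClosedIn
    (R := C.toSubring) hC
  have h1 := hs (Additive.ofMul ⟨γ, hγ⟩) (fun W hW => (hmem W ⟨γ, hγ⟩).2 (h W hW)) ⟨V, hV⟩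
  exact hγV ((V.valuation_le_one_iff _).1 ((hmem ⟨V, hV⟩ ⟨γ, hγ⟩).1 h1).le)

/-- A bounded sequence in a finitely generated group is ultimately in a single coset of the
constants. -/
theorem exists_eventually_div_mem [IsIntegrallyClosedIn C.toSubring F] {φ : Ultrafilter ℕ}
    {Γ : Subgroup Fˣ} (hΓ : Γ.FG) {u : ℕ → Fˣ} (hu : ∀ N, u N ∈ Γ)
    (hb : ((fun N => (u N : F) : ℕ → F) : Germ (φ : Filter ℕ) F) ∈ boundedSubfield C φ) :
    ∃ γ ∈ Γ, ∀ᶠ N in (φ : Filter ℕ), ((u N / γ : Fˣ) : F) ∈ C := by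
  obtain ⟨s, hs⟩ := exists_finset_valuationSubring (C := C) hΓ
  obtain ⟨M, hM, hb⟩ := (coe_mem_boundedSubfield C φ).1 hb
  have hw : ∀ V : {V : ValuationSubring F // ∀ x ∈ C, x ∈ V}, ∃ w,
      ∀ᶠ N in (φ : Filter ℕ), V.1.valuation (u N : F) = w := fun V => by
    have hfin := finite_valuation_image V.2 hM
    have h : ∀ᶠ N in (φ : Filter ℕ), ∃ w ∈ (Set.image2 (· / ·) {v | ∃ x ∈ M, x ≠ 0 ∧
        V.1.valuation x = v} {v | ∃ x ∈ M, x ≠ 0 ∧ V.1.valuation x = v}),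
        V.1.valuation (u N : F) = w := by
      filter_upwards [hb] with N hN
      obtain ⟨r, hr, t, ht, ht0, h1⟩ := hN
      refine ⟨_, Set.mem_image2_of_mem ⟨r, hr, ?_, rfl⟩ ⟨t, ht, ht0, rfl⟩, ?_⟩
      · rw [← h1]
        exact mul_ne_zero (u N).ne_zero ht0
      · rw [← map_div₀, ← h1, mul_div_cancel_right₀ _ ht0]
    obtain ⟨w, -, hw⟩ := (Ultrafilter.eventually_exists_mem_iff (hfin.image2 _ hfin)).1 h
    exact ⟨w, hw⟩
  choose w hw using hw
  have hall : ∀ᶠ N in (φ : Filter ℕ), ∀ V ∈ s, V.1.valuation (u N : F) = w V :=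
    (eventually_all_finset s).2 fun V _ => hw V
  obtain ⟨N₀, hN₀⟩ := hall.exists
  refine ⟨u N₀, hu N₀, ?_⟩
  filter_upwards [hall] with N hN
  refine hs _ (div_mem (hu N) (hu N₀)) fun V hV => ?_
  rw [Units.val_div_eq_div_val, map_div₀, hN V hV, hN₀ V hV, ← hN V hV]
  exact div_self ((V.1.valuation.ne_zero_iff).2 (u N).ne_zero)

end ValuationFinite

section ConstantField

variable {F : Type*} [Field F]

theorem isIntegrallyClosedIn_of_derivation [CharZero F] {C : Subfield F} (D : Derivation C F F)
    (hD : ∀ x, D x = 0 → x ∈ C) : IsIntegrallyClosedIn C.toSubring F := by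
  refine Subring.isIntegrallyClosedIn_iff.2 fun x hx => hD x ?_
  have hx' : IsIntegral C x := hx
  have h1 := D.map_aeval (minpoly C x) x
  rw [minpoly.aeval, map_zero, smul_eq_mul] at h1
  refine (mul_eq_zero.1 h1.symm).resolve_left fun h2 => ?_
  have h3 := minpoly.irreducible hx'
  have h4 := minpoly.dvd C x h2
  have h5 := Polynomial.degree_derivative_lt h3.ne_zero
  exact (Polynomial.separable_iff_derivative_ne_zero h3).1 h3.separable
    (Polynomial.eq_zero_of_dvd_of_degree_lt h4 h5)

theorem Subgroup.FG.comap_of_injective {G H : Type*} [CommGroup G] [CommGroup H] {f : H →* G}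
    (hf : Function.Injective f) {Γ : Subgroup G} (hΓ : Γ.FG) : (Γ.comap f).FG := by
  have : Group.FG Γ := (Group.fg_iff_subgroup_fg Γ).2 hΓ
  have : Module.Finite ℤ (Additive Γ) := Module.Finite.iff_addGroup_fg.2 inferInstance
  have : Module.Finite ℤ (Additive (Γ.comap f)) := Module.Finite.of_injective
    (MonoidHom.toAdditive (f.subgroupComap Γ)).toIntLinearMap fun x y h =>
      Subtype.ext (hf (congrArg Subtype.val h))
  have : AddGroup.FG (Additive (Γ.comap f)) := Module.Finite.iff_addGroup_fg.1 this
  exact (Group.fg_iff_subgroup_fg _).1 (GroupFG.iff_add_fg.2 this)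

/-- The circuit criterion for proportionality, for sequences along an ultrafilter. -/
theorem exists_eventually_eq_mul_of_circuit {ι : Type*} [Fintype ι] {φ : Ultrafilter ℕ}
    (u : ι → ℕ → Fˣ) (hs : ∀ N, ∑ i, (u i N : F) = 0)
    (hnd : ∀ N (J : Finset ι), J.Nonempty → J ≠ Finset.univ → ∑ i ∈ J, (u i N : F) ≠ 0)
    (h : ∀ b : ι → F, (∀ᶠ N in (φ : Filter ℕ), ∑ i, b i * (u i N : F) = 0) →
      (∀ b' : ι → F, b' ≠ 0 → (∀ᶠ N in (φ : Filter ℕ), ∑ i, b' i * (u i N : F) = 0) →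
        (∀ i, b i = 0 → b' i = 0) → ∀ i, b' i = 0 → b i = 0) →
      ∀ i j, b i ≠ 0 → b j ≠ 0 →
        ∃ c : F, ∀ᶠ N in (φ : Filter ℕ), (u i N : F) = c * u j N) (i j : ι) :
    ∃ c : F, ∀ᶠ N in (φ : Filter ℕ), (u i N : F) = c * u j N := by
  let : Algebra F (Germ (φ : Filter ℕ) F) := Algebra.ofModule
    (fun r x y => by
      induction x using Germ.inductionOn with | _ f
      induction y using Germ.inductionOn with | _ g
      rw [← Germ.coe_smul, ← Germ.coe_mul, ← Germ.coe_mul, ← Germ.coe_smul, smul_mul_assoc])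
    (fun r x y => by
      induction x using Germ.inductionOn with | _ f
      induction y using Germ.inductionOn with | _ g
      rw [← Germ.coe_smul, ← Germ.coe_mul, ← Germ.coe_mul, ← Germ.coe_smul, mul_smul_comm])
  set y : ι → Germ (φ : Filter ℕ) F := fun i => ((fun N => (u i N : F) : ℕ → F) : Germ _ F) with hy
  have hcoe : ∀ (i j : ι) (c : F), y i = c • y j ↔
      ∀ᶠ N in (φ : Filter ℕ), (u i N : F) = c * u j N := fun i j c => Germ.coe_eq
  have hrel : ∀ b : ι → F, ∑ i, b i • y i = 0 ↔
      ∀ᶠ N in (φ : Filter ℕ), ∑ i, b i * (u i N : F) = 0 := fun b => by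
    have h1 : ∑ i, b i • y i =
        ((fun N => ∑ i, b i * (u i N : F) : ℕ → F) : Germ (φ : Filter ℕ) F) := by
      rw [Germ.coe_sum_apply]
      rfl
    rw [h1]
    exact Germ.coe_eq
  simp only [← hcoe] at h ⊢
  refine ratio_mem_of_isCircuit_ratio y (fun i h0 => ?_) ?_ (fun J hJ hJ' h0 => ?_)
    (fun b hb => h b ((hrel b).1 hb.2.1) fun b' h1 h2 h3 => hb.2.2 b' h1 ((hrel b').2 h2) h3) i j
  · obtain ⟨N, hN⟩ := (Germ.coe_eq.1 h0).exists
    exact (u i N).ne_zero hN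
  · rw [hy, ← Germ.coe_sum_apply]
    exact Germ.coe_eq.2 (Eventually.of_forall hs)
  · rw [hy, ← Germ.coe_sum_apply] at h0
    obtain ⟨N, hN⟩ := (Germ.coe_eq.1 h0).exists
    exact hnd N J hJ hJ' hN

/-- The Mann property passes from the field of constants of a derivation to the whole field. -/
theorem IsMannField.of_derivation [CharZero F] {C : Subfield F} (D : Derivation C F F)
    (hD : ∀ x, D x = 0 → x ∈ C) (hC : IsMannField C) : IsMannField F := by
  classical
  intro Γ₀ hΓ₀
  have := isIntegrallyClosedIn_of_derivation D hD
  set Γ := Γ₀ ⊔ Subgroup.closure {(-1 : Fˣ)} with hΓdef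
  have hΓ : Γ.FG := hΓ₀.sup ⟨{-1}, by rw [Finset.coe_singleton]⟩
  refine Subgroup.HasMannProperty.mono (Γ' := Γ) ?_ le_sup_left
  refine Subgroup.hasMannProperty_of_forall_exists_eventually
    (le_sup_right (a := Γ₀) (Subgroup.mem_closure_singleton_self _)) fun n u hu hs hnd => ?_
  set φ : Ultrafilter ℕ := hyperfilter ℕ
  have hcoset : ∀ k, ∃ γ : Fˣ, ∃ c : ℕ → Cˣ,
      (∀ N, c N ∈ Γ.comap (Units.map (C.subtype : C →* F))) ∧
      ∀ᶠ N in (φ : Filter ℕ), (u k N : F) = u none N * (γ * (c N : C)) := fun k => by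
    obtain ⟨γ, hγ, hev⟩ := exists_eventually_div_mem (φ := φ) hΓ (u := fun N => u k N / u none N)
      (fun N => div_mem (hu k N) (hu none N)) (by
        simp only [Units.val_div_eq_div_val]
        exact exists_ratio_bounded D hD hΓ u hu hs hnd k none)
    have hex : ∀ N, ∃ c : Cˣ, c ∈ Γ.comap (Units.map (C.subtype : C →* F)) ∧
        (((u k N / u none N / γ : Fˣ) : F) ∈ C → (u k N : F) = u none N * (γ * (c : C))) :=
      fun N => by
        by_cases h : ((u k N / u none N / γ : Fˣ) : F) ∈ C
        · refine ⟨Units.mk0 ⟨_, h⟩ fun h0 => (u k N / u none N / γ).ne_zero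
            (congrArg Subtype.val h0), ?_, fun _ => ?_⟩
          · have h1 : Units.map (C.subtype : C →* F) (Units.mk0 ⟨_, h⟩ fun h0 =>
              (u k N / u none N / γ).ne_zero (congrArg Subtype.val h0)) = u k N / u none N / γ :=
              Units.ext rfl
            rw [Subgroup.mem_comap, h1]
            exact div_mem (div_mem (hu k N) (hu none N)) hγ
          · simp only [Units.val_mk0, Units.val_div_eq_div_val]
            field_simp
        · exact ⟨1, one_mem _, fun h1 => absurd h1 h⟩
    choose c hc hc' using hex
    exact ⟨γ, c, hc, hev.mono hc'⟩
  choose γ c hc hev using hcoset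
  have hev' := eventually_all.2 hev
  refine exists_eventually_eq_mul_of_circuit u hs hnd fun b hb hmin i j hi hj => ?_
  obtain ⟨l, hl⟩ : ∃ l : Module.Dual C F, l (b i * γ i) ≠ 0 := by
    by_contra! h
    exact mul_ne_zero hi (γ i).ne_zero ((Module.forall_dual_apply_eq_zero_iff C _).1 h)
  set a : Option (Fin n) → C := fun k => l (b k * γ k) with ha
  have hrel : ∀ N (J : Finset (Option (Fin n))),
      (∀ k, (u k N : F) = u none N * (γ k * (c k N : C))) →
      ∑ k ∈ J, (a k : F) / γ k * (u k N : F) =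
        u none N * ((∑ k ∈ J, a k * (c k N : C) : C) : F) := fun N J h => by
    rw [AddSubmonoidClass.coe_finsetSum, Finset.mul_sum]
    refine Finset.sum_congr rfl fun k _ => ?_
    rw [h k, Subfield.coe_mul]
    field_simp
  have hsupp : ∀ k, b k = 0 → a k = 0 := fun k hk => by simp [ha, hk]
  have hzero : ∀ᶠ N in (φ : Filter ℕ), ∑ k, a k * (c k N : C) = 0 := by
    filter_upwards [hb, hev'] with N h1 h2
    have h3 : (u none N : F) * ∑ k, (c k N : C) • (b k * (γ k : F)) = 0 := by
      rw [← h1, Finset.mul_sum]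
      refine Finset.sum_congr rfl fun k _ => ?_
      rw [h2 k, Subfield.smul_def, smul_eq_mul]
      ring
    have h4 := congrArg l ((mul_eq_zero.1 h3).resolve_left (u none N).ne_zero)
    rw [map_sum, map_zero] at h4
    rw [← h4]
    refine Finset.sum_congr rfl fun k _ => ?_
    rw [map_smul, smul_eq_mul, mul_comm]
  have hsub : ∀ J : Finset (Option (Fin n)), (∃ k ∈ J, a k ≠ 0) →
      (∀ᶠ N in (φ : Filter ℕ), ∑ k ∈ J, a k * (c k N : C) = 0) → ∀ k, b k ≠ 0 →
      k ∈ J ∧ a k ≠ 0 := by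
    rintro J ⟨k₀, hk₀, hak₀⟩ hJ k hk
    have h1 := mt (hmin (fun k => if k ∈ J then (a k : F) / γ k else 0) (fun h => ?_) ?_ ?_ k) hk
    · by_contra h2
      refine h1 ?_
      by_cases hkJ : k ∈ J
      · have : a k = 0 := by
          by_contra h3
          exact h2 ⟨hkJ, h3⟩
        simp [this]
      · simp [hkJ]
    · have h2 := congrFun h k₀
      simp [hk₀, hak₀] at h2
    · filter_upwards [hJ, hev'] with N h2 h3
      simp only [ite_mul, zero_mul, Finset.sum_ite_mem, Finset.univ_inter]
      rw [hrel N J h3, h2]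
      simp
    · intro k hk
      simp [hsupp k hk]
  have hne : ∀ k, b k ≠ 0 → a k ≠ 0 := fun k hk =>
    (hsub Finset.univ ⟨i, Finset.mem_univ i, hl⟩ hzero k hk).2
  have hfg : (Γ.comap (Units.map (C.subtype : C →* F)) ⊔ Subgroup.closure
      (Set.range fun k : {k // b k ≠ 0} => Units.mk0 (a k) (hne k k.2))).FG :=
    (hΓ.comap_of_injective (Units.map_injective C.subtype_injective)).sup
      ((Subgroup.fg_iff _).2 ⟨_, rfl, Set.finite_range _⟩)
  obtain ⟨e, he⟩ := hC.exists_eventually_eq_mul hfg (φ := φ)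
    (fun (k : {k // b k ≠ 0}) N => Units.mk0 (a k) (hne k k.2) * c k N)
    (fun k => Eventually.of_forall fun N => mul_mem
      (Subgroup.mem_sup_right (Subgroup.subset_closure ⟨k, rfl⟩))
      (Subgroup.mem_sup_left (hc k N)))
    (by
      filter_upwards [hzero] with N hN
      rw [← hN]
      simp only [Units.val_mul, Units.val_mk0]
      refine (Finset.sum_subtype (Finset.univ.filter fun k => b k ≠ 0) (fun k => by simp)
        fun k => a k * (c k N : C)).symm.trans (Finset.sum_filter_of_ne fun k _ h hk => ?_)
      exact h (by rw [hsupp k hk, zero_mul]))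
    (fun J hJ hJ' => Ultrafilter.eventually_not.2 fun h => hJ' (by
      simp only [Units.val_mul, Units.val_mk0] at h
      refine Finset.eq_univ_iff_forall.2 fun k => ?_
      obtain ⟨k₀, hk₀⟩ := hJ
      have h1 := hsub (J.map (Function.Embedding.subtype _)) ⟨k₀, by simpa using ⟨k₀.2, hk₀⟩,
        hne k₀ k₀.2⟩ (by simpa only [Finset.sum_map, Function.Embedding.subtype_apply] using h) k k.2
      simpa [k.2] using h1.1)) ⟨i, hi⟩ ⟨j, hj⟩
  refine ⟨e * a j / γ j / (a i / γ i), ?_⟩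
  filter_upwards [he, hev'] with N h1 h2
  simp only [Units.val_mul, Units.val_mk0] at h1
  have h3 := congrArg Subtype.val h1
  simp only [Subfield.coe_mul] at h3
  have h4 : (a i : F) ≠ 0 := fun h => hl (Subtype.ext h)
  rw [h2 i, h2 j]
  field_simp
  linear_combination h3

end ConstantField

end

section CharZero

universe u

theorem exists_derivation_ne_zero {E : Type*} [Field E] [Algebra ℚ E] [Algebra.EssFiniteType ℚ E]
    (h : ¬ Algebra.IsAlgebraic ℚ E) : ∃ D : Derivation ℚ E E, D ≠ 0 := by
  by_contra! hD
  refine h ?_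
  have hu : Algebra.FormallyUnramified ℚ E := (Algebra.formallyUnramified_iff ℚ E).2 <| by
    refine subsingleton_of_forall_eq 0 fun ω => ?_
    refine (Module.forall_dual_apply_eq_zero_iff E ω).1 fun l => ?_
    have h1 : l = 0 := (KaehlerDifferential.linearMapEquivDerivation ℚ E).injective
      ((hD _).trans (map_zero _).symm)
    rw [h1, LinearMap.zero_apply]
  have := (Algebra.FormallyUnramified.iff_isSeparable ℚ E).1 hu
  infer_instance

theorem IsMannField.of_forall_essFiniteType {E : Type u} [Field E] [Algebra ℚ E]
    (h : ∀ (L : Type u) [Field L] [Algebra ℚ L] [Algebra.EssFiniteType ℚ L], (L →ₐ[ℚ] E) →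
      IsMannField L) : IsMannField E := by
  classical
  intro Γ hΓ
  obtain ⟨S, hS⟩ := id hΓ
  set L := IntermediateField.adjoin ℚ ((S.image fun γ : Eˣ => (γ : E) : Finset E) : Set E)
  have hess : @Algebra.EssFiniteType ℚ L _ _ L.algebra' :=
    IntermediateField.essFiniteType_iff.2 (IntermediateField.fg_adjoin_finset _)
  have hmap := (@h L _ L.algebra' hess L.val _ (hΓ.comap_of_injective
    (Units.map_injective (f := (algebraMap L E : L →* E)) (algebraMap L E).injective))).map
      (algebraMap L E)
  refine hmap.mono ?_
  have hle : Γ ≤ (Units.map (algebraMap L E : L →* E)).range := by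
    rw [← hS, Subgroup.closure_le]
    intro γ hγ
    have hmem : (γ : E) ∈ L := IntermediateField.subset_adjoin _ _
      (Finset.mem_coe.2 (Finset.mem_image_of_mem _ hγ))
    exact ⟨Units.mk0 ⟨γ, hmem⟩ fun h0 => γ.ne_zero (congrArg Subtype.val h0), Units.ext rfl⟩
  rw [Subgroup.map_comap_eq]
  exact le_inf hle le_rfl

theorem isMannField_of_isAlgebraic {E : Type*} [Field E] [Algebra ℚ E]
    [Algebra.EssFiniteType ℚ E] (h : Algebra.IsAlgebraic ℚ E) : IsMannField E := by
  have h1 := algebraRat.charZero E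
  have h2 : FiniteDimensional ℚ E := by
    have := (Algebra.FormallyUnramified.iff_isSeparable ℚ E).2 inferInstance
    exact Algebra.FormallyUnramified.finite_of_free ℚ E
  obtain rfl : ‹Algebra ℚ E› = DivisionRing.toRatAlgebra := Subsingleton.elim _ _
  have : NumberField E := { to_charZero := h1, to_finiteDimensional := h2 }
  exact fun Γ hΓ => NumberField.hasMannProperty hΓ

/-- The field of constants of a derivation. -/
def Derivation.constants {R E : Type*} [CommRing R] [Field E] [Algebra R E]
    (D : Derivation R E E) : Subfield E where
  carrier := {x | D x = 0}
  mul_mem' {x y} hx hy := by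
    have hx' : D x = 0 := hx
    have hy' : D y = 0 := hy
    show D (x * y) = 0
    simp [hx', hy']
  one_mem' := D.map_one_eq_zero
  add_mem' {x y} hx hy := by
    have hx' : D x = 0 := hx
    have hy' : D y = 0 := hy
    show D (x + y) = 0
    simp [hx', hy']
  zero_mem' := map_zero D
  neg_mem' {x} hx := by
    have hx' : D x = 0 := hx
    show D (-x) = 0
    simp [hx']
  inv_mem' x hx := by
    have hx' : D x = 0 := hx
    show D x⁻¹ = 0
    simp [D.leibniz_inv, hx']

/-- A derivation is linear over its field of constants. -/
def Derivation.overConstants {R E : Type*} [CommRing R] [Field E] [Algebra R E]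
    (D : Derivation R E E) : Derivation D.constants E E :=
  Derivation.mk'
    { toFun := D
      map_add' := map_add D
      map_smul' := fun c x => by
        have h : D c = 0 := c.2
        simp [Subfield.smul_def, h] }
    fun x y => D.leibniz x y

theorem isMannField_of_trdeg_le (d : ℕ) (E : Type u) [Field E] [Algebra ℚ E]
    (hd : Algebra.trdeg ℚ E ≤ d) : IsMannField E := by
  induction d generalizing E with
  | zero =>
    refine IsMannField.of_forall_essFiniteType fun L _ _ _ f => ?_
    refine isMannField_of_isAlgebraic (trdeg_eq_zero_iff.1 ?_)
    simpa using (trdeg_le_of_injective f f.injective).trans hd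
  | succ d ih =>
    refine IsMannField.of_forall_essFiniteType fun L _ _ _ f => ?_
    by_cases halg : Algebra.IsAlgebraic ℚ L
    · exact isMannField_of_isAlgebraic halg
    have hLd := (trdeg_le_of_injective f f.injective).trans hd
    obtain ⟨D, hD⟩ := exists_derivation_ne_zero halg
    have := algebraRat.charZero L
    refine IsMannField.of_derivation D.overConstants (fun x hx => hx) (ih _ ?_)
    have hadd := trdeg_add_eq ℚ D.constants (A := L)
    have hpos : Algebra.trdeg D.constants L ≠ 0 := fun h0 => hD <| by
      have halg' := trdeg_eq_zero_iff.1 h0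
      have hint := isIntegrallyClosedIn_of_derivation D.overConstants fun x hx => hx
      ext x
      exact Subring.isIntegrallyClosedIn_iff.1 hint (halg'.isAlgebraic x).isIntegral
    rw [← Cardinal.one_le_iff_ne_zero] at hpos
    rw [← hadd] at hLd
    have h1 := (add_le_add_right hpos _).trans hLd
    rw [Nat.cast_succ] at h1
    exact Cardinal.add_one_le_add_one_iff.1 h1

theorem isMannField_of_charZero (E : Type u) [Field E] [CharZero E] : IsMannField E := by
  refine IsMannField.of_forall_essFiniteType fun L _ _ _ f => ?_
  obtain ⟨d, hd⟩ := Cardinal.lt_aleph0.1 (trdeg_lt_aleph0 ℚ L)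
  exact isMannField_of_trdeg_le d _ hd.le

end CharZero

theorem stmt_10 (p : ℕ) [Fact p.Prime] (G : Subgroup ℚ_[p]ˣ) (hG : G.FG)
    (n : ℕ) (a : Fin n → ℚ) (ha : ∀ i, a i ≠ 0) :
    {g : Fin n → ℚ_[p]ˣ | (∀ i, g i ∈ G) ∧
      (∑ i, (a i : ℚ_[p]) * ((g i : ℚ_[p]ˣ) : ℚ_[p])) = 1 ∧
      ∀ I : Finset (Fin n), I.Nonempty →
        (∑ i ∈ I, (a i : ℚ_[p]) * ((g i : ℚ_[p]ˣ) : ℚ_[p])) ≠ 0}.Finite := by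
  have ha' : ∀ i, (a i : ℚ_[p]) ≠ 0 := fun i => Rat.cast_ne_zero.2 (ha i)
  set c : Fin n → ℚ_[p]ˣ := fun i => Units.mk0 _ (ha' i)
  have hfg : (G ⊔ Subgroup.closure (Set.range c)).FG :=
    hG.sup ((Subgroup.fg_iff _).2 ⟨_, rfl, Set.finite_range c⟩)
  refine Set.Finite.of_finite_image (f := fun g => c * g)
    ((isMannField_of_charZero ℚ_[p] _ hfg n).subset ?_) (mul_right_injective c).injOn
  rintro _ ⟨g, ⟨hg, hsum, hnd⟩, rfl⟩
  exact ⟨fun i => mul_mem (Subgroup.mem_sup_right (Subgroup.subset_closure ⟨i, rfl⟩))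
    (Subgroup.mem_sup_left (hg i)), hsum, hnd⟩
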